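/- Let Ω₁, Ω₂ ⊂ ℂⁿ be bounded strictly pseudoconvex domains with C^∞ boundary, and let φ : Ω₁ → Ω₂ be a biholomorphic mapping. Then φ extends to a C^∞ diffeomorphism of Ω̄₁ onto Ω̄₂: there exist an open neighborhood U₁ of Ω̄₁ and a C^∞ map Φ : U₁ → ℂⁿ with Φ = φ on Ω₁, Φ(Ω̄₁) = Ω̄₂, Φ injective on Ω̄₁, and such that the inverse map φ⁻¹ : Ω₂ → Ω₁ likewise extends to a C^∞ map on an open neighborhood of Ω̄₂ which agrees with (Φ|_{Ω̄₁})⁻¹ on Ω̄₂. -/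

import Mathlib

open Complex Metric

noncomputable section

/-- The Wirtinger derivative `∂f/∂z_j` of `f : ℂⁿ → ℂ` at `z`. -/
def wDz (n : ℕ) (j : Fin n) (f : EuclideanSpace ℂ (Fin n) → ℂ)
    (z : EuclideanSpace ℂ (Fin n)) : ℂ :=
  (fderiv ℝ f z (EuclideanSpace.single j 1)
    - Complex.I * fderiv ℝ f z (EuclideanSpace.single j Complex.I)) / 2

/-- The Wirtinger derivative `∂f/∂z̄_j` of `f : ℂⁿ → ℂ` at `z`. -/
def wDzBar (n : ℕ) (j : Fin n) (f : EuclideanSpace ℂ (Fin n) → ℂ)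
    (z : EuclideanSpace ℂ (Fin n)) : ℂ :=
  (fderiv ℝ f z (EuclideanSpace.single j 1)
    + Complex.I * fderiv ℝ f z (EuclideanSpace.single j Complex.I)) / 2

/-- The complex Hessian matrix `H(u)(z) = [∂²u/∂z_i∂z̄_j(z)]` of a real-valued `u`. -/
def cHess (n : ℕ) (u : EuclideanSpace ℂ (Fin n) → ℝ)
    (z : EuclideanSpace ℂ (Fin n)) : Matrix (Fin n) (Fin n) ℂ :=
  Matrix.of fun i j => wDz n i (fun w => wDzBar n j (fun v => ((u v : ℝ) : ℂ)) w) z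

/-- The Hermitian form `Σ_{i,j} H(u)(z)_{ij} w_i w̄_j`. -/
def cHessForm (n : ℕ) (u : EuclideanSpace ℂ (Fin n) → ℝ)
    (z : EuclideanSpace ℂ (Fin n)) (w : Fin n → ℂ) : ℂ :=
  ∑ i, ∑ j, cHess n u z i j * w i * (starRingEnd ℂ) (w j)

/-- The pairing `Σ_j (∂u/∂z_j)(z) w_j` of the complex gradient with a vector. -/
def cGradPair (n : ℕ) (u : EuclideanSpace ℂ (Fin n) → ℝ)
    (z : EuclideanSpace ℂ (Fin n)) (w : Fin n → ℂ) : ℂ :=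
  ∑ j, wDz n j (fun v => ((u v : ℝ) : ℂ)) z * w j

/-- `ρ` is a `C^k` defining function for `Ω`, defined on the open neighborhood `U` of `Ω̄`. -/
def IsDefiningFn (n : ℕ) (k : ℕ∞) (Ω U : Set (EuclideanSpace ℂ (Fin n)))
    (ρ : EuclideanSpace ℂ (Fin n) → ℝ) : Prop :=
  IsOpen U ∧ closure Ω ⊆ U ∧ ContDiffOn ℝ k ρ U ∧
    Ω = {z ∈ U | ρ z < 0} ∧ ∀ z ∈ frontier Ω, fderiv ℝ ρ z ≠ 0

/-- `Ω` is a bounded strictly pseudoconvex domain with `C^k` boundary. -/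
def IsStrictlyPseudoconvexDomain (n : ℕ) (k : ℕ∞)
    (Ω : Set (EuclideanSpace ℂ (Fin n))) : Prop :=
  IsOpen Ω ∧ Bornology.IsBounded Ω ∧
    ∃ U ρ, IsDefiningFn n k Ω U ρ ∧
      ∀ z ∈ frontier Ω, ∀ w : Fin n → ℂ, w ≠ 0 →
        cGradPair n ρ z w = 0 → 0 < (cHessForm n ρ z w).re

/-- The complex Jacobian matrix `φ'(z) = [∂φ_i/∂z_j(z)]` of `φ : ℂⁿ → ℂⁿ`. -/
def jacobian (n : ℕ) (φ : EuclideanSpace ℂ (Fin n) → EuclideanSpace ℂ (Fin n))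
    (z : EuclideanSpace ℂ (Fin n)) : Matrix (Fin n) (Fin n) ℂ :=
  Matrix.of fun i j => wDz n j (fun w => φ w i) z

/-- `φ` is a proper map from `Ω₁` to `Ω₂`. -/
def IsProperMapOn (n : ℕ) (φ : EuclideanSpace ℂ (Fin n) → EuclideanSpace ℂ (Fin n))
    (Ω₁ Ω₂ : Set (EuclideanSpace ℂ (Fin n))) : Prop :=
  Set.MapsTo φ Ω₁ Ω₂ ∧ ∀ K ⊆ Ω₂, IsCompact K → IsCompact {z ∈ Ω₁ | φ z ∈ K}


set_option linter.unusedSectionVars false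
set_option linter.style.longLine false

namespace FM
section
section Holo
variable {E F : Type*} [NormedAddCommGroup E] [NormedSpace ℂ E] [FiniteDimensional ℂ E]
  [NormedAddCommGroup F] [NormedSpace ℂ F] [FiniteDimensional ℂ F]

lemma cauchy_fderiv {E F : Type*} [NormedAddCommGroup E] [NormedSpace ℂ E]
    [NormedAddCommGroup F] [NormedSpace ℂ F] {f : E → F} {z : E} {R M : ℝ} (hR : 0 < R)
    (hf : DifferentiableOn ℂ f (ball z R)) (hM : ∀ w ∈ ball z R, ‖f w‖ ≤ M) :
    ‖fderiv ℂ f z‖ ≤ M / R := by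
  have hM0 : 0 ≤ M := (norm_nonneg _).trans (hM z (mem_ball_self hR))
  refine ContinuousLinearMap.opNorm_le_bound _ (by positivity) fun t => ?_
  rcases eq_or_ne t 0 with rfl | ht
  · simp
  have ht' : 0 < ‖t‖ := norm_pos_iff.2 ht
  have key : ∀ ρ, 0 < ρ → ρ < R / ‖t‖ → ‖fderiv ℂ f z t‖ ≤ M / ρ := by
    intro ρ hρ hρR
    have hmem : ∀ ζ : ℂ, ‖ζ‖ ≤ ρ → z + ζ • t ∈ ball z R := by
      intro ζ hζ
      rw [mem_ball, dist_eq_norm, add_sub_cancel_left, norm_smul]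
      calc ‖ζ‖ * ‖t‖ ≤ ρ * ‖t‖ := by gcongr
        _ < R := (lt_div_iff₀ ht').1 hρR
    have hd : HasDerivAt (fun ζ : ℂ => f (z + ζ • t)) (fderiv ℂ f z t) 0 := by
      have h1 : HasFDerivAt f (fderiv ℂ f z) (z + (0:ℂ) • t) := by
        simpa using (hf.differentiableAt (isOpen_ball.mem_nhds (mem_ball_self hR))).hasFDerivAt
      have h2 : HasDerivAt (fun ζ : ℂ => z + ζ • t) t 0 := by
        simpa using ((hasDerivAt_id (0:ℂ)).smul_const t).const_add z
      exact h1.comp_hasDerivAt _ h2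
    rw [← hd.deriv]
    refine Complex.norm_deriv_le_of_forall_mem_sphere_norm_le hρ ?_ ?_
    · refine DifferentiableOn.diffContOnCl ?_
      intro ζ hζ
      rw [closure_ball _ hρ.ne', mem_closedBall_zero_iff] at hζ
      have h1 := hf.differentiableAt (isOpen_ball.mem_nhds (hmem ζ hζ))
      have : DifferentiableAt ℂ (fun ζ : ℂ => z + ζ • t) ζ := by fun_prop
      exact (h1.comp ζ this).differentiableWithinAt
    · intro ζ hζ
      exact hM _ (hmem ζ (by simpa using (mem_sphere.1 hζ).le))
  have : ‖fderiv ℂ f z t‖ ≤ M / (R / ‖t‖) := by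
    have hlim : Filter.Tendsto (fun ρ : ℝ => M / ρ) (nhdsWithin (R/‖t‖) (Set.Iio (R/‖t‖)))
        (nhds (M / (R / ‖t‖))) := by
      refine Filter.Tendsto.mono_left ?_ nhdsWithin_le_nhds
      exact (continuousAt_const.div continuousAt_id (by positivity))
    refine ge_of_tendsto hlim ?_
    have : Set.Ioo 0 (R/‖t‖) ∈ nhdsWithin (R/‖t‖) (Set.Iio (R/‖t‖)) :=
      Ioo_mem_nhdsLT (by positivity)
    filter_upwards [this] with ρ hρ using key ρ hρ.1 hρ.2
  calc _ ≤ _ := this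
    _ = M / R * ‖t‖ := by field_simp

lemma holo_fderiv_apply {f : E → F} {s : Set E} (hs : IsOpen s) (hf : DifferentiableOn ℂ f s)
    (t : E) : DifferentiableOn ℂ (fun z => fderiv ℂ f z t) s := by
  intro z0 hz0
  refine DifferentiableAt.differentiableWithinAt ?_
  have : ProperSpace E := FiniteDimensional.proper ℂ E
  have : CompleteSpace F := FiniteDimensional.complete ℂ F
  borelize E
  borelize F
  obtain ⟨R, hR, hRs⟩ : ∃ R > 0, closedBall z0 (3 * R) ⊆ s := by
    obtain ⟨R, hR, h⟩ := Metric.nhds_basis_closedBall.mem_iff.1 (hs.mem_nhds hz0)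
    exact ⟨R / 3, by positivity, by convert h using 2; ring⟩
  obtain ⟨M, hM⟩ := (isCompact_closedBall z0 (3 * R)).exists_bound_of_continuousOn
    (hf.continuousOn.mono hRs)
  -- bound on the derivative on the ball of radius 2 R
  have hD : ∀ w ∈ ball z0 (2 * R), ‖fderiv ℂ f w‖ ≤ M / R := by
    intro w hw
    have hsub : ball w R ⊆ closedBall z0 (3 * R) := by
      intro y hy
      rw [mem_ball] at hw hy
      rw [mem_closedBall]
      linarith [dist_triangle y w z0]
    exact cauchy_fderiv hR (hf.mono (hsub.trans hRs)) fun y hy => hM y (hsub hy)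
  -- reduce to small t
  obtain ⟨c, hc0, hct⟩ : ∃ c : ℝ, 0 < c ∧ ‖(c : ℂ) • t‖ < R := by
    refine ⟨R / (‖t‖ + 1), by positivity, ?_⟩
    rw [norm_smul, Complex.norm_real, Real.norm_of_nonneg (by positivity), div_mul_eq_mul_div,
      div_lt_iff₀ (by positivity)]
    nlinarith [norm_nonneg t]
  set t' := (c : ℂ) • t with ht'
  suffices h : DifferentiableAt ℂ (fun z => fderiv ℂ f z t') z0 by
    have : (fun z => fderiv ℂ f z t) = fun z => (c : ℂ)⁻¹ • fderiv ℂ f z t' := by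
      ext z
      rw [ht', map_smul, smul_smul, inv_mul_cancel₀ (by exact_mod_cast hc0.ne'), one_smul]
    rw [this]
    exact h.const_smul _
  have hmem : ∀ z ∈ ball z0 R, ∀ ζ : ℂ, ‖ζ‖ ≤ 1 → z + ζ • t' ∈ ball z0 (2 * R) := by
    intro z hz ζ hζ
    rw [mem_ball, dist_eq_norm] at hz ⊢
    calc ‖z + ζ • t' - z0‖ = ‖(z - z0) + ζ • t'‖ := by congr 1; abel
      _ ≤ ‖z - z0‖ + ‖ζ • t'‖ := norm_add_le _ _
      _ ≤ ‖z - z0‖ + 1 * ‖t'‖ := by rw [norm_smul]; gcongr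
      _ < 2 * R := by linarith
  have hb : ball z0 (2 * R) ⊆ s :=
    (ball_subset_closedBall.trans (closedBall_subset_closedBall (by linarith))).trans hRs
  have hformula : ∀ z ∈ ball z0 R, fderiv ℂ f z t' =
      (2 * Real.pi * I : ℂ)⁻¹ • ∮ ζ in C(0, 1), (ζ - 0) ^ (-2 : ℤ) • f (z + ζ • t') := by
    intro z hz
    have hd : HasDerivAt (fun ζ : ℂ => f (z + ζ • t')) (fderiv ℂ f z t') 0 := by
      have h1 : HasFDerivAt f (fderiv ℂ f z) (z + (0:ℂ) • t') := by
        simpa using (hf.differentiableAt (hs.mem_nhds (hb (by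
          simpa using hmem z hz 0 (by simp))))).hasFDerivAt
      have h2 : HasDerivAt (fun ζ : ℂ => z + ζ • t') t' 0 := by
        simpa using ((hasDerivAt_id (0:ℂ)).smul_const t').const_add z
      exact h1.comp_hasDerivAt _ h2
    rw [← hd.deriv]
    have hU : IsOpen {ζ : ℂ | z + ζ • t' ∈ s} :=
      hs.preimage (by fun_prop)
    have h := two_pi_I_inv_smul_circleIntegral_sub_sq_inv_smul_of_differentiable
      (f := fun ζ : ℂ => f (z + ζ • t')) (w₀ := 0) (R := 1) (c := 0) hU (fun ζ hζ => hb (hmem z hz ζ (by simpa using hζ)))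
      (fun ζ hζ => ((hf.differentiableAt (hs.mem_nhds hζ)).comp ζ
        (by fun_prop : DifferentiableAt ℂ (fun ζ : ℂ => z + ζ • t') ζ)).differentiableWithinAt)
      (by simp)
    rw [← h]
    congr 1
  have hcong : (fun z => fderiv ℂ f z t') =ᶠ[nhds z0] fun z =>
      (2 * Real.pi * I : ℂ)⁻¹ • ∮ ζ in C(0, 1), (ζ - 0) ^ (-2 : ℤ) • f (z + ζ • t') := by
    filter_upwards [ball_mem_nhds z0 hR] with z hz using hformula z hz
  refine DifferentiableAt.congr_of_eventuallyEq (DifferentiableAt.const_smul ?_ _) hcong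
  simp only [circleIntegral]
  have hn1 : ∀ θ : ℝ, ‖circleMap 0 1 θ‖ ≤ 1 := fun θ => by simp
  have hcm : Continuous (circleMap 0 1) := continuous_circleMap 0 1
  have hcoef : Continuous fun θ : ℝ => deriv (circleMap 0 1) θ * (circleMap 0 1 θ - 0) ^ (-2 : ℤ) := by
    simp only [deriv_circleMap, sub_zero]
    refine (by fun_prop : Continuous fun θ => circleMap 0 1 θ * I).mul ?_
    exact hcm.zpow₀ _ fun θ => Or.inl (by simp)
  have hnc : ∀ θ : ℝ, ‖deriv (circleMap 0 1) θ * (circleMap 0 1 θ - 0) ^ (-2 : ℤ)‖ ≤ 1 := by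
    intro θ; simp
  have hpath : ∀ z ∈ ball z0 R, Continuous fun θ => f (z + circleMap 0 1 θ • t') := by
    intro z hz
    refine ContinuousOn.comp_continuous (hf.continuousOn.mono hb) (by fun_prop) fun θ => hmem z hz _ (hn1 θ)
  have key := intervalIntegral.hasFDerivAt_integral_of_dominated_of_fderiv_le
    (μ := MeasureTheory.volume) (a := 0) (b := 2 * Real.pi) (𝕜 := ℂ)
    (F := fun z θ => (deriv (circleMap 0 1) θ * (circleMap 0 1 θ - 0) ^ (-2 : ℤ)) • f (z + circleMap 0 1 θ • t'))
    (F' := fun z θ => (deriv (circleMap 0 1) θ * (circleMap 0 1 θ - 0) ^ (-2 : ℤ)) • fderiv ℂ f (z + circleMap 0 1 θ • t'))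
    (x₀ := z0) (s := ball z0 R) (bound := fun _ => M / R) (ball_mem_nhds z0 hR) ?_ ?_ ?_ ?_ ?_ ?_
  · have := key.differentiableAt
    simpa only [smul_smul] using this
  · filter_upwards [ball_mem_nhds z0 hR] with z hz
    exact (hcoef.smul (hpath z hz)).aestronglyMeasurable
  · exact (hcoef.smul (hpath z0 (mem_ball_self hR))).intervalIntegrable _ _
  · have : FiniteDimensional ℂ (E →L[ℂ] F) := inferInstance
    have : ProperSpace (E →L[ℂ] F) := FiniteDimensional.proper ℂ _
    borelize (E →L[ℂ] F)
    have hm : Measurable fun θ : ℝ => fderiv ℂ f (z0 + circleMap 0 1 θ • t') :=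
      (measurable_fderiv ℂ f).comp (by fun_prop : Continuous fun θ : ℝ => z0 + circleMap 0 1 θ • t').measurable
    exact hcoef.aestronglyMeasurable.smul hm.aestronglyMeasurable
  · refine Filter.Eventually.of_forall fun θ _ z hz => ?_
    rw [norm_smul]
    calc _ ≤ 1 * (M / R) := by
          gcongr
          · exact hnc θ
          · exact hD _ (hmem z hz _ (hn1 θ))
      _ = _ := one_mul _
  · exact intervalIntegrable_const
  · refine Filter.Eventually.of_forall fun θ _ z hz => ?_
    have h1 := (hf.differentiableAt (hs.mem_nhds (hb (hmem z hz _ (hn1 θ))))).hasFDerivAt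
    have h2 : HasFDerivAt (fun z : E => z + circleMap 0 1 θ • t') (ContinuousLinearMap.id ℂ E) z :=
      (hasFDerivAt_id z).add_const _
    have := (h1.comp z h2).const_smul (deriv (circleMap 0 1) θ * (circleMap 0 1 θ - 0) ^ (-2 : ℤ))
    exact this

lemma holo_fderiv {f : E → F} {s : Set E} (hs : IsOpen s) (hf : DifferentiableOn ℂ f s) :
    DifferentiableOn ℂ (fderiv ℂ f) s := by
  intro z hz
  refine DifferentiableAt.differentiableWithinAt ?_
  let b := Module.finBasis ℂ E
  let co : Fin (Module.finrank ℂ E) → (E →L[ℂ] ℂ) := fun i => LinearMap.toContinuousLinearMap (b.coord i)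
  have hrep : fderiv ℂ f = fun z => ∑ i, (ContinuousLinearMap.smulRightL ℂ E F (co i)) (fderiv ℂ f z (b i)) := by
    ext z t
    have h := (congrArg (fderiv ℂ f z) (b.sum_repr t)).symm
    rw [map_sum] at h
    simpa [co] using h
  rw [hrep]
  refine DifferentiableAt.fun_sum fun i _ => ?_
  exact (ContinuousLinearMap.differentiableAt _).comp z
    ((holo_fderiv_apply hs hf (b i)).differentiableAt (hs.mem_nhds hz))

end Holo

section HoloReal
variable {E F : Type} [NormedAddCommGroup E] [NormedSpace ℂ E] [FiniteDimensional ℂ E]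
  [NormedSpace ℝ E] [IsScalarTower ℝ ℂ E]
  [NormedAddCommGroup F] [NormedSpace ℂ F] [FiniteDimensional ℂ F]
  [NormedSpace ℝ F] [IsScalarTower ℝ ℂ F]

lemma holo_contDiffOn_nat (n : ℕ) : ∀ {F : Type} [NormedAddCommGroup F] [NormedSpace ℂ F]
    [FiniteDimensional ℂ F] {f : E → F} {s : Set E} (_ : IsOpen s)
    (_ : DifferentiableOn ℂ f s), ContDiffOn ℂ n f s := by
  induction n with
  | zero => intro F _ _ _ f s hs hf; exact contDiffOn_zero.2 hf.continuousOn
  | succ n ih =>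
    intro F _ _ _ f s hs hf
    rw [Nat.cast_add, Nat.cast_one, contDiffOn_succ_iff_fderiv_of_isOpen hs]
    exact ⟨hf, by simp, ih hs (holo_fderiv hs hf)⟩

lemma holo_contDiffOn {f : E → F} {s : Set E} (hs : IsOpen s) (hf : DifferentiableOn ℂ f s) :
    ContDiffOn ℝ (⊤ : ℕ∞) f s := by
  rw [contDiffOn_infty]
  intro n
  exact (holo_contDiffOn_nat n hs hf).restrict_scalars ℝ

lemma fderiv_real_eq {f : E → F} {z : E} (hf : DifferentiableAt ℂ f z) :
    fderiv ℝ f z = (fderiv ℂ f z).restrictScalars ℝ :=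
  (hf.hasFDerivAt.restrictScalars ℝ).fderiv

lemma cauchy_iterated (j : ℕ) : ∃ K : ℝ, 0 ≤ K ∧ ∀ {F : Type} [NormedAddCommGroup F] [NormedSpace ℂ F]
    [FiniteDimensional ℂ F] [NormedSpace ℝ F] [IsScalarTower ℝ ℂ F] {f : E → F} {z : E} {R M : ℝ}
    (_ : 0 < R) (_ : DifferentiableOn ℂ f (ball z R)) (_ : ∀ w ∈ ball z R, ‖f w‖ ≤ M),
    ‖iteratedFDeriv ℝ j f z‖ ≤ K * M / R ^ j := by
  induction j with
  | zero =>
    refine ⟨1, by norm_num, ?_⟩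
    intro F _ _ _ _ _ f z R M hR hf hM
    simpa using hM z (mem_ball_self hR)
  | succ j ih =>
    obtain ⟨K, hK, ih⟩ := ih
    refine ⟨K * 2 ^ (j + 1), by positivity, ?_⟩
    intro F _ _ _ _ _ f z R M hR hf hM
    have hD : DifferentiableOn ℂ (fderiv ℂ f) (ball z (R / 2)) :=
      (holo_fderiv isOpen_ball hf).mono (ball_subset_ball (by linarith))
    have hb : ∀ w ∈ ball z (R / 2), ‖fderiv ℂ f w‖ ≤ M / (R / 2) := by
      intro w hw
      have hsub : ball w (R / 2) ⊆ ball z R := by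
        intro y hy
        rw [mem_ball] at *
        linarith [dist_triangle y w z]
      exact cauchy_fderiv (by positivity) (hf.mono hsub) fun y hy => hM y (hsub hy)
    have h := ih (by positivity : 0 < R / 2) hD hb
    have heq : fderiv ℝ f =ᶠ[nhds z]
        (ContinuousLinearMap.restrictScalarsIsometry ℂ E F ℝ ℝ) ∘ (fderiv ℂ f) := by
      filter_upwards [ball_mem_nhds z hR] with w hw
      exact fderiv_real_eq (hf.differentiableAt (isOpen_ball.mem_nhds hw))
    have hcd : ContDiffAt ℝ (j : ℕ∞) (fderiv ℂ f) z :=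
      ((holo_contDiffOn isOpen_ball hD).contDiffAt (ball_mem_nhds z (by positivity))).of_le
        (by exact_mod_cast le_top)
    rw [← norm_iteratedFDeriv_fderiv, (Filter.EventuallyEq.iteratedFDeriv ℝ heq j).self_of_nhds,
      LinearIsometry.norm_iteratedFDeriv_comp_left _ hcd le_rfl]
    refine h.trans (le_of_eq ?_)
    rw [div_pow, pow_succ R, pow_succ (2:ℝ)]
    field_simp

end HoloReal
end

section
lemma two_le_top : (2 : WithTop ℕ∞) ≤ ((⊤ : ℕ∞) : WithTop ℕ∞) := by
  have : ((2 : ℕ∞) : WithTop ℕ∞) ≤ ((⊤ : ℕ∞) : WithTop ℕ∞) := WithTop.coe_le_coe.2 le_top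
  exact this

section LeviCalc
variable {E : Type} [NormedAddCommGroup E] [NormedSpace ℂ E] [FiniteDimensional ℂ E] [NormedSpace ℝ E] [IsScalarTower ℝ ℂ E]
variable {F : Type} [NormedAddCommGroup F] [NormedSpace ℂ F] [FiniteDimensional ℂ F] [NormedSpace ℝ F] [IsScalarTower ℝ ℂ F]

/-- Real second derivative. -/
def D2 (u : E → ℝ) (z v w : E) : ℝ := fderiv ℝ (fderiv ℝ u) z v w

/-- Levi form (four times the complex Hessian). -/
def Lev (u : E → ℝ) (z v : E) : ℝ := D2 u z v v + D2 u z (I • v) (I • v)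

lemma D2_symm {u : E → ℝ} {z : E} (hu : ContDiffAt ℝ 2 u z) (v w : E) : D2 u z v w = D2 u z w v := by
  have := hu.isSymmSndFDerivAt (by simp [minSmoothness_of_isRCLikeNormedField])
  exact this v w

lemma diff_fderiv {G G' : Type} [NormedAddCommGroup G] [NormedSpace ℝ G] [NormedAddCommGroup G'] [NormedSpace ℝ G'] {u : G → G'} {z : G} (hu : ContDiffAt ℝ 2 u z) : DifferentiableAt ℝ (fderiv ℝ u) z := by
  have : ContDiffAt ℝ 1 (fderiv ℝ u) z := hu.fderiv_right (by norm_num)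
  exact this.differentiableAt (by norm_num)

lemma D2_line {u : E → ℝ} {z : E} (hu : ContDiffAt ℝ 2 u z) (v : E) :
    HasDerivAt (fun t : ℝ => fderiv ℝ u (z + t • v) v) (D2 u z v v) 0 := by
  have h1 : HasDerivAt (fun t : ℝ => z + t • v) v 0 := by
    simpa using ((hasDerivAt_id (0:ℝ)).smul_const v).const_add z
  have h2 : HasFDerivAt (fderiv ℝ u) (fderiv ℝ (fderiv ℝ u) z) (z + (0:ℝ) • v) := by
    simpa using (diff_fderiv hu).hasFDerivAt
  have h3 := h2.comp_hasDerivAt (0:ℝ) h1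
  have h4 := (ContinuousLinearMap.apply ℝ ℝ v).hasFDerivAt.comp_hasDerivAt (0:ℝ) h3
  exact h4

lemma eventually_line {u : E → ℝ} {z : E} (hu : ContDiffAt ℝ 2 u z) (v : E) :
    ∀ᶠ t : ℝ in nhds 0, HasDerivAt (fun t : ℝ => u (z + t • v)) (fderiv ℝ u (z + t • v) v) t := by
  have h0 : ∀ᶠ y in nhds z, ContDiffAt ℝ 2 u y := hu.eventually (by norm_num)
  have hc : Filter.Tendsto (fun t : ℝ => z + t • v) (nhds 0) (nhds z) := by
    have : Continuous (fun t : ℝ => z + t • v) := by fun_prop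
    simpa using this.tendsto 0
  filter_upwards [hc.eventually h0] with t ht
  have h1 : HasDerivAt (fun t : ℝ => z + t • v) v t := by
    simpa using ((hasDerivAt_id t).smul_const v).const_add z
  exact (ht.differentiableAt (by norm_num)).hasFDerivAt.comp_hasDerivAt t h1

lemma D2_nonpos_of_isLocalMax {u : E → ℝ} {z : E} (hu : ContDiffAt ℝ 2 u z) (hm : IsLocalMax u z) (v : E) :
    D2 u z v v ≤ 0 := by
  by_contra! hpos
  set g : ℝ → ℝ := fun t => u (z + t • v) with hg
  have hc : Filter.Tendsto (fun t : ℝ => z + t • v) (nhds 0) (nhds z) := by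
    have : Continuous (fun t : ℝ => z + t • v) := by fun_prop
    simpa using this.tendsto 0
  have hd : deriv g =ᶠ[nhds 0] fun t => fderiv ℝ u (z + t • v) v := by
    filter_upwards [eventually_line hu v] with t ht using ht.deriv
  have hdd : deriv (deriv g) 0 = D2 u z v v := by
    rw [hd.deriv_eq]; exact (D2_line hu v).deriv
  have hmax : IsLocalMax g 0 := by
    have := hc.eventually hm
    simpa [IsLocalMax, IsMaxFilter, hg] using this
  have hmin : IsLocalMin g 0 := by
    refine isLocalMin_of_deriv_deriv_pos (by rw [hdd]; exact hpos) hmax.deriv_eq_zero ?_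
    exact (eventually_line hu v).self_of_nhds.continuousAt
  have hcst : g =ᶠ[nhds 0] fun _ => g 0 := by
    filter_upwards [hmax, hmin] with t h1 h2 using le_antisymm h1 h2
  have h1 : deriv g =ᶠ[nhds 0] fun _ => 0 := by
    have := hcst.deriv
    simpa using this
  have : deriv (deriv g) 0 = 0 := by rw [h1.deriv_eq]; simp
  linarith

lemma Lev_nonpos_of_isLocalMax {u : E → ℝ} {z : E} (hu : ContDiffAt ℝ 2 u z) (hm : IsLocalMax u z) (v : E) :
    Lev u z v ≤ 0 :=
  add_nonpos (D2_nonpos_of_isLocalMax hu hm _) (D2_nonpos_of_isLocalMax hu hm _)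

/-- maximum principle -/
lemma max_principle {u : E → ℝ} {W : Set E} (hW : IsOpen W) (hu : ContDiffOn ℝ 2 u W)
    (hc : ∀ ε > 0, IsCompact {z ∈ W | ε ≤ u z})
    (hl : ∀ z ∈ W, 0 < u z → ∃ v, 0 < Lev u z v) : ∀ z ∈ W, u z ≤ 0 := by
  intro z hz
  by_contra! hpos
  obtain ⟨y, hy, hmax⟩ := (hc (u z) hpos).exists_isMaxOn ⟨z, hz, le_rfl⟩
    (hu.continuousOn.mono fun y hy => hy.1)
  have hy0 : 0 < u y := lt_of_lt_of_le hpos hy.2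
  obtain ⟨v, hv⟩ := hl y hy.1 hy0
  have hcd : ContDiffAt ℝ 2 u y := hu.contDiffAt (hW.mem_nhds hy.1)
  have : IsLocalMax u y := by
    filter_upwards [hW.mem_nhds hy.1] with t ht
    by_cases h : u z ≤ u t
    · exact hmax ⟨ht, h⟩
    · exact (not_le.1 h).le.trans hy.2
  exact absurd (Lev_nonpos_of_isLocalMax hcd this v) (not_le.2 hv)

lemma D2_congr {u w : E → ℝ} {z : E} (h : u =ᶠ[nhds z] w) (v v' : E) : D2 u z v v' = D2 w z v v' := by
  unfold D2; rw [h.fderiv.fderiv_eq]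

lemma Lev_congr {u w : E → ℝ} {z : E} (h : u =ᶠ[nhds z] w) (v : E) : Lev u z v = Lev w z v := by
  unfold Lev; rw [D2_congr h, D2_congr h]

lemma D2_add {u w : E → ℝ} {z : E} (hu : ContDiffAt ℝ 2 u z) (hw : ContDiffAt ℝ 2 w z) (v v' : E) :
    D2 (fun y => u y + w y) z v v' = D2 u z v v' + D2 w z v v' := by
  have h : fderiv ℝ (fun y => u y + w y) =ᶠ[nhds z] fun y => fderiv ℝ u y + fderiv ℝ w y := by
    filter_upwards [hu.eventually (by norm_num), hw.eventually (by norm_num)] with y h1 h2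
    exact fderiv_fun_add (h1.differentiableAt (by norm_num)) (h2.differentiableAt (by norm_num))
  unfold D2
  rw [h.fderiv_eq, fderiv_fun_add (diff_fderiv hu) (diff_fderiv hw)]; simp

lemma Lev_add {u w : E → ℝ} {z : E} (hu : ContDiffAt ℝ 2 u z) (hw : ContDiffAt ℝ 2 w z) (v : E) :
    Lev (fun y => u y + w y) z v = Lev u z v + Lev w z v := by
  unfold Lev; rw [D2_add hu hw, D2_add hu hw]; ring

lemma D2_comp {g : ℝ → ℝ} {u : E → ℝ} {z : E} (hg : ContDiffAt ℝ 2 g (u z)) (hu : ContDiffAt ℝ 2 u z) (v w : E) :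
    D2 (fun y => g (u y)) z v w = deriv g (u z) * D2 u z v w + deriv (deriv g) (u z) * (fderiv ℝ u z v * fderiv ℝ u z w) := by
  have h : fderiv ℝ (fun y => g (u y)) =ᶠ[nhds z] fun y => deriv g (u y) • fderiv ℝ u y := by
    have h2 := hu.continuousAt.eventually (hg.eventually (by norm_num))
    filter_upwards [hu.eventually (by norm_num), h2] with y h1 h2
    have a := (h2.differentiableAt (by norm_num)).hasDerivAt.comp_hasFDerivAt y (h1.differentiableAt (by norm_num)).hasFDerivAt
    exact a.fderiv
  unfold D2
  rw [h.fderiv_eq]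
  have hd : DifferentiableAt ℝ (deriv g) (u z) := by
    have : ContDiffAt ℝ 1 (fderiv ℝ g) (u z) := hg.fderiv_right (by norm_num)
    have h3 : DifferentiableAt ℝ (fun x => fderiv ℝ g x 1) (u z) := (this.differentiableAt (by norm_num)).clm_apply (differentiableAt_const _)
    exact h3
  have hd2 : HasFDerivAt (fun y => deriv g (u y)) (deriv (deriv g) (u z) • fderiv ℝ u z) z :=
    hd.hasDerivAt.comp_hasFDerivAt z (hu.differentiableAt (by norm_num)).hasFDerivAt
  have : HasFDerivAt (fun y => deriv g (u y) • fderiv ℝ u y) _ z := hd2.smul (diff_fderiv hu).hasFDerivAt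
  rw [this.fderiv]; simp; ring

lemma Lev_comp {g : ℝ → ℝ} {u : E → ℝ} {z : E} (hg : ContDiffAt ℝ 2 g (u z)) (hu : ContDiffAt ℝ 2 u z) (v : E) :
    Lev (fun y => g (u y)) z v = deriv g (u z) * Lev u z v + deriv (deriv g) (u z) * (fderiv ℝ u z v ^ 2 + fderiv ℝ u z (I • v) ^ 2) := by
  unfold Lev; rw [D2_comp hg hu, D2_comp hg hu]; ring

lemma Lev_const_mul {u : E → ℝ} {z : E} (c : ℝ) (hu : ContDiffAt ℝ 2 u z) (v : E) :
    Lev (fun y => c * u y) z v = c * Lev u z v := by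
  have hd : deriv (fun x : ℝ => c * x) = fun _ => c := by
    ext x; simpa using (hasDerivAt_id x).const_mul c |>.deriv
  have := Lev_comp (g := fun x => c * x) (u := u) (z := z) (by fun_prop) hu v
  rw [this, hd]; simp

lemma Lev_comp_holo {u : F → ℝ} {f : E → F} {z : E} {s : Set E} (hs : IsOpen s) (hz : z ∈ s)
    (hf : DifferentiableOn ℂ f s) (hu : ContDiffAt ℝ 2 u (f z)) (v : E) :
    Lev (fun y => u (f y)) z v = Lev u (f z) (fderiv ℂ f z v) := by
  have hd : ∀ y ∈ s, DifferentiableAt ℂ f y := fun y hy => hf.differentiableAt (hs.mem_nhds hy)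
  have hcf : ContDiffAt ℝ 2 f z := ((holo_contDiffOn hs hf).contDiffAt (hs.mem_nhds hz)).of_le two_le_top
  have h : fderiv ℝ (fun y => u (f y)) =ᶠ[nhds z] fun y => (fderiv ℝ u (f y)).comp (fderiv ℝ f y) := by
    have h2 := hcf.continuousAt.eventually (hu.eventually (by norm_num))
    filter_upwards [hs.mem_nhds hz, h2] with y h1 h2
    exact fderiv_comp y (h2.differentiableAt (by norm_num)) ((hd y h1).restrictScalars ℝ)
  have h1 : HasFDerivAt (fun y => fderiv ℝ u (f y)) ((fderiv ℝ (fderiv ℝ u) (f z)).comp (fderiv ℝ f z)) z :=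
    (diff_fderiv hu).hasFDerivAt.comp z (hcf.differentiableAt (by norm_num)).hasFDerivAt
  have h2 := h1.clm_comp (diff_fderiv hcf).hasFDerivAt
  have key : ∀ a b : E, D2 (fun y => u (f y)) z a b = D2 u (f z) (fderiv ℂ f z a) (fderiv ℂ f z b) + fderiv ℝ u (f z) (fderiv ℝ (fderiv ℝ f) z a b) := by
    intro a b
    unfold D2
    rw [h.fderiv_eq, h2.fderiv, fderiv_real_eq (hd z hz)]
    simp; ring
  have hff : ∀ a b : E, fderiv ℝ (fderiv ℝ f) z a b = fderiv ℂ (fderiv ℂ f) z a b := by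
    intro a b
    have e1 : fderiv ℝ f =ᶠ[nhds z] fun y => (fderiv ℂ f y).restrictScalars ℝ := by
      filter_upwards [hs.mem_nhds hz] with y hy using fderiv_real_eq (hd y hy)
    have e2 : HasFDerivAt (fderiv ℂ f) (fderiv ℂ (fderiv ℂ f) z) z :=
      ((holo_fderiv hs hf).differentiableAt (hs.mem_nhds hz)).hasFDerivAt
    have e3 := (ContinuousLinearMap.restrictScalarsL ℂ E F ℝ ℝ).hasFDerivAt.comp z (e2.restrictScalars ℝ)
    rw [e1.fderiv_eq]
    have e4 : HasFDerivAt (fun y => (fderiv ℂ f y).restrictScalars ℝ) _ z := e3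
    rw [e4.fderiv]; simp
  unfold Lev
  rw [key, key, hff, hff]
  simp only [map_smul, smul_apply, smul_smul, I_mul_I, neg_smul, one_smul, map_neg]
  ring

/-- Levi form of a real linear functional vanishes. -/
lemma Lev_clm (l : E →L[ℝ] ℝ) (z v : E) : Lev (fun y => l y) z v = 0 := by
  have : fderiv ℝ (fun y => l y) = fun _ => l := by ext1 y; exact l.fderiv
  unfold Lev D2; rw [this]; simp

lemma Lev_re_holo {f : E → ℂ} {z : E} {s : Set E} (hs : IsOpen s) (hz : z ∈ s)
    (hf : DifferentiableOn ℂ f s) (v : E) : Lev (fun y => (f y).re) z v = 0 := by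
  rw [Lev_comp_holo (u := fun w : ℂ => w.re) hs hz hf (by exact reCLM.contDiff.contDiffAt) v]
  exact Lev_clm reCLM _ _

lemma Lev_const (c : ℝ) (z v : E) : Lev (fun _ => c) z v = 0 := by
  unfold Lev D2; simp
end LeviCalc

section NormSq
variable {E : Type} [NormedAddCommGroup E] [InnerProductSpace ℂ E] [FiniteDimensional ℂ E] [NormedSpace ℝ E] [IsScalarTower ℝ ℂ E]
lemma Lev_normSq (a z v : E) : Lev (fun y => ‖y - a‖ ^ 2) z v = 4 * ‖v‖ ^ 2 := by
  have hc : ContDiff ℝ 2 (fun y : E => ‖y - a‖ ^ 2) := (contDiff_norm_sq ℂ).comp (contDiff_id.sub contDiff_const)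
  have key : ∀ w : E, D2 (fun y => ‖y - a‖ ^ 2) z w w = 2 * ‖w‖ ^ 2 := by
    intro w
    have h1 := D2_line (hc.contDiffAt (x := z)) w
    set c1 : ℝ := (inner ℂ (z - a) w : ℂ).re
    have h3 : ∀ t : ℝ, HasDerivAt (fun t : ℝ => ‖z + t • w - a‖ ^ 2) (2 * c1 + 2 * t * ‖w‖ ^ 2) t := by
      intro t
      have e : (fun t : ℝ => ‖z + t • w - a‖ ^ 2) = fun t => ‖z - a‖ ^ 2 + 2 * (t * c1) + t ^ 2 * ‖w‖ ^ 2 := by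
        ext t
        have : z + t • w - a = (z - a) + (t : ℂ) • w := by
          rw [show ((t : ℂ) • w) = t • w from by rw [← algebraMap_smul ℂ t w]; rfl]; abel
        rw [this, @norm_add_sq ℂ]
        rw [inner_smul_right, norm_smul, mul_pow]
        simp only [c1, RCLike.re_to_complex, Complex.re_ofReal_mul, Complex.norm_real, Real.norm_eq_abs, sq_abs]
      rw [e]
      have : HasDerivAt (fun t => ‖z - a‖ ^ 2 + 2 * (t * c1) + t ^ 2 * ‖w‖ ^ 2) _ t := (((hasDerivAt_id t).mul_const c1).const_mul 2).const_add (‖z - a‖ ^ 2) |>.add (((hasDerivAt_id t).pow 2).mul_const (‖w‖ ^ 2))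
      exact this.congr_deriv (by simp)
    have h4 : (fun t : ℝ => fderiv ℝ (fun y => ‖y - a‖ ^ 2) (z + t • w) w) =ᶠ[nhds 0] fun t => 2 * c1 + 2 * t * ‖w‖ ^ 2 := by
      filter_upwards [eventually_line (hc.contDiffAt (x := z)) w] with t ht
      exact ht.unique (h3 t)
    have h5 : HasDerivAt (fun t : ℝ => 2 * c1 + 2 * t * ‖w‖ ^ 2) (2 * ‖w‖ ^ 2) 0 := by
      have := (((hasDerivAt_id (0:ℝ)).const_mul 2).mul_const (‖w‖ ^ 2)).const_add (2 * c1)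
      simpa using this
    exact (h1.congr_of_eventuallyEq h4.symm).unique h5
  unfold Lev
  rw [key, key, norm_smul]; simp; ring
end NormSq
end

section
section Cext
variable {E : Type} [NormedAddCommGroup E] [NormedSpace ℂ E] [FiniteDimensional ℂ E] [NormedSpace ℝ E] [IsScalarTower ℝ ℂ E]
variable {G : Type} [NormedAddCommGroup G] [NormedSpace ℂ G] [NormedSpace ℝ G] [IsScalarTower ℝ ℂ G]

lemma csmul_eq {G : Type} [NormedAddCommGroup G] [NormedSpace ℂ G] [NormedSpace ℝ G] [IsScalarTower ℝ ℂ G] (c : ℂ) (v : G) :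
    c • v = c.re • v + c.im • (I • v) := by
  conv_lhs => rw [← Complex.re_add_im c, add_smul, mul_smul]
  rw [← algebraMap_smul ℂ c.re v, ← algebraMap_smul ℂ c.im (I • v)]; rfl

lemma rsmul_eq {G : Type} [NormedAddCommGroup G] [NormedSpace ℂ G] [NormedSpace ℝ G] [IsScalarTower ℝ ℂ G] (c : ℝ) (v : G) :
    (c : ℂ) • v = c • v := by
  rw [← algebraMap_smul ℂ c v]; rfl

lemma I_I_smul {G : Type} [NormedAddCommGroup G] [NormedSpace ℂ G] (v : G) : I • I • v = -v := by
  rw [smul_smul, I_mul_I, neg_smul, one_smul]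

lemma I_rsmul {G : Type} [NormedAddCommGroup G] [NormedSpace ℂ G] [NormedSpace ℝ G] [IsScalarTower ℝ ℂ G] (c : ℝ) (v : G) :
    I • (c • v) = c • (I • v) := by
  rw [← rsmul_eq, ← rsmul_eq, smul_comm]

def cext (T : E →L[ℝ] G) : E →L[ℂ] G :=
  LinearMap.toContinuousLinearMap
    { toFun := fun v => T v - I • T (I • v)
      map_add' := by intro a b; simp only [map_add, smul_add]; abel
      map_smul' := by
        intro c v
        have h1 : T (c • v) = c.re • T v + c.im • T (I • v) := by rw [csmul_eq c v]; simp
        have h2 : T (I • c • v) = c.re • T (I • v) - c.im • T v := by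
          rw [csmul_eq c v, smul_add, I_rsmul, I_rsmul, I_I_smul]; simp [sub_eq_add_neg]
        rw [h1, h2, RingHom.id_apply, csmul_eq c (T v - _)]
        simp only [smul_sub, smul_add, I_rsmul, I_I_smul, smul_neg]
        abel }

lemma cext_apply (T : E →L[ℝ] G) (v : E) : cext T v = T v - I • T (I • v) := rfl

lemma norm_cext_le (T : E →L[ℝ] G) : ‖cext T‖ ≤ 2 * ‖T‖ := by
  refine ContinuousLinearMap.opNorm_le_bound _ (by positivity) fun v => ?_
  rw [cext_apply]
  refine (norm_sub_le _ _).trans ?_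
  rw [norm_smul, norm_I, one_mul]
  have h1 := T.le_opNorm v
  have h2 := T.le_opNorm (I • v)
  rw [norm_smul, norm_I, one_mul] at h2
  linarith

def cextL : (E →L[ℝ] G) →L[ℝ] (E →L[ℂ] G) :=
  LinearMap.mkContinuous
    { toFun := fun T => cext T
      map_add' := by intro a b; ext v; simp only [cext_apply, add_apply, smul_add]; abel
      map_smul' := by
        intro c a; ext v; simp only [cext_apply, smul_apply, I_rsmul, smul_sub, RingHom.id_apply] } 2
    (fun T => norm_cext_le T)

lemma cextL_apply (T : E →L[ℝ] G) : cextL T = cext T := rfl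

/-- `(E →L[ℝ] ℝ) → (E →L[ℂ] ℂ)`. -/
def lamL : (E →L[ℝ] ℝ) →L[ℝ] (E →L[ℂ] ℂ) :=
  cextL.comp (ContinuousLinearMap.compL ℝ E ℝ ℂ ofRealCLM)

lemma lamL_apply (T : E →L[ℝ] ℝ) (v : E) : lamL T v = (T v : ℂ) - I * (T (I • v) : ℂ) := rfl

def lam (u : E → ℝ) (z : E) : E →L[ℂ] ℂ := lamL (fderiv ℝ u z)

lemma lam_apply (u : E → ℝ) (z v : E) : lam u z v = (fderiv ℝ u z v : ℂ) - I * (fderiv ℝ u z (I • v) : ℂ) := rfl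

lemma lam_re (u : E → ℝ) (z v : E) : (lam u z v).re = fderiv ℝ u z v := by
  simp [lam_apply]
lemma lam_im (u : E → ℝ) (z v : E) : (lam u z v).im = - fderiv ℝ u z (I • v) := by
  simp [lam_apply]

lemma lam_normSq (u : E → ℝ) (z v : E) : ‖lam u z v‖ ^ 2 = fderiv ℝ u z v ^ 2 + fderiv ℝ u z (I • v) ^ 2 := by
  rw [← Complex.normSq_eq_norm_sq, Complex.normSq_apply, lam_re, lam_im]; ring

def QQ (u : E → ℝ) (z : E) : E →L[ℂ] (E →L[ℂ] ℂ) :=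
  (1/4 : ℂ) • cext (lamL.comp (fderiv ℝ (fderiv ℝ u) z))

lemma norm_lamL_le (T : E →L[ℝ] ℝ) : ‖lamL T‖ ≤ 2 * ‖T‖ := by
  refine (norm_cext_le _).trans ?_
  gcongr
  refine ContinuousLinearMap.opNorm_le_bound _ (by positivity) fun v => ?_
  simpa using T.le_opNorm v

lemma norm_QQ_le (u : E → ℝ) (z : E) : ‖QQ u z‖ ≤ ‖fderiv ℝ (fderiv ℝ u) z‖ := by
  have h1 := norm_cext_le (lamL.comp (fderiv ℝ (fderiv ℝ u) z))
  have h2 : ‖lamL.comp (fderiv ℝ (fderiv ℝ u) z)‖ ≤ 2 * ‖fderiv ℝ (fderiv ℝ u) z‖ := by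
    refine ContinuousLinearMap.opNorm_le_bound _ (by positivity) fun v => ?_
    have := norm_lamL_le (fderiv ℝ (fderiv ℝ u) z v)
    have := (fderiv ℝ (fderiv ℝ u) z).le_opNorm v
    simp only [ContinuousLinearMap.comp_apply]; linarith
  refine ContinuousLinearMap.opNorm_le_bound _ (by positivity) fun v => ?_
  have e : QQ u z v = (1/4 : ℂ) • (cext (lamL.comp (fderiv ℝ (fderiv ℝ u) z)) v) := rfl
  rw [e, norm_smul]
  have : ‖(1/4 : ℂ)‖ = 1/4 := by simp
  have h3 := (cext (lamL.comp (fderiv ℝ (fderiv ℝ u) z))).le_opNorm v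
  rw [this]
  have := norm_nonneg v
  nlinarith

lemma QQ_re {u : E → ℝ} {z : E} (v : E) :
    (QQ u z v v).re = (D2 u z v v - D2 u z (I • v) (I • v)) / 4 := by
  have : QQ u z v v = (1/4 : ℂ) * (cext (lamL.comp (fderiv ℝ (fderiv ℝ u) z)) v) v := rfl
  rw [this, cext_apply]
  simp only [ContinuousLinearMap.comp_apply, sub_apply, smul_apply, lamL_apply, smul_eq_mul]
  unfold D2
  simp
  ring

lemma taylor3 {u : E → ℝ} {M : ℝ} (hu : ContDiff ℝ 2 u)
    (hM : ∀ x y, ‖fderiv ℝ (fderiv ℝ u) x - fderiv ℝ (fderiv ℝ u) y‖ ≤ M * ‖x - y‖) (z v : E) :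
    |u (z + v) - u z - (lam u z v + QQ u z v v).re - Lev u z v / 4| ≤ M * ‖v‖ ^ 3 := by
  have hsym := fun a b => D2_symm (hu.contDiffAt (x := z)) a b
  set B := fderiv ℝ (fderiv ℝ u) z with hB
  have hz : z ∈ closedBall z ‖v‖ := mem_closedBall_self (norm_nonneg _)
  have hzv : z + v ∈ closedBall z ‖v‖ := by simp
  have hM0 : ∀ y ∈ closedBall z ‖v‖, M * ‖y - z‖ ≤ M * ‖v‖ := by
    intro y hy
    rcases eq_or_ne v 0 with rfl | hv
    · simp at hy; simp [hy]
    · have h0 : 0 ≤ M * ‖z - (z + v)‖ := le_trans (by positivity) (hM z (z + v))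
      have h0 : 0 ≤ M := by
        have : 0 < ‖z - (z + v)‖ := by simpa using hv
        nlinarith
      have : ‖y - z‖ ≤ ‖v‖ := by simpa [dist_eq_norm] using hy
      gcongr
  have s1 : ∀ y ∈ closedBall z ‖v‖, ‖fderiv ℝ u y - fderiv ℝ u z - B (y - z)‖ ≤ M * ‖v‖ * ‖v‖ := by
    intro y hy
    have := (convex_closedBall z ‖v‖).norm_image_sub_le_of_norm_hasFDerivWithin_le' (f := fderiv ℝ u) (f' := fun x => fderiv ℝ (fderiv ℝ u) x) (φ := B) (C := M * ‖v‖)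
      (fun x _ => (diff_fderiv hu.contDiffAt).hasFDerivAt.hasFDerivWithinAt)
      (fun x hx => (hM x z).trans (hM0 x hx)) hz hy
    refine this.trans ?_
    have h2 : ‖y - z‖ ≤ ‖v‖ := by simpa [dist_eq_norm] using hy
    have h3 : 0 ≤ M * ‖v‖ := le_trans (by positivity) ((hM y z).trans (hM0 y hy))
    gcongr
  have hd : ∀ y, HasFDerivAt (fun y => u y - (1/2 : ℝ) * B (y - z) (y - z)) (fderiv ℝ u y - B (y - z)) y := by
    intro y
    have h1 : HasFDerivAt (fun y => y - z) (ContinuousLinearMap.id ℝ E) y := (hasFDerivAt_id y).sub_const z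
    have h2 := (B.hasFDerivAt.comp y h1).clm_apply h1
    have h3 := (hu.differentiable (by norm_num) y).hasFDerivAt.sub (h2.const_mul (1/2 : ℝ))
    refine h3.congr_fderiv ?_
    ext t
    have := hsym t (y - z)
    unfold D2 at this
    simp only [sub_apply, smul_apply, add_apply, ContinuousLinearMap.comp_apply, ContinuousLinearMap.flip_apply, ContinuousLinearMap.id_apply, smul_eq_mul]
    rw [this]; simp; ring
  have s2 := (convex_closedBall z ‖v‖).norm_image_sub_le_of_norm_hasFDerivWithin_le' (φ := fderiv ℝ u z) (C := M * ‖v‖ * ‖v‖)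
      (fun x _ => (hd x).hasFDerivWithinAt)
      (fun x hx => by rw [sub_right_comm]; exact s1 x hx) hz hzv
  have e : u (z + v) - u z - (lam u z v + QQ u z v v).re - Lev u z v / 4 = u (z + v) - (1/2 : ℝ) * B (z + v - z) (z + v - z) - (u z - (1/2 : ℝ) * B (z - z) (z - z)) - fderiv ℝ u z (z + v - z) := by
    rw [add_re, QQ_re, lam_re]; unfold Lev D2; simp; ring
  rw [e, ← Real.norm_eq_abs]
  refine s2.trans (le_of_eq ?_)
  simp; ring
end Cext
end

section
section SPDsec
variable {E : Type} [NormedAddCommGroup E] [InnerProductSpace ℂ E] [FiniteDimensional ℂ E] [NormedSpace ℝ E] [IsScalarTower ℝ ℂ E]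

structure SPD (Ω : Set E) (r : E → ℝ) (δ0 c M : ℝ) : Prop where
  smooth : ContDiff ℝ (⊤ : ℕ∞) r
  eq : Ω = {z | r z < 0}
  bdd : Bornology.IsBounded {z | r z ≤ δ0}
  δ0_pos : 0 < δ0
  δ0_le : δ0 ≤ 1
  c_pos : 0 < c
  c_le : c ≤ 1
  M_ge : 1 ≤ M
  grad : ∀ z, |r z| ≤ δ0 → c ≤ ‖lam r z‖
  lev : ∀ z v, |r z| ≤ δ0 → c * ‖v‖ ^ 2 ≤ Lev r z v
  b1 : ∀ z, ‖fderiv ℝ r z‖ ≤ M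
  b2 : ∀ z, ‖fderiv ℝ (fderiv ℝ r) z‖ ≤ M
  b3 : ∀ x y, ‖fderiv ℝ (fderiv ℝ r) x - fderiv ℝ (fderiv ℝ r) y‖ ≤ M * ‖x - y‖
  bΩ : ∀ z ∈ Ω, ‖z‖ ≤ M
  br : ∀ z, |r z| ≤ M

lemma real_fd : FiniteDimensional ℝ E := FiniteDimensional.trans ℝ ℂ E

lemma cont_Lev {r : E → ℝ} (hr : ContDiff ℝ (⊤ : ℕ∞) r) : Continuous (fun p : E × E => Lev r p.1 p.2) := by
  have h1 : Continuous (fderiv ℝ (fderiv ℝ r)) := by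
    have : ContDiff ℝ (⊤ : ℕ∞) (fderiv ℝ r) := hr.fderiv_right (by norm_num)
    exact this.continuous_fderiv (by simp)
  unfold Lev D2
  have hI : Continuous (fun p : E × E => I • p.2) := by fun_prop
  exact (((h1.comp continuous_fst).clm_apply continuous_snd).clm_apply continuous_snd).add
    (((h1.comp continuous_fst).clm_apply hI).clm_apply hI)

lemma cont_lam {r : E → ℝ} (hr : ContDiff ℝ (⊤ : ℕ∞) r) : Continuous (lam r) :=
  lamL.continuous.comp (hr.continuous_fderiv (by simp))

lemma bdd_of_const_off_compact {G : Type} [NormedAddCommGroup G] {f : E → G} (hf : Continuous f) {K : Set E} (hK : IsCompact K)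
    {a : G} (h : ∀ z ∉ K, f z = a) : ∃ M : ℝ, ∀ z, ‖f z‖ ≤ M := by
  obtain ⟨C, hC⟩ := hK.exists_bound_of_continuousOn hf.continuousOn
  refine ⟨max C ‖a‖, fun z => ?_⟩
  by_cases hz : z ∈ K
  · exact (hC z hz).trans (le_max_left _ _)
  · rw [h z hz]; exact le_max_right _ _

/-- Positivity on `{r = 0}` persists on a collar. -/
lemma collar {X : Type} [TopologicalSpace X] {K : Set X} (hK : IsCompact K) {r g : X → ℝ} (hr : ContinuousOn r K) (hg : ContinuousOn g K)
    (h : ∀ z ∈ K, r z = 0 → 0 < g z) : ∃ m > 0, ∀ z ∈ K, |r z| < m → m ≤ g z := by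
  rcases K.eq_empty_or_nonempty with rfl | hne
  · exact ⟨1, one_pos, by simp⟩
  obtain ⟨x, hx, hmin⟩ := hK.exists_isMinOn hne (f := fun z => max |r z| (g z)) (ContinuousOn.sup hr.abs hg)
  refine ⟨max |r x| (g x), ?_, fun z hz hzr => ?_⟩
  · by_cases h0 : r x = 0
    · exact lt_max_of_lt_right (h x hx h0)
    · exact lt_max_of_lt_left (abs_pos.2 h0)
  · have := hmin hz
    simp only [Set.mem_ofPred_eq] at this
    rcases le_max_iff.1 this with h1 | h1
    · exact absurd hzr (not_lt.2 h1)
    · exact h1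

lemma exists_bump {K U : Set E} (hK : IsCompact K) (hU : IsOpen U) (hKU : K ⊆ U) :
    ∃ (χ : E → ℝ) (L : Set E), ContDiff ℝ (⊤ : ℕ∞) χ ∧ IsCompact L ∧ L ⊆ U ∧ (∀ z ∉ L, χ =ᶠ[nhds z] 0) ∧
      (∀ z ∈ K, χ =ᶠ[nhds z] 1) ∧ (∀ z, 0 ≤ χ z ∧ χ z ≤ 1) := by
  have : FiniteDimensional ℝ E := real_fd
  have : ProperSpace E := FiniteDimensional.proper ℝ E
  obtain ⟨V, hV, hKV, hVU, hVc⟩ := exists_open_between_and_isCompact_closure hK hU hKU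
  obtain ⟨f, h0, h1, h01⟩ := exists_contMDiffMap_zero_one_nhds_of_isClosed (n := (⊤ : ℕ∞)) (modelWithCornersSelf ℝ E) (s := Vᶜ) (t := K) hV.isClosed_compl hK.isClosed
    (Set.disjoint_left.2 fun x hx hx' => hx (hKV hx'))
  refine ⟨f, closure V, f.contMDiff.contDiff, hVc, hVU, fun z hz => ?_, fun z hz => ?_, fun z => h01 z⟩
  · have hzV : z ∈ Vᶜ := fun h => hz (subset_closure h)
    exact Filter.Eventually.filter_mono (nhds_le_nhdsSet hzV) h0
  · exact Filter.Eventually.filter_mono (nhds_le_nhdsSet hz) h1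

theorem exists_SPD_aux {Ω U : Set E} {ρ : E → ℝ} (hΩ : IsOpen Ω) (hb : Bornology.IsBounded Ω) (hU : IsOpen U) (hcl : closure Ω ⊆ U)
    (hρ : ContDiffOn ℝ (⊤ : ℕ∞) ρ U) (heqΩ : Ω = {z ∈ U | ρ z < 0}) (hgrad : ∀ z ∈ frontier Ω, fderiv ℝ ρ z ≠ 0)
    (hlev : ∀ z ∈ frontier Ω, ∀ v : E, v ≠ 0 → lam ρ z v = 0 → 0 < Lev ρ z v) :
    ∃ r δ0 c M, SPD Ω r δ0 c M := by
  have : FiniteDimensional ℝ E := real_fd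
  have : ProperSpace E := FiniteDimensional.proper ℝ E
  have hclc : IsCompact (closure Ω) := hb.isCompact_closure
  have hfr0 : ∀ z ∈ frontier Ω, ρ z = 0 := by
    intro z hz
    have hzc : z ∈ closure Ω := frontier_subset_closure hz
    have hzU := hcl hzc
    have hcont : ContinuousAt ρ z := hρ.continuousOn.continuousAt (hU.mem_nhds hzU)
    have h1 : ρ z ≤ 0 := by
      have h2 := hcont.continuousWithinAt.mem_closure_image (s := Ω) hzc
      have h3 : ρ '' Ω ⊆ Set.Iic 0 := by
        rintro _ ⟨y, hy, rfl⟩; rw [heqΩ] at hy; exact hy.2.le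
      exact (closure_minimal h3 isClosed_Iic) h2
    have h2 : ¬ ρ z < 0 := by
      intro h
      have : z ∈ Ω := by rw [heqΩ]; exact ⟨hzU, h⟩
      rw [hΩ.frontier_eq] at hz; exact hz.2 this
    linarith [not_lt.1 h2]
  have hcρ' : ContinuousOn (fderiv ℝ ρ) U := hρ.continuousOn_fderiv_of_isOpen hU (by simp)
  set U' : Set E := {z ∈ U | ρ z < 0} ∪ {z ∈ U | fderiv ℝ ρ z ≠ 0} with hU'
  have hU'o : IsOpen U' := (hρ.continuousOn.isOpen_inter_preimage hU isOpen_Iio).union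
    (hcρ'.isOpen_inter_preimage hU isOpen_ne)
  have hclU' : closure Ω ⊆ U' := by
    intro z hz
    by_cases h : z ∈ Ω
    · left; rw [heqΩ] at h; exact h
    · right; exact ⟨hcl hz, hgrad z (by rw [hΩ.frontier_eq]; exact ⟨hz, h⟩)⟩
  have hU'U : U' ⊆ U := by rintro z (h | h) <;> exact h.1
  have hzero : ∀ z ∈ U', ρ z = 0 → z ∈ frontier Ω := by
    intro z hz h0
    have hg : fderiv ℝ ρ z ≠ 0 := by
      rcases hz with h | h
      · exact absurd h.2 (by simp [h0])
      · exact h.2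
    rw [hΩ.frontier_eq]
    refine ⟨?_, fun h => ?_⟩
    · by_contra hnc
      apply hg
      have : IsLocalMin ρ z := by
        filter_upwards [isClosed_closure.isOpen_compl.mem_nhds hnc, hU.mem_nhds (hU'U hz)] with y hy hyU
        rw [h0]; by_contra! hlt
        exact hy (subset_closure (by rw [heqΩ]; exact ⟨hyU, hlt⟩))
      exact this.fderiv_eq_zero
    · rw [heqΩ] at h; exact absurd h.2 (by simp [h0])
  obtain ⟨χ, L, hχ, hL, hLU, hχ0, hχ1, hχ01⟩ := exists_bump hclc hU'o hclU'
  set r0 : E → ℝ := fun z => χ z * ρ z + (1 - χ z) with hr0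
  have hr0off : ∀ z ∉ L, r0 =ᶠ[nhds z] fun _ => 1 := by
    intro z hz; filter_upwards [hχ0 z hz] with y hy; simp [hr0, hy]
  have hr0on : ∀ z ∈ closure Ω, r0 =ᶠ[nhds z] ρ := by
    intro z hz; filter_upwards [hχ1 z hz] with y hy; simp [hr0, hy]
  have hr0s : ContDiff ℝ (⊤ : ℕ∞) r0 := by
    rw [contDiff_iff_contDiffAt]
    intro z
    by_cases hz : z ∈ L
    · have h1 : ContDiffAt ℝ (⊤ : ℕ∞) ρ z := hρ.contDiffAt (hU.mem_nhds (hU'U (hLU hz)))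
      exact (hχ.contDiffAt.mul h1).add (contDiffAt_const.sub hχ.contDiffAt)
    · exact contDiffAt_const.congr_of_eventuallyEq (hr0off z hz)
  have hsign : ∀ z, (r0 z < 0 → z ∈ Ω) ∧ (z ∈ Ω → r0 z < 0) ∧ (r0 z = 0 → z ∈ frontier Ω) := by
    intro z
    have hin : z ∈ Ω → r0 z < 0 := by
      intro h
      rw [(hr0on z (subset_closure h)).self_of_nhds]; rw [heqΩ] at h; exact h.2
    by_cases hzΩ : z ∈ Ω
    · exact ⟨fun _ => hzΩ, hin, fun h => absurd (hin hzΩ) (by simp [h])⟩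
    by_cases hzL : z ∈ L
    · have hρ0 : 0 ≤ ρ z := by
        by_contra! hlt; exact hzΩ (by rw [heqΩ]; exact ⟨hU'U (hLU hzL), hlt⟩)
      have h1 := mul_nonneg (hχ01 z).1 hρ0
      have h2 := (hχ01 z).2
      refine ⟨fun h => ?_, hin, fun h => ?_⟩
      · simp only [hr0] at h; linarith
      · simp only [hr0] at h
        have h3 : χ z = 1 := by linarith
        rw [h3] at h
        exact hzero z (hLU hzL) (by linarith)
    · have := (hr0off z hzL).self_of_nhds
      refine ⟨fun h => ?_, hin, fun h => ?_⟩ <;> (rw [this] at h; norm_num at h)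
  -- Levi modification
  have hfrc : IsCompact (frontier Ω ×ˢ sphere (0:E) 1) :=
    (hclc.of_isClosed_subset isClosed_frontier frontier_subset_closure).prod (isCompact_sphere _ _)
  have hcL := cont_Lev hr0s
  have hcl2 : Continuous (fun p : E × E => ‖lam r0 p.1 p.2‖ ^ 2) :=
    ((((cont_lam hr0s).comp continuous_fst).clm_apply continuous_snd).norm.pow 2)
  have hpos : ∀ p ∈ frontier Ω ×ˢ sphere (0:E) 1, lam r0 p.1 p.2 = 0 → 0 < Lev r0 p.1 p.2 := by
    rintro ⟨z, v⟩ ⟨hz, hv⟩ h0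
    have hev := hr0on z (frontier_subset_closure hz)
    simp only at h0 hz hv ⊢
    rw [Lev_congr hev]
    refine hlev z hz v (by rintro rfl; simp at hv) ?_
    unfold lam at h0 ⊢; rwa [← hev.fderiv_eq]
  obtain ⟨A, hA1, hA⟩ : ∃ A : ℝ, 1 ≤ A ∧ ∀ p ∈ frontier Ω ×ˢ sphere (0:E) 1, 0 < Lev r0 p.1 p.2 + A * ‖lam r0 p.1 p.2‖ ^ 2 := by
    obtain ⟨m, hm, hmm⟩ := collar hfrc (r := fun p => ‖lam r0 p.1 p.2‖ ^ 2) (g := fun p => Lev r0 p.1 p.2) hcl2.continuousOn hcL.continuousOn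
      (fun p hp h => hpos p hp (by simpa using h))
    obtain ⟨B, hB⟩ := hfrc.exists_bound_of_continuousOn hcL.continuousOn
    refine ⟨max 1 ((|B| + 1) / m), le_max_left _ _, fun p hp => ?_⟩
    have hAge := le_max_right 1 ((|B| + 1) / m)
    set A := max 1 ((|B| + 1) / m)
    have hA0 : 1 ≤ A := le_max_left _ _
    by_cases h : |‖lam r0 p.1 p.2‖ ^ 2| < m
    · have := hmm p hp h
      have : 0 ≤ A * ‖lam r0 p.1 p.2‖ ^ 2 := by positivity
      linarith
    · rw [not_lt, abs_of_nonneg (by positivity)] at h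
      have h1 : |B| + 1 ≤ A * m := by rwa [div_le_iff₀ hm] at hAge
      have h2 : A * m ≤ A * ‖lam r0 p.1 p.2‖ ^ 2 := by gcongr
      have h3 := hB p hp
      rw [Real.norm_eq_abs] at h3
      have := neg_abs_le (Lev r0 p.1 p.2)
      have := le_abs_self B
      linarith
  set g : ℝ → ℝ := fun x => Real.exp (A * x) - 1 with hg
  have hgs : ContDiff ℝ (⊤ : ℕ∞) g := (Real.contDiff_exp.comp (contDiff_const.mul contDiff_id)).sub contDiff_const
  have hgd : ∀ x, HasDerivAt g (A * Real.exp (A * x)) x := by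
    intro x
    have h1 : HasDerivAt (fun x => A * x) A x := by simpa using (hasDerivAt_id x).const_mul A
    have h2 := (h1.exp).sub_const 1
    rw [mul_comm]; exact h2
  have hgd' : deriv g = fun x => A * Real.exp (A * x) := by ext x; exact (hgd x).deriv
  have hgdd : ∀ x, deriv (deriv g) x = A * (A * Real.exp (A * x)) := by
    intro x; rw [hgd']
    have h1 : HasDerivAt (fun x => A * x) A x := by simpa using (hasDerivAt_id x).const_mul A
    have h2 := (h1.exp).const_mul A
    rw [h2.deriv]; ring
  set r : E → ℝ := fun z => g (r0 z) with hr
  have hrs : ContDiff ℝ (⊤ : ℕ∞) r := hgs.comp hr0s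
  have hA0 : 0 < A := by linarith
  have hr_neg : ∀ z, r z < 0 ↔ r0 z < 0 := by
    intro z; simp only [hr, hg, sub_neg, Real.exp_lt_one_iff]
    constructor
    · intro h; by_contra! h'; nlinarith [mul_nonneg hA0.le h']
    · intro h; exact mul_neg_of_pos_of_neg hA0 h
  have hr_zero : ∀ z, r z = 0 → r0 z = 0 := by
    intro z h; simp only [hr, hg, sub_eq_zero, Real.exp_eq_one_iff] at h
    rcases mul_eq_zero.1 h with h | h
    · linarith
    · exact h
  have hroff : ∀ z ∉ L, r =ᶠ[nhds z] fun _ => g 1 := by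
    intro z hz; filter_upwards [hr0off z hz] with y hy; simp [hr, hy]
  have hg1 : 1 < g 1 := by
    simp only [hg, mul_one]
    have := Real.exp_one_gt_d9
    have : Real.exp 1 ≤ Real.exp A := Real.exp_le_exp.2 hA1
    linarith
  -- frontier estimates for r
  have hrd : ∀ z, fderiv ℝ r z = (A * Real.exp (A * r0 z)) • fderiv ℝ r0 z := by
    intro z
    have := (hgd (r0 z)).comp_hasFDerivAt z (hr0s.differentiable (by simp) z).hasFDerivAt
    exact this.fderiv
  have hrlev : ∀ z v, Lev r z v = A * Real.exp (A * r0 z) * (Lev r0 z v + A * ‖lam r0 z v‖ ^ 2) := by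
    intro z v
    have := Lev_comp (g := g) (u := r0) (z := z) (hgs.contDiffAt.of_le two_le_top) (hr0s.contDiffAt.of_le two_le_top) v
    rw [lam_normSq]
    change Lev (fun y => g (r0 y)) z v = _
    rw [this, hgdd, hgd']; ring
  obtain ⟨m1, hm1, hm1'⟩ := collar hL (r := r) (g := fun z => ‖lam r z‖) hrs.continuous.continuousOn (cont_lam hrs).norm.continuousOn (by
    intro z hz h0
    have hz := (hsign z).2.2 (hr_zero z h0)
    have hne : fderiv ℝ r z ≠ 0 := by
      rw [hrd, (hr0on z (frontier_subset_closure hz)).fderiv_eq]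
      exact smul_ne_zero (by positivity) (hgrad z hz)
    refine norm_pos_iff.2 fun h => hne ?_
    ext v; rw [← lam_re, h]; simp)
  obtain ⟨m2, hm2, hm2'⟩ := collar (hL.prod (isCompact_sphere (0:E) 1)) (r := fun p => r p.1) (g := fun p => Lev r p.1 p.2)
    (hrs.continuous.comp continuous_fst).continuousOn (cont_Lev hrs).continuousOn (by
    rintro ⟨z, v⟩ ⟨hz, hv⟩ h0
    have hz := (hsign z).2.2 (hr_zero z h0)
    rw [hrlev]
    have := hA (z, v) ⟨hz, hv⟩
    positivity)
  set δ0 := min (1/2) (min (m1/2) (m2/2))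
  have hδ1 : δ0 ≤ 1/2 := min_le_left _ _
  have hδ2 : δ0 ≤ m1/2 := (min_le_right _ _).trans (min_le_left _ _)
  have hδ3 : δ0 ≤ m2/2 := (min_le_right _ _).trans (min_le_right _ _)
  have hLmem : ∀ z, r z ≤ δ0 → z ∈ L := by
    intro z hz; by_contra hzL
    rw [(hroff z hzL).self_of_nhds] at hz; linarith
  obtain ⟨B0, hB0⟩ := bdd_of_const_off_compact hrs.continuous hL (a := g 1) (fun z hz => (hroff z hz).self_of_nhds)
  have hr1s : ContDiff ℝ (⊤ : ℕ∞) (fderiv ℝ r) := hrs.fderiv_right (by norm_num)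
  have hr2s : ContDiff ℝ (⊤ : ℕ∞) (fderiv ℝ (fderiv ℝ r)) := hr1s.fderiv_right (by norm_num)
  have e1 : ∀ z ∉ L, fderiv ℝ r =ᶠ[nhds z] fun _ => 0 := fun z hz => by
    have := Filter.EventuallyEq.fderiv (𝕜 := ℝ) (hroff z hz); simp only [fderiv_fun_const] at this; exact this
  have e2 : ∀ z ∉ L, fderiv ℝ (fderiv ℝ r) =ᶠ[nhds z] fun _ => 0 := fun z hz => by
    have := Filter.EventuallyEq.fderiv (𝕜 := ℝ) (e1 z hz); simp only [fderiv_fun_const] at this; exact this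
  have e3 : ∀ z ∉ L, fderiv ℝ (fderiv ℝ (fderiv ℝ r)) z = 0 := fun z hz => by
    have := Filter.EventuallyEq.fderiv_eq (𝕜 := ℝ) (e2 z hz); simpa using this
  obtain ⟨B1, hB1⟩ := bdd_of_const_off_compact hr1s.continuous hL (a := 0) (fun z hz => (e1 z hz).self_of_nhds)
  obtain ⟨B2, hB2⟩ := bdd_of_const_off_compact hr2s.continuous hL (a := 0) (fun z hz => (e2 z hz).self_of_nhds)
  obtain ⟨B3, hB3⟩ := bdd_of_const_off_compact (hr2s.continuous_fderiv (by simp)) hL (a := 0) e3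
  obtain ⟨B4, hB4⟩ := hb.exists_norm_le
  refine ⟨r, δ0, min 1 (min m1 m2), 1 + |B0| + |B1| + |B2| + |B3| + |B4|, ?_⟩
  have p0 := abs_nonneg B0
  have p1 := abs_nonneg B1
  have p2 := abs_nonneg B2
  have p3 := abs_nonneg B3
  have p4 := abs_nonneg B4
  refine ⟨hrs, ?_, ?_, by positivity, by linarith, by positivity, min_le_left _ _, by linarith, ?_, ?_, ?_, ?_, ?_, ?_, ?_⟩
  · ext z; simp only [Set.mem_ofPred_eq, hr_neg]; exact ⟨(hsign z).2.1, (hsign z).1⟩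
  · exact hL.isBounded.subset fun z hz => hLmem z hz
  · intro z hz
    have := hm1' z (hLmem z ((le_abs_self _).trans hz)) (by linarith)
    exact ((min_le_right _ _).trans (min_le_left _ _)).trans this
  · intro z v hz
    rcases eq_or_ne v 0 with rfl | hv
    · unfold Lev D2; simp
    · have hnv : 0 < ‖v‖ := norm_pos_iff.2 hv
      have hn1 : ‖(‖v‖⁻¹ : ℝ) • v‖ = 1 := by
        rw [norm_smul, norm_inv, norm_norm, inv_mul_cancel₀ hnv.ne']
      have := hm2' (z, (‖v‖⁻¹ : ℝ) • v) ⟨hLmem z ((le_abs_self _).trans hz), by simpa using hn1⟩ (by simp only; linarith)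
      have hs : Lev r z ((‖v‖⁻¹ : ℝ) • v) = (‖v‖⁻¹) ^ 2 * Lev r z v := by
        unfold Lev D2; rw [I_rsmul]; simp; ring
      simp only [hs] at this
      have h3 : min 1 (min m1 m2) ≤ m2 := (min_le_right _ _).trans (min_le_right _ _)
      calc min 1 (min m1 m2) * ‖v‖ ^ 2 ≤ ((‖v‖⁻¹) ^ 2 * Lev r z v) * ‖v‖ ^ 2 := by gcongr; linarith
        _ = Lev r z v := by field_simp
  · intro z; have := hB1 z; have := le_abs_self B1; linarith
  · intro z; have := hB2 z; have := le_abs_self B2; linarith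
  · intro x y
    have := Convex.norm_image_sub_le_of_norm_fderiv_le (f := fderiv ℝ (fderiv ℝ r)) (𝕜 := ℝ) (s := Set.univ) (C := 1 + |B0| + |B1| + |B2| + |B3| + |B4|) (fun z _ => hr2s.differentiable (by simp) z)
      (fun z _ => by have := hB3 z; have := le_abs_self B3; linarith) convex_univ (Set.mem_univ y) (Set.mem_univ x)
    exact this
  · intro z hz; have := hB4 z hz; have := le_abs_self B4; linarith
  · intro z; have := hB0 z; have := le_abs_self B0; rw [← Real.norm_eq_abs]; linarith
end SPDsec
end

section
section Pre
variable {n : ℕ}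

lemma fderiv_ofReal {E : Type} [NormedAddCommGroup E] [NormedSpace ℝ E] {u : E → ℝ} {z : E} (h : DifferentiableAt ℝ u z) (v : E) :
    fderiv ℝ (fun v => ((u v : ℝ) : ℂ)) z v = (fderiv ℝ u z v : ℂ) := by
  have := ofRealCLM.hasFDerivAt.comp z h.hasFDerivAt
  have h2 : HasFDerivAt (fun v => ((u v : ℝ) : ℂ)) (ofRealCLM.comp (fderiv ℝ u z)) z := this
  rw [h2.fderiv]; rfl

lemma single_I (j : Fin n) : (EuclideanSpace.single j Complex.I : EuclideanSpace ℂ (Fin n)) = I • EuclideanSpace.single j 1 := by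
  ext i; by_cases h : i = j <;> simp [h]

lemma toLp_eq (w : Fin n → ℂ) : (WithLp.toLp 2 w : EuclideanSpace ℂ (Fin n)) = ∑ j, w j • EuclideanSpace.single j (1:ℂ) := by
  ext i; simp [Pi.single_apply]

lemma cGradPair_eq {u : EuclideanSpace ℂ (Fin n) → ℝ} {z} (h : DifferentiableAt ℝ u z) (w : Fin n → ℂ) :
    cGradPair n u z w = (1/2) * lam u z (WithLp.toLp 2 w) := by
  rw [toLp_eq, map_sum, Finset.mul_sum]
  unfold cGradPair
  refine Finset.sum_congr rfl fun j _ => ?_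
  unfold wDz
  rw [fderiv_ofReal h, fderiv_ofReal h, map_smul, lam_apply, single_I, smul_eq_mul]; ring

lemma cHessForm_eq {u : EuclideanSpace ℂ (Fin n) → ℝ} {z} (h : ContDiffAt ℝ 2 u z) (w : Fin n → ℂ) :
    (cHessForm n u z w).re = (1/4) * Lev u z (WithLp.toLp 2 w) := by
  set e : Fin n → EuclideanSpace ℂ (Fin n) := fun j => EuclideanSpace.single j 1 with he
  have hev : ∀ j, (fun y => wDzBar n j (fun v => ((u v : ℝ) : ℂ)) y) =ᶠ[nhds z] fun y => (((fderiv ℝ u y (e j) : ℝ) : ℂ) + I * ((fderiv ℝ u y (I • e j) : ℝ) : ℂ)) / 2 := by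
    intro j
    filter_upwards [h.eventually (by norm_num)] with y hy
    have hy' : DifferentiableAt ℝ u y := hy.differentiableAt (by norm_num)
    unfold wDzBar; rw [fderiv_ofReal hy', fderiv_ofReal hy', single_I]
  have hD : ∀ a, DifferentiableAt ℝ (fun y => fderiv ℝ u y a) z := fun a => (diff_fderiv h).clm_apply (differentiableAt_const _)
  have hDa : ∀ a t, fderiv ℝ (fun y => ((fderiv ℝ u y a : ℝ) : ℂ)) z t = (D2 u z t a : ℂ) := by
    intro a t
    rw [fderiv_ofReal (hD a)]
    have := (diff_fderiv h).hasFDerivAt.clm_apply (hasFDerivAt_const a z)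
    rw [this.fderiv]; simp [D2]
  have hDc : ∀ a, DifferentiableAt ℝ (fun y => ((fderiv ℝ u y a : ℝ) : ℂ)) z := fun a => ofRealCLM.differentiableAt.comp z (hD a)
  have hf : ∀ j t, fderiv ℝ (fun y => wDzBar n j (fun v => ((u v : ℝ) : ℂ)) y) z t = ((D2 u z t (e j) : ℂ) + I * (D2 u z t (I • e j) : ℂ)) / 2 := by
    intro j t
    rw [(hev j).fderiv_eq]
    have h1 : HasFDerivAt (fun y => (((fderiv ℝ u y (e j) : ℝ) : ℂ) + I * ((fderiv ℝ u y (I • e j) : ℝ) : ℂ)) / 2) _ z :=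
      (((hDc (e j)).hasFDerivAt.add ((hDc (I • e j)).hasFDerivAt.const_mul I)).mul_const (1/2 : ℂ)).congr_of_eventuallyEq (Filter.Eventually.of_forall fun y => by simp [div_eq_mul_inv])
    rw [h1.fderiv]
    simp only [smul_apply, add_apply, hDa, smul_eq_mul]; ring
  have hH : ∀ i j, cHess n u z i j = (((D2 u z (e i) (e j) : ℂ) + I * (D2 u z (e i) (I • e j) : ℂ)) - I * ((D2 u z (I • e i) (e j) : ℂ) + I * (D2 u z (I • e i) (I • e j) : ℂ))) / 4 := by
    intro i j
    unfold cHess; rw [Matrix.of_apply]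
    unfold wDz; rw [hf, hf, single_I]; ring
  have hlin : ∀ (B : EuclideanSpace ℂ (Fin n) →L[ℝ] EuclideanSpace ℂ (Fin n) →L[ℝ] ℝ) (a b : Fin n → EuclideanSpace ℂ (Fin n)),
      B (∑ i, a i) (∑ j, b j) = ∑ i, ∑ j, B (a i) (b j) := by
    intro B a b
    rw [map_sum, Finset.sum_comm]
    refine Finset.sum_congr rfl fun i _ => ?_
    rw [map_sum]
    simp
  rw [toLp_eq]
  unfold cHessForm Lev
  rw [Complex.re_sum, Finset.smul_sum]
  unfold D2
  rw [hlin, hlin, ← Finset.sum_add_distrib, Finset.mul_sum]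
  refine Finset.sum_congr rfl fun i _ => ?_
  rw [Complex.re_sum, ← Finset.sum_add_distrib, Finset.mul_sum]
  refine Finset.sum_congr rfl fun j _ => ?_
  rw [hH, csmul_eq (w i), csmul_eq (w j)]
  change _ = (1/4) * (fderiv ℝ (fderiv ℝ u) z ((w i).re • e i + (w i).im • I • e i) ((w j).re • e j + (w j).im • I • e j) + fderiv ℝ (fderiv ℝ u) z (I • ((w i).re • e i + (w i).im • I • e i)) (I • ((w j).re • e j + (w j).im • I • e j)))
  simp only [smul_add, I_rsmul, I_I_smul]
  simp only [map_add, map_smul, add_apply, smul_apply, map_neg, neg_apply, smul_neg, smul_eq_mul]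
  unfold D2
  simp
  ring

theorem exists_SPD {Ω : Set (EuclideanSpace ℂ (Fin n))} (h : IsStrictlyPseudoconvexDomain n ⊤ Ω) :
    ∃ r δ0 c M, SPD Ω r δ0 c M := by
  obtain ⟨hΩ, hb, U, ρ, ⟨hU, hcl, hρ, heqΩ, hgrad⟩, hlev⟩ := h
  refine exists_SPD_aux hΩ hb hU hcl hρ heqΩ hgrad fun z hz v hv h0 => ?_
  have hzU := hcl (frontier_subset_closure hz)
  have hc : ContDiffAt ℝ 2 ρ z := (hρ.contDiffAt (hU.mem_nhds hzU)).of_le two_le_top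
  have := hlev z hz v.ofLp (by intro h; exact hv (by ext i; simpa using congrFun h i)) (by
    rw [cGradPair_eq (hc.differentiableAt (by norm_num))]
    change (1/2) * lam ρ z v = 0
    rw [h0]; simp)
  rw [cHessForm_eq hc] at this
  change 0 < (1/4) * Lev ρ z v at this
  linarith
end Pre
end

section
section Hopf
variable {E : Type} [NormedAddCommGroup E] [InnerProductSpace ℂ E] [FiniteDimensional ℂ E] [NormedSpace ℝ E] [IsScalarTower ℝ ℂ E]

namespace SPD
variable {Ω : Set E} {r : E → ℝ} {δ0 c M : ℝ}

lemma mono (h : SPD Ω r δ0 c M) {δ0' c' M' : ℝ} (h1 : 0 < δ0') (h1' : δ0' ≤ δ0) (h2 : 0 < c') (h2' : c' ≤ c) (h3 : M ≤ M') :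
    SPD Ω r δ0' c' M' where
  smooth := h.smooth
  eq := h.eq
  bdd := h.bdd.subset fun z hz => le_trans (show r z ≤ δ0' from hz) h1'
  δ0_pos := h1
  δ0_le := h1'.trans h.δ0_le
  c_pos := h2
  c_le := h2'.trans h.c_le
  M_ge := h.M_ge.trans h3
  grad := fun z hz => h2'.trans (h.grad z (hz.trans h1'))
  lev := fun z v hz => (mul_le_mul_of_nonneg_right h2' (by positivity)).trans (h.lev z v (hz.trans h1'))
  b1 := fun z => (h.b1 z).trans h3
  b2 := fun z => (h.b2 z).trans h3
  b3 := fun x y => (h.b3 x y).trans (mul_le_mul_of_nonneg_right h3 (by positivity))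
  bΩ := fun z hz => (h.bΩ z hz).trans h3
  br := fun z => (h.br z).trans h3

lemma M_pos (h : SPD Ω r δ0 c M) : 0 < M := lt_of_lt_of_le one_pos h.M_ge
lemma mem_iff (h : SPD Ω r δ0 c M) (z : E) : z ∈ Ω ↔ r z < 0 := by rw [h.eq]; rfl
lemma isOpen (h : SPD Ω r δ0 c M) : IsOpen Ω := by rw [h.eq]; exact isOpen_lt h.smooth.continuous continuous_const
lemma cd2 (h : SPD Ω r δ0 c M) : ContDiff ℝ 2 r := h.smooth.of_le two_le_top
lemma diff (h : SPD Ω r δ0 c M) (z : E) : DifferentiableAt ℝ r z := h.smooth.differentiable (by simp) z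

lemma lip (h : SPD Ω r δ0 c M) (x y : E) : |r x - r y| ≤ M * ‖x - y‖ := by
  have := Convex.norm_image_sub_le_of_norm_fderiv_le (f := r) (𝕜 := ℝ) (s := Set.univ) (C := M) (fun z _ => h.diff z)
      (fun z _ => h.b1 z) convex_univ (Set.mem_univ y) (Set.mem_univ x)
  exact this

lemma lam_le (h : SPD Ω r δ0 c M) (z : E) : ‖lam r z‖ ≤ 2 * M := (norm_lamL_le _).trans (by have := h.b1 z; linarith)

lemma lam_app_le (h : SPD Ω r δ0 c M) (z v : E) : ‖lam r z v‖ ≤ 2 * M * ‖v‖ := ((lam r z).le_opNorm v).trans (mul_le_mul_of_nonneg_right (h.lam_le z) (norm_nonneg _))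

lemma lam_lip (h : SPD Ω r δ0 c M) (x y : E) : ‖lam r x - lam r y‖ ≤ 2 * M * ‖x - y‖ := by
  have h1 := Convex.norm_image_sub_le_of_norm_fderiv_le (f := fderiv ℝ r) (𝕜 := ℝ) (s := Set.univ) (C := M) (fun z _ => diff_fderiv h.cd2.contDiffAt)
      (fun z _ => h.b2 z) convex_univ (Set.mem_univ y) (Set.mem_univ x)
  have h2 := norm_lamL_le (fderiv ℝ r x - fderiv ℝ r y)
  rw [map_sub] at h2
  unfold lam
  linarith

lemma D2_le (h : SPD Ω r δ0 c M) (z v w : E) : |D2 r z v w| ≤ M * ‖v‖ * ‖w‖ := by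
  have h1 := (fderiv ℝ (fderiv ℝ r) z).le_opNorm v
  have h2 := (fderiv ℝ (fderiv ℝ r) z v).le_opNorm w
  have h3 := h.b2 z
  unfold D2; rw [← Real.norm_eq_abs]
  refine h2.trans ?_
  gcongr
  exact h1.trans (by gcongr)

lemma Lev_le (h : SPD Ω r δ0 c M) (z v : E) : Lev r z v ≤ 2 * M * ‖v‖ ^ 2 := by
  have h1 := (le_abs_self _).trans (h.D2_le z v v)
  have h2 := (le_abs_self _).trans (h.D2_le z (I • v) (I • v))
  rw [norm_smul, norm_I, one_mul] at h2
  unfold Lev; nlinarith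

lemma QQ_le (h : SPD Ω r δ0 c M) (z v w : E) : ‖QQ r z v w‖ ≤ M * ‖v‖ * ‖w‖ := by
  refine ((QQ r z v).le_opNorm w).trans ?_
  gcongr
  exact ((QQ r z).le_opNorm v).trans (mul_le_mul_of_nonneg_right ((norm_QQ_le r z).trans (h.b2 z)) (norm_nonneg _))

lemma taylor (h : SPD Ω r δ0 c M) (z v : E) : |r (z + v) - r z - (lam r z v + QQ r z v v).re - Lev r z v / 4| ≤ M * ‖v‖ ^ 3 :=
  taylor3 h.cd2 h.b3 z v

lemma compact_le (h : SPD Ω r δ0 c M) {x : ℝ} (hx : x ≤ δ0) : IsCompact {z | r z ≤ x} := by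
  have : FiniteDimensional ℝ E := real_fd
  have : ProperSpace E := FiniteDimensional.proper ℝ E
  exact isCompact_of_isClosed_isBounded (isClosed_le h.smooth.continuous continuous_const)
    (h.bdd.subset fun z hz => le_trans (show r z ≤ x from hz) hx)

/-- a normal vector: `λ n = 1`, `‖n‖ ≤ 2/c`. -/
lemma exists_normal (h : SPD Ω r δ0 c M) {z : E} (hz : |r z| ≤ δ0) : ∃ n : E, lam r z n = 1 ∧ ‖n‖ ≤ 2 / c := by
  have hc := h.c_pos
  have h1 := h.grad z hz
  obtain ⟨v, hv⟩ : ∃ v, c / 2 * ‖v‖ < ‖lam r z v‖ := by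
    by_contra! hcon
    have := ContinuousLinearMap.opNorm_le_bound (lam r z) (by positivity) hcon
    linarith
  have hne : lam r z v ≠ 0 := by
    intro h0; rw [h0, norm_zero] at hv
    have : 0 ≤ c / 2 * ‖v‖ := by positivity
    linarith
  have hp : 0 < ‖lam r z v‖ := norm_pos_iff.2 hne
  refine ⟨(lam r z v)⁻¹ • v, by rw [map_smul, smul_eq_mul, inv_mul_cancel₀ hne], ?_⟩
  rw [norm_smul, norm_inv, inv_mul_le_iff₀ hp, mul_comm, div_mul_eq_mul_div, le_div_iff₀ hc]
  linarith
end SPD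

structure BH (Ω₁ Ω₂ : Set E) (r₁ r₂ : E → ℝ) (δ0 c M : ℝ) (φ ψ : E → E) : Prop where
  s1 : SPD Ω₁ r₁ δ0 c M
  s2 : SPD Ω₂ r₂ δ0 c M
  hφ : DifferentiableOn ℂ φ Ω₁
  hψ : DifferentiableOn ℂ ψ Ω₂
  mφ : Set.MapsTo φ Ω₁ Ω₂
  mψ : Set.MapsTo ψ Ω₂ Ω₁
  li : ∀ z ∈ Ω₁, ψ (φ z) = z
  ri : ∀ w ∈ Ω₂, φ (ψ w) = w

variable {Ω₁ Ω₂ : Set E} {r₁ r₂ : E → ℝ} {δ0 c M : ℝ} {φ ψ : E → E}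

lemma BH.symm (h : BH Ω₁ Ω₂ r₁ r₂ δ0 c M φ ψ) : BH Ω₂ Ω₁ r₂ r₁ δ0 c M ψ φ :=
  ⟨h.s2, h.s1, h.hψ, h.hφ, h.mψ, h.mφ, h.ri, h.li⟩

lemma hopf (h1 : SPD Ω₁ r₁ δ0 c M) (h2 : SPD Ω₂ r₂ δ0 c M) (hφ : DifferentiableOn ℂ φ Ω₁) (mφ : Set.MapsTo φ Ω₁ Ω₂) :
    ∃ a > 0, ∀ z ∈ Ω₁, r₂ (φ z) ≤ a * r₁ z := by
  have hc := h1.c_pos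
  have hM := h1.M_pos
  have hδ := h1.δ0_pos
  set A : ℝ := 16 * M / c ^ 2 with hA
  have hA0 : 0 < A := by positivity
  set δ1 : ℝ := min δ0 (1 / (2 * A)) with hδ1
  have hδ1p : 0 < δ1 := by positivity
  have hδ1a : δ1 ≤ δ0 := min_le_left _ _
  have hδ1b : 2 * A * δ1 ≤ 1 := by
    have : δ1 ≤ 1 / (2 * A) := min_le_right _ _
    rw [le_div_iff₀ (by positivity)] at this; linarith
  set u : E → ℝ := fun z => r₂ (φ z) with hu
  have hus : ContDiffOn ℝ 2 u Ω₁ := h2.cd2.comp_contDiffOn ((holo_contDiffOn h1.isOpen hφ).of_le two_le_top)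
  have hun : ∀ z ∈ Ω₁, u z < 0 := fun z hz => (h2.mem_iff _).1 (mφ hz)
  -- deep part
  obtain ⟨m, hm, hmu⟩ : ∃ m > 0, ∀ z, r₁ z ≤ -δ1 → u z ≤ -m := by
    have hK : IsCompact {z | r₁ z ≤ -δ1} := h1.compact_le (by linarith)
    have hKΩ : {z | r₁ z ≤ -δ1} ⊆ Ω₁ := fun z hz => (h1.mem_iff z).2 (by have : r₁ z ≤ -δ1 := hz; linarith)
    rcases Set.eq_empty_or_nonempty {z | r₁ z ≤ -δ1} with he | hne
    · exact ⟨1, one_pos, fun z hz => by have : z ∈ {z | r₁ z ≤ -δ1} := hz; rw [he] at this; exact absurd this (by simp)⟩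
    · obtain ⟨x, hx, hmax⟩ := hK.exists_isMaxOn hne (hus.continuousOn.mono hKΩ)
      refine ⟨-u x, by have := hun x (hKΩ hx); linarith, fun z hz => ?_⟩
      have : u z ≤ u x := hmax hz
      linarith
  set a : ℝ := min (m / M) (min (m / (2 * δ1)) (δ0 / (2 * δ1))) with ha
  have ha0 : 0 < a := by positivity
  have ha1 : a * M ≤ m := by
    have : a ≤ m / M := min_le_left _ _
    rwa [le_div_iff₀ hM] at this
  have ha2 : a * (2 * δ1) ≤ m := by
    have : a ≤ m / (2 * δ1) := (min_le_right _ _).trans (min_le_left _ _)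
    rwa [le_div_iff₀ (by positivity)] at this
  have ha3 : a * (2 * δ1) ≤ δ0 := by
    have : a ≤ δ0 / (2 * δ1) := (min_le_right _ _).trans (min_le_right _ _)
    rwa [le_div_iff₀ (by positivity)] at this
  set g : ℝ → ℝ := fun x => -a * (x - A * x ^ 2) with hg
  have hgs : ContDiff ℝ 2 g := by fun_prop
  have hgd : deriv g = fun x => -a * (1 - 2 * A * x) := by
    ext x
    have h1 : HasDerivAt g (-a * (1 - A * (2 * x))) x := by
      have := ((hasDerivAt_id x).sub (((hasDerivAt_pow 2 x)).const_mul A)).const_mul (-a)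
      exact this.congr_deriv (by simp)
    rw [h1.deriv]; ring
  have hgdd : ∀ x, deriv (deriv g) x = 2 * a * A := by
    intro x; rw [hgd]
    have h1 : HasDerivAt (fun x => -a * (1 - 2 * A * x)) (2 * a * A) x := by
      have := (((hasDerivAt_id x).const_mul (2 * A)).const_sub 1).const_mul (-a)
      exact this.congr_deriv (by ring)
    exact h1.deriv
  set W : Set E := {z | -δ1 < r₁ z ∧ r₁ z < 0} with hW
  have hWΩ : W ⊆ Ω₁ := fun z hz => (h1.mem_iff z).2 hz.2
  have hWo : IsOpen W := (isOpen_lt continuous_const h1.smooth.continuous).inter (isOpen_lt h1.smooth.continuous continuous_const)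
  -- bound on g
  have hgb : ∀ x, -δ1 ≤ x → x ≤ 0 → 0 ≤ g x ∧ g x ≤ a * (2 * (-x)) := by
    intro x hx hx0
    have e1 : A * x ^ 2 ≤ -x := by nlinarith [mul_nonneg hA0.le (sub_nonneg.2 hx), mul_nonneg (neg_nonneg.2 hx0) hA0.le]
    have e0 : 0 ≤ A * x ^ 2 := by positivity
    constructor
    · simp only [hg]; nlinarith
    · simp only [hg]; nlinarith
  have key : ∀ z ∈ W, u z + g (r₁ z) ≤ 0 := by
    refine max_principle hWo ((hus.mono hWΩ).add ((hgs.comp h1.cd2).contDiffOn)) ?_ ?_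
    · intro ε hε
      have hset : {z | z ∈ W ∧ ε ≤ u z + g (r₁ z)} = {z | r₁ z ≤ -(ε / (2 * a))} ∩ ({z | -δ1 ≤ r₁ z} ∩ {z | z ∈ Ω₁ ∧ ε ≤ u z + g (r₁ z)}) := by
        ext z
        constructor
        · rintro ⟨hz, hzε⟩
          refine ⟨?_, hz.1.le, hWΩ hz, hzε⟩
          have b := (hgb _ hz.1.le hz.2.le).2
          have := hun z (hWΩ hz)
          change r₁ z ≤ -(ε / (2 * a))
          have : ε / (2 * a) ≤ -r₁ z := by rw [div_le_iff₀ (by positivity)]; nlinarith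
          linarith
        · rintro ⟨hz1, hz2, hz3, hz4⟩
          refine ⟨⟨lt_of_le_of_ne hz2 ?_, (h1.mem_iff z).1 hz3⟩, hz4⟩
          intro he
          have b := (hgb (r₁ z) hz2 ((h1.mem_iff z).1 hz3).le).2
          have := hmu z he.symm.le
          rw [← he] at b hz4
          simp only [neg_neg] at b
          linarith
      rw [hset]
      have hK : IsCompact ({z | r₁ z ≤ -(ε / (2 * a))} ∩ {z | -δ1 ≤ r₁ z}) :=
        (h1.compact_le (by have : 0 < ε / (2 * a) := by positivity
                           linarith)).inter_right (isClosed_le continuous_const h1.smooth.continuous)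
      have hKΩ : {z | r₁ z ≤ -(ε / (2 * a))} ∩ {z | -δ1 ≤ r₁ z} ⊆ Ω₁ := fun z hz => (h1.mem_iff z).2 (by
        have h1 : r₁ z ≤ -(ε / (2 * a)) := hz.1
        have : 0 < ε / (2 * a) := by positivity
        linarith)
      have hcont : ContinuousOn (fun z => u z + g (r₁ z)) ({z | r₁ z ≤ -(ε / (2 * a))} ∩ {z | -δ1 ≤ r₁ z}) :=
        (hus.continuousOn.mono hKΩ).add (hgs.continuous.comp h1.smooth.continuous).continuousOn
      have hcl := hcont.preimage_isClosed_of_isClosed hK.isClosed (isClosed_Ici (a := ε))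
      have hfin := hK.of_isClosed_subset hcl Set.inter_subset_left
      convert hfin using 1
      ext z; constructor
      · rintro ⟨a1, a2, _, a3⟩; exact ⟨⟨a1, a2⟩, a3⟩
      · rintro ⟨⟨a1, a2⟩, a3⟩; exact ⟨a1, a2, hKΩ ⟨a1, a2⟩, a3⟩
    · intro z hz hpos
      have hzΩ := hWΩ hz
      have b := (hgb _ hz.1.le hz.2.le).2
      have hu0 := hun z hzΩ
      have hzδ : |r₁ z| ≤ δ0 := by rw [abs_of_neg hz.2]; linarith [hz.1]
      have hwδ : |r₂ (φ z)| ≤ δ0 := by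
        rw [abs_of_neg hu0]
        have : a * (2 * -r₁ z) ≤ a * (2 * δ1) := by gcongr; linarith [hz.1]
        simp only [hu] at hpos; linarith
      obtain ⟨n, hn1, hn2⟩ := h1.exists_normal hzδ
      refine ⟨n, ?_⟩
      have hcu : ContDiffAt ℝ 2 u z := hus.contDiffAt (h1.isOpen.mem_nhds hzΩ)
      rw [Lev_add (w := fun z => g (r₁ z)) hcu (hgs.comp h1.cd2).contDiffAt]
      have l1 : 0 ≤ Lev u z n := by
        rw [hu, Lev_comp_holo h1.isOpen hzΩ hφ h2.cd2.contDiffAt]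
        have := h2.lev (φ z) (fderiv ℂ φ z n) hwδ
        exact le_trans (mul_nonneg h2.c_pos.le (by positivity)) this
      have l2 : Lev (fun y => g (r₁ y)) z n = -a * (1 - 2 * A * r₁ z) * Lev r₁ z n + 2 * a * A := by
        rw [Lev_comp hgs.contDiffAt h1.cd2.contDiffAt, ← lam_normSq, hn1, hgdd, hgd]; simp
      have l3 := h1.Lev_le z n
      have l4 := h1.lev z n hzδ
      have hn3 : ‖n‖ ^ 2 ≤ 4 / c ^ 2 := by
        calc ‖n‖ ^ 2 ≤ (2 / c) ^ 2 := by gcongr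
          _ = 4 / c ^ 2 := by rw [div_pow]; norm_num
      have l5 : Lev r₁ z n ≤ A / 2 := by
        calc Lev r₁ z n ≤ 2 * M * (4 / c ^ 2) := l3.trans (by gcongr)
          _ = A / 2 := by rw [hA]; ring
      have l6 : 1 - 2 * A * r₁ z ≤ 2 := by nlinarith [hz.1]
      have l7 : 0 ≤ 1 - 2 * A * r₁ z := by nlinarith [hz.2]
      have l8 : (1 - 2 * A * r₁ z) * Lev r₁ z n ≤ A := by
        have : 0 ≤ Lev r₁ z n := le_trans (by positivity) l4
        nlinarith
      rw [l2]
      have : a * ((1 - 2 * A * r₁ z) * Lev r₁ z n) ≤ a * A := by gcongr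
      have : 0 < a * A := by positivity
      nlinarith
  refine ⟨a, ha0, fun z hz => ?_⟩
  have hz0 := (h1.mem_iff z).1 hz
  by_cases hd : -δ1 < r₁ z
  · have := key z ⟨hd, hz0⟩
    have e0 : 0 ≤ a * (A * r₁ z ^ 2) := by positivity
    simp only [hg, hu] at this
    nlinarith
  · have h3 := hmu z (not_lt.1 hd)
    have h4 := (abs_le.1 (h1.br z)).1
    have : a * (-r₁ z) ≤ a * M := by gcongr; linarith
    simp only [hu] at h3
    nlinarith
end Hopf
end

section
section Grad
variable {E : Type} [NormedAddCommGroup E] [InnerProductSpace ℂ E] [FiniteDimensional ℂ E] [NormedSpace ℝ E] [IsScalarTower ℝ ℂ E]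

lemma disc_max {S : ℂ → ℝ} {ρ B : ℝ} (hρ : 0 < ρ) (hc : ContinuousOn S (closedBall 0 ρ)) (hs : ContDiffOn ℝ 2 S (ball 0 ρ))
    (hl : ∀ z ∈ ball (0:ℂ) ρ, ∀ v, 0 ≤ Lev S z v) (hb : ∀ z ∈ sphere (0:ℂ) ρ, S z ≤ B) :
    ∀ z ∈ ball (0:ℂ) ρ, S z ≤ B := by
  intro z hz
  refine le_of_forall_pos_le_add fun κ hκ => ?_
  set κ' := κ / ρ ^ 2 with hκ'
  have hκ'0 : 0 < κ' := by positivity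
  have hq : ContDiff ℝ 2 (fun y : ℂ => ‖y - 0‖ ^ 2) := (contDiff_norm_sq ℂ).comp (contDiff_id.sub contDiff_const)
  set u : ℂ → ℝ := fun y => S y + (κ' * ‖y - 0‖ ^ 2 + (-B - κ)) with hu
  have hqq : ContDiff ℝ 2 (fun y : ℂ => κ' * ‖y - 0‖ ^ 2 + (-B - κ)) := (contDiff_const.mul hq).add contDiff_const
  have huc : ContinuousOn u (closedBall 0 ρ) := hc.add hqq.continuous.continuousOn
  have hsph : ∀ y ∈ sphere (0:ℂ) ρ, u y ≤ 0 := by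
    intro y hy
    have h1 := hb y hy
    have h2 : ‖y‖ = ρ := by simpa using hy
    simp only [hu, sub_zero, h2, hκ']
    rw [div_mul_cancel₀ _ (by positivity)]; linarith
  have := max_principle (u := u) (W := ball 0 ρ) isOpen_ball (hs.add hqq.contDiffOn) ?_ ?_ z hz
  · simp only [hu] at this
    have : 0 ≤ κ' * ‖z - 0‖ ^ 2 := by positivity
    linarith
  · intro ε hε
    have hcl := huc.preimage_isClosed_of_isClosed isClosed_closedBall (isClosed_Ici (a := ε))
    have hfin := (isCompact_closedBall (0:ℂ) ρ).of_isClosed_subset hcl Set.inter_subset_left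
    convert hfin using 1
    ext y; constructor
    · rintro ⟨h1, h2⟩; exact ⟨ball_subset_closedBall h1, h2⟩
    · rintro ⟨h1, h2⟩
      refine ⟨?_, h2⟩
      rcases (mem_closedBall.1 h1).lt_or_eq with h | h
      · exact h
      · have := hsph y h
        have : ε ≤ u y := h2
        linarith
  · intro y hy _
    refine ⟨1, ?_⟩
    have h1 : ContDiffAt ℝ 2 S y := hs.contDiffAt (isOpen_ball.mem_nhds hy)
    rw [hu, Lev_add (w := fun y : ℂ => κ' * ‖y - 0‖ ^ 2 + (-B - κ)) h1 hqq.contDiffAt, Lev_add (u := fun y : ℂ => κ' * ‖y - 0‖ ^ 2) (contDiffAt_const.mul hq.contDiffAt) contDiffAt_const,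
      Lev_const_mul _ hq.contDiffAt, Lev_normSq, Lev_const]
    have := hl y hy 1
    simp; positivity

lemma deriv_bound {f : ℂ → E} {R B : ℝ} {z : ℂ} (hR : 0 < R) (hf : DifferentiableOn ℂ f (ball z R)) (hB : ∀ w ∈ ball z R, ‖f w‖ ≤ B) :
    ‖deriv f z‖ ≤ B / R := by
  have h1 := cauchy_fderiv hR hf hB
  have h2 := (fderiv ℂ f z).le_opNorm 1
  simp only [norm_one, mul_one] at h2
  exact h2.trans h1

lemma disc_lip {f : ℂ → E} {B : ℝ} (hf : DifferentiableOn ℂ f (ball 0 1)) (hB : ∀ w ∈ ball (0:ℂ) (1/2), ‖deriv f w‖ ≤ B) :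
    ∀ w ∈ ball (0:ℂ) (1/2), ‖f w - f 0‖ ≤ B * ‖w‖ := by
  intro w hw
  have := Convex.norm_image_sub_le_of_norm_deriv_le (f := f) (s := ball (0:ℂ) (1/2)) (C := B)
    (fun x hx => hf.differentiableAt (isOpen_ball.mem_nhds (ball_subset_ball (by norm_num) hx))) hB (convex_ball _ _) (mem_ball_self (by norm_num)) hw
  simpa using this

variable {Ω : Set E} {r : E → ℝ} {δ0 c M : ℝ}

lemma grad_lemma (h : SPD Ω r δ0 c M) : ∃ K > 0, ∀ f : ℂ → E, DifferentiableOn ℂ f (ball 0 1) → Set.MapsTo f (ball 0 1) Ω →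
    ‖deriv f 0‖ ^ 2 ≤ K * (-r (f 0)) := by
  have hc := h.c_pos
  have hM := h.M_pos
  have hδ := h.δ0_pos
  set ρ : ℝ := min (1/4) (δ0 / (4 * M ^ 2)) with hρ
  have hρ0 : 0 < ρ := by positivity
  have hρ1 : ρ ≤ 1/4 := min_le_left _ _
  have hρ2 : ρ * (4 * M ^ 2) ≤ δ0 := by
    have : ρ ≤ δ0 / (4 * M ^ 2) := min_le_right _ _
    rwa [le_div_iff₀ (by positivity)] at this
  set ε := c / 4 with hε
  have hε0 : 0 < ε := by positivity
  refine ⟨max (2 * M ^ 2 / δ0) (1 / (ε * ρ ^ 2)), by positivity, fun f hf hm => ?_⟩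
  have hneg : ∀ ζ ∈ ball (0:ℂ) 1, r (f ζ) < 0 := fun ζ hζ => (h.mem_iff _).1 (hm hζ)
  have h00 : (0:ℂ) ∈ ball (0:ℂ) 1 := mem_ball_self one_pos
  have hr0 := hneg 0 h00
  have hfM : ∀ ζ ∈ ball (0:ℂ) 1, ‖f ζ‖ ≤ M := fun ζ hζ => h.bΩ _ (hm hζ)
  by_cases hbig : δ0 / 2 ≤ -r (f 0)
  · have h1 := deriv_bound one_pos hf hfM
    rw [div_one] at h1
    calc ‖deriv f 0‖ ^ 2 ≤ M ^ 2 := by gcongr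
      _ = 2 * M ^ 2 / δ0 * (δ0 / 2) := by field_simp
      _ ≤ max (2 * M ^ 2 / δ0) (1 / (ε * ρ ^ 2)) * (-r (f 0)) := by
        gcongr; exact le_max_left _ _
  push Not at hbig
  set a := deriv f 0 with ha
  have hder : ∀ w ∈ ball (0:ℂ) (1/2), ‖deriv f w‖ ≤ 2 * M := by
    intro w hw
    have hsub : ball w (1/2) ⊆ ball (0:ℂ) 1 := by
      intro y hy; rw [mem_ball] at *; have := dist_triangle y w 0; linarith
    have := deriv_bound (by norm_num : (0:ℝ) < 1/2) (hf.mono hsub) (fun y hy => hfM y (hsub hy))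
    linarith
  have hlip := disc_lip hf hder
  have hsub1 : closedBall (0:ℂ) ρ ⊆ ball 0 (1/2) := closedBall_subset_ball (by linarith)
  have hsub2 : ball (0:ℂ) (1/2) ⊆ ball 0 1 := ball_subset_ball (by norm_num)
  have hcollar : ∀ ζ ∈ closedBall (0:ℂ) ρ, |r (f ζ)| ≤ δ0 := by
    intro ζ hζ
    have h1 := h.lip (f ζ) (f 0)
    have h2 := hlip ζ (hsub1 hζ)
    have h3 : ‖ζ‖ ≤ ρ := by simpa using hζ
    have h4 : M * ‖f ζ - f 0‖ ≤ M * (2 * M * ρ) := by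
      gcongr; exact h2.trans (by gcongr)
    have h5 := hneg ζ (hsub2 (hsub1 hζ))
    rw [abs_of_neg h5]
    have := (abs_le.1 h1).1
    nlinarith
  haveI : CompleteSpace E := FiniteDimensional.complete ℂ E
  set F1 : ℂ → E := dslope f 0 with hF1
  have hF1d : DifferentiableOn ℂ F1 (ball 0 1) := (Complex.differentiableOn_dslope (isOpen_ball.mem_nhds h00)).2 hf
  have hF10 : F1 0 = a := dslope_same f 0
  set P : ℂ → ℂ := fun ζ => (2 * (ε * ρ ^ 2) : ℝ) * inner ℂ a (F1 ζ) with hP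
  have hPd : DifferentiableOn ℂ P (ball 0 1) := by
    have : DifferentiableOn ℂ (fun ζ => innerSL ℂ a (F1 ζ)) (ball 0 1) := (innerSL ℂ a).differentiable.comp_differentiableOn hF1d
    exact this.const_mul _
  set N : E → ℝ := fun y => r y + (-ε) * ‖y - f 0‖ ^ 2 with hN
  have hq : ContDiff ℝ 2 (fun y : E => ‖y - f 0‖ ^ 2) := (contDiff_norm_sq ℂ).comp (contDiff_id.sub contDiff_const)
  have hNs : ContDiff ℝ 2 N := h.cd2.add (contDiff_const.mul hq)
  have hNf : ContDiffOn ℝ 2 (fun ζ => N (f ζ)) (ball 0 1) := hNs.comp_contDiffOn ((holo_contDiffOn isOpen_ball hf).of_le two_le_top)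
  have hPr : ContDiffOn ℝ 2 (fun ζ => (P ζ).re) (ball 0 1) := reCLM.contDiff.comp_contDiffOn ((holo_contDiffOn isOpen_ball hPd).of_le two_le_top)
  have hmain := disc_max (S := fun ζ => N (f ζ) + (P ζ).re) (ρ := ρ) (B := ε * ρ ^ 2 * ‖a‖ ^ 2) hρ0
    ((hNf.continuousOn.add hPr.continuousOn).mono (hsub1.trans hsub2)) ((hNf.add hPr).mono (ball_subset_closedBall.trans (hsub1.trans hsub2))) ?_ ?_ 0 (mem_ball_self hρ0)
  · have e : (P 0).re = 2 * (ε * ρ ^ 2) * ‖a‖ ^ 2 := by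
      simp only [hP, hF10]
      rw [Complex.re_ofReal_mul]
      congr 1
      have := inner_self_eq_norm_sq (𝕜 := ℂ) a
      simpa using this
    simp only [e, hN, sub_self, norm_zero] at hmain
    have h2 : ε * ρ ^ 2 * ‖a‖ ^ 2 ≤ -r (f 0) := by nlinarith
    have h3 : 0 < ε * ρ ^ 2 := by positivity
    calc ‖a‖ ^ 2 = 1 / (ε * ρ ^ 2) * (ε * ρ ^ 2 * ‖a‖ ^ 2) := by field_simp
      _ ≤ 1 / (ε * ρ ^ 2) * (-r (f 0)) := by gcongr
      _ ≤ _ := by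
        have : 0 ≤ -r (f 0) := by linarith
        gcongr; exact le_max_right _ _
  · intro ζ hζ v
    have hζ1 : ζ ∈ ball (0:ℂ) 1 := hsub2 (hsub1 (ball_subset_closedBall hζ))
    rw [Lev_add (u := fun ζ => N (f ζ)) (hNf.contDiffAt (isOpen_ball.mem_nhds hζ1)) (hPr.contDiffAt (isOpen_ball.mem_nhds hζ1)),
      Lev_re_holo isOpen_ball hζ1 hPd, Lev_comp_holo isOpen_ball hζ1 hf hNs.contDiffAt, hN,
      Lev_add (w := fun y => (-ε) * ‖y - f 0‖ ^ 2) h.cd2.contDiffAt (contDiffAt_const.mul hq.contDiffAt), Lev_const_mul _ hq.contDiffAt, Lev_normSq]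
    have := h.lev (f ζ) (fderiv ℂ f ζ v) (hcollar ζ (ball_subset_closedBall hζ))
    rw [hε]; nlinarith
  · intro ζ hζ
    have hζ1 : ζ ∈ ball (0:ℂ) 1 := hsub2 (hsub1 (sphere_subset_closedBall hζ))
    have h1 := hneg ζ hζ1
    have hn : ‖ζ‖ = ρ := by simpa using hζ
    have e1 : f ζ - f 0 = ζ • F1 ζ := by
      have := sub_smul_dslope f 0 ζ
      rw [sub_zero] at this; exact this.symm
    have e2 : ‖f ζ - f 0‖ ^ 2 = ρ ^ 2 * ‖F1 ζ‖ ^ 2 := by rw [e1, norm_smul, hn, mul_pow]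
    have e3 : ‖a - F1 ζ‖ ^ 2 = ‖a‖ ^ 2 - 2 * (inner ℂ a (F1 ζ) : ℂ).re + ‖F1 ζ‖ ^ 2 := by
      have := @norm_sub_sq ℂ E _ _ _ a (F1 ζ); simpa using this
    have e4 : (P ζ).re = 2 * (ε * ρ ^ 2) * (inner ℂ a (F1 ζ) : ℂ).re := by simp only [hP]; rw [Complex.re_ofReal_mul]
    simp only [hN, e2, e4]
    have : 0 ≤ ε * ρ ^ 2 * ‖a - F1 ζ‖ ^ 2 := by positivity
    rw [e3] at this
    nlinarith

/-- gradient and normal estimate for discs in a collar of depth `D`. -/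
lemma disc_est (h : SPD Ω r δ0 c M) : ∃ K > 0, ∀ (f : ℂ → E) (D : ℝ), DifferentiableOn ℂ f (ball 0 1) → Set.MapsTo f (ball 0 1) Ω →
    (∀ ζ ∈ ball (0:ℂ) 1, -r (f ζ) ≤ D) → ‖deriv f 0‖ ^ 2 ≤ K * D ∧ ‖lam r (f 0) (deriv f 0)‖ ≤ K * D := by
  obtain ⟨K, hK, hgr⟩ := grad_lemma h
  have hc := h.c_pos
  have hM := h.M_pos
  have hδ := h.δ0_pos
  set B : ℝ := 1 + M * (K * (4 * K * M).sqrt) with hB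
  have hB0 : 0 < B := by positivity
  refine ⟨K + 2 * M ^ 2 / δ0 + 16 * B, by positivity, fun f D hf hm hD => ?_⟩
  have h00 : (0:ℂ) ∈ ball (0:ℂ) 1 := mem_ball_self one_pos
  have hneg : ∀ ζ ∈ ball (0:ℂ) 1, r (f ζ) < 0 := fun ζ hζ => (h.mem_iff _).1 (hm hζ)
  have hD0 : 0 < D := by have := hD 0 h00; have := hneg 0 h00; linarith
  have hfM : ∀ ζ ∈ ball (0:ℂ) 1, ‖f ζ‖ ≤ M := fun ζ hζ => h.bΩ _ (hm hζ)
  have g1 : ‖deriv f 0‖ ^ 2 ≤ K * D := (hgr f hf hm).trans (by have := hD 0 h00; gcongr)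
  refine ⟨g1.trans ?_, ?_⟩
  · gcongr
    have : 0 < 2 * M ^ 2 / δ0 + 16 * B := by positivity
    linarith
  by_cases hbig : δ0 ≤ -r (f 0) ∨ M < D
  · have h1 := deriv_bound one_pos hf hfM
    rw [div_one] at h1
    have h2 := h.lam_app_le (f 0) (deriv f 0)
    have h3 : δ0 ≤ D := by
      rcases hbig with hbig | hbig
      · exact hbig.trans (hD 0 h00)
      · have := h.δ0_le; have := h.M_ge; linarith
    calc ‖lam r (f 0) (deriv f 0)‖ ≤ 2 * M * M := h2.trans (by gcongr)
      _ = 2 * M ^ 2 / δ0 * δ0 := by field_simp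
      _ ≤ 2 * M ^ 2 / δ0 * D := by gcongr
      _ ≤ _ := by
        gcongr
        have : 0 < 16 * B := by positivity
        linarith
  push Not at hbig
  obtain ⟨hbig, hDM⟩ := hbig
  have hrδ : |r (f 0)| ≤ δ0 := by rw [abs_of_neg (hneg 0 h00)]; exact hbig.le
  set S := (4 * K * D).sqrt with hS
  have hS0 : 0 ≤ S := Real.sqrt_nonneg _
  have hS2 : S ^ 2 = 4 * K * D := Real.sq_sqrt (by positivity)
  have hder : ∀ w ∈ ball (0:ℂ) (1/2), ‖deriv f w‖ ≤ S := by
    intro w hw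
    have hmap : ∀ ζ ∈ ball (0:ℂ) 1, w + (1/2 : ℂ) * ζ ∈ ball (0:ℂ) 1 := by
      intro ζ hζ
      rw [mem_ball_zero_iff] at *
      calc ‖w + (1/2 : ℂ) * ζ‖ ≤ ‖w‖ + ‖(1/2 : ℂ) * ζ‖ := norm_add_le _ _
        _ = ‖w‖ + 1/2 * ‖ζ‖ := by rw [norm_mul]; norm_num
        _ < 1 := by linarith
    have hw1 : w ∈ ball (0:ℂ) 1 := ball_subset_ball (by norm_num) hw
    have hdd : HasDerivAt (fun ζ : ℂ => w + (1/2 : ℂ) * ζ) (1/2) 0 := by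
      simpa using ((hasDerivAt_id (0:ℂ)).const_mul (1/2 : ℂ)).const_add w
    have h1 := hgr (fun ζ => f (w + (1/2 : ℂ) * ζ)) (hf.comp (by fun_prop) hmap) (fun ζ hζ => hm (hmap ζ hζ))
    have hfd : HasDerivAt f (deriv f w) (w + (1/2 : ℂ) * 0) := by
      simpa using (hf.differentiableAt (isOpen_ball.mem_nhds hw1)).hasDerivAt
    have h2 := (hfd.scomp (0:ℂ) hdd).deriv
    have h2' : deriv (fun ζ => f (w + (1/2 : ℂ) * ζ)) 0 = (1/2 : ℂ) • deriv f w := h2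
    rw [h2', norm_smul] at h1
    have h3 := hD w hw1
    have : ‖(1/2 : ℂ)‖ = 1/2 := by norm_num
    rw [this] at h1
    simp only [mul_zero, add_zero] at h1
    apply Real.le_sqrt_of_sq_le
    have : K * (-r (f w)) ≤ K * D := by gcongr
    nlinarith
  have hlip := disc_lip hf hder
  set Gf : ℂ → ℂ := fun ζ => lam r (f 0) (f ζ - f 0) + QQ r (f 0) (f ζ - f 0) (f ζ - f 0) with hGf
  have hsub2 : ball (0:ℂ) (1/2) ⊆ ball 0 1 := ball_subset_ball (by norm_num)
  have hGd : DifferentiableOn ℂ Gf (ball 0 1) := by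
    have h1 : DifferentiableOn ℂ (fun ζ => f ζ - f 0) (ball 0 1) := hf.sub_const _
    exact ((lam r (f 0)).differentiable.comp_differentiableOn h1).add
      (((QQ r (f 0)).differentiable.comp_differentiableOn h1).clm_apply h1)
  have hG0 : Gf 0 = 0 := by simp [hGf]
  have hGre : ∀ ζ ∈ ball (0:ℂ) (1/2), (Gf ζ).re ≤ B * D := by
    intro ζ hζ
    have h1 := (abs_le.1 (h.taylor (f 0) (f ζ - f 0))).1
    rw [add_sub_cancel] at h1
    have h2 := h.lev (f 0) (f ζ - f 0) hrδ
    have h3 := hneg ζ (hsub2 hζ)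
    have h4 := hD 0 h00
    have h5 : ‖f ζ - f 0‖ ≤ S / 2 := (hlip ζ hζ).trans (by
      have : ‖ζ‖ < 1/2 := by simpa using hζ
      nlinarith)
    have h6 : ‖f ζ - f 0‖ ^ 3 ≤ (S / 2) ^ 3 := by gcongr
    have h7 : S ≤ (4 * K * M).sqrt := Real.sqrt_le_sqrt (by gcongr)
    have h8 : M * ‖f ζ - f 0‖ ^ 3 ≤ M * (K * (4 * K * M).sqrt) * D := by
      calc M * ‖f ζ - f 0‖ ^ 3 ≤ M * (S / 2) ^ 3 := by gcongr
        _ = M * (K * D * S / 2) := by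
          have : S ^ 3 = S * (4 * K * D) := by rw [← hS2]; ring
          rw [div_pow, this]; ring
        _ ≤ M * (K * D * (4 * K * M).sqrt) := by
          gcongr
          have : K * D * S ≤ K * D * (4 * K * M).sqrt := by gcongr
          have : 0 ≤ K * D * (4 * K * M).sqrt := by positivity
          linarith
        _ = _ := by ring
    have h9 : 0 ≤ Lev r (f 0) (f ζ - f 0) := le_trans (by positivity) h2
    simp only [hGf] at *
    rw [hB]
    linarith
  have hGn : ∀ ζ ∈ ball (0:ℂ) (1/4), ‖Gf ζ‖ ≤ 2 * (B * D) := by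
    intro ζ hζ
    have hζn : ‖ζ‖ < 1/4 := by simpa using hζ
    have := Complex.borelCaratheodory_zero (M := B * D) (R := 1/2) (f := Gf) (z := ζ) (by positivity) (hGd.mono hsub2) (fun ζ hζ => hGre ζ hζ) (by norm_num) (ball_subset_ball (by norm_num) hζ) hG0
    refine this.trans ?_
    rw [div_le_iff₀ (by linarith)]
    have : 0 < B * D := by positivity
    nlinarith
  have hdG := deriv_bound (E := ℂ) (by norm_num : (0:ℝ) < 1/4) (hGd.mono (ball_subset_ball (by norm_num))) hGn
  have hdeq : deriv Gf 0 = lam r (f 0) (deriv f 0) := by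
    have hfd : HasDerivAt (fun ζ => f ζ - f 0) (deriv f 0) 0 := (hf.differentiableAt (isOpen_ball.mem_nhds h00)).hasDerivAt.sub_const _
    have h1 := (lam r (f 0)).hasFDerivAt.comp_hasDerivAt (0:ℂ) hfd
    have h2 := (((QQ r (f 0)).hasFDerivAt.comp_hasDerivAt (0:ℂ) hfd)).clm_apply hfd
    have h3 : HasDerivAt Gf _ 0 := h1.add h2
    rw [h3.deriv]; simp
  rw [hdeq] at hdG
  refine hdG.trans ?_
  have : 0 < K + 2 * M ^ 2 / δ0 := by positivity
  have : 0 < B * D := by positivity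
  nlinarith
end Grad
end

section
section Est
variable {E : Type} [NormedAddCommGroup E] [InnerProductSpace ℂ E] [FiniteDimensional ℂ E] [NormedSpace ℝ E] [IsScalarTower ℝ ℂ E]
variable {Ω₁ Ω₂ Ω : Set E} {r₁ r₂ r : E → ℝ} {δ0 c M C : ℝ} {φ ψ : E → E}

lemma SPD.abs_Lev_le (h : SPD Ω r δ0 c M) (z v : E) : |Lev r z v| ≤ 2 * M * ‖v‖ ^ 2 := by
  have h1 := h.D2_le z v v
  have h2 := h.D2_le z (I • v) (I • v)
  have h3 : ‖I • v‖ = ‖v‖ := by rw [norm_smul]; simp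
  rw [h3] at h2
  have : Lev r z v = D2 r z v v + D2 r z (I • v) (I • v) := rfl
  rw [this]
  refine (abs_add_le _ _).trans ?_
  nlinarith

/-- quadratic closeness of `r` along complex tangential directions. -/
lemma SPD.tang (h : SPD Ω r δ0 c M) {z v : E} (hv : lam r z v = 0) (h1 : ‖v‖ ≤ 1) : |r (z + v) - r z| ≤ 3 * M * ‖v‖ ^ 2 := by
  have h2 := h.taylor z v
  have h3 := h.abs_Lev_le z v
  have h4 := (Complex.abs_re_le_norm _).trans (h.QQ_le z v v)
  rw [hv, zero_add] at h2
  have hM := h.M_pos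
  have h5 : M * ‖v‖ ^ 3 ≤ M * ‖v‖ ^ 2 := by
    have := pow_le_pow_of_le_one (norm_nonneg v) h1 (by norm_num : 2 ≤ 3)
    gcongr
  rw [abs_le] at *
  constructor <;> nlinarith

structure Est (Ω₁ : Set E) (r₁ r₂ : E → ℝ) (φ : E → E) (C : ℝ) : Prop where
  pos : 0 < C
  e1 : ∀ z ∈ Ω₁, -r₂ (φ z) ≤ C * (-r₁ z)
  e2 : ∀ z ∈ Ω₁, -r₁ z ≤ C * (-r₂ (φ z))
  g : ∀ z ∈ Ω₁, ∀ t, √(-r₁ z) * ‖fderiv ℂ φ z t‖ ≤ C * ‖t‖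
  n : ∀ z ∈ Ω₁, ∀ t, ‖lam r₂ (φ z) (fderiv ℂ φ z t)‖ ≤ C * ‖t‖
  tg : ∀ z ∈ Ω₁, ∀ t, lam r₁ z t = 0 → ‖fderiv ℂ φ z t‖ ≤ C * ‖t‖
  tn : ∀ z ∈ Ω₁, ∀ t, lam r₁ z t = 0 → ‖lam r₂ (φ z) (fderiv ℂ φ z t)‖ ≤ C * √(-r₁ z) * ‖t‖

lemma disc_apply (h : BH Ω₁ Ω₂ r₁ r₂ δ0 c M φ ψ) : ∃ K > 0, ∀ z ∈ Ω₁, ∀ s : E,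
    (∀ ζ : ℂ, ‖ζ‖ < 1 → |r₁ (z + ζ • s) - r₁ z| ≤ (-r₁ z) / 2) →
      ‖fderiv ℂ φ z s‖ ^ 2 ≤ K * (-r₁ z) ∧ ‖lam r₂ (φ z) (fderiv ℂ φ z s)‖ ≤ K * (-r₁ z) := by
  obtain ⟨K, hK, hest⟩ := disc_est h.s2
  obtain ⟨a, ha, hhopf⟩ := hopf h.s2 h.s1 h.hψ h.mψ
  refine ⟨K * (2 / a), by positivity, fun z hz s hs => ?_⟩
  have hz0 := (h.s1.mem_iff z).1 hz
  have hmem : ∀ ζ ∈ ball (0:ℂ) 1, z + ζ • s ∈ Ω₁ := by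
    intro ζ hζ
    rw [h.s1.mem_iff]
    have := (abs_le.1 (hs ζ (by simpa using hζ))).2
    linarith
  have hin : DifferentiableOn ℂ (fun ζ : ℂ => z + ζ • s) (ball 0 1) := by fun_prop
  have hd := hest (fun ζ => φ (z + ζ • s)) (2 / a * (-r₁ z)) (h.hφ.comp hin hmem) (fun ζ hζ => h.mφ (hmem ζ hζ)) ?_
  · have hφd : HasFDerivAt φ (fderiv ℂ φ z) (z + (0:ℂ) • s) := by
      simpa using (h.hφ.differentiableAt (h.s1.isOpen.mem_nhds hz)).hasFDerivAt
    have hl : HasDerivAt (fun ζ : ℂ => z + ζ • s) s 0 := by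
      simpa using ((hasDerivAt_id (0:ℂ)).smul_const s).const_add z
    have := (hφd.comp_hasDerivAt (0:ℂ) hl).deriv
    have e : deriv (fun ζ : ℂ => φ (z + ζ • s)) 0 = fderiv ℂ φ z s := this
    rw [e] at hd
    simp only [zero_smul, add_zero] at hd
    exact ⟨hd.1.trans (le_of_eq (by ring)), hd.2.trans (le_of_eq (by ring))⟩
  · intro ζ hζ
    have h1 := hhopf (φ (z + ζ • s)) (h.mφ (hmem ζ hζ))
    rw [h.li _ (hmem ζ hζ)] at h1
    have := (abs_le.1 (hs ζ (by simpa using hζ))).1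
    have h2 : a * (-r₂ (φ (z + ζ • s))) ≤ 2 * (-r₁ z) := by nlinarith
    rw [div_mul_eq_mul_div, le_div_iff₀ ha]; linarith

lemma Est.mono (h : Est Ω₁ r₁ r₂ φ C) {C' : ℝ} (hC : C ≤ C') (h1 : ∀ z ∈ Ω₁, r₁ z ≤ 0) (h2 : ∀ z ∈ Ω₁, r₂ (φ z) ≤ 0) : Est Ω₁ r₁ r₂ φ C' := by
  refine ⟨h.pos.trans_le hC, fun z hz => (h.e1 z hz).trans ?_, fun z hz => (h.e2 z hz).trans ?_, fun z hz t => (h.g z hz t).trans ?_,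
    fun z hz t => (h.n z hz t).trans ?_, fun z hz t ht => (h.tg z hz t ht).trans ?_, fun z hz t ht => (h.tn z hz t ht).trans ?_⟩
  · have := h1 z hz
    exact mul_le_mul_of_nonneg_right hC (by linarith)
  · have := h2 z hz
    exact mul_le_mul_of_nonneg_right hC (by linarith)
  all_goals gcongr

lemma exists_Est_aux (h : BH Ω₁ Ω₂ r₁ r₂ δ0 c M φ ψ) : ∃ C, Est Ω₁ r₁ r₂ φ C := by
  obtain ⟨K, hK, hd⟩ := disc_apply h
  obtain ⟨a, ha, hh⟩ := hopf h.s1 h.s2 h.hφ h.mφ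
  obtain ⟨a', ha', hh'⟩ := hopf h.s2 h.s1 h.hψ h.mψ
  have hM := h.s1.M_pos
  have hneg : ∀ z ∈ Ω₁, r₁ z < 0 := fun z hz => (h.s1.mem_iff z).1 hz
  have hneg2 : ∀ z ∈ Ω₁, r₂ (φ z) < 0 := fun z hz => (h.s2.mem_iff _).1 (h.mφ hz)
  set C : ℝ := 1 / a + 1 / a' + (√(K * (4 * M ^ 2))) + K * (2 * M) + √(K * (6 * M)) + K * √(6 * M) with hC
  have p1 : 0 < 1 / a := by positivity
  have p2 : 0 < 1 / a' := by positivity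
  have p3 : 0 ≤ √(K * (4 * M ^ 2)) := by positivity
  have p4 : 0 ≤ K * (2 * M) := by positivity
  have p5 : 0 ≤ √(K * (6 * M)) := by positivity
  have p6 : 0 ≤ K * √(6 * M) := by positivity
  have hC0 : 0 < C := by linarith
  -- scaled estimate
  have key : ∀ z ∈ Ω₁, ∀ t : E, ∀ κ : ℝ, 0 < κ → (∀ v : E, ‖v‖ ≤ κ → (∃ ζ : ℂ, v = ζ • t) → |r₁ (z + v) - r₁ z| ≤ (-r₁ z) / 2) →
      κ ^ 2 * ‖fderiv ℂ φ z t‖ ^ 2 ≤ K * (-r₁ z) * ‖t‖ ^ 2 ∧ κ * ‖lam r₂ (φ z) (fderiv ℂ φ z t)‖ ≤ K * (-r₁ z) * ‖t‖ := by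
    intro z hz t κ hκ hv
    rcases eq_or_ne t 0 with rfl | ht
    · simp
    have ht' : 0 < ‖t‖ := norm_pos_iff.2 ht
    have hn : ‖((κ / ‖t‖ : ℝ) : ℂ)‖ = κ / ‖t‖ := by rw [Complex.norm_real, Real.norm_of_nonneg (by positivity)]
    have := hd z hz (((κ / ‖t‖ : ℝ) : ℂ) • t) (by
      intro ζ hζ
      refine hv _ ?_ ⟨ζ * ((κ / ‖t‖ : ℝ) : ℂ), by rw [mul_smul]⟩
      rw [norm_smul, norm_smul, hn, div_mul_cancel₀ _ ht'.ne']
      nlinarith)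
    rw [map_smul, map_smul, norm_smul, norm_smul, hn] at this
    obtain ⟨q1, q2⟩ := this
    constructor
    · have := mul_le_mul_of_nonneg_right q1 (sq_nonneg ‖t‖)
      refine le_trans (le_of_eq ?_) this
      field_simp
    · have := mul_le_mul_of_nonneg_right q2 ht'.le
      refine le_trans (le_of_eq ?_) this
      field_simp
  have gen : ∀ z ∈ Ω₁, ∀ t : E, ((-r₁ z) / (2 * M)) ^ 2 * ‖fderiv ℂ φ z t‖ ^ 2 ≤ K * (-r₁ z) * ‖t‖ ^ 2 ∧
      ((-r₁ z) / (2 * M)) * ‖lam r₂ (φ z) (fderiv ℂ φ z t)‖ ≤ K * (-r₁ z) * ‖t‖ := by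
    intro z hz t
    have := hneg z hz
    refine key z hz t _ (by have : 0 < -r₁ z := by linarith
                            positivity) fun v hv _ => ?_
    have h1 := h.s1.lip (z + v) z
    rw [add_sub_cancel_left] at h1
    rw [le_div_iff₀ (by positivity)] at hv
    linarith
  have tan : ∀ z ∈ Ω₁, ∀ t : E, lam r₁ z t = 0 → (√((-r₁ z) / (6 * M))) ^ 2 * ‖fderiv ℂ φ z t‖ ^ 2 ≤ K * (-r₁ z) * ‖t‖ ^ 2 ∧
      (√((-r₁ z) / (6 * M))) * ‖lam r₂ (φ z) (fderiv ℂ φ z t)‖ ≤ K * (-r₁ z) * ‖t‖ := by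
    intro z hz t ht
    have hz0 : 0 < -r₁ z := by have := hneg z hz; linarith
    have hz1 : r₁ z ≠ 0 := (hneg z hz).ne
    refine key z hz t _ (by positivity) fun v hv => ?_
    rintro ⟨ζ, rfl⟩
    have hv2 : ‖ζ • t‖ ^ 2 ≤ (-r₁ z) / (6 * M) := by
      have := pow_le_pow_left₀ (norm_nonneg _) hv 2
      rwa [Real.sq_sqrt (by positivity)] at this
    have hb := (abs_le.1 (h.s1.br z)).1
    rw [le_div_iff₀ (by positivity)] at hv2
    have h1 : ‖ζ • t‖ ≤ 1 := by
      by_contra hcon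
      push Not at hcon
      have : 1 < ‖ζ • t‖ ^ 2 := by nlinarith
      nlinarith
    have := h.s1.tang (z := z) (v := ζ • t) (by rw [map_smul, ht, smul_zero]) h1
    linarith
  have sq_le : ∀ {x y : ℝ}, 0 ≤ y → x ^ 2 ≤ y ^ 2 → x ≤ y := fun hy hxy => le_of_sq_le_sq hxy hy
  refine ⟨C, hC0, ?_, ?_, ?_, ?_, ?_, ?_⟩
  · intro z hz
    have := hh' (φ z) (h.mφ hz)
    rw [h.li z hz] at this
    have h1 : -r₂ (φ z) ≤ 1 / a' * (-r₁ z) := by rw [div_mul_eq_mul_div, le_div_iff₀ ha']; linarith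
    have := hneg z hz
    nlinarith
  · intro z hz
    have := hh z hz
    have h1 : -r₁ z ≤ 1 / a * (-r₂ (φ z)) := by rw [div_mul_eq_mul_div, le_div_iff₀ ha]; linarith
    have := hneg2 z hz
    nlinarith
  · intro z hz t
    have hz0 : 0 < -r₁ z := by have := hneg z hz; linarith
    have hz1 : r₁ z ≠ 0 := (hneg z hz).ne
    obtain ⟨q1, -⟩ := gen z hz t
    have h1 : √(-r₁ z) * ‖fderiv ℂ φ z t‖ ≤ √(K * (4 * M ^ 2)) * ‖t‖ := by
      refine sq_le (by positivity) ?_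
      rw [mul_pow, mul_pow, Real.sq_sqrt hz0.le, Real.sq_sqrt (by positivity)]
      have := mul_le_mul_of_nonneg_right q1 (show 0 ≤ (4 * M ^ 2) / (-r₁ z) by positivity)
      calc _ = (-r₁ z / (2 * M)) ^ 2 * ‖(fderiv ℂ φ z) t‖ ^ 2 * (4 * M ^ 2 / -r₁ z) := by field_simp; ring
        _ ≤ _ := this
        _ = _ := by field_simp
    exact h1.trans (by gcongr; linarith)
  · intro z hz t
    have hz0 : 0 < -r₁ z := by have := hneg z hz; linarith
    have hz1 : r₁ z ≠ 0 := (hneg z hz).ne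
    obtain ⟨-, q1⟩ := gen z hz t
    have h1 : ‖lam r₂ (φ z) (fderiv ℂ φ z t)‖ ≤ K * (2 * M) * ‖t‖ := by
      have := mul_le_mul_of_nonneg_right q1 (show 0 ≤ (2 * M) / (-r₁ z) by positivity)
      calc _ = (-r₁ z / (2 * M)) * ‖lam r₂ (φ z) (fderiv ℂ φ z t)‖ * (2 * M / -r₁ z) := by field_simp
        _ ≤ _ := this
        _ = _ := by field_simp
    exact h1.trans (by gcongr; linarith)
  · intro z hz t ht
    have hz0 : 0 < -r₁ z := by have := hneg z hz; linarith
    have hz1 : r₁ z ≠ 0 := (hneg z hz).ne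
    obtain ⟨q1, -⟩ := tan z hz t ht
    have h1 : ‖fderiv ℂ φ z t‖ ≤ √(K * (6 * M)) * ‖t‖ := by
      refine sq_le (by positivity) ?_
      rw [mul_pow, Real.sq_sqrt (by positivity)]
      rw [Real.sq_sqrt (by positivity)] at q1
      have := mul_le_mul_of_nonneg_right q1 (show 0 ≤ (6 * M) / (-r₁ z) by positivity)
      calc _ = (-r₁ z / (6 * M)) * ‖(fderiv ℂ φ z) t‖ ^ 2 * (6 * M / -r₁ z) := by field_simp
        _ ≤ _ := this
        _ = _ := by field_simp
    exact h1.trans (by gcongr; linarith)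
  · intro z hz t ht
    have hz0 : 0 < -r₁ z := by have := hneg z hz; linarith
    have hz1 : r₁ z ≠ 0 := (hneg z hz).ne
    obtain ⟨-, q1⟩ := tan z hz t ht
    have h1 : ‖lam r₂ (φ z) (fderiv ℂ φ z t)‖ ≤ K * √(6 * M) * √(-r₁ z) * ‖t‖ := by
      have e1 : √(-r₁ z / (6 * M)) = √(-r₁ z) / √(6 * M) := Real.sqrt_div hz0.le _
      have e2 : -r₁ z = √(-r₁ z) * √(-r₁ z) := (Real.mul_self_sqrt hz0.le).symm
      have pz : 0 < √(-r₁ z) := Real.sqrt_pos.2 hz0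
      have pM : 0 < √(6 * M) := by positivity
      rw [e1] at q1
      have := mul_le_mul_of_nonneg_right q1 (show 0 ≤ √(6 * M) / √(-r₁ z) by positivity)
      calc _ = √(-r₁ z) / √(6 * M) * ‖lam r₂ (φ z) (fderiv ℂ φ z t)‖ * (√(6 * M) / √(-r₁ z)) := by field_simp
        _ ≤ _ := this
        _ = (K * √(6 * M) * ‖t‖) * ((-r₁ z) / √(-r₁ z)) := by ring
        _ = (K * √(6 * M) * ‖t‖) * √(-r₁ z) := by rw [Real.div_sqrt]
        _ = _ := by ring
    exact h1.trans (by gcongr; linarith)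

lemma exists_Est (h : BH Ω₁ Ω₂ r₁ r₂ δ0 c M φ ψ) : ∃ C, 1 ≤ C ∧ Est Ω₁ r₁ r₂ φ C ∧ Est Ω₂ r₂ r₁ ψ C := by
  obtain ⟨C1, h1⟩ := exists_Est_aux h
  obtain ⟨C2, h2⟩ := exists_Est_aux h.symm
  refine ⟨max 1 (max C1 C2), le_max_left _ _, h1.mono ((le_max_left _ _).trans (le_max_right _ _)) ?_ ?_, h2.mono ((le_max_right _ _).trans (le_max_right _ _)) ?_ ?_⟩
  · intro z hz; exact ((h.s1.mem_iff z).1 hz).le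
  · intro z hz; exact ((h.s2.mem_iff _).1 (h.mφ hz)).le
  · intro z hz; exact ((h.s2.mem_iff z).1 hz).le
  · intro z hz; exact ((h.s1.mem_iff _).1 (h.mψ hz)).le
end Est
end

section
section Chart
variable {E : Type} [NormedAddCommGroup E] [InnerProductSpace ℂ E] [FiniteDimensional ℂ E] [NormedSpace ℝ E] [IsScalarTower ℝ ℂ E]
variable {Ω₁ Ω₂ Ω : Set E} {r₁ r₂ r : E → ℝ} {δ0 c M C : ℝ} {φ ψ : E → E}

lemma Lev_csmul (r : E → ℝ) (z v : E) (a : ℂ) : Lev r z (a • v) = ‖a‖ ^ 2 * Lev r z v := by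
  have h1 : I • a • v = a.re • (I • v) + (-a.im) • v := by
    rw [csmul_eq a v, smul_add, I_rsmul, I_rsmul, I_I_smul, smul_neg, neg_smul]
  unfold Lev D2
  rw [h1, csmul_eq a v]
  simp only [map_add, map_smul, add_apply, smul_apply, smul_eq_mul]
  rw [← Complex.normSq_eq_norm_sq, Complex.normSq_apply]
  ring

lemma contDiff_Lev (r : E → ℝ) (z : E) : ContDiff ℝ 2 (fun v => Lev r z v) := by
  unfold Lev D2
  have hI : ContDiff ℝ 2 (fun v : E => I • v) := by
    exact ((I • ContinuousLinearMap.id ℂ E).restrictScalars ℝ).contDiff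
  exact ((ContinuousLinearMap.contDiff _).clm_apply contDiff_id).add (((ContinuousLinearMap.contDiff _).comp hI).clm_apply hI)

lemma D2_quad (B : E →L[ℝ] E →L[ℝ] ℝ) (L : E →L[ℝ] E) (x y : E) : D2 (fun v => B (L v) (L v)) x y y = 2 * B (L y) (L y) := by
  have h : ∀ x, HasFDerivAt (fun v => B (L v) (L v)) (((B.flip (L x)).comp L + (B (L x)).comp L)) x := by
    intro x
    have h1 : HasFDerivAt (fun v => B (L v)) (B.comp L) x := (B.comp L).hasFDerivAt
    have h2 := h1.clm_apply (L.hasFDerivAt (x := x))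
    refine h2.congr_fderiv ?_
    ext y; simp [add_comm]
  have h' : fderiv ℝ (fun v => B (L v) (L v)) = fun x => ((B.flip (L x)).comp L + (B (L x)).comp L) := by
    ext1 x; exact (h x).fderiv
  unfold D2
  rw [h']
  have hd : HasFDerivAt (fun x => ((B.flip (L x)).comp L + (B (L x)).comp L)) (((ContinuousLinearMap.compL ℝ E E ℝ).flip L).comp (B.flip.comp L) + ((ContinuousLinearMap.compL ℝ E E ℝ).flip L).comp (B.comp L)) x :=
    (ContinuousLinearMap.hasFDerivAt (((ContinuousLinearMap.compL ℝ E E ℝ).flip L).comp (B.flip.comp L))).add (ContinuousLinearMap.hasFDerivAt (((ContinuousLinearMap.compL ℝ E E ℝ).flip L).comp (B.comp L)))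
  rw [hd.fderiv]
  simp; ring

lemma Lev_Lev (r : E → ℝ) (z x y : E) : Lev (fun v => Lev r z v) x y = 4 * Lev r z y := by
  set J : E →L[ℝ] E := (I • ContinuousLinearMap.id ℂ E).restrictScalars ℝ with hJ
  set B := fderiv ℝ (fderiv ℝ r) z with hB
  have hJa : ∀ v, J v = I • v := fun v => by simp [hJ]
  have e : (fun v => Lev r z v) = fun v => B (ContinuousLinearMap.id ℝ E v) (ContinuousLinearMap.id ℝ E v) + B (J v) (J v) := by
    ext v; simp only [hJa]; rfl
  have c1 : ∀ L : E →L[ℝ] E, ContDiff ℝ 2 (fun v => B (L v) (L v)) := fun L => ((B.comp L).contDiff).clm_apply L.contDiff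
  have d : ∀ y, D2 (fun v => Lev r z v) x y y = 2 * Lev r z y := by
    intro y
    rw [e, D2_add (u := fun v => B (ContinuousLinearMap.id ℝ E v) (ContinuousLinearMap.id ℝ E v)) (c1 _).contDiffAt (c1 _).contDiffAt, D2_quad, D2_quad]
    simp only [hJa, ContinuousLinearMap.coe_id', id]
    unfold Lev D2; ring
  have e2 : Lev (fun v => Lev r z v) x y = D2 (fun v => Lev r z v) x y y + D2 (fun v => Lev r z v) x (I • y) (I • y) := rfl
  rw [e2, d, d, Lev_csmul]; simp; ring

/-- chart Schwarz lemma -/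
lemma chart_schwarz (h : SPD Ω r δ0 c M) {L η : ℝ} (hL : 0 < L) (hη : 0 < η) : ∃ d0 > 0, d0 ≤ δ0 ∧ ∀ (p : E) (G : ℂ → E),
    0 < -r p → -r p ≤ d0 → DifferentiableOn ℂ G (ball 0 1) → Set.MapsTo G (ball 0 1) Ω → G 0 = p →
    (∀ ζ ∈ ball (0:ℂ) 1, ‖G ζ - p‖ ≤ L * √(-r p)) → ∃ q : ℂ → ℂ, DifferentiableOn ℂ q (ball 0 1) ∧ q 0 = 0 ∧
      deriv q 0 = lam r p (deriv G 0) / ((-r p : ℝ) : ℂ) ∧ (∀ ζ ∈ ball (0:ℂ) 1, 2 - q ζ ≠ 0) ∧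
      (∀ ζ ∈ ball (0:ℂ) 1, ‖q ζ‖ ^ 2 / ‖2 - q ζ‖ ^ 2 + Lev r p (G ζ - p) / ((-r p) * ‖2 - q ζ‖ ^ 2) ≤ ‖ζ‖ ^ 2 * (1 + η)) ∧
      (∀ ζ ∈ ball (0:ℂ) 1, 1 - (q ζ).re - Lev r p (G ζ - p) / (4 * (-r p)) - η ≤ (-r (G ζ)) / (-r p)) ∧
      ‖lam r p (deriv G 0)‖ ^ 2 / (4 * (-r p) ^ 2) + Lev r p (deriv G 0) / (4 * (-r p)) ≤ 1 + η := by
  have hM := h.M_pos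
  have hδ := h.δ0_pos
  set η' := min (η / 16) (1 / 2) with hη'
  have hη'0 : 0 < η' := by positivity
  have hη'1 : 16 * η' ≤ η := by have : η' ≤ η / 16 := min_le_left _ _; linarith
  have hη'2 : η' ≤ 1 / 2 := min_le_right _ _
  refine ⟨min δ0 ((η' / (M * L ^ 3)) ^ 2), by positivity, min_le_left _ _, fun p G hp hpd hG hm hG0 hb => ?_⟩
  set d := -r p with hd
  have hpδ : |r p| ≤ δ0 := by rw [abs_of_neg (by linarith), ← hd]; exact hpd.trans (min_le_left _ _)
  have hsq : M * L ^ 3 * √d ≤ η' := by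
    have h1 : √d ≤ η' / (M * L ^ 3) := by
      rw [Real.sqrt_le_left (by positivity)]; exact hpd.trans (min_le_right _ _)
    rw [le_div_iff₀ (by positivity)] at h1; linarith
  have h00 : (0:ℂ) ∈ ball (0:ℂ) 1 := mem_ball_self one_pos
  set q : ℂ → ℂ := fun ζ => (lam r p (G ζ - p) + QQ r p (G ζ - p) (G ζ - p)) / (d : ℂ) with hq
  have hdc : (d : ℂ) ≠ 0 := by exact_mod_cast hp.ne'
  have hgd : DifferentiableOn ℂ (fun ζ => G ζ - p) (ball 0 1) := hG.sub_const _
  have hqd : DifferentiableOn ℂ q (ball 0 1) := by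
    exact (((lam r p).differentiable.comp_differentiableOn hgd).add
      (((QQ r p).differentiable.comp_differentiableOn hgd).clm_apply hgd)).div_const _
  have hq0 : q 0 = 0 := by simp [hq, hG0]
  have hLev0 : ∀ v, 0 ≤ Lev r p v := fun v => le_trans (by have := h.c_pos; positivity) (h.lev p v hpδ)
  -- Taylor
  have hT : ∀ ζ ∈ ball (0:ℂ) 1, |(-r (G ζ)) / d - (1 - (q ζ).re - Lev r p (G ζ - p) / (4 * d))| ≤ η' := by
    intro ζ hζ
    have h1 := h.taylor p (G ζ - p)
    rw [add_sub_cancel] at h1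
    have h2 : M * ‖G ζ - p‖ ^ 3 ≤ d * η' := by
      calc M * ‖G ζ - p‖ ^ 3 ≤ M * (L * √d) ^ 3 := by gcongr; exact hb ζ hζ
        _ = (M * L ^ 3 * √d) * (√d) ^ 2 := by ring
        _ = (M * L ^ 3 * √d) * d := by rw [Real.sq_sqrt hp.le]
        _ ≤ η' * d := by gcongr
        _ = _ := by ring
    have h3 : (lam r p (G ζ - p) + QQ r p (G ζ - p) (G ζ - p)).re = d * (q ζ).re := by
      rw [← Complex.re_ofReal_mul]; simp only [hq]; rw [mul_div_cancel₀ _ hdc]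
    rw [h3] at h1
    have h4 : (-r (G ζ)) / d - (1 - (q ζ).re - Lev r p (G ζ - p) / (4 * d)) = -(r (G ζ) - r p - d * (q ζ).re - Lev r p (G ζ - p) / 4) / d := by
      have : r p = -d := by rw [hd]; ring
      rw [this]; field_simp; ring
    rw [h4, abs_div, abs_neg, abs_of_pos hp, div_le_iff₀ hp]
    linarith
  have hDpos : ∀ ζ ∈ ball (0:ℂ) 1, 0 ≤ (-r (G ζ)) / d := by
    intro ζ hζ
    have := (h.mem_iff _).1 (hm hζ)
    exact div_nonneg (by linarith) hp.le
  have hre : ∀ ζ ∈ ball (0:ℂ) 1, 1 / 2 ≤ (2 - q ζ).re := by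
    intro ζ hζ
    have h1 := (abs_le.1 (hT ζ hζ)).2
    have h2 := hDpos ζ hζ
    have h3 : 0 ≤ Lev r p (G ζ - p) / (4 * d) := div_nonneg (hLev0 _) (by positivity)
    simp
    linarith
  have hn : ∀ ζ ∈ ball (0:ℂ) 1, 1 / 2 ≤ ‖2 - q ζ‖ := fun ζ hζ => (hre ζ hζ).trans (Complex.re_le_norm _)
  have hne : ∀ ζ ∈ ball (0:ℂ) 1, 2 - q ζ ≠ 0 := by
    intro ζ hζ h0
    have := hn ζ hζ; rw [h0, norm_zero] at this; linarith
  have hF : ∀ ζ ∈ ball (0:ℂ) 1, ‖q ζ‖ ^ 2 / ‖2 - q ζ‖ ^ 2 + Lev r p (G ζ - p) / (d * ‖2 - q ζ‖ ^ 2) ≤ 1 + η := by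
    intro ζ hζ
    have h1 := (abs_le.1 (hT ζ hζ)).2
    have h2 := hDpos ζ hζ
    have hnn := hn ζ hζ
    have hN : 0 < ‖2 - q ζ‖ := by linarith
    have e1 : ‖2 - q ζ‖ ^ 2 = ‖q ζ‖ ^ 2 + 4 - 4 * (q ζ).re := by
      rw [← Complex.normSq_eq_norm_sq, ← Complex.normSq_eq_norm_sq, Complex.normSq_apply, Complex.normSq_apply]; simp; ring
    have e2 : ‖q ζ‖ ^ 2 / ‖2 - q ζ‖ ^ 2 + Lev r p (G ζ - p) / (d * ‖2 - q ζ‖ ^ 2) = (‖q ζ‖ ^ 2 + Lev r p (G ζ - p) / d) / ‖2 - q ζ‖ ^ 2 := by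
      field_simp
    have e3 : Lev r p (G ζ - p) / d = 4 * (Lev r p (G ζ - p) / (4 * d)) := by field_simp
    rw [e2, div_le_iff₀ (by positivity), e3]
    have : 1/4 ≤ ‖2 - q ζ‖ ^ 2 := by nlinarith
    nlinarith
  haveI : CompleteSpace E := FiniteDimensional.complete ℂ E
  set a : ℂ → ℂ := fun ζ => q ζ / (2 - q ζ) with ha
  set b : ℂ → E := fun ζ => (2 - q ζ)⁻¹ • (G ζ - p) with hbdef
  have hsub : DifferentiableOn ℂ (fun ζ => 2 - q ζ) (ball 0 1) := hqd.const_sub 2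
  have had : DifferentiableOn ℂ a (ball 0 1) := hqd.div hsub hne
  have hbd : DifferentiableOn ℂ b (ball 0 1) := (hsub.inv hne).smul hgd
  have ha0 : a 0 = 0 := by simp [ha, hq0]
  have hb0 : b 0 = 0 := by simp [hbdef, hG0]
  have hnh := isOpen_ball.mem_nhds h00
  set A := dslope a 0 with hA
  set B := dslope b 0 with hB
  have hAd : DifferentiableOn ℂ A (ball 0 1) := (Complex.differentiableOn_dslope hnh).2 had
  have hBd : DifferentiableOn ℂ B (ball 0 1) := (Complex.differentiableOn_dslope hnh).2 hbd
  have hAm : ∀ ζ, a ζ = ζ * A ζ := by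
    intro ζ; have := sub_smul_dslope a 0 ζ; rw [sub_zero, ha0, sub_zero] at this; exact this.symm
  have hBm : ∀ ζ, b ζ = ζ • B ζ := by
    intro ζ; have := sub_smul_dslope b 0 ζ; rw [sub_zero, hb0, sub_zero] at this; exact this.symm
  have hFab : ∀ ζ ∈ ball (0:ℂ) 1, ‖q ζ‖ ^ 2 / ‖2 - q ζ‖ ^ 2 + Lev r p (G ζ - p) / (d * ‖2 - q ζ‖ ^ 2) = ‖ζ‖ ^ 2 * (‖A ζ‖ ^ 2 + Lev r p (B ζ) / d) := by
    intro ζ hζ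
    have hN : 0 < ‖2 - q ζ‖ := by have := hn ζ hζ; linarith
    have e1 : ‖q ζ‖ ^ 2 / ‖2 - q ζ‖ ^ 2 = ‖ζ‖ ^ 2 * ‖A ζ‖ ^ 2 := by
      rw [← mul_pow, ← norm_mul, ← hAm, ← div_pow, ← norm_div]
    have e2 : Lev r p (G ζ - p) / (‖2 - q ζ‖ ^ 2) = ‖ζ‖ ^ 2 * Lev r p (B ζ) := by
      rw [← Lev_csmul, ← hBm, hbdef, Lev_csmul, norm_inv, inv_pow, div_eq_inv_mul]
    rw [e1, mul_add, ← mul_div_assoc, ← e2]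
    congr 1; field_simp
  set S : ℂ → ℝ := fun ζ => ‖A ζ - 0‖ ^ 2 + (1 / d) * Lev r p (B ζ) with hS
  have hsq2 : ContDiff ℝ 2 (fun y : ℂ => ‖y - 0‖ ^ 2) := (contDiff_norm_sq ℂ).comp (contDiff_id.sub contDiff_const)
  have hA2 : ContDiffOn ℝ 2 A (ball 0 1) := (holo_contDiffOn isOpen_ball hAd).of_le two_le_top
  have hB2 : ContDiffOn ℝ 2 B (ball 0 1) := (holo_contDiffOn isOpen_ball hBd).of_le two_le_top
  have hS1 : ContDiffOn ℝ 2 (fun ζ => ‖A ζ - 0‖ ^ 2) (ball 0 1) := hsq2.comp_contDiffOn hA2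
  have hS2' : ContDiffOn ℝ 2 (fun ζ => Lev r p (B ζ)) (ball 0 1) := (contDiff_Lev r p).comp_contDiffOn hB2
  have hS2 : ContDiffOn ℝ 2 (fun ζ => (1 / d) * Lev r p (B ζ)) (ball 0 1) := contDiffOn_const.mul hS2'
  have hSle : ∀ ζ ∈ ball (0:ℂ) 1, S ζ ≤ 1 + η := by
    have key : ∀ ρ : ℝ, 0 < ρ → ρ < 1 → ∀ ζ ∈ ball (0:ℂ) ρ, S ζ ≤ (1 + η) / ρ ^ 2 := by
      intro ρ hρ hρ1
      have hs1 : closedBall (0:ℂ) ρ ⊆ ball 0 1 := closedBall_subset_ball hρ1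
      refine disc_max hρ ((hS1.add hS2).continuousOn.mono hs1) ((hS1.add hS2).mono (ball_subset_closedBall.trans hs1)) ?_ ?_
      · intro ζ hζ v
        have hζ1 := hs1 (ball_subset_closedBall hζ)
        have hnz := isOpen_ball.mem_nhds hζ1
        rw [hS, Lev_add (u := fun ζ => ‖A ζ - 0‖ ^ 2) (hS1.contDiffAt hnz) (hS2.contDiffAt hnz), Lev_const_mul _ (hS2'.contDiffAt hnz),
          Lev_comp_holo (u := fun y : ℂ => ‖y - 0‖ ^ 2) isOpen_ball hζ1 hAd hsq2.contDiffAt, Lev_comp_holo (u := fun v => Lev r p v) isOpen_ball hζ1 hBd (contDiff_Lev r p).contDiffAt, Lev_normSq, Lev_Lev]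
        have := hLev0 (fderiv ℂ B ζ v)
        positivity
      · intro ζ hζ
        have hζ1 := hs1 (sphere_subset_closedBall hζ)
        have hn : ‖ζ‖ = ρ := by simpa using hζ
        have h1 := hF ζ hζ1
        rw [hFab ζ hζ1, hn] at h1
        rw [le_div_iff₀ (by positivity)]
        simp only [hS, sub_zero]
        calc _ = ρ ^ 2 * (‖A ζ‖ ^ 2 + Lev r p (B ζ) / d) := by ring
          _ ≤ _ := h1
    intro ζ hζ
    have hζn : ‖ζ‖ < 1 := by simpa using hζ
    have ht : Filter.Tendsto (fun ρ : ℝ => (1 + η) / ρ ^ 2) (nhdsWithin 1 (Set.Iio 1)) (nhds ((1 + η) / 1 ^ 2)) := by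
      apply Filter.Tendsto.mono_left _ nhdsWithin_le_nhds
      exact (continuousAt_const.div (continuousAt_id.pow 2) (by norm_num)).tendsto
    rw [one_pow, div_one] at ht
    refine ge_of_tendsto ht ?_
    filter_upwards [Ioo_mem_nhdsLT (show max ‖ζ‖ 0 < 1 by simp [hζn])] with ρ hρ
    have h1 := (max_lt_iff.1 hρ.1)
    exact key ρ h1.2 hρ.2 ζ (by simpa using h1.1)
  -- derivatives at 0
  have hGd0 : HasDerivAt (fun ζ => G ζ - p) (deriv G 0) 0 := (hG.differentiableAt hnh).hasDerivAt.sub_const _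
  have hqd0 : HasDerivAt q (lam r p (deriv G 0) / (d : ℂ)) 0 := by
    have h1 := (lam r p).hasFDerivAt.comp_hasDerivAt (0:ℂ) hGd0
    have h2 := (((QQ r p).hasFDerivAt.comp_hasDerivAt (0:ℂ) hGd0)).clm_apply hGd0
    have h3 := (h1.add h2).div_const (d : ℂ)
    refine h3.congr_deriv ?_
    simp [hG0]
  refine ⟨q, hqd, hq0, hqd0.deriv, hne, ?_, ?_, ?_⟩
  · intro ζ hζ
    rw [hFab ζ hζ]
    have := hSle ζ hζ
    simp only [hS, sub_zero] at this
    refine mul_le_mul_of_nonneg_left ?_ (sq_nonneg _)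
    calc _ = ‖A ζ‖ ^ 2 + 1 / d * Lev r p (B ζ) := by ring
      _ ≤ _ := this
  · intro ζ hζ
    have := (abs_le.1 (hT ζ hζ)).1
    linarith
  · have hA0 : A 0 = lam r p (deriv G 0) / (d : ℂ) / 2 := by
      rw [hA, dslope_same]
      have := hqd0.div ((hasDerivAt_const (0:ℂ) (2:ℂ)).sub hqd0) (hne 0 h00)
      rw [show deriv a 0 = _ from this.deriv]
      simp only [hq0, Pi.sub_apply]
      field_simp; ring
    have hB0 : B 0 = (2:ℂ)⁻¹ • deriv G 0 := by
      rw [hB, dslope_same]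
      have h1 := ((hasDerivAt_const (0:ℂ) (2:ℂ)).sub hqd0).inv (hne 0 h00)
      have := h1.smul hGd0
      rw [show deriv b 0 = _ from this.deriv]
      simp [hq0, hG0]
    have := hSle 0 h00
    simp only [hS, sub_zero, hA0, hB0, Lev_csmul] at this
    refine le_trans (le_of_eq ?_) this
    rw [norm_div, norm_div, Complex.norm_real, Real.norm_of_nonneg hp.le]
    simp only [norm_inv, Complex.norm_ofNat]
    field_simp; ring
end Chart
end

section
section Rig
variable {E : Type} [NormedAddCommGroup E] [InnerProductSpace ℂ E] [FiniteDimensional ℂ E] [NormedSpace ℝ E] [IsScalarTower ℝ ℂ E]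
variable {Ω₁ Ω₂ Ω : Set E} {r₁ r₂ r : E → ℝ} {δ0 c M C : ℝ} {φ ψ : E → E}

lemma Lev_add_vec (h : SPD Ω r δ0 c M) (z x y : E) : ∃ b : ℝ, Lev r z (x + y) = Lev r z x + b + Lev r z y ∧ |b| ≤ 4 * M * ‖x‖ * ‖y‖ ∧
    ∀ s : ℝ, Lev r z ((s : ℂ) • x - y) = s ^ 2 * Lev r z x - s * b + Lev r z y := by
  refine ⟨D2 r z x y + D2 r z (I • x) (I • y) + (D2 r z y x + D2 r z (I • y) (I • x)), ?_, ?_, ?_⟩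
  · unfold Lev D2; simp only [smul_add, map_add, add_apply]; ring
  · have hI : ∀ v : E, ‖I • v‖ = ‖v‖ := fun v => by rw [norm_smul]; simp
    have h1 := h.D2_le z x y
    have h2 := h.D2_le z (I • x) (I • y)
    have h3 := h.D2_le z y x
    have h4 := h.D2_le z (I • y) (I • x)
    rw [hI, hI] at h2 h4
    have := abs_add_le (D2 r z x y + D2 r z (I • x) (I • y)) (D2 r z y x + D2 r z (I • y) (I • x))
    have := abs_add_le (D2 r z x y) (D2 r z (I • x) (I • y))
    have := abs_add_le (D2 r z y x) (D2 r z (I • y) (I • x))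
    nlinarith
  · intro s
    unfold Lev D2
    rw [rsmul_eq, smul_sub, I_rsmul]
    simp only [map_sub, map_smul, sub_apply, smul_apply, smul_eq_mul]; ring

lemma Lev_add_le (h : SPD Ω r δ0 c M) {z : E} (hz : |r z| ≤ δ0) (x y : E) {s : ℝ} (hs : 0 < s) : Lev r z (x + y) ≤ (1 + s) * Lev r z x + (1 + 1 / s) * Lev r z y := by
  obtain ⟨b, h1, -, h3⟩ := Lev_add_vec h z x y
  have h4 : 0 ≤ Lev r z ((s : ℂ) • x - y) := le_trans (by have := h.c_pos; positivity) (h.lev z _ hz)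
  rw [h3] at h4
  have h5 : b ≤ s * Lev r z x + Lev r z y / s := by
    have : b * s ≤ (s * Lev r z x + Lev r z y / s) * s := by
      rw [add_mul, div_mul_cancel₀ _ hs.ne']; nlinarith
    exact le_of_mul_le_mul_right this hs
  rw [h1]
  have : (1 + s) * Lev r z x + (1 + 1 / s) * Lev r z y = Lev r z x + (s * Lev r z x + Lev r z y / s) + Lev r z y := by ring
  linarith

set_option maxHeartbeats 1000000 in
/-- tangential quadratic disc -/
lemma tdisc (h : SPD Ω r δ0 c M) : ∃ K > 0, ∀ z v : E, |r z| ≤ δ0 → lam r z v = 0 → ‖v‖ ≤ 1 → ∃ f : ℂ → E, Differentiable ℂ f ∧ f 0 = z ∧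
    HasDerivAt f v 0 ∧ ∀ ζ : ℂ, ‖ζ‖ ≤ 1 → |r (f ζ) - r z - ‖ζ‖ ^ 2 * Lev r z v / 4| ≤ K * ‖v‖ ^ 3 := by
  have hM := h.M_pos
  have hc := h.c_pos
  set K1 := 2 * M / c with hK1
  have hK1p : 0 < K1 := by positivity
  refine ⟨M * (1 + K1) ^ 3 + 2 * M * K1 + M * K1 ^ 2 + (4 * M * K1 + 2 * M * K1 ^ 2) / 4, by positivity, fun z v hz hv hv1 => ?_⟩
  obtain ⟨n, hn1, hn2⟩ := h.exists_normal hz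
  set e : E := (-QQ r z v v) • n with he
  have hle : lam r z e = -QQ r z v v := by rw [he, map_smul, hn1]; simp
  set a := ‖v‖ with ha
  have ha0 : 0 ≤ a := norm_nonneg _
  have hea : ‖e‖ ≤ K1 * a ^ 2 := by
    rw [he, norm_smul, norm_neg]
    calc ‖QQ r z v v‖ * ‖n‖ ≤ (M * a * a) * (2 / c) := by gcongr; exact h.QQ_le z v v
      _ = _ := by rw [hK1]; ring
  have hea' : K1 * a ^ 2 ≤ K1 * a := by
    have : a ^ 2 ≤ a := by nlinarith
    gcongr
  refine ⟨fun ζ => z + (ζ • v + ζ ^ 2 • e), by fun_prop, by simp, ?_, ?_⟩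
  · have h1 := (hasDerivAt_id (0:ℂ)).smul_const v
    have h2 := ((hasDerivAt_id (0:ℂ)).pow 2).smul_const e
    have := (h1.add h2).const_add z
    refine this.congr_deriv ?_
    simp
  intro ζ hζ
  set x := ζ • v with hx
  set y := ζ ^ 2 • e with hy
  have hxn : ‖x‖ ≤ a := by rw [hx, norm_smul]; nlinarith [norm_nonneg v]
  have hζ2 : ‖ζ ^ 2‖ ≤ 1 := by rw [norm_pow]; exact pow_le_one₀ (norm_nonneg _) hζ
  have hyn : ‖y‖ ≤ K1 * a ^ 2 := by
    rw [hy, norm_smul]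
    have : ‖ζ ^ 2‖ * ‖e‖ ≤ 1 * (K1 * a ^ 2) := by gcongr
    linarith
  have hyn' : ‖y‖ ≤ K1 * a := hyn.trans hea'
  have hs : ‖x + y‖ ≤ (1 + K1) * a := (norm_add_le _ _).trans (by linarith)
  have hT := h.taylor z (x + y)
  obtain ⟨b, hb1, hb2, -⟩ := Lev_add_vec h z x y
  have hLx : Lev r z x = ‖ζ‖ ^ 2 * Lev r z v := by rw [hx, Lev_csmul]
  have hLy := h.abs_Lev_le z y
  have hq : lam r z (x + y) + QQ r z (x + y) (x + y) = QQ r z x y + QQ r z y x + QQ r z y y := by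
    have : QQ r z x x = ζ ^ 2 * QQ r z v v := by rw [hx]; simp; ring
    have h2 : lam r z (x + y) = - (ζ ^ 2 * QQ r z v v) := by
      rw [map_add, hx, hy, map_smul, map_smul, hv, hle]; simp
    rw [h2]; simp only [map_add, add_apply]; rw [this]; ring
  have hqn : |(lam r z (x + y) + QQ r z (x + y) (x + y)).re| ≤ 2 * M * K1 * a ^ 3 + M * K1 ^ 2 * a ^ 3 := by
    rw [hq]
    refine (Complex.abs_re_le_norm _).trans ((norm_add₃_le).trans ?_)
    have q1 := h.QQ_le z x y
    have q2 := h.QQ_le z y x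
    have q3 := h.QQ_le z y y
    have p1 : ‖x‖ * ‖y‖ ≤ a * (K1 * a ^ 2) := by gcongr
    have p2 : ‖y‖ * ‖y‖ ≤ (K1 * a) * (K1 * a ^ 2) := by gcongr
    nlinarith
  have hb3 : |b| ≤ 4 * M * K1 * a ^ 3 := by
    have p1 : ‖x‖ * ‖y‖ ≤ a * (K1 * a ^ 2) := by gcongr
    nlinarith
  have hL3 : |Lev r z y| ≤ 2 * M * K1 ^ 2 * a ^ 3 := by
    have p2 : ‖y‖ * ‖y‖ ≤ (K1 * a) * (K1 * a ^ 2) := by gcongr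
    nlinarith
  have hs3 : M * ‖x + y‖ ^ 3 ≤ M * (1 + K1) ^ 3 * a ^ 3 := by
    calc M * ‖x + y‖ ^ 3 ≤ M * ((1 + K1) * a) ^ 3 := by gcongr
      _ = _ := by ring
  rw [hb1, hLx] at hT
  have e : r (z + (x + y)) - r z - ‖ζ‖ ^ 2 * Lev r z v / 4 = (r (z + (x + y)) - r z - (lam r z (x + y) + QQ r z (x + y) (x + y)).re - (‖ζ‖ ^ 2 * Lev r z v + b + Lev r z y) / 4)
    + (lam r z (x + y) + QQ r z (x + y) (x + y)).re + (b + Lev r z y) / 4 := by ring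
  have e2 : (M * (1 + K1) ^ 3 + 2 * M * K1 + M * K1 ^ 2 + (4 * M * K1 + 2 * M * K1 ^ 2) / 4) * a ^ 3 = M * (1 + K1) ^ 3 * a ^ 3 + (2 * M * K1 * a ^ 3 + M * K1 ^ 2 * a ^ 3) + (4 * M * K1 * a ^ 3 + 2 * M * K1 ^ 2 * a ^ 3) / 4 := by ring
  rw [e, e2]
  have hT1 := abs_le.1 hT
  have hq1 := abs_le.1 hqn
  have hb4 := abs_le.1 hb3
  have hL4 := abs_le.1 hL3
  refine abs_le.2 ⟨?_, ?_⟩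
  · linarith [hT1.1, hq1.1, hb4.1, hL4.1]
  · linarith [hT1.2, hq1.2, hb4.2, hL4.2]

lemma lip_disc (h : SPD Ω r δ0 c M) : ∃ K > 0, ∀ (f : ℂ → E) (D ρ : ℝ), DifferentiableOn ℂ f (ball 0 1) → Set.MapsTo f (ball 0 1) Ω →
    (∀ ζ ∈ ball (0:ℂ) 1, -r (f ζ) ≤ D) → 0 < ρ → ρ < 1 → ∀ ζ ∈ ball (0:ℂ) ρ, ‖f ζ - f 0‖ ≤ √(K * D) / (1 - ρ) := by
  obtain ⟨K, hK, hgr⟩ := grad_lemma h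
  refine ⟨K, hK, fun f D ρ hf hm hD hρ hρ1 ζ hζ => ?_⟩
  have hder : ∀ w ∈ ball (0:ℂ) ρ, ‖deriv f w‖ ≤ √(K * D) / (1 - ρ) := by
    intro w hw
    have hw' : ‖w‖ < ρ := by simpa using hw
    set κ : ℝ := 1 - ρ with hκ
    have hκ0 : 0 < κ := by linarith
    have hκn : ‖(κ : ℂ)‖ = κ := by rw [Complex.norm_real, Real.norm_of_nonneg hκ0.le]
    have hmap : ∀ ζ ∈ ball (0:ℂ) 1, w + (κ : ℂ) * ζ ∈ ball (0:ℂ) 1 := by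
      intro ζ hζ
      rw [mem_ball_zero_iff] at *
      calc ‖w + (κ : ℂ) * ζ‖ ≤ ‖w‖ + ‖(κ : ℂ) * ζ‖ := norm_add_le _ _
        _ = ‖w‖ + κ * ‖ζ‖ := by rw [norm_mul, hκn]
        _ < 1 := by nlinarith
    have hw1 : w ∈ ball (0:ℂ) 1 := ball_subset_ball hρ1.le hw
    have hdd : HasDerivAt (fun ζ : ℂ => w + (κ : ℂ) * ζ) κ 0 := by
      simpa using ((hasDerivAt_id (0:ℂ)).const_mul (κ : ℂ)).const_add w
    have h1 := hgr (fun ζ => f (w + (κ : ℂ) * ζ)) (hf.comp (by fun_prop) hmap) (fun ζ hζ => hm (hmap ζ hζ))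
    have hfd : HasDerivAt f (deriv f w) (w + (κ : ℂ) * 0) := by
      simpa using (hf.differentiableAt (isOpen_ball.mem_nhds hw1)).hasDerivAt
    have h2' : deriv (fun ζ => f (w + (κ : ℂ) * ζ)) 0 = (κ : ℂ) • deriv f w := (hfd.scomp (0:ℂ) hdd).deriv
    rw [h2', norm_smul, hκn] at h1
    have h3 := hD w hw1
    simp only [mul_zero, add_zero] at h1
    rw [le_div_iff₀ hκ0]
    apply Real.le_sqrt_of_sq_le
    have : K * (-r (f w)) ≤ K * D := by gcongr
    nlinarith
  have := Convex.norm_image_sub_le_of_norm_deriv_le (f := f) (s := ball (0:ℂ) ρ)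
    (fun x hx => hf.differentiableAt (isOpen_ball.mem_nhds (ball_subset_ball hρ1.le hx))) hder (convex_ball _ _) (mem_ball_self hρ) hζ
  refine this.trans ?_
  have hz : ‖ζ - 0‖ ≤ 1 := by
    have : ‖ζ‖ < ρ := by simpa using hζ
    rw [sub_zero]; linarith
  have : 0 ≤ √(K * D) / (1 - ρ) := div_nonneg (Real.sqrt_nonneg _) (by linarith)
  nlinarith

lemma bc_lemma {m : ℂ → ℂ} {ε : ℝ} (hε : 0 < ε) (hε1 : ε ≤ 1 / 16) (hm : DifferentiableOn ℂ m (ball 0 1)) (hb : ∀ ζ ∈ ball (0:ℂ) 1, ‖m ζ‖ ≤ 1 + ε ^ 2 / 100)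
    (h0 : 1 - 2 * (ε ^ 2 / 100) ≤ ‖m 0‖) : ∃ ζ : ℂ, ‖ζ‖ = 1 - ε ∧ ‖1 - ζ * m ζ‖ ≤ 2 * ε := by
  set e := ε ^ 2 / 100 with he
  have he0 : 0 < e := by positivity
  have hee : e ≤ ε / 1600 := by rw [he]; nlinarith
  set m0 := m 0 with hm0
  have hm0p : 0 < ‖m0‖ := by linarith
  have hm0u : ‖m0‖ ≤ 1 + e := hb 0 (mem_ball_self one_pos)
  set u : ℂ := (starRingEnd ℂ) m0 / (‖m0‖ : ℂ) with hu
  have hmc : (‖m0‖ : ℂ) ≠ 0 := by exact_mod_cast hm0p.ne'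
  have hun : ‖u‖ = 1 := by rw [hu, norm_div, Complex.norm_conj]; simp [hm0p.ne']
  have hum : u * m0 = (‖m0‖ : ℂ) := by
    rw [hu, div_mul_eq_mul_div, Complex.conj_mul', div_eq_iff hmc]; ring
  set t := 1 - ε with ht
  have htn : ‖(t : ℂ)‖ = t := by rw [Complex.norm_real, Real.norm_of_nonneg (by linarith)]
  refine ⟨t * u, by rw [norm_mul, hun, htn, mul_one], ?_⟩
  set ζ : ℂ := t * u with hζ
  have hζn : ‖ζ‖ = t := by rw [norm_mul, hun, htn, mul_one]
  have hbc := Complex.borelCaratheodory_zero (M := 3 * e) (R := 1) (f := fun ζ => u * (m ζ - m0)) (z := ζ) (by positivity) ((hm.sub_const _).const_mul _) ?_ one_pos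
    (by rw [mem_ball_zero_iff, hζn]; linarith) (by simp [hm0])
  · rw [norm_mul, hun, one_mul, hζn] at hbc
    have h1 : ‖m ζ - m0‖ ≤ ε / 10 := by
      refine hbc.trans ?_
      have : 1 - t = ε := by rw [ht]; ring
      rw [this, div_le_iff₀ hε, he]
      have : t ≤ 1 := by linarith
      nlinarith [sq_nonneg ε]
    have h2 : 1 - ζ * m ζ = ((1 - t * ‖m0‖ : ℝ) : ℂ) - ζ * (m ζ - m0) := by
      rw [mul_sub, hζ, mul_assoc (t:ℂ) u m0, hum]; push_cast; ring
    rw [h2]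
    refine (norm_sub_le _ _).trans ?_
    rw [norm_mul, hζn, Complex.norm_real]
    have h3 : ‖(1 - t * ‖m0‖ : ℝ)‖ ≤ ε + 2 * e := by
      rw [Real.norm_eq_abs, abs_le]; constructor <;> nlinarith
    have h4 : t * ‖m ζ - m0‖ ≤ ε / 10 := by nlinarith [norm_nonneg (m ζ - m0)]
    linarith
  · intro x hx
    show (u * (m x - m0)).re ≤ 3 * e
    rw [mul_sub, hum, Complex.sub_re, Complex.ofReal_re]
    have := Complex.re_le_norm (u * m x)
    rw [norm_mul, hun, one_mul] at this
    have := hb x hx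
    linarith
end Rig
end

section
section Rig
variable {E : Type} [NormedAddCommGroup E] [InnerProductSpace ℂ E] [FiniteDimensional ℂ E] [NormedSpace ℝ E] [IsScalarTower ℝ ℂ E]
variable {Ω₁ Ω₂ Ω : Set E} {r₁ r₂ r : E → ℝ} {δ0 c M C : ℝ} {φ ψ : E → E}

lemma SPD.taylor1 (h : SPD Ω r δ0 c M) {z v : E} (h1 : ‖v‖ ≤ 1) : |r (z + v) - r z - (lam r z v).re| ≤ 3 * M * ‖v‖ ^ 2 := by
  have h2 := h.taylor z v
  have h3 := h.abs_Lev_le z v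
  have h4 := (Complex.abs_re_le_norm _).trans (h.QQ_le z v v)
  rw [Complex.add_re] at h2
  have hM := h.M_pos
  have h5 : M * ‖v‖ ^ 3 ≤ M * ‖v‖ ^ 2 := by
    have := pow_le_pow_of_le_one (norm_nonneg v) h1 (by norm_num : 2 ≤ 3)
    gcongr
  rw [abs_le] at *
  constructor <;> nlinarith

lemma lip_disc' (h : SPD Ω r δ0 c M) (A ρ : ℝ) (hA : 0 < A) (hρ : 0 < ρ) (hρ1 : ρ < 1) : ∃ L > 0, ∀ (f : ℂ → E), DifferentiableOn ℂ f (ball 0 1) → Set.MapsTo f (ball 0 1) Ω →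
    (∀ ζ ∈ ball (0:ℂ) 1, -r (f ζ) ≤ A * (-r (f 0))) → ∃ G : ℂ → E, G = (fun ζ => f (ρ * ζ)) ∧ DifferentiableOn ℂ G (ball 0 1) ∧ Set.MapsTo G (ball 0 1) Ω ∧ G 0 = f 0 ∧
      deriv G 0 = (ρ : ℂ) • deriv f 0 ∧ ∀ ζ ∈ ball (0:ℂ) 1, ‖G ζ - f 0‖ ≤ L * √(-r (f 0)) := by
  obtain ⟨K, hK, hl⟩ := lip_disc h
  refine ⟨√(K * A) / (1 - ρ), div_pos (by positivity) (by linarith), fun f hf hm hd => ⟨_, rfl, ?_⟩⟩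
  have hρn : ‖(ρ : ℂ)‖ = ρ := by rw [Complex.norm_real, Real.norm_of_nonneg hρ.le]
  have hmap : ∀ ζ ∈ ball (0:ℂ) 1, (ρ : ℂ) * ζ ∈ ball (0:ℂ) ρ := by
    intro ζ hζ
    rw [mem_ball_zero_iff] at *
    rw [norm_mul, hρn]; nlinarith
  have hsub : ball (0:ℂ) ρ ⊆ ball 0 1 := ball_subset_ball hρ1.le
  have h00 : (0:ℂ) ∈ ball (0:ℂ) 1 := mem_ball_self one_pos
  refine ⟨hf.comp (by fun_prop) (fun ζ hζ => hsub (hmap ζ hζ)), fun ζ hζ => hm (hsub (hmap ζ hζ)), by simp, ?_, ?_⟩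
  · have hdd : HasDerivAt (fun ζ : ℂ => (ρ : ℂ) * ζ) ρ 0 := by
      simpa using ((hasDerivAt_id (0:ℂ)).const_mul (ρ : ℂ))
    have hfd : HasDerivAt f (deriv f 0) ((ρ : ℂ) * 0) := by
      simpa using (hf.differentiableAt (isOpen_ball.mem_nhds h00)).hasDerivAt
    exact (hfd.scomp (0:ℂ) hdd).deriv
  · intro ζ hζ
    have := hl f (A * (-r (f 0))) ρ hf hm hd hρ hρ1 _ (hmap ζ hζ)
    refine this.trans (le_of_eq ?_)
    have h0 : 0 ≤ -r (f 0) := by have := (h.mem_iff _).1 (hm h00); linarith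
    rw [← mul_assoc, Real.sqrt_mul (by positivity)]; ring

lemma rig_core {q : ℂ → ℂ} {Lv : ℂ → ℝ} {d ε : ℝ} (hd : 0 < d) (hε0 : 0 < ε) (hε1 : ε ≤ 1 / 16) (hqd : DifferentiableOn ℂ q (ball 0 1)) (hq0 : q 0 = 0)
    (hqne : ∀ ζ ∈ ball (0:ℂ) 1, 2 - q ζ ≠ 0) (hLv : ∀ ζ, 0 ≤ Lv ζ)
    (hqF : ∀ ζ ∈ ball (0:ℂ) 1, ‖q ζ‖ ^ 2 / ‖2 - q ζ‖ ^ 2 + Lv ζ / (d * ‖2 - q ζ‖ ^ 2) ≤ ‖ζ‖ ^ 2 * (1 + ε ^ 2 / 100))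
    (hN : (‖deriv q 0‖ / 2) ^ 2 ≤ 1 + ε ^ 2 / 100) (hcon : 1 - 2 * (ε ^ 2 / 100) ≤ ‖deriv q 0‖ / 2) :
    ∃ ζ ∈ ball (0:ℂ) 1, 1 ≤ 4 * ε * (1 - (q ζ).re - Lv ζ / (4 * d)) := by
  have h00 : (0:ℂ) ∈ ball (0:ℂ) 1 := mem_ball_self one_pos
  set e := ε ^ 2 / 100 with he
  have he0 : 0 < e := by positivity
  have hee : e ≤ ε / 1600 := by rw [he]; nlinarith
  set k : ℂ → ℂ := fun ζ => -(q ζ / (2 - q ζ)) with hk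
  have hkd : DifferentiableOn ℂ k (ball 0 1) := (hqd.div (hqd.const_sub 2) hqne).neg
  have hk0 : k 0 = 0 := by simp [hk, hq0]
  have hmd : DifferentiableOn ℂ (dslope k 0) (ball 0 1) := (Complex.differentiableOn_dslope (isOpen_ball.mem_nhds h00)).2 hkd
  have hkm : ∀ ζ, k ζ = ζ * dslope k 0 ζ := by
    intro ζ; have := sub_smul_dslope k 0 ζ; rw [sub_zero, hk0, sub_zero] at this; exact this.symm
  have hm0 : ‖dslope k 0 0‖ = ‖deriv q 0‖ / 2 := by
    rw [dslope_same]
    have h1 : HasDerivAt q (deriv q 0) 0 := (hqd.differentiableAt (isOpen_ball.mem_nhds h00)).hasDerivAt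
    have := (h1.div ((hasDerivAt_const (0:ℂ) (2:ℂ)).sub h1) (hqne 0 h00)).neg
    rw [show deriv k 0 = _ from this.deriv]
    simp only [hq0, Pi.sub_apply]
    have e2 : -((deriv q 0 * (2 - 0) - 0 * (0 - deriv q 0)) / (2 - 0) ^ 2) = - (deriv q 0 / 2) := by
      field_simp; ring
    rw [e2, norm_neg, norm_div]; simp
  have hmb : ∀ ζ ∈ ball (0:ℂ) 1, ‖dslope k 0 ζ‖ ≤ 1 + e := by
    intro ζ hζ
    have hsq : ‖dslope k 0 ζ‖ ^ 2 ≤ 1 + e := by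
      rcases eq_or_ne ζ 0 with rfl | hne
      · rw [hm0]; exact hN
      · have hzp : 0 < ‖ζ‖ := norm_pos_iff.2 hne
        have h1 := hqF ζ hζ
        have h2 : 0 ≤ Lv ζ / (d * ‖2 - q ζ‖ ^ 2) := div_nonneg (hLv _) (by positivity)
        have h3 : ‖k ζ‖ ^ 2 = ‖q ζ‖ ^ 2 / ‖2 - q ζ‖ ^ 2 := by rw [hk]; simp only [norm_neg, norm_div, div_pow]
        have h4 : ‖ζ‖ ^ 2 * ‖dslope k 0 ζ‖ ^ 2 ≤ ‖ζ‖ ^ 2 * (1 + e) := by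
          rw [← mul_pow, ← norm_mul, ← hkm, h3]; linarith
        exact le_of_mul_le_mul_left h4 (by positivity)
    nlinarith [norm_nonneg (dslope k 0 ζ)]
  obtain ⟨ζ, hζn, hζk⟩ := bc_lemma hε0 hε1 hmd hmb (by rw [hm0]; exact hcon)
  have hζ1 : ζ ∈ ball (0:ℂ) 1 := by rw [mem_ball_zero_iff, hζn]; linarith
  rw [← hkm] at hζk
  have hqne' := hqne ζ hζ1
  have hNp : 0 < ‖2 - q ζ‖ := norm_pos_iff.2 hqne'
  have h1k : 1 - k ζ = 2 / (2 - q ζ) := by simp only [hk]; field_simp; ring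
  refine ⟨ζ, hζ1, ?_⟩
  set X := 1 - (q ζ).re - Lv ζ / (4 * d) with hX
  have hFX : 1 - (‖q ζ‖ ^ 2 / ‖2 - q ζ‖ ^ 2 + Lv ζ / (d * ‖2 - q ζ‖ ^ 2)) = ‖1 - k ζ‖ ^ 2 * X := by
    rw [h1k, norm_div, div_pow]
    have e1 : ‖2 - q ζ‖ ^ 2 = ‖q ζ‖ ^ 2 + 4 - 4 * (q ζ).re := by
      rw [← Complex.normSq_eq_norm_sq, ← Complex.normSq_eq_norm_sq, Complex.normSq_apply, Complex.normSq_apply]; simp; ring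
    rw [hX, Complex.norm_ofNat]
    set Q := ‖2 - q ζ‖ ^ 2 with hQ
    have hQ0 : Q ≠ 0 := by positivity
    have hq2 : ‖q ζ‖ ^ 2 = Q - 4 + 4 * (q ζ).re := by linarith
    rw [hq2]
    field_simp
    ring
  have hF1 := hqF ζ hζ1
  rw [hζn] at hF1
  have hXe : ε ≤ ‖1 - k ζ‖ ^ 2 * X := by
    rw [← hFX]
    have h2 : (1 - ε) ^ 2 * (1 + e) ≤ 1 - ε := by
      have h3 : (1 - ε) * (1 + e) ≤ 1 := by nlinarith
      calc (1 - ε) ^ 2 * (1 + e) = (1 - ε) * ((1 - ε) * (1 + e)) := by ring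
        _ ≤ (1 - ε) * 1 := mul_le_mul_of_nonneg_left h3 (by linarith)
        _ = _ := mul_one _
    linarith
  have hXpos : 0 < X := by
    by_contra hx
    push Not at hx
    have := mul_nonpos_of_nonneg_of_nonpos (sq_nonneg ‖1 - k ζ‖) hx
    linarith
  have hX2 : ε ≤ (2 * ε) ^ 2 * X := hXe.trans (by gcongr)
  have : ε * 1 ≤ ε * (4 * ε * X) := by
    calc ε * 1 = ε := mul_one _
      _ ≤ _ := hX2
      _ = _ := by ring
  exact le_of_mul_le_mul_left this hε0

set_option maxHeartbeats 1000000 in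
/-- tangential strict contraction -/
lemma rig_a (h : BH Ω₁ Ω₂ r₁ r₂ δ0 c M φ ψ) (hC : 1 ≤ C) (hE : Est Ω₁ r₁ r₂ φ C) : ∃ e > 0, e ≤ 1 / 16 ∧ ∀ η : ℝ, 0 < η → η < 1 → ∃ d0 > 0, ∀ z ∈ Ω₁,
    -r₁ z ≤ d0 → ∀ v, lam r₁ z v = 0 → Lev r₁ z v ≤ 4 * (-r₁ z) * (1 - η) → ‖lam r₂ (φ z) (fderiv ℂ φ z v)‖ ≤ 2 * (-r₂ (φ z)) * (1 - e) := by
  set ε : ℝ := 1 / (16 * C ^ 2) with hε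
  have hC2 : 1 ≤ C ^ 2 := one_le_pow₀ hC
  have hε0 : 0 < ε := by positivity
  have hεC : ε * (16 * C ^ 2) = 1 := by rw [hε]; field_simp
  have hε1 : ε ≤ 1 / 16 := by rw [hε]; apply one_div_le_one_div_of_le <;> nlinarith
  set e := ε ^ 2 / 100 with he
  have he0 : 0 < e := by positivity
  have hee : e ≤ ε / 1600 := by rw [he]; nlinarith
  refine ⟨e, he0, by linarith, fun η hη hη1 => ?_⟩
  obtain ⟨K, hK, htd⟩ := tdisc h.s1
  obtain ⟨L, hL, hlip⟩ := lip_disc' h.s2 (2 * C ^ 2) (1 - e) (by positivity) (by linarith) (by linarith)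
  obtain ⟨d1, hd1, hd1', hch⟩ := chart_schwarz h.s2 hL he0
  have hc := h.s1.c_pos
  have hδ := h.s1.δ0_pos
  set x0 : ℝ := min 1 (η * c / (8 * K)) with hx0
  have hx0p : 0 < x0 := by positivity
  refine ⟨min (d1 / C) (min δ0 (x0 ^ 2 * c / 4)), by positivity, fun z hz hzd v hv hvL => ?_⟩
  have hzn := (h.s1.mem_iff z).1 hz
  set δ := -r₁ z with hδd
  have hδ0 : 0 < δ := by linarith
  have hzd1 : δ * C ≤ d1 := by
    have : δ ≤ d1 / C := hzd.trans (min_le_left _ _)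
    rwa [le_div_iff₀ (by positivity)] at this
  have hzδ : |r₁ z| ≤ δ0 := by rw [abs_of_neg hzn]; exact hzd.trans ((min_le_right _ _).trans (min_le_left _ _))
  have hzx : 4 * δ ≤ x0 ^ 2 * c := by
    have := hzd.trans ((min_le_right _ _).trans (min_le_right _ _)); linarith
  have hvn2 : c * ‖v‖ ^ 2 ≤ 4 * δ := (h.s1.lev z v hzδ).trans (hvL.trans (by nlinarith))
  have hvx : ‖v‖ ≤ x0 := by
    refine le_of_sq_le_sq ?_ hx0p.le
    have : c * ‖v‖ ^ 2 ≤ c * x0 ^ 2 := by linarith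
    exact le_of_mul_le_mul_left this hc
  have hv1 : ‖v‖ ≤ 1 := hvx.trans (min_le_left _ _)
  have hvx2 : ‖v‖ * (8 * K) ≤ η * c := by
    have := hvx.trans (min_le_right _ _)
    rwa [le_div_iff₀ (by positivity)] at this
  obtain ⟨f, hfd, hf0, hfd0, hf⟩ := htd z v hzδ hv hv1
  have hKv : K * ‖v‖ ^ 3 ≤ η * δ / 2 := by
    have h1 : c * (K * ‖v‖ ^ 3) ≤ c * (η * δ / 2) := by
      calc c * (K * ‖v‖ ^ 3) = (c * ‖v‖ ^ 2) * (K * ‖v‖) := by ring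
        _ ≤ (4 * δ) * (K * ‖v‖) := by gcongr
        _ ≤ (4 * δ) * (η * c / 8) := by gcongr; linarith
        _ = _ := by ring
    exact le_of_mul_le_mul_left h1 hc
  have hLv : 0 ≤ Lev r₁ z v := le_trans (by positivity) (h.s1.lev z v hzδ)
  have hfin : ∀ ζ ∈ ball (0:ℂ) 1, r₁ (f ζ) < 0 ∧ -r₁ (f ζ) ≤ 2 * δ := by
    intro ζ hζ
    have hζ1 : ‖ζ‖ ≤ 1 := by have : ‖ζ‖ < 1 := by simpa using hζ
                             exact this.le
    have h1 := abs_le.1 (hf ζ hζ1)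
    have h2 : ‖ζ‖ ^ 2 ≤ 1 := pow_le_one₀ (norm_nonneg _) hζ1
    have h3 : ‖ζ‖ ^ 2 * Lev r₁ z v ≤ 1 * (4 * δ * (1 - η)) := by
      refine mul_le_mul h2 hvL hLv zero_le_one
    have h4 : 0 ≤ ‖ζ‖ ^ 2 * Lev r₁ z v := by positivity
    have h5 : 0 < η * δ := by positivity
    have h6 : η * δ < δ := by nlinarith
    constructor
    · linarith [h1.2]
    · linarith [h1.1]
  have hfm : Set.MapsTo f (ball 0 1) Ω₁ := fun ζ hζ => (h.s1.mem_iff _).2 (hfin ζ hζ).1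
  have hw := h.mφ hz
  set w := φ z with hwd
  have hwn := (h.s2.mem_iff w).1 hw
  set δ' := -r₂ w with hδ'
  have hδ'0 : 0 < δ' := by linarith
  have hE1 : δ' ≤ C * δ := hE.e1 z hz
  have hE2 : δ ≤ C * δ' := hE.e2 z hz
  have hφf0 : φ (f 0) = w := by rw [hf0]
  have hdep : ∀ ζ ∈ ball (0:ℂ) 1, -r₂ (φ (f ζ)) ≤ 2 * C ^ 2 * δ' := by
    intro ζ hζ
    have h1 := hE.e1 _ (hfm hζ)
    have h2 := (hfin ζ hζ).2
    calc -r₂ (φ (f ζ)) ≤ C * (-r₁ (f ζ)) := h1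
      _ ≤ C * (2 * (C * δ')) := by gcongr; linarith
      _ = _ := by ring
  obtain ⟨G, hGdef, hGd, hGm, hG0, hGder, hGl⟩ := hlip (fun ζ => φ (f ζ)) (h.hφ.comp hfd.differentiableOn hfm) (fun ζ hζ => h.mφ (hfm hζ)) (by
    intro ζ hζ; show _ ≤ 2 * C ^ 2 * (-r₂ (φ (f 0))); rw [hφf0]; exact hdep ζ hζ)
  simp only [hφf0] at hGl hG0
  have hder : deriv (fun ζ => φ (f ζ)) 0 = fderiv ℂ φ z v := by
    have hφd : HasFDerivAt φ (fderiv ℂ φ z) (f 0) := by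
      rw [hf0]; exact (h.hφ.differentiableAt (h.s1.isOpen.mem_nhds hz)).hasFDerivAt
    exact (hφd.comp_hasDerivAt (0:ℂ) hfd0).deriv
  rw [hder] at hGder
  obtain ⟨q, hqd, hq0, hqder, hqne, hqF, hqD, hqN⟩ := hch w G hδ'0 (by linarith) hGd hGm hG0 hGl
  by_contra hcon
  push Not at hcon
  have hwδ : |r₂ w| ≤ δ0 := by rw [abs_of_neg hwn]; linarith
  have hLG : ∀ x, 0 ≤ Lev r₂ w x := fun x => le_trans (mul_nonneg hc.le (sq_nonneg _)) (h.s2.lev w x hwδ)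
  have hqn : ‖deriv q 0‖ / 2 = ‖lam r₂ w (deriv G 0)‖ / (2 * δ') := by
    rw [hqder, norm_div, Complex.norm_real, Real.norm_of_nonneg hδ'0.le, div_div, mul_comm]
  obtain ⟨ζ, hζ1, hX⟩ := rig_core (Lv := fun ζ => Lev r₂ w (G ζ - w)) hδ'0 hε0 hε1 hqd hq0 hqne (fun ζ => hLG _) hqF (by
      rw [hqn, div_pow, mul_pow]
      have : 0 ≤ Lev r₂ w (deriv G 0) / (4 * δ') := div_nonneg (hLG _) (by linarith)
      have e4 : (2:ℝ) ^ 2 = 4 := by norm_num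
      rw [e4]; linarith) (by
      rw [hqn, hGder, map_smul, norm_smul, Complex.norm_real, Real.norm_of_nonneg (by linarith), ← he, le_div_iff₀ (by linarith)]
      have h1 : (1 - e) * (2 * δ' * (1 - e)) ≤ (1 - e) * ‖lam r₂ w (fderiv ℂ φ z v)‖ := mul_le_mul_of_nonneg_left hcon.le (by linarith)
      have h2 : 0 ≤ 2 * δ' * e ^ 2 := by positivity
      have h3 : (1 - e) * (2 * δ' * (1 - e)) = (1 - 2 * e) * (2 * δ') + 2 * δ' * e ^ 2 := by ring
      linarith)
  have hD1 := hqD ζ hζ1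
  have hD2 : -r₂ (G ζ) ≤ 2 * C ^ 2 * δ' := by
    have : G ζ = φ (f (((1 - e : ℝ) : ℂ) * ζ)) := by rw [hGdef]
    rw [this]
    refine hdep _ ?_
    rw [mem_ball_zero_iff] at hζ1 ⊢
    rw [norm_mul, Complex.norm_real, Real.norm_of_nonneg (by linarith)]
    have : (1 - e) * ‖ζ‖ ≤ 1 * ‖ζ‖ := mul_le_mul_of_nonneg_right (by linarith) (norm_nonneg _)
    linarith
  have hD3 : -r₂ (G ζ) / δ' ≤ 2 * C ^ 2 := by rw [div_le_iff₀ hδ'0]; exact hD2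
  rw [← hδ'] at hD1
  have hX4 : 1 - (q ζ).re - Lev r₂ w (G ζ - w) / (4 * δ') ≤ 2 * C ^ 2 + e := by linarith
  have hX5 : 4 * ε * (1 - (q ζ).re - Lev r₂ w (G ζ - w) / (4 * δ')) ≤ 4 * ε * (2 * C ^ 2 + e) := mul_le_mul_of_nonneg_left hX4 (by linarith)
  have hX6 : 4 * ε * e ≤ 4 * ε * (1 / 100) := mul_le_mul_of_nonneg_left (by linarith) (by linarith)
  have hX7 : 4 * ε * (2 * C ^ 2 + e) = ε * (16 * C ^ 2) / 2 + 4 * ε * e := by ring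
  linarith
end Rig
end

section
section Rig
variable {E : Type} [NormedAddCommGroup E] [InnerProductSpace ℂ E] [FiniteDimensional ℂ E] [NormedSpace ℝ E] [IsScalarTower ℝ ℂ E]
variable {Ω₁ Ω₂ Ω : Set E} {r₁ r₂ r : E → ℝ} {δ0 c M C : ℝ} {φ ψ : E → E}

lemma mob_re {u : ℂ} {κ : ℝ} (hκ : 0 < κ) (hκ1 : κ ≤ 1) (hu : ‖u‖ ≤ 1 - κ) : κ ≤ ‖1 - u‖ ∧ κ / 4 ≤ 1 + (2 * u / (1 - u)).re ∧ ‖2 * u / (1 - u)‖ ≤ 2 / κ := by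
  have h1 : κ ≤ ‖1 - u‖ := by
    have := norm_sub_norm_le (1:ℂ) u
    rw [norm_one] at this; linarith
  have hp : 0 < ‖1 - u‖ := by linarith
  have hne : 1 - u ≠ 0 := norm_pos_iff.1 hp
  refine ⟨h1, ?_, ?_⟩
  · have e1 : 1 + (2 * u / (1 - u)).re = (1 - ‖u‖ ^ 2) / ‖1 - u‖ ^ 2 := by
      have hns : Complex.normSq (1 - u) ≠ 0 := by rwa [Ne, Complex.normSq_eq_zero]
      rw [← Complex.normSq_eq_norm_sq, ← Complex.normSq_eq_norm_sq, Complex.div_re]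
      field_simp
      rw [Complex.normSq_apply, Complex.normSq_apply]; simp; ring
    rw [e1, le_div_iff₀ (by positivity)]
    have h2 : ‖1 - u‖ ≤ 2 := by
      have := norm_sub_le (1:ℂ) u
      rw [norm_one] at this; linarith
    have h3 : ‖1 - u‖ ^ 2 ≤ 4 := by nlinarith
    have h4 : ‖u‖ ^ 2 ≤ 1 - κ := by nlinarith [norm_nonneg u]
    nlinarith
  · rw [norm_div, norm_mul, Complex.norm_ofNat]
    apply div_le_div₀ <;> linarith [norm_nonneg u]

/-- normal discs -/
lemma ndisc (h : SPD Ω r δ0 c M) {κ : ℝ} (hκ : 0 < κ) (hκ1 : κ ≤ 1 / 8) : ∃ d0 > 0, ∀ w n, w ∈ Ω → -r w ≤ d0 → lam r w n = 1 → ‖n‖ ≤ 2 / c →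
    ∃ f : ℂ → E, DifferentiableOn ℂ f (ball 0 1) ∧ f 0 = w ∧ HasDerivAt f ((-(2 * (-r w) * (1 - κ) : ℝ) : ℂ) • n) 0 ∧ Set.MapsTo f (ball 0 1) Ω ∧
      ∀ ζ ∈ ball (0:ℂ) 1, -r (f ζ) ≤ 4 / κ * (-r w) := by
  have hM := h.M_pos
  have hc := h.c_pos
  refine ⟨min (c * κ / 4) (c ^ 2 * κ ^ 3 / (384 * M)), by positivity, fun w n hw hwd hn hnn => ?_⟩
  have hwn := (h.mem_iff w).1 hw
  set δ := -r w with hδ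
  have hδ0 : 0 < δ := by linarith
  have h1 : 4 * δ ≤ c * κ := by have := hwd.trans (min_le_left _ _); linarith
  have h2 : δ * (384 * M) ≤ c ^ 2 * κ ^ 3 := by
    have := hwd.trans (min_le_right _ _); rwa [le_div_iff₀ (by positivity)] at this
  set ρ : ℝ := 1 - κ with hρ
  have hu : ∀ ζ ∈ ball (0:ℂ) 1, ‖(ρ:ℂ) * ζ‖ ≤ 1 - κ := by
    intro ζ hζ
    rw [mem_ball_zero_iff] at hζ
    rw [norm_mul, Complex.norm_real, Real.norm_of_nonneg (by linarith)]
    nlinarith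
  set g : ℂ → ℂ := fun ζ => 2 * ((ρ:ℂ) * ζ) / (1 - (ρ:ℂ) * ζ) with hg
  have hne : ∀ ζ ∈ ball (0:ℂ) 1, 1 - (ρ:ℂ) * ζ ≠ 0 := fun ζ hζ => norm_pos_iff.1 (lt_of_lt_of_le hκ (mob_re hκ (by linarith) (hu ζ hζ)).1)
  have hgd : DifferentiableOn ℂ g (ball 0 1) := by
    apply DifferentiableOn.div (by fun_prop) (by fun_prop) hne
  have hg0 : g 0 = 0 := by simp [hg]
  have h00 : (0:ℂ) ∈ ball (0:ℂ) 1 := mem_ball_self one_pos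
  have hgder : HasDerivAt g (2 * ρ) 0 := by
    have a1 : HasDerivAt (fun ζ : ℂ => 2 * ((ρ:ℂ) * ζ)) (2 * ρ) 0 := by
      simpa using ((hasDerivAt_id (0:ℂ)).const_mul (ρ:ℂ)).const_mul 2
    have a2 : HasDerivAt (fun ζ : ℂ => 1 - (ρ:ℂ) * ζ) (-ρ) 0 := by
      simpa using ((hasDerivAt_id (0:ℂ)).const_mul (ρ:ℂ)).const_sub 1
    refine (a1.div a2 (hne 0 h00)).congr_deriv ?_
    simp
  have hkey : ∀ ζ ∈ ball (0:ℂ) 1, r (w + (-(δ:ℂ) * g ζ) • n) < 0 ∧ -r (w + (-(δ:ℂ) * g ζ) • n) ≤ 4 / κ * δ := by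
    intro ζ hζ
    obtain ⟨-, b1, b2⟩ := mob_re hκ (by linarith) (hu ζ hζ)
    rw [show 2 * ((ρ:ℂ) * ζ) / (1 - (ρ:ℂ) * ζ) = g ζ from rfl] at b1 b2
    set v := (-(δ:ℂ) * g ζ) • n with hv
    have hvn : ‖v‖ ≤ 4 * δ / (c * κ) := by
      rw [hv, norm_smul, norm_mul, norm_neg, Complex.norm_real, Real.norm_of_nonneg hδ0.le]
      calc δ * ‖g ζ‖ * ‖n‖ ≤ δ * (2 / κ) * (2 / c) := by gcongr
        _ = _ := by field_simp; ring
    have hv1 : ‖v‖ ≤ 1 := hvn.trans (by rw [div_le_one (by positivity)]; exact h1)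
    have ht := abs_le.1 (h.taylor1 (z := w) hv1)
    have hlv : (lam r w v).re = - (δ * (g ζ).re) := by
      rw [hv, map_smul, hn, smul_eq_mul, mul_one, neg_mul, neg_re, Complex.re_ofReal_mul]
    have herr : 3 * M * ‖v‖ ^ 2 ≤ δ * κ / 8 := by
      have : ‖v‖ ^ 2 ≤ (4 * δ / (c * κ)) ^ 2 := by gcongr
      calc 3 * M * ‖v‖ ^ 2 ≤ 3 * M * (4 * δ / (c * κ)) ^ 2 := by gcongr
        _ = δ * (δ * (384 * M)) / (8 * c ^ 2 * κ ^ 2) := by field_simp; ring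
        _ ≤ δ * (c ^ 2 * κ ^ 3) / (8 * c ^ 2 * κ ^ 2) := by gcongr
        _ = _ := by field_simp
    rw [hlv] at ht
    have b3 : δ * (κ / 4) ≤ δ * (1 + (g ζ).re) := by gcongr
    have b4 : (g ζ).re ≤ 2 / κ := (Complex.re_le_norm _).trans b2
    have b5 : δ * (g ζ).re ≤ δ * (2 / κ) := by gcongr
    have b6 : 0 < δ * κ := by positivity
    have b7 : δ * 8 ≤ δ * (1 / κ) := by
      gcongr; rw [le_div_iff₀ hκ]; linarith
    have b8 : 4 / κ * δ = 2 * (δ * (1 / κ)) + δ * (2 / κ) := by ring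
    have b9 : δ * κ ≤ δ * 1 := by gcongr; linarith
    constructor
    · linarith [ht.2]
    · linarith [ht.1]
  refine ⟨fun ζ => w + (-(δ:ℂ) * g ζ) • n, ?_, by simp [hg0], ?_, fun ζ hζ => (h.mem_iff _).2 (hkey ζ hζ).1, fun ζ hζ => (hkey ζ hζ).2⟩
  · exact ((hgd.const_mul _).smul_const n).const_add w
  · refine (((hgder.const_mul (-(δ:ℂ))).smul_const n).const_add w).congr_deriv ?_
    congr 1
    push_cast; ring

lemma rig_b (h : BH Ω₁ Ω₂ r₁ r₂ δ0 c M φ ψ) (hC : 1 ≤ C) (hE : Est Ω₂ r₂ r₁ ψ C) {η : ℝ} (hη : 0 < η) (hη1 : η ≤ 1) : ∃ d0 > 0, ∀ w ∈ Ω₂,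
    -r₂ w ≤ d0 → ∀ n, lam r₂ w n = 1 → ‖n‖ ≤ 2 / c → (-r₂ w) ^ 2 * Lev r₁ (ψ w) (fderiv ℂ ψ w n) ≤ (-r₁ (ψ w)) * (1 + η) := by
  set κ : ℝ := η / 32 with hκ
  have hκ0 : 0 < κ := by positivity
  have hκ1 : κ ≤ 1 / 32 := by rw [hκ]; linarith
  obtain ⟨d1, hd1, hnd⟩ := ndisc h.s2 hκ0 (by linarith)
  obtain ⟨L, hL, hlip⟩ := lip_disc' h.s1 (4 * C ^ 2 / κ) (1 - κ) (by positivity) (by linarith) (by linarith)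
  obtain ⟨d2, hd2, hd2', hch⟩ := chart_schwarz h.s1 hL (by positivity : 0 < η / 4)
  have hc := h.s1.c_pos
  refine ⟨min d1 (d2 / C), by positivity, fun w hw hwd n hn hnn => ?_⟩
  obtain ⟨f, hfd, hf0, hfd0, hfm, hf⟩ := hnd w n hw (hwd.trans (min_le_left _ _)) hn hnn
  have hz := h.mψ hw
  set z := ψ w with hzd
  have hzn := (h.s1.mem_iff z).1 hz
  have hwn := (h.s2.mem_iff w).1 hw
  set δ := -r₁ z with hδ
  set δ' := -r₂ w with hδ'
  have hδ0 : 0 < δ := by linarith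
  have hδ'0 : 0 < δ' := by linarith
  have hE1 : δ ≤ C * δ' := hE.e1 w hw
  have hE2 : δ' ≤ C * δ := hE.e2 w hw
  have hδd : δ ≤ d2 := by
    have := hwd.trans (min_le_right _ _)
    rw [le_div_iff₀ (by positivity)] at this
    linarith
  have hψf0 : ψ (f 0) = z := by rw [hf0]
  obtain ⟨G, hGdef, hGd, hGm, hG0, hGder, hGl⟩ := hlip (fun ζ => ψ (f ζ)) (h.hψ.comp hfd hfm) (fun ζ hζ => h.mψ (hfm hζ)) (by
    intro ζ hζ
    show _ ≤ 4 * C ^ 2 / κ * (-r₁ (ψ (f 0)))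
    rw [hψf0]
    calc -r₁ (ψ (f ζ)) ≤ C * (-r₂ (f ζ)) := hE.e1 _ (hfm hζ)
      _ ≤ C * (4 / κ * (C * δ)) := by
        refine mul_le_mul_of_nonneg_left ((hf ζ hζ).trans ?_) (by linarith)
        exact mul_le_mul_of_nonneg_left hE2 (by positivity)
      _ = 4 * C ^ 2 / κ * δ := by ring)
  simp only [hψf0] at hGl hG0
  have hder : deriv (fun ζ => ψ (f ζ)) 0 = ((-(2 * δ' * (1 - κ) : ℝ) : ℂ)) • fderiv ℂ ψ w n := by
    have hφd : HasFDerivAt ψ (fderiv ℂ ψ w) (f 0) := by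
      rw [hf0]; exact (h.hψ.differentiableAt (h.s2.isOpen.mem_nhds hw)).hasFDerivAt
    have := (hφd.comp_hasDerivAt (0:ℂ) hfd0).deriv
    rw [map_smul] at this
    exact this
  obtain ⟨q, hqd, hq0, hqder, hqne, hqF, hqD, hqN⟩ := hch z G hδ0 hδd hGd hGm hG0 hGl
  rw [← hδ, hGder, hder, smul_smul, Lev_csmul] at hqN
  have hnorm : ‖((1 - κ : ℝ) : ℂ) * -((2 * δ' * (1 - κ) : ℝ) : ℂ)‖ = 2 * δ' * (1 - κ) ^ 2 := by
    have : 0 < 1 - κ := by linarith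
    rw [norm_mul, norm_neg, Complex.norm_real, Complex.norm_real, Real.norm_of_nonneg this.le, Real.norm_of_nonneg (by positivity)]; ring
  rw [hnorm] at hqN
  set Lv := Lev r₁ z (fderiv ℂ ψ w n) with hLv
  have hp : 0 ≤ ‖lam r₁ z ((((1 - κ : ℝ) : ℂ) * -((2 * δ' * (1 - κ) : ℝ) : ℂ)) • fderiv ℂ ψ w n)‖ ^ 2 / (4 * δ ^ 2) := by positivity
  have h1 : (2 * δ' * (1 - κ) ^ 2) ^ 2 * Lv / (4 * δ) ≤ 1 + η / 4 := by linarith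
  rw [div_le_iff₀ (by positivity)] at h1
  have hLv0 : 0 ≤ Lv := by
    refine le_trans (mul_nonneg hc.le (sq_nonneg _)) (h.s1.lev z _ ?_)
    rw [abs_of_neg hzn]; linarith
  set Y := δ' ^ 2 * Lv with hY
  have hY0 : 0 ≤ Y := by positivity
  have h2 : Y * (1 - κ) ^ 4 ≤ δ * (1 + η / 4) := by
    have : (2 * δ' * (1 - κ) ^ 2) ^ 2 * Lv = 4 * (Y * (1 - κ) ^ 4) := by rw [hY]; ring
    linarith
  have h3 : 1 - 4 * κ ≤ (1 - κ) ^ 4 := by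
    have := one_add_mul_le_pow (a := -κ) (by linarith) 4
    have e : (1 + -κ) = 1 - κ := by ring
    rw [e] at this; push_cast at this; linarith
  have h4 : Y * (1 - η / 8) ≤ δ * (1 + η / 4) := by
    refine le_trans ?_ h2
    exact mul_le_mul_of_nonneg_left (by rw [hκ] at h3 ⊢; linarith) hY0
  have h5 : δ * (1 + η / 4) ≤ δ * (1 + η) * (1 - η / 8) := by
    rw [mul_assoc]; refine mul_le_mul_of_nonneg_left ?_ hδ0.le
    nlinarith
  exact le_of_mul_le_mul_right (h4.trans h5) (by linarith)
lemma BH.inv (h : BH Ω₁ Ω₂ r₁ r₂ δ0 c M φ ψ) {w : E} (hw : w ∈ Ω₂) (v : E) : fderiv ℂ φ (ψ w) (fderiv ℂ ψ w v) = v := by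
  have h1 : HasFDerivAt ψ (fderiv ℂ ψ w) w := (h.hψ.differentiableAt (h.s2.isOpen.mem_nhds hw)).hasFDerivAt
  have h2 : HasFDerivAt φ (fderiv ℂ φ (ψ w)) (ψ w) := (h.hφ.differentiableAt (h.s1.isOpen.mem_nhds (h.mψ hw))).hasFDerivAt
  have h3 := h2.comp w h1
  have h4 : HasFDerivAt (φ ∘ ψ) (ContinuousLinearMap.id ℂ E) w := by
    refine (hasFDerivAt_id w).congr_of_eventuallyEq ?_
    filter_upwards [h.s2.isOpen.mem_nhds hw] with x hx using h.ri x hx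
  have := congrArg (fun T => T v) (h3.unique h4)
  simpa using this

lemma rig_c (h : BH Ω₁ Ω₂ r₁ r₂ δ0 c M φ ψ) (hC : 1 ≤ C) (hE : Est Ω₁ r₁ r₂ φ C) (hE' : Est Ω₂ r₂ r₁ ψ C) : ∃ c' > 0, ∃ d0 > 0, ∀ w ∈ Ω₂,
    -r₂ w ≤ d0 → ∀ n, lam r₂ w n = 1 → ‖n‖ ≤ 2 / c → c' ≤ ‖lam r₁ (ψ w) (fderiv ℂ ψ w n)‖ := by
  obtain ⟨e, he0, he1, hra⟩ := rig_a h hC hE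
  set η : ℝ := e / 16 with hη
  have hη0 : 0 < η := by positivity
  obtain ⟨d1, hd1, ha⟩ := hra η hη0 (by rw [hη]; linarith)
  obtain ⟨d2, hd2, hb⟩ := rig_b h hC hE' hη0 (by rw [hη]; linarith)
  have hc := h.s1.c_pos
  have hM := h.s1.M_pos
  have hδ0' := h.s1.δ0_pos
  set A : ℝ := C * (2 / c) with hA
  have hA0 : 0 < A := by positivity
  set B : ℝ := (1 + 1 / η) * (2 * M * (A * (2 / c)) ^ 2) with hB
  have hB0 : 0 < B := by positivity
  refine ⟨e / (2 * A), by positivity, min (min d2 (d1 / C)) (min (δ0 / C) (η / (B * C))), by positivity, fun w hw hwd n hn hnn => ?_⟩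
  have k1 := hwd.trans ((min_le_left _ _).trans (min_le_left _ _))
  have k2 := hwd.trans ((min_le_left _ _).trans (min_le_right _ _))
  have k3 := hwd.trans ((min_le_right _ _).trans (min_le_left _ _))
  have k4 := hwd.trans ((min_le_right _ _).trans (min_le_right _ _))
  rw [le_div_iff₀ (by positivity)] at k2 k3 k4
  have hLb := hb w hw k1 n hn hnn
  have hz := h.mψ hw
  have hinv := h.inv hw
  have hwz := h.ri w hw
  set z := ψ w with hzd
  have hzn := (h.s1.mem_iff z).1 hz
  have hwn := (h.s2.mem_iff w).1 hw
  have hE1 : -r₁ z ≤ C * (-r₂ w) := hE'.e1 w hw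
  have hE2 : -r₂ w ≤ C * (-r₁ z) := hE'.e2 w hw
  have hzδ : |r₁ z| ≤ δ0 := by rw [abs_of_neg hzn]; linarith
  obtain ⟨m, hm, hmn⟩ := h.s1.exists_normal hzδ
  set N := fderiv ℂ ψ w n with hN
  set α := lam r₁ z N with hα
  have hαA : ‖α‖ ≤ A := (hE'.n w hw n).trans (mul_le_mul_of_nonneg_left hnn (by linarith))
  set t := N + (-α) • m with ht
  have htl : lam r₁ z t = 0 := by rw [ht, map_add, map_smul, hm, ← hα]; simp
  have hLt : Lev r₁ z t ≤ (1 + η) * Lev r₁ z N + B := by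
    have h1 := Lev_add_le h.s1 hzδ N ((-α) • m) hη0
    have h2 := h.s1.Lev_le z ((-α) • m)
    have h3 : ‖(-α) • m‖ ≤ A * (2 / c) := by
      rw [norm_smul, norm_neg]; gcongr
    have h4 : Lev r₁ z ((-α) • m) ≤ 2 * M * (A * (2 / c)) ^ 2 := h2.trans (by gcongr)
    have h5 : (1 + 1 / η) * Lev r₁ z ((-α) • m) ≤ B := mul_le_mul_of_nonneg_left h4 (by positivity)
    linarith
  set δ := -r₁ z with hδ
  set δ' := -r₂ w with hδ'
  have hδ0 : 0 < δ := by linarith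
  have hδ'0 : 0 < δ' := by linarith
  have hLt2 : δ' ^ 2 * Lev r₁ z t ≤ δ * (1 + 4 * η) := by
    have h1 : δ' ^ 2 * Lev r₁ z t ≤ δ' ^ 2 * ((1 + η) * Lev r₁ z N + B) := mul_le_mul_of_nonneg_left hLt (by positivity)
    have h2 : (1 + η) * (δ' ^ 2 * Lev r₁ z N) ≤ (1 + η) * (δ * (1 + η)) := mul_le_mul_of_nonneg_left hLb (by linarith)
    have h3 : δ' ^ 2 * B ≤ δ * η := by
      calc δ' ^ 2 * B = δ' * (δ' * B) := by ring
        _ ≤ (C * δ) * (δ' * B) := mul_le_mul_of_nonneg_right hE2 (by positivity)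
        _ = δ * (δ' * (B * C)) := by ring
        _ ≤ δ * η := mul_le_mul_of_nonneg_left k4 hδ0.le
    have h4 : (1 + η) * (δ * (1 + η)) = δ * (1 + 2 * η) + δ * η * η := by ring
    have h5 : δ * η * η ≤ δ * η * 1 := mul_le_mul_of_nonneg_left (by rw [hη]; linarith) (by positivity)
    linarith
  set θ : ℝ := 1 - e / 2 with hθ
  have hθ0 : 0 < θ := by rw [hθ]; linarith
  have hf := ha z hz (by linarith) (((2 * θ * δ' : ℝ) : ℂ) • t) (by rw [map_smul, htl, smul_zero]) (by
    rw [Lev_csmul, Complex.norm_real, Real.norm_of_nonneg (by positivity)]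
    have h1 : (2 * θ * δ') ^ 2 * Lev r₁ z t = 4 * (θ ^ 2 * (δ' ^ 2 * Lev r₁ z t)) := by ring
    have h2 : θ ^ 2 * (δ' ^ 2 * Lev r₁ z t) ≤ θ ^ 2 * (δ * (1 + 4 * η)) := mul_le_mul_of_nonneg_left hLt2 (by positivity)
    have h3 : θ ^ 2 * (1 + 4 * η) ≤ 1 - η := by
      rw [hθ, hη]
      have : (1 - e / 2) ^ 2 * (1 + 4 * (e / 16)) = 1 - 3 / 4 * e + e ^ 3 / 16 := by ring
      rw [this]
      nlinarith [mul_pos he0 he0]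
    have h4 : δ * (θ ^ 2 * (1 + 4 * η)) ≤ δ * (1 - η) := mul_le_mul_of_nonneg_left h3 hδ0.le
    rw [h1]
    have h5 : θ ^ 2 * (δ * (1 + 4 * η)) = δ * (θ ^ 2 * (1 + 4 * η)) := by ring
    linarith)
  rw [hwz, map_smul, map_smul, norm_smul, Complex.norm_real, Real.norm_of_nonneg (by positivity), ← hδ'] at hf
  set x := ‖lam r₂ w (fderiv ℂ φ z t)‖ with hx
  have hf2 : θ * x ≤ 1 - e := by
    have : (2 * δ') * (θ * x) ≤ (2 * δ') * (1 - e) := by linarith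
    exact le_of_mul_le_mul_left this (by positivity)
  have hx2 : x ≤ θ := by
    have h1 : θ * x ≤ θ * θ := by
      refine hf2.trans ?_
      rw [hθ]; nlinarith [sq_nonneg e]
    exact le_of_mul_le_mul_left h1 hθ0
  have hsum : (1:ℂ) = lam r₂ w (fderiv ℂ φ z t) + α * lam r₂ w (fderiv ℂ φ z m) := by
    have h1 : N = t + α • m := by rw [ht]; simp
    have h2 := hinv n
    rw [← hN, h1, map_add, map_smul] at h2
    have h3 := congrArg (lam r₂ w) h2
    rw [map_add, map_smul, hn, smul_eq_mul] at h3
    exact h3.symm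
  have hmA : ‖lam r₂ w (fderiv ℂ φ z m)‖ ≤ A := by
    have := hE.n z hz m
    rw [hwz] at this
    exact this.trans (mul_le_mul_of_nonneg_left hmn (by linarith))
  have h1 : (1:ℝ) ≤ x + ‖α‖ * A := by
    calc (1:ℝ) = ‖(1:ℂ)‖ := by simp
      _ = ‖lam r₂ w (fderiv ℂ φ z t) + α * lam r₂ w (fderiv ℂ φ z m)‖ := by rw [← hsum]
      _ ≤ x + ‖α * lam r₂ w (fderiv ℂ φ z m)‖ := norm_add_le _ _
      _ ≤ x + ‖α‖ * A := by rw [norm_mul]; gcongr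
  rw [div_le_iff₀ (by positivity)]
  linarith
end Rig
end

section
section TwoD

lemma D2_comp_aff {F Y : Type} [NormedAddCommGroup F] [NormedSpace ℝ F] [NormedAddCommGroup Y] [NormedSpace ℝ Y]
    {u : F → Y} (l : Y →L[ℝ] ℝ) (L : ℂ →L[ℝ] F) (z0 : F) {ζ : ℂ} (hu : ContDiffAt ℝ 2 u (z0 + L ζ)) (v w : ℂ) :
    D2 (fun ζ => l (u (z0 + L ζ))) ζ v w = l (fderiv ℝ (fderiv ℝ u) (z0 + L ζ) (L v) (L w)) := by
  have ha : ∀ y, HasFDerivAt (fun ζ : ℂ => z0 + L ζ) L y := fun y => L.hasFDerivAt.const_add z0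
  have hc : ContinuousAt (fun ζ : ℂ => z0 + L ζ) ζ := (ha ζ).continuousAt
  have h : fderiv ℝ (fun ζ => l (u (z0 + L ζ))) =ᶠ[nhds ζ] fun y => l.comp ((fderiv ℝ u (z0 + L y)).comp L) := by
    filter_upwards [hc.eventually (hu.eventually (by norm_num))] with y hy
    have h1 : HasFDerivAt u (fderiv ℝ u (z0 + L y)) (z0 + L y) := (hy.differentiableAt (by norm_num)).hasFDerivAt
    exact (l.hasFDerivAt.comp y (h1.comp y (ha y))).fderiv
  unfold D2
  rw [h.fderiv_eq]
  have h2 : HasFDerivAt (fun y => fderiv ℝ u (z0 + L y)) ((fderiv ℝ (fderiv ℝ u) (z0 + L ζ)).comp L) ζ :=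
    (diff_fderiv hu).hasFDerivAt.comp ζ (ha ζ)
  have h3 : HasFDerivAt (fun y => l.comp ((fderiv ℝ u (z0 + L y)).comp L))
      (((ContinuousLinearMap.compL ℝ ℂ Y ℝ l).comp ((ContinuousLinearMap.compL ℝ ℂ F Y).flip L)).comp ((fderiv ℝ (fderiv ℝ u) (z0 + L ζ)).comp L)) ζ :=
    ((ContinuousLinearMap.compL ℝ ℂ Y ℝ l).comp ((ContinuousLinearMap.compL ℝ ℂ F Y).flip L)).hasFDerivAt.comp ζ h2
  rw [h3.fderiv]; rfl

lemma bar {v : ℂ → ℝ} {ρ a A : ℝ} (hρ : 0 < ρ) (ha : 0 ≤ a) (hA : 0 < A) {U : Set ℂ} (hU : IsOpen U)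
    (hUS : ∀ ζ : ℂ, |ζ.re| ≤ ρ → 0 < ζ.im → ζ.im ≤ ρ → ζ ∈ U) (hv : ContDiffOn ℝ 2 v U)
    (hb : ∀ ζ : ℂ, |ζ.re| ≤ ρ → 0 < ζ.im → ζ.im ≤ ρ → v ζ ≤ a)
    (hΔ : ∀ ζ : ℂ, |ζ.re| ≤ ρ → 0 < ζ.im → ζ.im ≤ ρ → -A ≤ Lev v ζ 1)
    (h0 : ∀ η > 0, ∃ t > 0, ∀ ζ : ℂ, |ζ.re| ≤ ρ → 0 < ζ.im → ζ.im ≤ ρ → ζ.im < t → v ζ ≤ η) :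
    ∀ t : ℝ, 0 < t → t ≤ ρ → v (t * I) ≤ (2 * a / ρ + A * ρ) * t := by
  set α : ℝ := a / ρ ^ 2 with hα
  have hα0 : 0 ≤ α := by positivity
  set γ : ℝ := α + A with hγ
  set β : ℝ := a / ρ + γ * ρ with hβ
  have hβe : β = 2 * a / ρ + A * ρ := by rw [hβ, hγ, hα]; field_simp; ring
  set W : Set ℂ := {ζ | |ζ.re| < ρ ∧ 0 < ζ.im ∧ ζ.im < ρ} with hW
  have hWo : IsOpen W := by
    refine (isOpen_lt Complex.continuous_re.abs continuous_const).inter ((isOpen_lt continuous_const Complex.continuous_im).inter (isOpen_lt Complex.continuous_im continuous_const))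
  have hWU : W ⊆ U := fun ζ hζ => hUS ζ hζ.1.le hζ.2.1 hζ.2.2.le
  set b : ℂ → ℝ := fun ζ => α * ζ.re ^ 2 + (β * ζ.im + (-γ) * ζ.im ^ 2) with hbd
  have hbc : ContDiff ℝ 2 b := by
    have h1 : ContDiff ℝ 2 (fun ζ : ℂ => ζ.re) := reCLM.contDiff
    have h2 : ContDiff ℝ 2 (fun ζ : ℂ => ζ.im) := imCLM.contDiff
    exact (contDiff_const.mul (h1.pow 2)).add ((contDiff_const.mul h2).add (contDiff_const.mul (h2.pow 2)))
  have hLb : ∀ ζ, Lev b ζ 1 = 2 * α - 2 * γ := by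
    intro ζ
    have h1 : ContDiff ℝ 2 (fun ζ : ℂ => ζ.re) := reCLM.contDiff
    have h2 : ContDiff ℝ 2 (fun ζ : ℂ => ζ.im) := imCLM.contDiff
    have d1 : ∀ z : ℂ, fderiv ℝ (fun ζ : ℂ => ζ.re) z = reCLM := fun z => reCLM.hasFDerivAt.fderiv
    have d2 : ∀ z : ℂ, fderiv ℝ (fun ζ : ℂ => ζ.im) z = imCLM := fun z => imCLM.hasFDerivAt.fderiv
    have dd : deriv (fun x : ℝ => x ^ 2) = fun x => 2 * x := by ext x; simp
    have ddd : deriv (fun x : ℝ => 2 * x) = fun x => 2 := by ext x; simpa using ((hasDerivAt_id x).const_mul (2:ℝ)).deriv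
    have e1 : Lev (fun ζ : ℂ => ζ.re ^ 2) ζ 1 = 2 := by
      rw [Lev_comp (g := fun x => x ^ 2) (u := fun ζ : ℂ => ζ.re) (by fun_prop) h1.contDiffAt, dd, ddd, d1]
      have : Lev (fun ζ : ℂ => ζ.re) ζ 1 = 0 := Lev_clm reCLM ζ 1
      rw [this]; simp
    have e2 : Lev (fun ζ : ℂ => ζ.im ^ 2) ζ 1 = 2 := by
      rw [Lev_comp (g := fun x => x ^ 2) (u := fun ζ : ℂ => ζ.im) (by fun_prop) h2.contDiffAt, dd, ddd, d2]
      have : Lev (fun ζ : ℂ => ζ.im) ζ 1 = 0 := Lev_clm imCLM ζ 1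
      rw [this]; simp
    have e3 : Lev (fun ζ : ℂ => ζ.im) ζ 1 = 0 := Lev_clm imCLM ζ 1
    rw [hbd, Lev_add (u := fun ζ : ℂ => α * ζ.re ^ 2) (w := fun ζ : ℂ => β * ζ.im + (-γ) * ζ.im ^ 2) (contDiff_const.mul (h1.pow 2)).contDiffAt
      ((contDiff_const.mul h2).add (contDiff_const.mul (h2.pow 2))).contDiffAt,
      Lev_add (u := fun ζ : ℂ => β * ζ.im) (w := fun ζ : ℂ => (-γ) * ζ.im ^ 2) (contDiff_const.mul h2).contDiffAt (contDiff_const.mul (h2.pow 2)).contDiffAt,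
      Lev_const_mul α (u := fun ζ : ℂ => ζ.re ^ 2) (h1.pow 2).contDiffAt, Lev_const_mul β (u := fun ζ : ℂ => ζ.im) h2.contDiffAt,
      Lev_const_mul (-γ) (u := fun ζ : ℂ => ζ.im ^ 2) (h2.pow 2).contDiffAt, e1, e2, e3]
    ring
  have hγ0 : 0 < γ := by positivity
  -- bounds of b
  have hb1 : ∀ ζ : ℂ, 0 < ζ.im → ζ.im ≤ ρ → α * ζ.re ^ 2 ≤ b ζ ∧ a / ρ * ζ.im ≤ b ζ := by
    intro ζ h1 h2
    have h3 : γ * ζ.im * ζ.im ≤ γ * ζ.im * ρ := mul_le_mul_of_nonneg_left h2 (by positivity)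
    have h4 : β * ζ.im = a / ρ * ζ.im + γ * ζ.im * ρ := by rw [hβ]; ring
    have h5 : 0 ≤ a / ρ * ζ.im := by positivity
    have h6 : 0 ≤ α * ζ.re ^ 2 := by positivity
    have h7 : b ζ = α * ζ.re ^ 2 + (β * ζ.im - γ * ζ.im * ζ.im) := by rw [hbd]; ring
    constructor <;> linarith
  have hsub : ContDiffOn ℝ 2 (fun ζ => v ζ + (-1) * b ζ) U := hv.add (contDiff_const.mul hbc).contDiffOn
  have hmp := max_principle (u := fun ζ => v ζ + (-1) * b ζ) hWo (hsub.mono hWU) (by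
    intro ε hε
    obtain ⟨t, ht, hvt⟩ := h0 (ε / 2) (by linarith)
    have hK : IsCompact {ζ : ℂ | |ζ.re| ≤ ρ ∧ t ≤ ζ.im ∧ ζ.im ≤ ρ} := by
      refine Metric.isCompact_of_isClosed_isBounded ?_ ?_
      · exact (isClosed_le Complex.continuous_re.abs continuous_const).inter ((isClosed_le continuous_const Complex.continuous_im).inter (isClosed_le Complex.continuous_im continuous_const))
      · refine (Metric.isBounded_closedBall (x := (0:ℂ)) (r := 2 * ρ)).subset ?_
        rintro ζ ⟨h1, h2, h3⟩
        rw [mem_closedBall_zero_iff]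
        have h4 : |ζ.im| ≤ ρ := by rw [abs_of_pos (by linarith)]; exact h3
        have := Complex.norm_le_abs_re_add_abs_im ζ
        linarith
    have hKU : {ζ : ℂ | |ζ.re| ≤ ρ ∧ t ≤ ζ.im ∧ ζ.im ≤ ρ} ⊆ U := fun ζ hζ => hUS ζ hζ.1 (by linarith [hζ.2.1]) hζ.2.2
    have hset : {z ∈ W | ε ≤ v z + (-1) * b z} = {ζ : ℂ | |ζ.re| ≤ ρ ∧ t ≤ ζ.im ∧ ζ.im ≤ ρ} ∩ (fun ζ => v ζ + (-1) * b ζ) ⁻¹' (Set.Ici ε) := by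
      ext ζ
      constructor
      · rintro ⟨⟨h1, h2, h3⟩, h4⟩
        refine ⟨⟨h1.le, ?_, h3.le⟩, h4⟩
        by_contra hlt
        push Not at hlt
        have h5 := hvt ζ h1.le h2 h3.le hlt
        have h6 := (hb1 ζ h2 h3.le).1
        have h7 : 0 ≤ α * ζ.re ^ 2 := by positivity
        linarith
      · rintro ⟨⟨h1, h2, h3⟩, h4⟩
        have h4 : ε ≤ v ζ + (-1) * b ζ := h4
        have h2' : 0 < ζ.im := by linarith
        have h5 := hb ζ h1 h2' h3
        obtain ⟨h6, h7⟩ := hb1 ζ h2' h3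
        refine ⟨⟨lt_of_le_of_ne h1 ?_, h2', lt_of_le_of_ne h3 ?_⟩, h4⟩
        · intro he
          have : ζ.re ^ 2 = ρ ^ 2 := by rw [← he, sq_abs]
          rw [this, hα, div_mul_cancel₀ _ (by positivity)] at h6
          linarith
        · intro he
          rw [he, div_mul_cancel₀ _ hρ.ne'] at h7
          linarith
    rw [hset]
    exact hK.of_isClosed_subset (ContinuousOn.preimage_isClosed_of_isClosed (hsub.continuousOn.mono hKU) hK.isClosed isClosed_Ici) Set.inter_subset_left) (by
    intro ζ hζ _
    refine ⟨1, ?_⟩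
    have hU' := hU.mem_nhds (hWU hζ)
    rw [Lev_add (u := v) (w := fun ζ => (-1) * b ζ) (hv.contDiffAt hU') (contDiff_const.mul hbc).contDiffAt, Lev_const_mul (-1) hbc.contDiffAt, hLb]
    have := hΔ ζ hζ.1.le hζ.2.1 hζ.2.2.le
    linarith)
  have hlt : ∀ t : ℝ, 0 < t → t < ρ → v (t * I) ≤ β * t := by
    intro t h1 h2
    have h3 := hmp (t * I) ⟨by simpa using hρ, by simpa using h1, by simpa using h2⟩
    have h4 : b (t * I) = β * t - γ * t ^ 2 := by simp [hbd]; ring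
    have h5 : 0 ≤ γ * t ^ 2 := by positivity
    simp only [h4] at h3
    linarith
  intro t h1 h2
  rw [← hβe]
  rcases h2.lt_or_eq with h3 | h3
  · exact hlt t h1 h3
  · have h4 := hb (t * I) (by simpa using hρ.le) (by simpa using h1) (by simpa using h2)
    have h5 : β * t = a + γ * ρ ^ 2 := by rw [hβ, h3]; field_simp
    have : 0 ≤ γ * ρ ^ 2 := by positivity
    linarith

/-- The real-linear map `ζ ↦ re ζ • p + im ζ • q`. -/
def LL {F : Type} [NormedAddCommGroup F] [NormedSpace ℝ F] (p q : F) : ℂ →L[ℝ] F :=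
  reCLM.smulRight p + imCLM.smulRight q

lemma LL_apply {F : Type} [NormedAddCommGroup F] [NormedSpace ℝ F] (p q : F) (ζ : ℂ) :
    LL p q ζ = ζ.re • p + ζ.im • q := by simp [LL]

lemma Lev_LL {F Y : Type} [NormedAddCommGroup F] [NormedSpace ℝ F] [NormedAddCommGroup Y] [NormedSpace ℝ Y]
    {u : F → Y} (l : Y →L[ℝ] ℝ) (p q z0 : F) {ζ : ℂ} (hu : ContDiffAt ℝ 2 u (z0 + LL p q ζ)) :
    Lev (fun ζ => l (u (z0 + LL p q ζ))) ζ 1 = l (fderiv ℝ (fderiv ℝ u) (z0 + LL p q ζ) p p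
      + fderiv ℝ (fderiv ℝ u) (z0 + LL p q ζ) q q) := by
  unfold Lev
  rw [D2_comp_aff l (LL p q) z0 hu, D2_comp_aff l (LL p q) z0 hu, map_add]
  have h1 : LL p q 1 = p := by simp [LL_apply]
  have h2 : LL p q (I • 1) = q := by simp [LL_apply]
  rw [h1, h2]

lemma norming {Y : Type} [NormedAddCommGroup Y] [NormedSpace ℝ Y] {y : Y} {c : ℝ} (hc : 0 ≤ c)
    (h : ∀ l : Y →L[ℝ] ℝ, ‖l‖ ≤ 1 → l y ≤ c) : ‖y‖ ≤ c := by
  refine NormedSpace.norm_le_dual_bound ℝ y hc fun l => ?_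
  rcases eq_or_ne l 0 with rfl | hl
  · simp
  have hl' : 0 < ‖l‖ := norm_pos_iff.2 hl
  have key : ∀ s : ℝ, |s| ≤ 1 → s * l y ≤ c * ‖l‖ := by
    intro s hs
    have := h ((s * ‖l‖⁻¹) • l) (by
      rw [norm_smul, norm_mul, norm_inv, norm_norm, mul_assoc, inv_mul_cancel₀ hl'.ne', mul_one]; exact hs)
    rw [smul_apply, smul_eq_mul, mul_assoc, mul_comm, mul_assoc, mul_comm] at this
    have h2 : l y * s ≤ c * ‖l‖ := by
      rw [← div_le_iff₀ hl', div_eq_mul_inv]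
      linarith
    linarith
  rw [Real.norm_eq_abs, abs_le]
  have h1 := key 1 (by simp)
  have h2 := key (-1) (by simp)
  constructor <;> linarith

lemma grad2 {F Y : Type} [NormedAddCommGroup F] [NormedSpace ℝ F] [NormedAddCommGroup Y] [NormedSpace ℝ Y]
    {u : F → Y} {O : Set F} (hO : IsOpen O) (hu : ContDiffOn ℝ 2 u O) {p q z0 : F} {R a A : ℝ} (hR : 0 < R)
    (ha : 0 ≤ a) (hA : 0 < A)
    (hin : ∀ s t : ℝ, |s| ≤ R → |t| ≤ R → z0 + (s • p + t • q) ∈ O)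
    (hb : ∀ s t : ℝ, |s| ≤ R → |t| ≤ R → ‖u (z0 + (s • p + t • q))‖ ≤ a)
    (hl : ∀ s t : ℝ, |s| ≤ R → |t| ≤ R → ‖fderiv ℝ (fderiv ℝ u) (z0 + (s • p + t • q)) p p
      + fderiv ℝ (fderiv ℝ u) (z0 + (s • p + t • q)) q q‖ ≤ A) :
    ‖fderiv ℝ u z0 q‖ ≤ 2 * a / R + A * R := by
  have hz0 : z0 ∈ O := by simpa using hin 0 0 (by simpa using hR.le) (by simpa using hR.le)
  have hdz : HasFDerivAt u (fderiv ℝ u z0) z0 :=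
    ((hu.contDiffAt (hO.mem_nhds hz0)).differentiableAt (by norm_num)).hasFDerivAt
  refine norming (by positivity) fun l hl1 => ?_
  have hln : ∀ y, l y ≤ ‖y‖ := fun y => (le_abs_self _).trans ((l.le_opNorm y).trans (by nlinarith [norm_nonneg y]))
  have hln' : ∀ y, -‖y‖ ≤ l y := fun y => by have := hln (-y); rw [map_neg, norm_neg] at this; linarith
  have eL : ∀ ζ, LL p (-q) ζ = ζ.re • p + (-ζ.im) • q := fun ζ => by rw [LL_apply]; simp
  set U : Set ℂ := (fun ζ => z0 + LL p q ζ) ⁻¹' O ∩ (fun ζ => z0 + LL p (-q) ζ) ⁻¹' O with hU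
  have hUo : IsOpen U := (hO.preimage (by fun_prop)).inter (hO.preimage (by fun_prop))
  have c1 : ∀ ζ ∈ U, ContDiffAt ℝ 2 u (z0 + LL p q ζ) := fun ζ hζ => hu.contDiffAt (hO.mem_nhds hζ.1)
  have c2 : ∀ ζ ∈ U, ContDiffAt ℝ 2 u (z0 + LL p (-q) ζ) := fun ζ hζ => hu.contDiffAt (hO.mem_nhds hζ.2)
  have d1 : ∀ ζ ∈ U, ContDiffAt ℝ 2 (fun ζ => l (u (z0 + LL p q ζ))) ζ := fun ζ hζ =>
    l.contDiff.contDiffAt.comp ζ ((c1 ζ hζ).comp ζ (contDiff_const.add (LL p q).contDiff).contDiffAt)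
  have d2 : ∀ ζ ∈ U, ContDiffAt ℝ 2 (fun ζ => l (u (z0 + LL p (-q) ζ))) ζ := fun ζ hζ =>
    l.contDiff.contDiffAt.comp ζ ((c2 ζ hζ).comp ζ (contDiff_const.add (LL p (-q)).contDiff).contDiffAt)
  have hmem : ∀ ζ : ℂ, |ζ.re| ≤ R → |ζ.im| ≤ R → ζ ∈ U := by
    intro ζ h1 h2
    refine ⟨?_, ?_⟩
    · change z0 + LL p q ζ ∈ O
      rw [LL_apply]; exact hin _ _ h1 h2
    · change z0 + LL p (-q) ζ ∈ O
      rw [eL]; exact hin _ _ h1 (by rwa [abs_neg])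
  have habs : ∀ ζ : ℂ, 0 < ζ.im → ζ.im ≤ R → |ζ.im| ≤ R := fun ζ h1 h2 => by rwa [abs_of_pos h1]
  set v : ℂ → ℝ := fun ζ => (1/2) * l (u (z0 + LL p q ζ)) + (-(1/2)) * l (u (z0 + LL p (-q) ζ)) with hv
  have hbar := bar (v := v) hR ha hA hUo (fun ζ h1 h2 h3 => hmem ζ h1 (habs ζ h2 h3))
    (fun ζ hζ => ((contDiffAt_const.mul (d1 ζ hζ)).add (contDiffAt_const.mul (d2 ζ hζ))).contDiffWithinAt)
    (fun ζ h1 h2 h3 => by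
      have i1 := hb _ _ h1 (habs ζ h2 h3)
      have i2 := hb ζ.re (-ζ.im) h1 (by rw [abs_neg]; exact habs ζ h2 h3)
      have j1 := hln (u (z0 + (ζ.re • p + ζ.im • q)))
      have j2 := hln' (u (z0 + (ζ.re • p + (-ζ.im) • q)))
      simp only [hv, eL, LL_apply p q]
      linarith)
    (fun ζ h1 h2 h3 => by
      have hζ := hmem ζ h1 (habs ζ h2 h3)
      rw [hv, Lev_add (u := fun ζ => (1/2) * l (u (z0 + LL p q ζ))) (w := fun ζ => (-(1/2)) * l (u (z0 + LL p (-q) ζ)))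
        (contDiffAt_const.mul (d1 ζ hζ)) (contDiffAt_const.mul (d2 ζ hζ)), Lev_const_mul (1/2) (d1 ζ hζ), Lev_const_mul (-(1/2)) (d2 ζ hζ),
        Lev_LL l p q z0 (c1 ζ hζ), Lev_LL l p (-q) z0 (c2 ζ hζ)]
      have i1 := hl _ _ h1 (habs ζ h2 h3)
      have i2 := hl ζ.re (-ζ.im) h1 (by rw [abs_neg]; exact habs ζ h2 h3)
      rw [← LL_apply] at i1
      rw [← eL] at i2
      have j1 := hln' (fderiv ℝ (fderiv ℝ u) (z0 + LL p q ζ) p p + fderiv ℝ (fderiv ℝ u) (z0 + LL p q ζ) q q)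
      have j2 := hln (fderiv ℝ (fderiv ℝ u) (z0 + LL p (-q) ζ) p p + fderiv ℝ (fderiv ℝ u) (z0 + LL p (-q) ζ) q q)
      have e : fderiv ℝ (fderiv ℝ u) (z0 + LL p (-q) ζ) (-q) (-q) = fderiv ℝ (fderiv ℝ u) (z0 + LL p (-q) ζ) q q := by
        simp
      rw [e]
      linarith)
    (fun η hη => by
      have hK : IsCompact (Set.Icc (-R) R ×ˢ Set.Icc (-R) R) := isCompact_Icc.prod isCompact_Icc
      have hcont : ContinuousOn (fun x : ℝ × ℝ => l (u (z0 + (x.1 • p + x.2 • q)))) (Set.Icc (-R) R ×ˢ Set.Icc (-R) R) := by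
        intro x hx
        have hx' := hin x.1 x.2 (abs_le.2 hx.1) (abs_le.2 hx.2)
        have : ContinuousAt u (z0 + (x.1 • p + x.2 • q)) := (hu.contDiffAt (hO.mem_nhds hx')).continuousAt
        exact (l.continuous.continuousAt.comp (ContinuousAt.comp (f := fun x : ℝ × ℝ => z0 + (x.1 • p + x.2 • q)) this (by fun_prop))).continuousWithinAt
      obtain ⟨d, hd, hd'⟩ := Metric.uniformContinuousOn_iff.1 (hK.uniformContinuousOn_of_continuous hcont) η hη
      refine ⟨d / 2, by positivity, fun ζ h1 h2 h3 h4 => ?_⟩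
      have := hd' (ζ.re, ζ.im) ⟨abs_le.1 h1, abs_le.1 (habs ζ h2 h3)⟩ (ζ.re, -ζ.im)
        ⟨abs_le.1 h1, abs_le.1 (by rw [abs_neg]; exact habs ζ h2 h3)⟩ (by
          rw [Prod.dist_eq, dist_self, Real.dist_eq]
          simp only [sub_neg_eq_add]
          rw [abs_of_pos (by linarith)]
          exact max_lt hd (by linarith))
      rw [Real.dist_eq] at this
      have := (abs_lt.1 this).2
      simp only [hv, eL, LL_apply p q]
      simp only at this
      linarith)
  -- derivative at 0
  have hder : HasDerivAt (fun t : ℝ => v (t * I)) (l (fderiv ℝ u z0 q)) 0 := by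
    have e1 : ∀ t : ℝ, v (t * I) = (1/2) * l (u (z0 + t • q)) + (-(1/2)) * l (u (z0 + (-t) • q)) := by
      intro t; simp [hv, LL_apply]
    simp only [e1]
    have k1 : HasDerivAt (fun t : ℝ => z0 + t • q) q 0 := by
      simpa using ((hasDerivAt_id (0:ℝ)).smul_const q).const_add z0
    have k2 : HasDerivAt (fun t : ℝ => z0 + (-t) • q) (-q) 0 := by
      simpa using ((hasDerivAt_id (0:ℝ)).neg.smul_const q).const_add z0
    have m1 := l.hasFDerivAt.comp_hasDerivAt (0:ℝ) (HasFDerivAt.comp_hasDerivAt (f := fun t : ℝ => z0 + t • q) (0:ℝ) (by simpa using hdz) k1)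
    have m2 := l.hasFDerivAt.comp_hasDerivAt (0:ℝ) (HasFDerivAt.comp_hasDerivAt (f := fun t : ℝ => z0 + (-t) • q) (0:ℝ) (by simpa using hdz) k2)
    refine ((m1.const_mul (1/2)).add (m2.const_mul (-(1/2)))).congr_deriv ?_
    simp only [map_neg]; ring
  have hlim := hder.tendsto_slope_zero_right
  refine le_of_tendsto hlim ?_
  filter_upwards [Ioc_mem_nhdsGT hR] with t ht
  have h1 := hbar t ht.1 ht.2
  have h2 : v ((0:ℝ) * I) = 0 := by simp only [hv]; simp
  have h3 : v (((0:ℝ) + t : ℝ) * I) = v (t * I) := by simp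
  rw [h3, h2, sub_zero, smul_eq_mul, inv_mul_le_iff₀ ht.1]
  linarith

end TwoD
end

section
section Cone
variable {E Y : Type} [NormedAddCommGroup E] [NormedSpace ℝ E] [NormedAddCommGroup Y] [NormedSpace ℝ Y]

/-- Cone points: `z = (x,y)` with `x` small and `y` close to `τ • u0`. -/
def GG (u0 : E) (ε : ℝ) (z : E × E) (τ : ℝ) : Prop :=
  ‖z.1‖ < ε ∧ 0 < τ ∧ τ < ε ∧ ‖z.2 - τ • u0‖ < ε * τ

def Cn (u0 : E) (ε : ℝ) : Set (E × E) := {z | ∃ τ, GG u0 ε z τ}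

lemma GG.mono {u0 : E} {ε ε' : ℝ} (h : ε ≤ ε') {z : E × E} {τ : ℝ} (hz : GG u0 ε z τ) : GG u0 ε' z τ :=
  ⟨hz.1.trans_le h, hz.2.1, hz.2.2.1.trans_le h, hz.2.2.2.trans_le (mul_le_mul_of_nonneg_right h hz.2.1.le)⟩

lemma GG.mem {u0 : E} {ε : ℝ} {z : E × E} {τ : ℝ} (hz : GG u0 ε z τ) : z ∈ Cn u0 ε := ⟨τ, hz⟩

lemma GG.pos {u0 : E} {ε : ℝ} {z : E × E} {τ : ℝ} (hz : GG u0 ε z τ) : 0 < ε := hz.2.1.trans hz.2.2.1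

lemma isOpen_Cn (u0 : E) (ε : ℝ) : IsOpen (Cn u0 ε) := by
  have : Cn u0 ε = ⋃ τ : ℝ, {z | GG u0 ε z τ} := by ext z; simp [Cn]
  rw [this]
  refine isOpen_iUnion fun τ => ?_
  unfold GG
  have h1 : IsOpen {z : E × E | ‖z.1‖ < ε} := isOpen_lt (by fun_prop) (by fun_prop)
  have h2 : IsOpen {z : E × E | ‖z.2 - τ • u0‖ < ε * τ} := isOpen_lt (by fun_prop) (by fun_prop)
  exact h1.inter (isOpen_const.inter (isOpen_const.inter h2))

lemma Cn_mono {u0 : E} {ε ε' : ℝ} (h : ε ≤ ε') : Cn u0 ε ⊆ Cn u0 ε' := fun _ ⟨τ, hz⟩ => ⟨τ, hz.mono h⟩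

lemma GG.ball {u0 : E} {ε : ℝ} (h1 : ε ≤ 1) {z z' : E × E} {τ : ℝ} (hz : GG u0 (ε / 2) z τ) (h : ‖z' - z‖ ≤ ε / 2 * τ) :
    GG u0 ε z' τ := by
  obtain ⟨a, b, c, d⟩ := hz
  have hx : ‖z'.1 - z.1‖ ≤ ε / 2 * τ := (norm_fst_le (z' - z)).trans h
  have hy : ‖z'.2 - z.2‖ ≤ ε / 2 * τ := (norm_snd_le (z' - z)).trans h
  have hε : 0 < ε := by linarith
  have h3 : ε / 2 * τ ≤ ε / 2 := by nlinarith
  refine ⟨?_, b, by linarith, ?_⟩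
  · have := norm_add_le z.1 (z'.1 - z.1)
    rw [add_sub_cancel] at this
    linarith
  · have := norm_add_le (z.2 - τ • u0) (z'.2 - z.2)
    rw [show z.2 - τ • u0 + (z'.2 - z.2) = z'.2 - τ • u0 by abel] at this
    linarith

lemma GG.norm_snd {u0 : E} {ε : ℝ} (h1 : ε ≤ 1) {z : E × E} {τ : ℝ} (hz : GG u0 ε z τ) : ‖z.2‖ ≤ (‖u0‖ + 1) * τ := by
  obtain ⟨a, b, c, d⟩ := hz
  have := norm_add_le (z.2 - τ • u0) (τ • u0)
  rw [sub_add_cancel, norm_smul, Real.norm_eq_abs, abs_of_pos b] at this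
  nlinarith

/-- shift in the `x` direction -/
lemma GG.shift {u0 : E} {ε : ℝ} {z : E × E} {τ : ℝ} (hz : GG u0 (ε / 2) z τ) {w : E} (h : ‖w‖ ≤ ε / 2) :
    GG u0 ε (z + (w, 0)) τ := by
  have hz' := hz.mono (show ε / 2 ≤ ε by linarith [hz.pos])
  refine ⟨?_, hz'.2.1, hz'.2.2.1, by simpa using hz'.2.2.2⟩
  have := norm_add_le z.1 w
  have := hz.1
  simp only [Prod.fst_add]
  linarith

def shr (u0 : E) (ε : ℝ) : ℝ := ε / (4 * (‖u0‖ + 1))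

lemma shr_pos {u0 : E} {ε : ℝ} (h : 0 < ε) : 0 < shr u0 ε := by unfold shr; positivity
lemma shr_le {u0 : E} {ε : ℝ} (h : 0 < ε) : shr u0 ε ≤ ε / 4 := by
  unfold shr
  have := norm_nonneg u0
  gcongr
  linarith

lemma GG_disc {u0 : E} {ε : ℝ} (h1 : ε ≤ 1) {z : E × E} {τ0 : ℝ} (hz : GG u0 (shr u0 ε) z τ0) {s t : ℝ} (hs : |s| ≤ shr u0 ε)
    (ht : 0 < t) (ht' : t ≤ shr u0 ε) :
    GG u0 ε ((z.1, 0) + (s • (τ0⁻¹ • z.2, (0:E)) + t • ((0:E), τ0⁻¹ • z.2))) t ∧ ‖τ0⁻¹ • z.2‖ ≤ ‖u0‖ + 1 := by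
  have hsp := hz.pos
  have hε : 0 < ε := by
    unfold shr at hsp
    have := norm_nonneg u0
    by_contra hh
    push Not at hh
    have : ε / (4 * (‖u0‖ + 1)) ≤ 0 := div_nonpos_of_nonpos_of_nonneg hh (by positivity)
    linarith
  have hle := shr_le (u0 := u0) hε
  have hK : shr u0 ε * (‖u0‖ + 1) = ε / 4 := by
    unfold shr; have := norm_nonneg u0; field_simp
  obtain ⟨a, b, c, d⟩ := hz
  have e1 : ‖τ0⁻¹ • z.2 - u0‖ < shr u0 ε := by
    have : τ0⁻¹ • z.2 - u0 = τ0⁻¹ • (z.2 - τ0 • u0) := by rw [smul_sub, smul_smul, inv_mul_cancel₀ b.ne', one_smul]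
    rw [this, norm_smul, norm_inv, Real.norm_eq_abs, abs_of_pos b, inv_mul_lt_iff₀ b]
    linarith
  have e2 : ‖τ0⁻¹ • z.2‖ ≤ ‖u0‖ + 1 := by
    have := norm_add_le (τ0⁻¹ • z.2 - u0) u0
    rw [sub_add_cancel] at this
    linarith
  refine ⟨⟨?_, ht, by linarith, ?_⟩, e2⟩
  · simp only [Prod.fst_add, Prod.smul_fst, smul_zero, add_zero]
    have i1 := norm_add_le z.1 (s • τ0⁻¹ • z.2)
    rw [norm_smul s, Real.norm_eq_abs] at i1
    have i2 : |s| * ‖τ0⁻¹ • z.2‖ ≤ shr u0 ε * (‖u0‖ + 1) := mul_le_mul hs e2 (norm_nonneg _) hsp.le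
    linarith
  · simp only [Prod.snd_add, Prod.smul_snd, smul_zero, zero_add]
    rw [← smul_sub, norm_smul, Real.norm_eq_abs, abs_of_pos ht, mul_comm]
    exact mul_lt_mul_of_pos_right (by linarith) ht

/-- vector Laplacian in direction `v` -/
def Lap (W : E × E → Y) (z : E × E) (v : E) : Y :=
  fderiv ℝ (fderiv ℝ W) z (v, 0) (v, 0) + fderiv ℝ (fderiv ℝ W) z (0, v) (0, v)

lemma cone_bar {u0 : E} {ε : ℝ} (h1 : ε ≤ 1) {W : E × E → Y} (hW : ContDiffOn ℝ 2 W (Cn u0 ε)) {a A : ℝ}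
    (ha : 0 ≤ a) (hA : 0 < A) (hb : ∀ z τ, GG u0 ε z τ → ‖W z‖ ≤ a)
    (hl : ∀ z τ v, GG u0 ε z τ → ‖v‖ ≤ ‖u0‖ + 1 → ‖Lap W z v‖ ≤ A)
    (h0 : ∀ η > 0, ∃ t > 0, ∀ z τ, GG u0 ε z τ → τ < t → ‖W z‖ ≤ η) :
    ∀ z τ, GG u0 (shr u0 ε) z τ → ‖W z‖ ≤ (2 * a / shr u0 ε + A * shr u0 ε) * τ := by
  intro z τ0 hz
  have hρ := hz.pos
  have hτ := hz.2.1
  refine norming (by positivity) fun l hl1 => ?_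
  have hln : ∀ y, l y ≤ ‖y‖ := fun y => (le_abs_self _).trans ((l.le_opNorm y).trans (by nlinarith [norm_nonneg y]))
  have hln' : ∀ y, -‖y‖ ≤ l y := fun y => by have := hln (-y); rw [map_neg, norm_neg] at this; linarith
  set p : E × E := (τ0⁻¹ • z.2, (0:E)) with hp
  set q : E × E := ((0:E), τ0⁻¹ • z.2) with hq
  have hG : ∀ ζ : ℂ, |ζ.re| ≤ shr u0 ε → 0 < ζ.im → ζ.im ≤ shr u0 ε → GG u0 ε ((z.1, 0) + LL p q ζ) ζ.im := by
    intro ζ i1 i2 i3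
    rw [LL_apply]
    exact (GG_disc h1 hz i1 i2 i3).1
  have hv : ‖τ0⁻¹ • z.2‖ ≤ ‖u0‖ + 1 := (GG_disc h1 hz (s := 0) (by simpa using hρ.le) hρ le_rfl).2
  have hUo : IsOpen ((fun ζ => ((z.1, 0) : E × E) + LL p q ζ) ⁻¹' (Cn u0 ε)) := (isOpen_Cn u0 ε).preimage (by fun_prop)
  have hc : ∀ ζ ∈ ((fun ζ => ((z.1, 0) : E × E) + LL p q ζ) ⁻¹' (Cn u0 ε)), ContDiffAt ℝ 2 W ((z.1, 0) + LL p q ζ) :=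
    fun ζ hζ => hW.contDiffAt ((isOpen_Cn u0 ε).mem_nhds hζ)
  have hbar := bar (v := fun ζ => l (W ((z.1, 0) + LL p q ζ))) hρ ha hA hUo (fun ζ i1 i2 i3 => (hG ζ i1 i2 i3).mem)
    (fun ζ hζ => (l.contDiff.contDiffAt.comp ζ ((hc ζ hζ).comp ζ (contDiff_const.add (LL p q).contDiff).contDiffAt)).contDiffWithinAt)
    (fun ζ i1 i2 i3 => (hln _).trans (hb _ _ (hG ζ i1 i2 i3)))
    (fun ζ i1 i2 i3 => by
      rw [Lev_LL l p q _ (hc ζ (hG ζ i1 i2 i3).mem)]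
      have := hl _ _ _ (hG ζ i1 i2 i3) hv
      have j := hln' (Lap W ((z.1, 0) + LL p q ζ) (τ0⁻¹ • z.2))
      unfold Lap at this j
      linarith)
    (fun η hη => by
      obtain ⟨t, ht, htt⟩ := h0 η hη
      exact ⟨t, ht, fun ζ i1 i2 i3 i4 => (hln _).trans (htt _ _ (hG ζ i1 i2 i3) i4)⟩)
  have := hbar τ0 hτ hz.2.2.1.le
  have e : ((z.1, 0) : E × E) + LL p q (τ0 * I) = z := by
    rw [LL_apply]
    simp [hp, hq, smul_smul, mul_inv_cancel₀ hτ.ne']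
  simp only [e] at this
  exact this

/-- gradient bound on the cone -/
lemma cone_grad {u0 : E} {ε : ℝ} (h1 : ε ≤ 1) {W : E × E → Y} (hW : ContDiffOn ℝ 2 W (Cn u0 ε)) {a A : ℝ}
    (ha : 0 ≤ a) (hA : 0 < A) (hb : ∀ z τ, GG u0 ε z τ → ‖W z‖ ≤ a * τ)
    (hl : ∀ z τ v, GG u0 ε z τ → ‖v‖ ≤ 1 → ‖Lap W z v‖ ≤ A) :
    ∀ z τ, GG u0 (ε / 2) z τ → ∀ v, ‖v‖ ≤ 1 → ‖fderiv ℝ W z (v, 0)‖ ≤ 8 * a / ε + A ∧ ‖fderiv ℝ W z (0, v)‖ ≤ 8 * a / ε + A := by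
  intro z τ hz v hv
  have hε : 0 < ε := by linarith [hz.pos]
  have hτ := hz.2.1
  have hτ1 : τ < 1 := by linarith [hz.2.2.1]
  set R : ℝ := ε / 4 * τ with hR
  have hR0 : 0 < R := by positivity
  have hR1 : R ≤ 1 := by rw [hR]; nlinarith
  have hG : ∀ s t : ℝ, |s| ≤ R → |t| ≤ R → GG u0 ε (z + (s • (v, (0:E)) + t • ((0:E), v))) τ := by
    intro s t hs ht
    refine hz.ball h1 ?_
    rw [add_sub_cancel_left]
    refine (norm_add_le _ _).trans ?_
    have n1 : ‖s • (v, (0:E))‖ ≤ R := by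
      rw [norm_smul, Real.norm_eq_abs]
      have : ‖(v, (0:E))‖ = ‖v‖ := by simp [Prod.norm_def]
      rw [this]
      calc |s| * ‖v‖ ≤ R * 1 := mul_le_mul hs hv (norm_nonneg _) hR0.le
        _ = R := mul_one _
    have n2 : ‖t • ((0:E), v)‖ ≤ R := by
      rw [norm_smul, Real.norm_eq_abs]
      have : ‖((0:E), v)‖ = ‖v‖ := by simp [Prod.norm_def]
      rw [this]
      calc |t| * ‖v‖ ≤ R * 1 := mul_le_mul ht hv (norm_nonneg _) hR0.le
        _ = R := mul_one _
    linarith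
  have e0 : 2 * (a * τ) / R + A * R ≤ 8 * a / ε + A := by
    have : 2 * (a * τ) / R = 8 * a / ε := by rw [hR]; field_simp; ring
    rw [this]
    nlinarith
  constructor
  · refine (grad2 (isOpen_Cn u0 ε) hW (p := ((0:E), v)) (q := (v, (0:E))) hR0 (a := a * τ) (by positivity) hA ?_ ?_ ?_).trans e0
    · intro s t hs ht
      rw [add_comm (s • _)]; exact (hG t s ht hs).mem
    · intro s t hs ht
      rw [add_comm (s • _)]; exact hb _ _ (hG t s ht hs)
    · intro s t hs ht
      have := hl _ _ v (hG t s ht hs) hv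
      unfold Lap at this
      rw [add_comm (s • _), add_comm (fderiv ℝ (fderiv ℝ W) _ _ _)]; exact this
  · refine (grad2 (isOpen_Cn u0 ε) hW (p := (v, (0:E))) (q := ((0:E), v)) hR0 (a := a * τ) (by positivity) hA ?_ ?_ ?_).trans e0
    · intro s t hs ht
      exact (hG s t hs ht).mem
    · intro s t hs ht
      exact hb _ _ (hG s t hs ht)
    · intro s t hs ht
      have := hl _ _ v (hG s t hs ht) hv
      unfold Lap at this
      exact this
end Cone
end

section
section Cone2
variable {E Y Z : Type} [NormedAddCommGroup E] [NormedSpace ℝ E] [NormedAddCommGroup Y] [NormedSpace ℝ Y]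
  [NormedAddCommGroup Z] [NormedSpace ℝ Z]

def BdOn (u0 : E) (ε : ℝ) (k : ℕ) (f : E × E → Y) : Prop :=
  ∀ j ≤ k, ∃ C, ∀ z τ, GG u0 ε z τ → ‖iteratedFDeriv ℝ j f z‖ ≤ C

def Tend0 (u0 : E) (ε : ℝ) (f : E × E → Y) : Prop :=
  ∀ η > 0, ∃ t > 0, ∀ z τ, GG u0 ε z τ → τ < t → ‖f z‖ ≤ η

lemma BdOn.mono {u0 : E} {ε ε' : ℝ} {k k' : ℕ} {f : E × E → Y} (h : BdOn u0 ε k f) (hε : ε' ≤ ε) (hk : k' ≤ k) : BdOn u0 ε' k' f :=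
  fun j hj => let ⟨C, hC⟩ := h j (hj.trans hk); ⟨C, fun z τ hz => hC z τ (hz.mono hε)⟩

lemma Tend0.mono {u0 : E} {ε ε' : ℝ} {f : E × E → Y} (h : Tend0 u0 ε f) (hε : ε' ≤ ε) : Tend0 u0 ε' f :=
  fun η hη => let ⟨t, ht, H⟩ := h η hη; ⟨t, ht, fun z τ hz => H z τ (hz.mono hε)⟩

lemma bdOn_zero {u0 : E} {ε : ℝ} {f : E × E → Y} (C : ℝ) (h : ∀ z τ, GG u0 ε z τ → ‖f z‖ ≤ C) : BdOn u0 ε 0 f := by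
  intro j hj
  obtain rfl : j = 0 := by omega
  exact ⟨C, fun z τ hz => by rw [norm_iteratedFDeriv_zero]; exact h z τ hz⟩

lemma BdOn.fderiv {u0 : E} {ε : ℝ} {k : ℕ} {f : E × E → Y} (h : BdOn u0 ε (k + 1) f) : BdOn u0 ε k (fderiv ℝ f) := by
  intro j hj
  obtain ⟨C, hC⟩ := h (j + 1) (by omega)
  exact ⟨C, fun z τ hz => by rw [norm_iteratedFDeriv_fderiv]; exact hC z τ hz⟩

lemma bdOn_succ {u0 : E} {ε : ℝ} {k : ℕ} {f : E × E → Y} (h0 : BdOn u0 ε 0 f) (h : BdOn u0 ε k (fderiv ℝ f)) : BdOn u0 ε (k + 1) f := by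
  intro j hj
  rcases j with _ | j
  · exact h0 0 le_rfl
  · obtain ⟨C, hC⟩ := h j (by omega)
    exact ⟨C, fun z τ hz => by rw [← norm_iteratedFDeriv_fderiv]; exact hC z τ hz⟩

lemma cAt {u0 : E} {ε : ℝ} {f : E × E → Y} (hf : ContDiffOn ℝ (⊤ : ℕ∞) f (Cn u0 ε)) {z : E × E} {τ : ℝ} (hz : GG u0 ε z τ) (n : ℕ) :
    ContDiffAt ℝ n f z :=
  (hf.contDiffAt ((isOpen_Cn u0 ε).mem_nhds hz.mem)).of_le (by exact_mod_cast le_top)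

lemma BdOn.clm {u0 : E} {ε : ℝ} {k : ℕ} {f : E × E → Y} (hf : ContDiffOn ℝ (⊤ : ℕ∞) f (Cn u0 ε)) (h : BdOn u0 ε k f) (L : Y →L[ℝ] Z) :
    BdOn u0 ε k (fun z => L (f z)) := by
  intro j hj
  obtain ⟨C, hC⟩ := h j hj
  refine ⟨‖L‖ * C, fun z τ hz => ?_⟩
  exact (L.norm_iteratedFDeriv_comp_left (cAt hf hz j) le_rfl).trans (mul_le_mul_of_nonneg_left (hC z τ hz) (norm_nonneg _))

lemma BdOn.add {u0 : E} {ε : ℝ} {k : ℕ} {f g : E × E → Y} (hf : ContDiffOn ℝ (⊤ : ℕ∞) f (Cn u0 ε)) (hg : ContDiffOn ℝ (⊤ : ℕ∞) g (Cn u0 ε))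
    (h : BdOn u0 ε k f) (h' : BdOn u0 ε k g) : BdOn u0 ε k (fun z => f z + g z) := by
  intro j hj
  obtain ⟨C, hC⟩ := h j hj
  obtain ⟨C', hC'⟩ := h' j hj
  refine ⟨C + C', fun z τ hz => ?_⟩
  have : iteratedFDeriv ℝ j (fun z => f z + g z) z = iteratedFDeriv ℝ j f z + iteratedFDeriv ℝ j g z := by
    have := iteratedFDeriv_add_apply (cAt hf hz j) (cAt hg hz j)
    exact this
  rw [this]
  exact (norm_add_le _ _).trans (add_le_add (hC z τ hz) (hC' z τ hz))

lemma BdOn.congr {u0 : E} {ε : ℝ} {k : ℕ} {f g : E × E → Y} (h : BdOn u0 ε k f) (hfg : ∀ z ∈ Cn u0 ε, g z = f z) : BdOn u0 ε k g := by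
  intro j hj
  obtain ⟨C, hC⟩ := h j hj
  refine ⟨C, fun z τ hz => ?_⟩
  have : Filter.EventuallyEq (nhds z) g f := by
    filter_upwards [(isOpen_Cn u0 ε).mem_nhds hz.mem] with w hw using hfg w hw
  rw [(Filter.EventuallyEq.iteratedFDeriv ℝ this j).eq_of_nhds]
  exact hC z τ hz

def Dx (f : E × E → Y) (z : E × E) : E →L[ℝ] Y := (fderiv ℝ f z).comp (ContinuousLinearMap.inl ℝ E E)
def Dy (f : E × E → Y) (z : E × E) : E →L[ℝ] Y := (fderiv ℝ f z).comp (ContinuousLinearMap.inr ℝ E E)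
def e1 (A V : E × E → Y) (z : E × E) : E →L[ℝ] Y := Dy A z + Dx V z
def e2 (A V : E × E → Y) (z : E × E) : E →L[ℝ] Y := Dy V z - Dx A z

def cL (E Y : Type) [NormedAddCommGroup E] [NormedSpace ℝ E] [NormedAddCommGroup Y] [NormedSpace ℝ Y] (i : E →L[ℝ] E × E) :
    (E × E →L[ℝ] Y) →L[ℝ] (E →L[ℝ] Y) := (ContinuousLinearMap.compL ℝ E (E × E) Y).flip i

lemma Dx_eq (f : E × E → Y) : Dx f = fun z => cL E Y (ContinuousLinearMap.inl ℝ E E) (fderiv ℝ f z) := rfl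
lemma Dy_eq (f : E × E → Y) : Dy f = fun z => cL E Y (ContinuousLinearMap.inr ℝ E E) (fderiv ℝ f z) := rfl
lemma Dx_app (f : E × E → Y) (z : E × E) (v : E) : Dx f z v = fderiv ℝ f z (v, 0) := rfl
lemma Dy_app (f : E × E → Y) (z : E × E) (v : E) : Dy f z v = fderiv ℝ f z (0, v) := rfl

lemma sm_fderiv {F : Type} [NormedAddCommGroup F] [NormedSpace ℝ F] {s : Set F} (hs : IsOpen s) {f : F → Y} (hf : ContDiffOn ℝ (⊤ : ℕ∞) f s) :
    ContDiffOn ℝ (⊤ : ℕ∞) (fderiv ℝ f) s := hf.fderiv_of_isOpen hs (by simp)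

lemma sm_Dx {s : Set (E × E)} (hs : IsOpen s) {f : E × E → Y} (hf : ContDiffOn ℝ (⊤ : ℕ∞) f s) : ContDiffOn ℝ (⊤ : ℕ∞) (Dx f) s := by
  rw [Dx_eq]; exact (cL E Y _).contDiff.comp_contDiffOn (sm_fderiv hs hf)
lemma sm_Dy {s : Set (E × E)} (hs : IsOpen s) {f : E × E → Y} (hf : ContDiffOn ℝ (⊤ : ℕ∞) f s) : ContDiffOn ℝ (⊤ : ℕ∞) (Dy f) s := by
  rw [Dy_eq]; exact (cL E Y _).contDiff.comp_contDiffOn (sm_fderiv hs hf)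
lemma sm_e1 {s : Set (E × E)} (hs : IsOpen s) {A V : E × E → Y} (hA : ContDiffOn ℝ (⊤ : ℕ∞) A s) (hV : ContDiffOn ℝ (⊤ : ℕ∞) V s) :
    ContDiffOn ℝ (⊤ : ℕ∞) (e1 A V) s := (sm_Dy hs hA).add (sm_Dx hs hV)
lemma sm_e2 {s : Set (E × E)} (hs : IsOpen s) {A V : E × E → Y} (hA : ContDiffOn ℝ (⊤ : ℕ∞) A s) (hV : ContDiffOn ℝ (⊤ : ℕ∞) V s) :
    ContDiffOn ℝ (⊤ : ℕ∞) (e2 A V) s := (sm_Dy hs hV).sub (sm_Dx hs hA)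

lemma fderiv_Dx {f : E × E → Y} {z : E × E} (hf : ContDiffAt ℝ 2 f z) (a : E × E) (v : E) :
    fderiv ℝ (Dx f) z a v = fderiv ℝ (fderiv ℝ f) z a (v, 0) := by
  have h : HasFDerivAt (Dx f) ((cL E Y (ContinuousLinearMap.inl ℝ E E)).comp (fderiv ℝ (fderiv ℝ f) z)) z :=
    (cL E Y (ContinuousLinearMap.inl ℝ E E)).hasFDerivAt.comp z (diff_fderiv hf).hasFDerivAt
  rw [h.fderiv]; rfl
lemma fderiv_Dy {f : E × E → Y} {z : E × E} (hf : ContDiffAt ℝ 2 f z) (a : E × E) (v : E) :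
    fderiv ℝ (Dy f) z a v = fderiv ℝ (fderiv ℝ f) z a (0, v) := by
  have h : HasFDerivAt (Dy f) ((cL E Y (ContinuousLinearMap.inr ℝ E E)).comp (fderiv ℝ (fderiv ℝ f) z)) z :=
    (cL E Y (ContinuousLinearMap.inr ℝ E E)).hasFDerivAt.comp z (diff_fderiv hf).hasFDerivAt
  rw [h.fderiv]; rfl
lemma diff_Dx {f : E × E → Y} {z : E × E} (hf : ContDiffAt ℝ 2 f z) : DifferentiableAt ℝ (Dx f) z := by
  rw [Dx_eq]; exact (cL E Y _).differentiableAt.comp z (diff_fderiv hf)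
lemma diff_Dy {f : E × E → Y} {z : E × E} (hf : ContDiffAt ℝ 2 f z) : DifferentiableAt ℝ (Dy f) z := by
  rw [Dy_eq]; exact (cL E Y _).differentiableAt.comp z (diff_fderiv hf)

lemma dd_symm {F : Type} [NormedAddCommGroup F] [NormedSpace ℝ F] {f : F → Y} {z : F} (hf : ContDiffAt ℝ 2 f z) (a b : F) :
    fderiv ℝ (fderiv ℝ f) z a b = fderiv ℝ (fderiv ℝ f) z b a :=
  (hf.isSymmSndFDerivAt (by simp)) a b

lemma fd_e1 {A V : E × E → Y} {z : E × E} (hA : ContDiffAt ℝ 2 A z) (hV : ContDiffAt ℝ 2 V z) (a : E × E) (v : E) :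
    fderiv ℝ (e1 A V) z a v = fderiv ℝ (fderiv ℝ A) z a (0, v) + fderiv ℝ (fderiv ℝ V) z a (v, 0) := by
  have : e1 A V = Dy A + Dx V := rfl
  rw [this, fderiv_add (diff_Dy hA) (diff_Dx hV), add_apply, add_apply, fderiv_Dx hV, fderiv_Dy hA]
lemma fd_e2 {A V : E × E → Y} {z : E × E} (hA : ContDiffAt ℝ 2 A z) (hV : ContDiffAt ℝ 2 V z) (a : E × E) (v : E) :
    fderiv ℝ (e2 A V) z a v = fderiv ℝ (fderiv ℝ V) z a (0, v) - fderiv ℝ (fderiv ℝ A) z a (v, 0) := by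
  have : e2 A V = Dy V - Dx A := rfl
  rw [this, fderiv_sub (diff_Dy hV) (diff_Dx hA), sub_apply, sub_apply, fderiv_Dx hA, fderiv_Dy hV]

lemma Lap_eq {A V : E × E → Y} {z : E × E} (hA : ContDiffAt ℝ 2 A z) (hV : ContDiffAt ℝ 2 V z) (v : E) :
    Lap V z v = fderiv ℝ (e1 A V) z (v, 0) v + fderiv ℝ (e2 A V) z (0, v) v := by
  rw [fd_e1 hA hV, fd_e2 hA hV, dd_symm hA (v, 0) (0, v)]
  unfold Lap; abel

lemma norm_pr1 (v : E) : ‖(v, (0:E))‖ = ‖v‖ := by simp [Prod.norm_def]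
lemma norm_pr2 (v : E) : ‖((0:E), v)‖ = ‖v‖ := by simp [Prod.norm_def]

lemma app2_le (T : E × E →L[ℝ] E →L[ℝ] Y) (a : E × E) (v : E) {M : ℝ} (h : ‖T‖ ≤ M) : ‖T a v‖ ≤ M * ‖a‖ * ‖v‖ :=
  (T.le_opNorm₂ a v).trans (by gcongr)

lemma norm_dd {F : Type} [NormedAddCommGroup F] [NormedSpace ℝ F] (f : F → Y) (z v : F) {M : ℝ} (h : ‖iteratedFDeriv ℝ 2 f z‖ ≤ M) :
    ‖fderiv ℝ (fderiv ℝ f) z v‖ ≤ M * ‖v‖ := by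
  rw [← norm_iteratedFDeriv_fderiv, norm_iteratedFDeriv_one] at h
  exact (ContinuousLinearMap.le_opNorm _ _).trans (mul_le_mul_of_nonneg_right h (norm_nonneg _))

set_option maxHeartbeats 1000000 in
lemma cone_step {u0 : E} {ε : ℝ} (hε : 0 < ε) (h1 : ε ≤ 1) {A V : E × E → Y} (hA : ContDiffOn ℝ (⊤ : ℕ∞) A (Cn u0 ε))
    (hV : ContDiffOn ℝ (⊤ : ℕ∞) V (Cn u0 ε)) (bV : BdOn u0 ε 0 V) (tV : Tend0 u0 ε V)
    (b1 : BdOn u0 ε 2 (e1 A V)) (b2 : BdOn u0 ε 2 (e2 A V)) :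
    ∃ ε' > 0, ε' ≤ ε ∧ BdOn u0 ε' 0 (Dx A) ∧ BdOn u0 ε' 0 (Dx V) ∧ Tend0 u0 ε' (Dx V) := by
  have hO := isOpen_Cn u0 ε
  have s1 := sm_e1 hO hA hV
  have s2 := sm_e2 hO hA hV
  have A2 : ∀ {z τ}, GG u0 ε z τ → ContDiffAt ℝ 2 A z := fun hz => cAt hA hz 2
  have V2 : ∀ {z τ}, GG u0 ε z τ → ContDiffAt ℝ 2 V z := fun hz => cAt hV hz 2
  obtain ⟨C0, hC0⟩ := bV 0 le_rfl
  obtain ⟨C1, hC1⟩ := b1 1 (by norm_num)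
  obtain ⟨C2, hC2⟩ := b2 1 (by norm_num)
  obtain ⟨C3, hC3⟩ := b1 2 (by norm_num)
  obtain ⟨C4, hC4⟩ := b2 2 (by norm_num)
  obtain ⟨C5, hC5⟩ := b2 0 (by norm_num)
  set M : ℝ := 1 + |C0| + |C1| + |C2| + |C3| + |C4| + |C5| with hM
  have hp := abs_nonneg C0
  have hp := abs_nonneg C1
  have hp := abs_nonneg C2
  have hp := abs_nonneg C3
  have hp := abs_nonneg C4
  have hp := abs_nonneg C5
  have hM1 : 1 ≤ M := by linarith
  have m0 : ∀ z τ, GG u0 ε z τ → ‖V z‖ ≤ M := fun z τ hz => by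
    have := hC0 z τ hz; rw [norm_iteratedFDeriv_zero] at this; linarith [le_abs_self C0]
  have m1 : ∀ z τ, GG u0 ε z τ → ‖fderiv ℝ (e1 A V) z‖ ≤ M := fun z τ hz => by
    have := hC1 z τ hz; rw [norm_iteratedFDeriv_one] at this; linarith [le_abs_self C1]
  have m2 : ∀ z τ, GG u0 ε z τ → ‖fderiv ℝ (e2 A V) z‖ ≤ M := fun z τ hz => by
    have := hC2 z τ hz; rw [norm_iteratedFDeriv_one] at this; linarith [le_abs_self C2]
  have m3 : ∀ z τ, GG u0 ε z τ → ∀ v, ‖fderiv ℝ (fderiv ℝ (e1 A V)) z v‖ ≤ M * ‖v‖ := fun z τ hz v =>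
    norm_dd _ z v ((hC3 z τ hz).trans (by linarith [le_abs_self C3]))
  have m4 : ∀ z τ, GG u0 ε z τ → ∀ v, ‖fderiv ℝ (fderiv ℝ (e2 A V)) z v‖ ≤ M * ‖v‖ := fun z τ hz v =>
    norm_dd _ z v ((hC4 z τ hz).trans (by linarith [le_abs_self C4]))
  have m5 : ∀ z τ, GG u0 ε z τ → ‖e2 A V z‖ ≤ M := fun z τ hz => by
    have := hC5 z τ hz; rw [norm_iteratedFDeriv_zero] at this; linarith [le_abs_self C5]
  set K : ℝ := ‖u0‖ + 1 with hK
  have hK1 : 1 ≤ K := by linarith [norm_nonneg u0]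
  have lapV : ∀ z τ v, GG u0 ε z τ → ‖v‖ ≤ K → ‖Lap V z v‖ ≤ 2 * M * K ^ 2 := by
    intro z τ v hz hv
    rw [Lap_eq (A2 hz) (V2 hz)]
    refine (norm_add_le _ _).trans ?_
    have i1 := app2_le (fderiv ℝ (e1 A V) z) (v, 0) v (m1 z τ hz)
    have i2 := app2_le (fderiv ℝ (e2 A V) z) (0, v) v (m2 z τ hz)
    rw [norm_pr1] at i1
    rw [norm_pr2] at i2
    have : M * ‖v‖ * ‖v‖ ≤ M * K * K := by gcongr
    nlinarith
  -- step 1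
  have hV2 : ContDiffOn ℝ 2 V (Cn u0 ε) := hV.of_le two_le_top
  set ε1 := shr u0 ε with hε1
  have hε1p : 0 < ε1 := shr_pos hε
  have hε1l : ε1 ≤ ε := (shr_le hε).trans (by linarith)
  have step1 := cone_bar h1 hV2 (by linarith : 0 ≤ M) (by positivity : 0 < 2 * M * K ^ 2) m0 lapV tV
  set a1 : ℝ := 2 * M / ε1 + 2 * M * K ^ 2 * ε1 with ha1
  have ha1p : 0 ≤ a1 := by positivity
  -- step 2
  have step2 := cone_grad (hε1l.trans h1) (hV2.mono (Cn_mono hε1l)) ha1p (by positivity : 0 < 2 * M * K ^ 2) step1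
    (fun z τ v hz hv => lapV z τ v (hz.mono hε1l) (hv.trans hK1))
  set a2 : ℝ := 8 * a1 / ε1 + 2 * M * K ^ 2 with ha2
  have ha2p : 0 < a2 := by positivity
  set ε2 := ε1 / 2 with hε2
  have hε2p : 0 < ε2 := by positivity
  have hε2l : ε2 ≤ ε := by linarith
  have unit : ∀ (T : E →L[ℝ] Y) (C : ℝ), 0 ≤ C → (∀ v, ‖v‖ ≤ 1 → ‖T v‖ ≤ C) → ‖T‖ ≤ C := fun T C hC h =>
    T.opNorm_le_of_unit_norm hC (fun x hx => h x hx.le)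
  have bDxV : ∀ z τ, GG u0 ε2 z τ → ‖Dx V z‖ ≤ a2 := fun z τ hz => unit _ _ ha2p.le fun v hv => (step2 z τ hz v hv).1
  have bDyV : ∀ z τ, GG u0 ε2 z τ → ‖Dy V z‖ ≤ a2 := fun z τ hz => unit _ _ ha2p.le fun v hv => (step2 z τ hz v hv).2
  have bDxA : ∀ z τ, GG u0 ε2 z τ → ‖Dx A z‖ ≤ a2 + M := fun z τ hz => by
    have : Dx A z = Dy V z - e2 A V z := by unfold e2; abel
    rw [this]
    exact (norm_sub_le _ _).trans (add_le_add (bDyV z τ hz) (m5 z τ (hz.mono hε2l)))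
  -- step 3
  set ε3 := ε2 / 2 with hε3
  have hε3p : 0 < ε3 := by positivity
  have hε3l : ε3 ≤ ε := by linarith
  set a4 : ℝ := 2 * a2 / shr u0 ε3 + 2 * M * K ^ 2 * shr u0 ε3 with ha4
  have key : ∀ z τ, GG u0 (shr u0 ε3) z τ → ∀ v, ‖v‖ ≤ 1 → ‖fderiv ℝ V z (v, 0)‖ ≤ a4 * τ := by
    intro z τ hz v hv
    have hz3 : GG u0 ε z τ := hz.mono (((shr_le hε3p).trans (by linarith)).trans hε3l)
    have main : ∀ h : ℝ, 0 < h → h ≤ ε3 → ‖V (z + (h • v, 0)) - V z‖ ≤ h * (a4 * τ) := by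
      intro h hh hh'
      have hhv : ‖h • v‖ ≤ h := by rw [norm_smul, Real.norm_eq_abs, abs_of_pos hh]; nlinarith
      have sh : ∀ z τ, GG u0 ε3 z τ → GG u0 ε2 (z + (h • v, 0)) τ := fun z τ hz => hz.shift (hhv.trans hh')
      have hmv : ∀ (Q : Type) [NormedAddCommGroup Q] [NormedSpace ℝ Q] (f : E × E → Q) (B : ℝ), ContDiffOn ℝ (⊤ : ℕ∞) f (Cn u0 ε) →
          ∀ z τ, GG u0 ε3 z τ → (∀ z', GG u0 ε2 z' τ → ‖fderiv ℝ f z' (v, 0)‖ ≤ B) → ‖f (z + (h • v, 0)) - f z‖ ≤ h * B := by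
        intro Q _ _ f B hf z τ hz hB
        have hseg : ∀ t ∈ Set.Icc (0:ℝ) h, GG u0 ε2 (z + (t • v, 0)) τ := by
          intro t ht
          refine hz.shift ?_
          rw [norm_smul, Real.norm_eq_abs, abs_of_nonneg ht.1]
          have : t * ‖v‖ ≤ h * 1 := mul_le_mul ht.2 hv (norm_nonneg _) hh.le
          linarith
        have hd : ∀ t ∈ Set.Icc (0:ℝ) h, HasDerivWithinAt (fun t : ℝ => f (z + (t • v, 0))) (fderiv ℝ f (z + (t • v, 0)) (v, 0)) (Set.Icc 0 h) t := by
          intro t ht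
          have k1 : HasDerivAt (fun t : ℝ => z + (t • v, (0:E))) (v, 0) t := by
            have : HasDerivAt (fun t : ℝ => (t • v, (0:E))) (v, 0) t := by
              have := ((hasDerivAt_id t).smul_const v).prodMk (hasDerivAt_const t (0:E))
              simpa using this
            exact this.const_add z
          have k2 : HasFDerivAt f (fderiv ℝ f (z + (t • v, 0))) (z + (t • v, 0)) :=
            ((cAt hf ((hseg t ht).mono hε2l) 1).differentiableAt (by norm_num)).hasFDerivAt
          exact (HasFDerivAt.comp_hasDerivAt (f := fun t : ℝ => z + (t • v, (0:E))) t k2 k1).hasDerivWithinAt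
        have := norm_image_sub_le_of_norm_deriv_le_segment' hd (fun t ht => hB _ (hseg t ⟨ht.1, ht.2.le⟩)) h ⟨hh.le, le_rfl⟩
        simp only [zero_smul, Prod.mk_zero_zero, add_zero, sub_zero] at this
        linarith
      have smW : ContDiffOn ℝ 2 (fun z => V (z + (h • v, 0)) - V z) (Cn u0 ε3) := by
        refine ContDiffOn.sub ?_ (hV2.mono (Cn_mono hε3l))
        refine hV2.comp (contDiff_id.add contDiff_const).contDiffOn ?_
        rintro z ⟨τ, hz⟩
        exact ((sh z τ hz).mono hε2l).mem
      have lapW : ∀ z τ, GG u0 ε3 z τ → ∀ u, Lap (fun z => V (z + (h • v, 0)) - V z) z u = Lap V (z + (h • v, 0)) u - Lap V z u := by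
        intro z τ hz u
        have hzz := hz.mono hε3l
        have hzs := (sh z τ hz).mono hε2l
        have ev : fderiv ℝ (fun z => V (z + (h • v, 0)) - V z) =ᶠ[nhds z] fun z => fderiv ℝ V (z + (h • v, 0)) - fderiv ℝ V z := by
          filter_upwards [(isOpen_Cn u0 ε3).mem_nhds hz.mem] with w hw
          obtain ⟨τ', hw⟩ := hw
          have d1 : DifferentiableAt ℝ V w := (cAt hV (hw.mono hε3l) 1).differentiableAt (by norm_num)
          have d2 : DifferentiableAt ℝ V (w + (h • v, 0)) := (cAt hV ((sh w τ' hw).mono hε2l) 1).differentiableAt (by norm_num)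
          rw [fderiv_fun_sub ((differentiableAt_comp_add_right _).2 d2) d1, fderiv_comp_add_right]
        have d3 := diff_fderiv (V2 hzs)
        have d4 := diff_fderiv (V2 hzz)
        unfold Lap
        rw [ev.fderiv_eq, fderiv_fun_sub ((differentiableAt_comp_add_right _).2 d3) d4, fderiv_comp_add_right]
        simp only [sub_apply]
        abel
      have cb := cone_bar (hε3l.trans h1) smW (a := h * a2) (A := h * (2 * M * K ^ 2)) (by positivity) (by positivity)
        (fun z τ hz => hmv Y V a2 hV z τ hz fun z' hz' => (step2 z' τ hz' v hv).1)
        (fun z τ u hz hu => by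
          rw [lapW z τ hz, Lap_eq (A2 ((sh z τ hz).mono hε2l)) (V2 ((sh z τ hz).mono hε2l)), Lap_eq (A2 (hz.mono hε3l)) (V2 (hz.mono hε3l))]
          have j1 := hmv _ (fderiv ℝ (e1 A V)) M (sm_fderiv hO s1) z τ hz fun z' hz' => by
            refine (m3 z' τ (hz'.mono hε2l) (v, 0)).trans ?_
            rw [norm_pr1]
            nlinarith
          have j2 := hmv _ (fderiv ℝ (e2 A V)) M (sm_fderiv hO s2) z τ hz fun z' hz' => by
            refine (m4 z' τ (hz'.mono hε2l) (v, 0)).trans ?_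
            rw [norm_pr1]
            nlinarith
          have i1 := app2_le _ (u, 0) u j1
          have i2 := app2_le _ (0, u) u j2
          rw [norm_pr1, sub_apply, sub_apply] at i1
          rw [norm_pr2, sub_apply, sub_apply] at i2
          have i3 : h * M * ‖u‖ * ‖u‖ ≤ h * M * K * K := by gcongr
          have i4 := norm_add_le (fderiv ℝ (e1 A V) (z + (h • v, 0)) (u, 0) u - fderiv ℝ (e1 A V) z (u, 0) u)
            (fderiv ℝ (e2 A V) (z + (h • v, 0)) (0, u) u - fderiv ℝ (e2 A V) z (0, u) u)
          rw [add_sub_add_comm]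
          have : h * (2 * M * K ^ 2) = h * M * K * K + h * M * K * K := by ring
          linarith)
        (fun η hη => by
          obtain ⟨t, ht, H⟩ := tV (η / 2) (by positivity)
          refine ⟨t, ht, fun z τ hz hτ => ?_⟩
          have k1 := H z τ (hz.mono hε3l) hτ
          have k2 := H _ τ ((sh z τ hz).mono hε2l) hτ
          exact (norm_sub_le _ _).trans (by linarith))
      refine (cb z τ hz).trans (le_of_eq ?_)
      rw [ha4]; ring
    have hder : HasDerivAt (fun t : ℝ => V (z + (t • v, 0))) (fderiv ℝ V z (v, 0)) 0 := by
      have k1 : HasDerivAt (fun t : ℝ => z + (t • v, (0:E))) (v, 0) 0 := by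
        have : HasDerivAt (fun t : ℝ => (t • v, (0:E))) (v, 0) 0 := by
          have := ((hasDerivAt_id (0:ℝ)).smul_const v).prodMk (hasDerivAt_const (0:ℝ) (0:E))
          simpa using this
        exact this.const_add z
      have k2 : HasFDerivAt V (fderiv ℝ V z) (z + ((0:ℝ) • v, (0:E))) := by
        have := ((V2 hz3).differentiableAt (by norm_num)).hasFDerivAt
        rw [zero_smul, Prod.mk_zero_zero, add_zero]; exact this
      exact HasFDerivAt.comp_hasDerivAt (f := fun t : ℝ => z + (t • v, (0:E))) 0 k2 k1
    refine le_of_tendsto hder.tendsto_slope_zero_right.norm ?_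
    filter_upwards [Ioc_mem_nhdsGT hε3p] with t ht
    have := main t ht.1 ht.2
    rw [norm_smul, norm_inv, Real.norm_eq_abs, abs_of_pos ht.1, inv_mul_le_iff₀ ht.1]
    simp only [zero_add, zero_smul, Prod.mk_zero_zero, add_zero]
    exact this
  have hs4 : shr u0 ε3 ≤ ε2 := (shr_le hε3p).trans (by linarith)
  refine ⟨shr u0 ε3, shr_pos hε3p, hs4.trans hε2l, bdOn_zero _ fun z τ hz => bDxA z τ (hz.mono hs4),
    bdOn_zero _ fun z τ hz => bDxV z τ (hz.mono hs4), fun η hη => ?_⟩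
  have ha4p : 0 < a4 := by have := shr_pos (u0 := u0) hε3p; positivity
  refine ⟨η / a4, by positivity, fun z τ hz hτ => unit _ _ hη.le fun v hv => (key z τ hz v hv).trans ?_⟩
  rw [lt_div_iff₀ ha4p] at hτ
  linarith

lemma e1_Dx {A V : E × E → Y} {z : E × E} (hA : ContDiffAt ℝ 2 A z) (hV : ContDiffAt ℝ 2 V z) :
    e1 (Dx A) (Dx V) z = ContinuousLinearMap.flip (Dx (e1 A V) z) := by
  ext v w
  rw [ContinuousLinearMap.flip_apply, Dx_app, fd_e1 hA hV]
  unfold e1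
  rw [add_apply, add_apply, Dx_app, Dy_app, fderiv_Dx hA, fderiv_Dx hV, dd_symm hA, dd_symm hV]

lemma e2_Dx {A V : E × E → Y} {z : E × E} (hA : ContDiffAt ℝ 2 A z) (hV : ContDiffAt ℝ 2 V z) :
    e2 (Dx A) (Dx V) z = ContinuousLinearMap.flip (Dx (e2 A V) z) := by
  ext v w
  rw [ContinuousLinearMap.flip_apply, Dx_app, fd_e2 hA hV]
  unfold e2
  rw [sub_apply, sub_apply, Dx_app, Dy_app, fderiv_Dx hA, fderiv_Dx hV, dd_symm hA, dd_symm hV]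

/-- continuous flip map -/
def flL (E Y : Type) [NormedAddCommGroup E] [NormedSpace ℝ E] [NormedAddCommGroup Y] [NormedSpace ℝ Y] :
    (E →L[ℝ] E →L[ℝ] Y) →L[ℝ] (E →L[ℝ] E →L[ℝ] Y) :=
  (ContinuousLinearMap.flipₗᵢ ℝ E E Y).toContinuousLinearEquiv.toContinuousLinearMap

lemma flL_apply (T : E →L[ℝ] E →L[ℝ] Y) : flL E Y T = T.flip := rfl

set_option maxHeartbeats 1000000 in
lemma bd_flip {u0 : E} {ε : ℝ} {k : ℕ} {f : E × E → E →L[ℝ] Y} (hf : ContDiffOn ℝ (⊤ : ℕ∞) f (Cn u0 ε)) (h : BdOn u0 ε (k + 1) f) :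
    BdOn u0 ε k (fun z => ContinuousLinearMap.flip (Dx f z)) := by
  have h1 : BdOn u0 ε k (Dx f) := by
    rw [Dx_eq]; exact BdOn.clm (sm_fderiv (isOpen_Cn u0 ε) hf) h.fderiv _
  have h2 := BdOn.clm (Z := E →L[ℝ] E →L[ℝ] Y) (sm_Dx (isOpen_Cn u0 ε) hf) h1 (flL E Y)
  exact h2.congr fun z _ => (flL_apply _).symm

def prL (E Y : Type) [NormedAddCommGroup E] [NormedSpace ℝ E] [NormedAddCommGroup Y] [NormedSpace ℝ Y] (i : E × E →L[ℝ] E) :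
    (E →L[ℝ] Y) →L[ℝ] (E × E →L[ℝ] Y) := (ContinuousLinearMap.compL ℝ (E × E) E Y).flip i

lemma fd_split (f : E × E → Y) (z : E × E) : fderiv ℝ f z = prL E Y (ContinuousLinearMap.fst ℝ E E) (Dx f z) + prL E Y (ContinuousLinearMap.snd ℝ E E) (Dy f z) := by
  refine ContinuousLinearMap.ext fun a => ?_
  change fderiv ℝ f z a = fderiv ℝ f z (a.1, 0) + fderiv ℝ f z (0, a.2)
  rw [← map_add]; simp

theorem cone_reg {u0 : E} (k : ℕ) : ∀ (Y : Type) [NormedAddCommGroup Y] [NormedSpace ℝ Y] (ε : ℝ), 0 < ε → ε ≤ 1 →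
    ∀ A V : E × E → Y, ContDiffOn ℝ (⊤ : ℕ∞) A (Cn u0 ε) → ContDiffOn ℝ (⊤ : ℕ∞) V (Cn u0 ε) → BdOn u0 ε 0 A → BdOn u0 ε 0 V →
    Tend0 u0 ε V → BdOn u0 ε (k + 2) (e1 A V) → BdOn u0 ε (k + 2) (e2 A V) →
    ∃ ε' > 0, ε' ≤ ε ∧ BdOn u0 ε' k A ∧ BdOn u0 ε' k V := by
  induction k with
  | zero =>
    intro Y _ _ ε hε h1 A V _ _ bA bV _ _ _
    exact ⟨ε, hε, le_rfl, bA, bV⟩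
  | succ k ih =>
    intro Y _ _ ε hε h1 A V hA hV bA bV tV b1 b2
    obtain ⟨ε', hε', hle, c1, c2, c3⟩ := cone_step hε h1 hA hV bV tV (b1.mono le_rfl (by omega)) (b2.mono le_rfl (by omega))
    have hO := isOpen_Cn u0 ε'
    have hA' := hA.mono (Cn_mono hle)
    have hV' := hV.mono (Cn_mono hle)
    have b1' : BdOn u0 ε' (k + 1 + 2) (e1 A V) := b1.mono hle le_rfl
    have b2' : BdOn u0 ε' (k + 1 + 2) (e2 A V) := b2.mono hle le_rfl
    obtain ⟨ε'', hε'', hle'', d1, d2⟩ := ih (E →L[ℝ] Y) ε' hε' (hle.trans h1) (Dx A) (Dx V) (sm_Dx hO hA') (sm_Dx hO hV') c1 c2 c3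
      ((bd_flip (sm_e1 hO hA' hV') b1').congr fun z ⟨τ, hz⟩ => e1_Dx (cAt hA' hz 2) (cAt hV' hz 2))
      ((bd_flip (sm_e2 hO hA' hV') b2').congr fun z ⟨τ, hz⟩ => e2_Dx (cAt hA' hz 2) (cAt hV' hz 2))
    have hO' := isOpen_Cn u0 ε''
    have hA'' := hA'.mono (Cn_mono hle'')
    have hV'' := hV'.mono (Cn_mono hle'')
    have b1'' : BdOn u0 ε'' k (e1 A V) := b1'.mono hle'' (by omega)
    have b2'' : BdOn u0 ε'' k (e2 A V) := b2'.mono hle'' (by omega)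
    have sxA := sm_Dx hO' hA''
    have sxV := sm_Dx hO' hV''
    have s1 := sm_e1 hO' hA'' hV''
    have s2 := sm_e2 hO' hA'' hV''
    have yA : BdOn u0 ε'' k (Dy A) := by
      refine (BdOn.add s1 ((-ContinuousLinearMap.id ℝ (E →L[ℝ] Y)).contDiff.comp_contDiffOn sxV) b1'' (BdOn.clm sxV d2 (-ContinuousLinearMap.id ℝ (E →L[ℝ] Y)))).congr fun z _ => ?_
      change Dy A z = (Dy A z + Dx V z) + -(Dx V z)
      abel
    have yV : BdOn u0 ε'' k (Dy V) := by
      refine (BdOn.add s2 sxA b2'' d1).congr fun z _ => ?_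
      change Dy V z = (Dy V z - Dx A z) + Dx A z
      abel
    have fin : ∀ f : E × E → Y, ContDiffOn ℝ (⊤ : ℕ∞) f (Cn u0 ε'') → BdOn u0 ε'' 0 f → BdOn u0 ε'' k (Dx f) → BdOn u0 ε'' k (Dy f) → BdOn u0 ε'' (k + 1) f := by
      intro f hf f0 fx fy
      refine bdOn_succ f0 ?_
      refine (BdOn.add ((prL E Y (ContinuousLinearMap.fst ℝ E E)).contDiff.comp_contDiffOn (sm_Dx hO' hf))
        ((prL E Y (ContinuousLinearMap.snd ℝ E E)).contDiff.comp_contDiffOn (sm_Dy hO' hf)) (BdOn.clm (sm_Dx hO' hf) fx _) (BdOn.clm (sm_Dy hO' hf) fy _)).congr fun z _ => ?_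
      exact fd_split f z
    exact ⟨ε'', hε'', hle''.trans hle, fin A hA'' (bA.mono (hle''.trans hle) le_rfl) d1 yA, fin V hV'' (bV.mono (hle''.trans hle) le_rfl) d2 yV⟩

end Cone2
end

section
section Landau
variable {E : Type} [NormedAddCommGroup E] [NormedSpace ℝ E]

lemma landau1 {F Y : Type} [NormedAddCommGroup F] [NormedSpace ℝ F] [NormedAddCommGroup Y] [NormedSpace ℝ Y]
    {f : F → Y} {z : F} {ℓ a b : ℝ} (hl : 0 < ℓ) (ha : 0 ≤ a) (hb : 0 ≤ b)
    (hf : ∀ y, ‖y - z‖ ≤ ℓ → ContDiffAt ℝ 2 f y)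
    (h0 : ∀ y, ‖y - z‖ ≤ ℓ → ‖f y‖ ≤ a) (h2 : ∀ y, ‖y - z‖ ≤ ℓ → ‖iteratedFDeriv ℝ 2 f y‖ ≤ b) :
    ‖fderiv ℝ f z‖ ≤ 2 * a / ℓ + b * ℓ := by
  have hz : ‖z - z‖ ≤ ℓ := by simpa using hl.le
  have hlip : ∀ y, ‖y - z‖ ≤ ℓ → ‖fderiv ℝ f y - fderiv ℝ f z‖ ≤ b * ℓ := by
    intro y hy
    have := (convex_closedBall z ℓ).norm_image_sub_le_of_norm_fderiv_le (f := fderiv ℝ f) (𝕜 := ℝ) (C := b)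
      (fun x hx => diff_fderiv (hf x (by rwa [mem_closedBall_iff_norm] at hx)))
      (fun x hx => by
        have := h2 x (by rwa [mem_closedBall_iff_norm] at hx)
        rwa [← norm_iteratedFDeriv_fderiv, norm_iteratedFDeriv_one] at this)
      (x := z) (y := y) (mem_closedBall_self hl.le) (by rwa [mem_closedBall_iff_norm])
    exact this.trans (mul_le_mul_of_nonneg_left hy hb)
  refine ContinuousLinearMap.opNorm_le_of_unit_norm (by positivity) fun v hv => ?_
  have hy : ‖z + ℓ • v - z‖ ≤ ℓ := by
    rw [add_sub_cancel_left, norm_smul, hv, Real.norm_eq_abs, abs_of_pos hl, mul_one]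
  have key := (convex_closedBall z ℓ).norm_image_sub_le_of_norm_hasFDerivWithin_le' (f := f) (𝕜 := ℝ) (φ := fderiv ℝ f z) (C := b * ℓ)
    (fun x hx => ((hf x (by rwa [mem_closedBall_iff_norm] at hx)).differentiableAt (by norm_num)).hasFDerivAt.hasFDerivWithinAt)
    (fun x hx => hlip x (by rwa [mem_closedBall_iff_norm] at hx))
    (x := z) (y := z + ℓ • v) (mem_closedBall_self hl.le) (by rwa [mem_closedBall_iff_norm])
  rw [add_sub_cancel_left, map_smul, norm_smul ℓ v, hv, Real.norm_eq_abs, abs_of_pos hl, mul_one] at key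
  have h3 : ‖ℓ • fderiv ℝ f z v‖ ≤ 2 * a + b * ℓ * ℓ := by
    have e : ℓ • fderiv ℝ f z v = f (z + ℓ • v) - f z - (f (z + ℓ • v) - f z - ℓ • fderiv ℝ f z v) := by abel
    rw [e]
    refine (norm_sub_le _ _).trans ?_
    have := norm_sub_le (f (z + ℓ • v)) (f z)
    have := h0 _ hy
    have := h0 _ hz
    linarith
  rw [norm_smul, Real.norm_eq_abs, abs_of_pos hl] at h3
  have h4 : ‖fderiv ℝ f z v‖ ≤ (2 * a + b * ℓ * ℓ) / ℓ := by rw [le_div_iff₀ hl]; linarith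
  refine h4.trans (le_of_eq ?_)
  field_simp

lemma cone_landau (J : ℕ) : ∀ s : ℕ, ∃ N : ℕ, ∀ (u0 : E) (Y : Type) [NormedAddCommGroup Y] [NormedSpace ℝ Y] (ε : ℝ), 0 < ε → ε ≤ 1 →
    ∀ e : E × E → Y, ContDiffOn ℝ (⊤ : ℕ∞) e (Cn u0 ε) →
    (∀ j ≤ J + 1, ∃ C, ∀ z τ, GG u0 ε z τ → ‖iteratedFDeriv ℝ j e z‖ ≤ C * (τ ^ (j + s))⁻¹) →
    (∃ C, ∀ z τ, GG u0 ε z τ → ‖e z‖ ≤ C * τ ^ N) → BdOn u0 (ε / 2 ^ J) J e := by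
  induction J with
  | zero =>
    intro s
    refine ⟨0, fun u0 Y _ _ ε hε h1 e he _ h => ?_⟩
    obtain ⟨C, hC⟩ := h
    refine bdOn_zero C fun z τ hz => ?_
    simpa using hC z τ (by simpa using hz)
  | succ J ih =>
    intro s
    obtain ⟨N1, hN1⟩ := ih (s + 1)
    set L := N1 + 2 + s with hL
    refine ⟨N1 + L, fun u0 Y _ _ ε hε h1 e he hj h => ?_⟩
    obtain ⟨C, hC⟩ := h
    obtain ⟨C2, hC2⟩ := hj 2 (by omega)
    have hb : ∀ z τ, GG u0 (ε / 2) z τ → ‖fderiv ℝ e z‖ ≤ (4 * |C| / ε + |C2|) * τ ^ N1 := by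
      intro z τ hz
      have hτ := hz.2.1
      have hτ1 : τ ≤ 1 := by linarith [hz.2.2.1]
      have hl : 0 < ε / 2 * τ ^ L := by positivity
      have hg : ∀ y, ‖y - z‖ ≤ ε / 2 * τ ^ L → GG u0 ε y τ := by
        intro y hy
        refine hz.ball h1 (hy.trans ?_)
        have : τ ^ L ≤ τ ^ 1 := pow_le_pow_of_le_one hτ.le hτ1 (by omega)
        rw [pow_one] at this
        gcongr
      refine (landau1 hl (a := |C| * τ ^ (N1 + L)) (b := |C2| * (τ ^ (2 + s))⁻¹) (by positivity) (by positivity)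
        (fun y hy => cAt he (hg y hy) 2) (fun y hy => (hC y τ (hg y hy)).trans (by gcongr; exact le_abs_self C))
        (fun y hy => (hC2 y τ (hg y hy)).trans (by gcongr; exact le_abs_self C2))).trans ?_
      have e1 : 2 * (|C| * τ ^ (N1 + L)) / (ε / 2 * τ ^ L) = 4 * |C| / ε * τ ^ N1 := by
        rw [pow_add]; field_simp; ring
      have e2 : |C2| * (τ ^ (2 + s))⁻¹ * (ε / 2 * τ ^ L) = ε / 2 * (|C2| * τ ^ N1) := by
        have : τ ^ L = τ ^ N1 * τ ^ (2 + s) := by rw [← pow_add, hL]; congr 1; omega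
        rw [this]; field_simp
      rw [e1, e2, add_mul]
      have : 0 ≤ |C2| * τ ^ N1 := by positivity
      nlinarith
    have hh := hN1 u0 (E × E →L[ℝ] Y) (ε / 2) (by positivity) (by linarith) (fderiv ℝ e)
      ((sm_fderiv (isOpen_Cn u0 ε) he).mono (Cn_mono (by linarith)))
      (fun j hj' => by
        obtain ⟨C', hC'⟩ := hj (j + 1) (by omega)
        refine ⟨C', fun z τ hz => ?_⟩
        rw [norm_iteratedFDeriv_fderiv]
        have := hC' z τ (hz.mono (by linarith))
        rwa [show j + (s + 1) = j + 1 + s by ring])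
      ⟨_, hb⟩
    have e3 : ε / 2 / 2 ^ J = ε / 2 ^ (J + 1) := by rw [pow_succ]; field_simp
    rw [e3] at hh
    refine bdOn_succ (bdOn_zero |C| fun z τ hz => ?_) hh
    have hle : ε / 2 ^ (J + 1) ≤ ε := div_le_self hε.le (one_le_pow₀ (by norm_num))
    have hz' := hz.mono hle
    refine (hC z τ hz').trans ?_
    have hτ := hz'.2.1
    have : τ ^ (N1 + L) ≤ 1 := pow_le_one₀ hτ.le (by linarith [hz'.2.2.1])
    calc C * τ ^ (N1 + L) ≤ |C| * τ ^ (N1 + L) := by gcongr; exact le_abs_self C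
      _ ≤ |C| * 1 := by gcongr
      _ = |C| := mul_one _
end Landau
end

section
section AE
variable {E W : Type} [NormedAddCommGroup E] [NormedSpace ℝ E] [NormedAddCommGroup W] [NormedSpace ℝ W]

def TT (b : E → W) : ℕ → E × E → W
  | 0 => fun z => b z.1
  | k + 1 => fun z => fderiv ℝ (TT b k) z (z.2, 0)

lemma TT_smooth {b : E → W} (hb : ContDiff ℝ (⊤ : ℕ∞) b) (k : ℕ) : ContDiff ℝ (⊤ : ℕ∞) (TT b k) := by
  induction k with
  | zero => exact hb.comp contDiff_fst
  | succ k ih =>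
    have : ContDiff ℝ (⊤ : ℕ∞) (fderiv ℝ (TT b k)) := ih.fderiv_right (by simp)
    exact this.clm_apply (contDiff_snd.prodMk contDiff_const)

lemma fd_TT {b : E → W} (hb : ContDiff ℝ (⊤ : ℕ∞) b) (k : ℕ) (z a : E × E) :
    fderiv ℝ (TT b (k + 1)) z a = fderiv ℝ (fderiv ℝ (TT b k)) z a (z.2, 0) + fderiv ℝ (TT b k) z (a.2, 0) := by
  have h2 : ContDiffAt ℝ 2 (TT b k) z := (TT_smooth hb k).contDiffAt.of_le two_le_top
  have h3 : HasFDerivAt (fun z : E × E => (z.2, (0:E))) ((ContinuousLinearMap.inl ℝ E E).comp (ContinuousLinearMap.snd ℝ E E)) z :=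
    ((ContinuousLinearMap.inl ℝ E E).comp (ContinuousLinearMap.snd ℝ E E)).hasFDerivAt
  have h4 := (diff_fderiv h2).hasFDerivAt.clm_apply h3
  have h5 : fderiv ℝ (TT b (k + 1)) z = _ := h4.fderiv
  rw [h5]
  simp [add_comm]

lemma fd_fd_app {F Q : Type} [NormedAddCommGroup F] [NormedSpace ℝ F] [NormedAddCommGroup Q] [NormedSpace ℝ Q] {f : F → Q} {z : F} (hf : ContDiffAt ℝ 2 f z) (a c : F) :
    fderiv ℝ (fun w => fderiv ℝ f w c) z a = fderiv ℝ (fderiv ℝ f) z a c := by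
  have := ((ContinuousLinearMap.apply ℝ Q c).hasFDerivAt.comp z (diff_fderiv hf).hasFDerivAt).fderiv
  have h2 : fderiv ℝ (fun w => fderiv ℝ f w c) z = _ := this
  rw [h2]; rfl

lemma TT_dy {b : E → W} (hb : ContDiff ℝ (⊤ : ℕ∞) b) (k : ℕ) : ∀ z v, fderiv ℝ (TT b (k + 1)) z (0, v) = ((k : ℝ) + 1) • fderiv ℝ (TT b k) z (v, 0) := by
  have c2 : ∀ k z, ContDiffAt ℝ 2 (TT b k) z := fun k z => (TT_smooth hb k).contDiffAt.of_le two_le_top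
  induction k with
  | zero =>
    intro z v
    rw [fd_TT hb, dd_symm (c2 0 z), ← fd_fd_app (c2 0 z)]
    have : (fun w => fderiv ℝ (TT b 0) w ((0:E), v)) = fun _ => 0 := by
      funext w
      have h1 : HasFDerivAt (TT b 0) ((fderiv ℝ b w.1).comp (ContinuousLinearMap.fst ℝ E E)) w :=
        (hb.differentiable (by simp) w.1).hasFDerivAt.comp w (ContinuousLinearMap.fst ℝ E E).hasFDerivAt
      rw [h1.fderiv]; simp
    rw [this]
    simp
  | succ k ih =>
    intro z v
    rw [fd_TT hb, dd_symm (c2 (k + 1) z), ← fd_fd_app (c2 (k + 1) z)]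
    have : (fun w => fderiv ℝ (TT b (k + 1)) w ((0:E), v)) = fun w => ((k : ℝ) + 1) • fderiv ℝ (TT b k) w (v, 0) := funext fun w => ih w v
    rw [this, fderiv_fun_const_smul, smul_apply, fd_fd_app (c2 k z), dd_symm (c2 k z)]
    · have h := fd_TT hb k z (v, 0)
      have h0 : ((0:E), (0:E)) = 0 := rfl
      simp only [h0, map_zero, add_zero] at h
      rw [← h]
      push_cast
      module
    · exact ((diff_fderiv (c2 k z)).clm_apply (differentiableAt_const _))

lemma TT_hom {b : E → W} (hb : ContDiff ℝ (⊤ : ℕ∞) b) (k : ℕ) : ∀ (c : ℝ) (x y v : E),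
    TT b k (x, c • y) = c ^ k • TT b k (x, y) ∧ fderiv ℝ (TT b k) (x, c • y) (v, 0) = c ^ k • fderiv ℝ (TT b k) (x, y) (v, 0) := by
  have part : ∀ k, (∀ (c : ℝ) (x y : E), TT b k (x, c • y) = c ^ k • TT b k (x, y)) → ∀ (c : ℝ) (x y v : E),
      fderiv ℝ (TT b k) (x, c • y) (v, 0) = c ^ k • fderiv ℝ (TT b k) (x, y) (v, 0) := by
    intro k h c x y v
    have dT : ∀ z, HasFDerivAt (TT b k) (fderiv ℝ (TT b k) z) z := fun z => ((TT_smooth hb k).differentiable (by simp) z).hasFDerivAt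
    have hx : ∀ y' : E, HasFDerivAt (fun x' : E => (x', y')) (ContinuousLinearMap.inl ℝ E E) x := by
      intro y'
      have := (hasFDerivAt_id (𝕜 := ℝ) x).prodMk (hasFDerivAt_const y' x)
      exact this
    have h1 := (dT (x, c • y)).comp x (hx (c • y))
    have h2 := ((dT (x, y)).comp x (hx y)).const_smul (c ^ k)
    have e : (TT b k ∘ fun x' : E => (x', c • y)) = c ^ k • (TT b k ∘ fun x' : E => (x', y)) := by
      funext x'; exact h c x' y
    rw [e] at h1
    have := congrArg (fun L => L v) (h1.unique h2)
    simpa using this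
  induction k with
  | zero =>
    have h0 : ∀ (c : ℝ) (x y : E), TT b 0 (x, c • y) = c ^ 0 • TT b 0 (x, y) := fun c x y => by simp [TT]
    exact fun c x y v => ⟨h0 c x y, part 0 h0 c x y v⟩
  | succ k ih =>
    have h0 : ∀ (c : ℝ) (x y : E), TT b (k + 1) (x, c • y) = c ^ (k + 1) • TT b (k + 1) (x, y) := by
      intro c x y
      change fderiv ℝ (TT b k) (x, c • y) (c • y, 0) = c ^ (k + 1) • fderiv ℝ (TT b k) (x, y) (y, 0)
      rw [(ih c x y (c • y)).2]
      have : (c • y, (0:E)) = c • (y, (0:E)) := by simp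
      rw [this, map_smul, smul_smul, pow_succ]
    exact fun c x y v => ⟨h0 c x y, part (k + 1) h0 c x y v⟩

lemma TT_bound [FiniteDimensional ℝ E] {b : E → W} (hb : ContDiff ℝ (⊤ : ℕ∞) b) (N : ℕ) :
    ∃ C, ∀ x y v : E, ‖x‖ ≤ 1 → ‖fderiv ℝ (TT b N) (x, y) (v, 0)‖ ≤ C * ‖y‖ ^ N * ‖v‖ := by
  have hc : Continuous (fun z => ‖fderiv ℝ (TT b N) z‖) := ((TT_smooth hb N).continuous_fderiv (by simp)).norm
  obtain ⟨C, hC⟩ := ((isCompact_closedBall (0:E) 1).prod (isCompact_closedBall (0:E) 1)).bddAbove_image hc.continuousOn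
  refine ⟨C, fun x y v hx => ?_⟩
  set y' : E := ‖y‖⁻¹ • y with hy'
  have e : y = ‖y‖ • y' := by
    rcases eq_or_ne y 0 with h | h
    · simp [h]
    · rw [hy', smul_smul, mul_inv_cancel₀ (norm_ne_zero_iff.2 h), one_smul]
  have hn : ‖y'‖ ≤ 1 := by
    rw [hy', norm_smul, norm_inv, norm_norm]; exact inv_mul_le_one
  have h1 : ‖fderiv ℝ (TT b N) (x, y')‖ ≤ C := hC ⟨(x, y'), ⟨by simpa using hx, by simpa using hn⟩, rfl⟩
  have h2 := (TT_hom hb N ‖y‖ x y' v).2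
  rw [← e] at h2
  rw [h2, norm_smul, norm_pow, norm_norm]
  have h3 := (fderiv ℝ (TT b N) (x, y')).le_opNorm (v, 0)
  rw [norm_pr1] at h3
  calc ‖y‖ ^ N * ‖fderiv ℝ (TT b N) (x, y') (v, 0)‖ ≤ ‖y‖ ^ N * (C * ‖v‖) := by gcongr; exact h3.trans (by gcongr)
    _ = C * ‖y‖ ^ N * ‖v‖ := by ring
end AE

section AE2
variable {E W : Type} [NormedAddCommGroup E] [NormedSpace ℝ E] [NormedAddCommGroup W] [NormedSpace ℝ W] [NormedSpace ℂ W] [IsScalarTower ℝ ℂ W]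

def AEx (b : E → W) : ℕ → E × E → W
  | 0 => TT b 0
  | N + 1 => fun z => AEx b N z + ((I ^ (N + 1) / ((N + 1).factorial : ℂ)) : ℂ) • TT b (N + 1) z

lemma AEx_smooth {b : E → W} (hb : ContDiff ℝ (⊤ : ℕ∞) b) (N : ℕ) : ContDiff ℝ (⊤ : ℕ∞) (AEx b N) := by
  induction N with
  | zero => exact TT_smooth hb 0
  | succ N ih =>
    have : ContDiff ℝ (⊤ : ℕ∞) (fun z => ((I ^ (N + 1) / ((N + 1).factorial : ℂ)) : ℂ) • TT b (N + 1) z) := (TT_smooth hb (N + 1)).const_smul _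
    exact ih.add this

lemma AEx_zero {b : E → W} (N : ℕ) (x : E) : AEx b N (x, 0) = b x := by
  induction N with
  | zero => rfl
  | succ N ih =>
    have h0 : ((0:E), (0:E)) = 0 := rfl
    have : TT b (N + 1) (x, 0) = 0 := by
      change fderiv ℝ (TT b N) (x, 0) ((0:E), (0:E)) = 0
      rw [h0, map_zero]
    change AEx b N (x, 0) + _ • TT b (N + 1) (x, 0) = b x
    rw [this, smul_zero, add_zero, ih]

lemma AEx_dbar {b : E → W} (hb : ContDiff ℝ (⊤ : ℕ∞) b) (N : ℕ) (z : E × E) (v : E) :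
    fderiv ℝ (AEx b N) z (0, v) - I • fderiv ℝ (AEx b N) z (v, 0) = -((I * (I ^ N / (N.factorial : ℂ))) • fderiv ℝ (TT b N) z (v, 0)) := by
  have dT : ∀ k z, HasFDerivAt (TT b k) (fderiv ℝ (TT b k) z) z := fun k z => ((TT_smooth hb k).differentiable (by simp) z).hasFDerivAt
  induction N with
  | zero =>
    have h1 : HasFDerivAt (TT b 0) ((fderiv ℝ b z.1).comp (ContinuousLinearMap.fst ℝ E E)) z :=
      (hb.differentiable (by simp) z.1).hasFDerivAt.comp z (ContinuousLinearMap.fst ℝ E E).hasFDerivAt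
    have h2 : fderiv ℝ (TT b 0) z (0, v) = 0 := by rw [h1.fderiv]; simp
    change fderiv ℝ (TT b 0) z (0, v) - I • fderiv ℝ (TT b 0) z (v, 0) = _
    rw [h2]; simp
  | succ N ih =>
    set α : ℂ := I ^ (N + 1) / ((N + 1).factorial : ℂ) with hα
    have dA : HasFDerivAt (AEx b N) (fderiv ℝ (AEx b N) z) z := ((AEx_smooth hb N).differentiable (by simp) z).hasFDerivAt
    have hh : HasFDerivAt (AEx b (N + 1)) (fderiv ℝ (AEx b N) z + α • fderiv ℝ (TT b (N + 1)) z) z := dA.add ((dT (N + 1) z).const_smul α)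
    rw [hh.fderiv]
    simp only [add_apply, smul_apply]
    rw [TT_dy hb N, smul_add, add_sub_add_comm, ih, smul_smul I α]
    have e : α • ((N : ℝ) + 1) • fderiv ℝ (TT b N) z (v, 0) = (I * (I ^ N / (N.factorial : ℂ))) • fderiv ℝ (TT b N) z (v, 0) := by
      have h1 : ((N : ℝ) + 1) • fderiv ℝ (TT b N) z (v, 0) = ((N : ℂ) + 1) • fderiv ℝ (TT b N) z (v, 0) := by
        rw [show ((N : ℂ) + 1) = (((N : ℝ) + 1 : ℝ) : ℂ) by push_cast; ring]
        rw [← rsmul_eq]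
      rw [h1, smul_smul]
      congr 1
      rw [hα, Nat.factorial_succ]
      have : ((N : ℂ) + 1) ≠ 0 := by exact_mod_cast Nat.succ_ne_zero N
      have : (N.factorial : ℂ) ≠ 0 := by exact_mod_cast Nat.factorial_ne_zero N
      push_cast
      field_simp
      ring
    rw [e]; abel

theorem exists_AE [FiniteDimensional ℝ E] {b : E → W} (hb : ContDiff ℝ (⊤ : ℕ∞) b) (N : ℕ) :
    ∃ P : E × E → W, ContDiff ℝ (⊤ : ℕ∞) P ∧ (∀ x, P (x, 0) = b x) ∧
      ∃ C, ∀ x y v, ‖x‖ ≤ 1 → ‖fderiv ℝ P (x, y) (0, v) - I • fderiv ℝ P (x, y) (v, 0)‖ ≤ C * ‖y‖ ^ N * ‖v‖ := by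
  obtain ⟨C, hC⟩ := TT_bound hb N
  refine ⟨AEx b N, AEx_smooth hb N, AEx_zero N, C, fun x y v hx => ?_⟩
  rw [AEx_dbar hb, norm_neg, norm_smul]
  have : ‖I * (I ^ N / (N.factorial : ℂ))‖ ≤ 1 := by
    rw [norm_mul, norm_div, norm_pow, Complex.norm_I, one_pow, one_mul, Complex.norm_natCast]
    exact div_le_one_of_le₀ (by exact_mod_cast Nat.one_le_iff_ne_zero.2 (Nat.factorial_ne_zero N)) (by positivity)
  exact (mul_le_of_le_one_left (norm_nonneg _) this).trans (hC x y v hx)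
end AE2
end

section
section LocInv
variable {X Y : Type} [NormedAddCommGroup X] [NormedSpace ℝ X] [FiniteDimensional ℝ X] [NormedAddCommGroup Y] [NormedSpace ℝ Y] [FiniteDimensional ℝ Y]

/-- multiply by a bump to globalize a locally smooth function -/
lemma globalize {Z : Type} [NormedAddCommGroup Z] [NormedSpace ℝ Z] {G : Y → Z} {b : Y} {ε : ℝ} (hε : 0 < ε)
    (hG : ∀ y, ‖y - b‖ < ε → ContDiffAt ℝ (⊤ : ℕ∞) G y) :
    ∃ G' : Y → Z, ContDiff ℝ (⊤ : ℕ∞) G' ∧ ∀ y, ‖y - b‖ < ε / 3 → G' y = G y := by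
  let χ : ContDiffBump b := ⟨ε / 3, ε / 2, by positivity, by linarith⟩
  refine ⟨fun y => χ y • G y, ?_, fun y hy => ?_⟩
  · rw [contDiff_iff_contDiffAt]
    intro y
    by_cases hy : ‖y - b‖ < ε
    · exact (χ.contDiff.contDiffAt).smul (hG y hy)
    · have : (fun y => χ y • G y) =ᶠ[nhds y] fun _ => 0 := by
        have h1 : {y | ε / 2 < ‖y - b‖} ∈ nhds y := (isOpen_lt continuous_const (by fun_prop)).mem_nhds (by
          change ε / 2 < ‖y - b‖; linarith)
        filter_upwards [h1] with x hx
        have : χ x = 0 := χ.zero_of_le_dist (by rw [dist_eq_norm]; exact le_of_lt hx)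
        rw [this, zero_smul]
      exact contDiffAt_const.congr_of_eventuallyEq this
  · have : χ y = 1 := χ.one_of_mem_closedBall (by rw [mem_closedBall, dist_eq_norm]; exact hy.le)
    simp [this]

lemma loc_inv {F : X → Y} (hF : ContDiff ℝ (⊤ : ℕ∞) F) (a : X) (hd : Module.finrank ℝ X = Module.finrank ℝ Y)
    (hinj : ∀ v, fderiv ℝ F a v = 0 → v = 0) :
    ∃ G : Y → X, ContDiff ℝ (⊤ : ℕ∞) G ∧ G (F a) = a ∧ ∃ ε > 0, (∀ y, ‖y - F a‖ < ε → F (G y) = y) ∧ ∀ x, ‖x - a‖ < ε → G (F x) = x := by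
  haveI : CompleteSpace X := FiniteDimensional.complete ℝ X
  let e : X ≃L[ℝ] Y := (LinearMap.linearEquivOfInjective (fderiv ℝ F a : X →ₗ[ℝ] Y)
    ((injective_iff_map_eq_zero _).2 hinj) hd).toContinuousLinearEquiv
  have he : HasFDerivAt F (e : X →L[ℝ] Y) a := by
    refine ((hF.differentiable (by simp)) a).hasFDerivAt.congr_fderiv ?_
    ext v; rfl
  have hFa : ContDiffAt ℝ (⊤ : ℕ∞) F a := hF.contDiffAt
  set T := hFa.toOpenPartialHomeomorph F he (by simp) with hT
  have hTF : (T : X → Y) = F := rfl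
  have haT : a ∈ T.source := hFa.mem_toOpenPartialHomeomorph_source he (by simp)
  have hbT : F a ∈ T.target := T.map_source haT
  have hs : T.symm (F a) = a := T.left_inv haT
  -- invertibility near a
  have hco : Continuous (fderiv ℝ F) := hF.continuous_fderiv (by simp)
  have hopen : ∀ᶠ y in nhds (F a), fderiv ℝ F (T.symm y) ∈ Set.range ((↑) : (X ≃L[ℝ] Y) → (X →L[ℝ] Y)) := by
    have h1 : Set.range ((↑) : (X ≃L[ℝ] Y) → (X →L[ℝ] Y)) ∈ nhds (fderiv ℝ F a) := by
      rw [he.fderiv]; exact ContinuousLinearEquiv.nhds e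
    have h2 : ContinuousAt (fun y => fderiv ℝ F (T.symm y)) (F a) :=
      hco.continuousAt.comp (T.symm.continuousAt hbT)
    exact h2 (by change _ ∈ nhds (fderiv ℝ F (T.symm (F a))); rw [hs]; exact h1)
  have htgt : ∀ᶠ y in nhds (F a), y ∈ T.target := T.open_target.mem_nhds hbT
  obtain ⟨ε, hε, hb⟩ := Metric.eventually_nhds_iff.1 (hopen.and htgt)
  have hsm : ∀ y, ‖y - F a‖ < ε → ContDiffAt ℝ (⊤ : ℕ∞) T.symm y := by
    intro y hy
    obtain ⟨⟨e', he'⟩, hyT⟩ := hb (by rwa [dist_eq_norm])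
    refine T.contDiffAt_symm hyT (f₀' := e') ?_ hF.contDiffAt
    rw [he']
    exact ((hF.differentiable (by simp)) _).hasFDerivAt
  obtain ⟨G, hG, hGe⟩ := globalize hε hsm
  have hGa : G (F a) = a := by rw [hGe _ (by simp; positivity), hs]
  refine ⟨G, hG, hGa, ?_⟩
  have hsrc : ∀ᶠ x in nhds a, x ∈ T.source ∧ ‖F x - F a‖ < ε / 3 := by
    have hsr : ∀ᶠ x in nhds a, x ∈ T.source := T.open_source.mem_nhds haT
    refine hsr.and ?_
    have : Continuous fun x => ‖F x - F a‖ := by have := hF.continuous; fun_prop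
    exact this.continuousAt.eventually (gt_mem_nhds (by simp; positivity))
  obtain ⟨ε', hε', hb'⟩ := Metric.eventually_nhds_iff.1 hsrc
  refine ⟨min (ε / 3) ε', by positivity, fun y hy => ?_, fun x hx => ?_⟩
  · rw [hGe y (hy.trans_le (min_le_left _ _))]
    exact T.right_inv (hb (by rw [dist_eq_norm]; linarith [min_le_left (ε/3) ε'])).2
  · obtain ⟨h1, h2⟩ := hb' (by rw [dist_eq_norm]; exact hx.trans_le (min_le_right _ _))
    rw [hGe _ h2]
    exact T.left_inv h1

lemma loc_inv_fderiv {F : X → Y} {G : Y → X} (hF : ContDiff ℝ (⊤ : ℕ∞) F) (hG : ContDiff ℝ (⊤ : ℕ∞) G) {a : X} (hGa : G (F a) = a)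
    {ε : ℝ} (hε : 0 < ε) (h : ∀ y, ‖y - F a‖ < ε → F (G y) = y) (w : Y) : fderiv ℝ F a (fderiv ℝ G (F a) w) = w := by
  have h1 : HasFDerivAt (fun y => F (G y)) ((fderiv ℝ F a).comp (fderiv ℝ G (F a))) (F a) := by
    refine HasFDerivAt.comp (F a) ?_ ((hG.differentiable (by simp)) _).hasFDerivAt
    rw [hGa]; exact ((hF.differentiable (by simp)) _).hasFDerivAt
  have h2 : HasFDerivAt (fun y => F (G y)) (ContinuousLinearMap.id ℝ Y) (F a) := by
    refine (hasFDerivAt_id (F a)).congr_of_eventuallyEq ?_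
    exact Metric.eventually_nhds_iff.2 ⟨ε, hε, fun y hy => h y (by rwa [← dist_eq_norm])⟩
  exact congrArg (fun L => L w) (h1.unique h2)
end LocInv

section Chart
variable {E : Type} [NormedAddCommGroup E] [InnerProductSpace ℂ E] [FiniteDimensional ℂ E] [NormedSpace ℝ E] [IsScalarTower ℝ ℂ E]

lemma exists_chart {Ω : Set E} {r : E → ℝ} {δ0 c M : ℝ} (h : SPD Ω r δ0 c M) {p n : E} (hp : r p = 0) (hn : fderiv ℝ r p n = 1) :
    ∃ σ F : E → E, ContDiff ℝ (⊤ : ℕ∞) σ ∧ ContDiff ℝ (⊤ : ℕ∞) F ∧ σ 0 = p ∧ F p = 0 ∧ fderiv ℝ σ 0 = ContinuousLinearMap.id ℝ E ∧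
      (∀ z, fderiv ℝ r p (F z) = r z) ∧
      ∃ ε > 0, (∀ y, ‖y‖ < ε → F (σ y) = y ∧ r (σ y) = fderiv ℝ r p y) ∧ (∀ z, ‖z - p‖ < ε → σ (F z) = z) := by
  haveI : FiniteDimensional ℝ E := real_fd
  set ℓ := fderiv ℝ r p with hℓ
  set F : E → E := fun z => z - p + (r z - ℓ (z - p)) • n with hFdef
  have hF : ContDiff ℝ (⊤ : ℕ∞) F := by have := h.smooth; fun_prop
  have hFp : F p = 0 := by simp [hFdef, hp]
  have hFr : ∀ z, ℓ (F z) = r z := by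
    intro z; simp only [hFdef, map_add, map_smul, hn, smul_eq_mul]; ring
  have hd : HasFDerivAt F (ContinuousLinearMap.id ℝ E) p := by
    have h1 : HasFDerivAt (fun z => z - p) (ContinuousLinearMap.id ℝ E) p := (hasFDerivAt_id p).sub_const p
    have h2 : HasFDerivAt (fun z => ℓ (z - p)) (ℓ.comp (ContinuousLinearMap.id ℝ E)) p := ℓ.hasFDerivAt.comp p h1
    have h3 := h1.add (((h.diff p).hasFDerivAt.sub h2).smul_const n)
    refine h3.congr_fderiv ?_
    ext v; simp [← hℓ]
  obtain ⟨σ, hσ, hσ0, ε, hε, h1, h2⟩ := loc_inv hF p rfl (fun v hv => by rw [hd.fderiv] at hv; simpa using hv)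
  have h3 := loc_inv_fderiv hF hσ hσ0 hε h1
  rw [hFp] at hσ0 h1 h3
  rw [hd.fderiv] at h3
  refine ⟨σ, F, hσ, hF, hσ0, hFp, ?_, hFr, ε, hε, fun y hy => ?_, h2⟩
  · ext v; exact h3 v
  · have := h1 y (by simpa using hy)
    exact ⟨this, by rw [← hFr, this]⟩
end Chart
end

section
section Lim
variable {E : Type} [NormedAddCommGroup E] [InnerProductSpace ℂ E] [FiniteDimensional ℂ E] [NormedSpace ℝ E] [IsScalarTower ℝ ℂ E]

lemma SPD.inward {Ω : Set E} {r : E → ℝ} {δ0 c M : ℝ} (h : SPD Ω r δ0 c M) {p n : E} (hn : fderiv ℝ r p n = 1) :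
    ∃ ρ > 0, ∀ z s, 0 ≤ s → ‖z - p‖ ≤ ρ → s ≤ ρ → r (z - s • n) ≤ r z - s / 2 := by
  have hM := h.M_pos
  have hlip : ∀ x, 1 / 2 ≤ fderiv ℝ r x n ∨ 1 < 2 * (M * ‖x - p‖ * ‖n‖) := by
    intro x
    have h1 := Convex.norm_image_sub_le_of_norm_fderiv_le (f := fderiv ℝ r) (𝕜 := ℝ) (s := Set.univ) (C := M) (fun z _ => diff_fderiv h.cd2.contDiffAt)
      (fun z _ => h.b2 z) convex_univ (Set.mem_univ p) (Set.mem_univ x)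
    have h2 := (fderiv ℝ r x - fderiv ℝ r p).le_of_opNorm_le h1 n
    rw [sub_apply, hn, Real.norm_eq_abs] at h2
    have := (abs_le.1 h2).1
    by_cases h3 : 1 < 2 * (M * ‖x - p‖ * ‖n‖)
    · right; exact h3
    · left; linarith
  set ρ : ℝ := 1 / (2 * M * (1 + ‖n‖) * (1 + ‖n‖)) with hρ
  have hρ0 : 0 < ρ := by positivity
  have hρ1 : 2 * M * (ρ * (1 + ‖n‖)) * ‖n‖ ≤ 1 := by
    have : 2 * M * (ρ * (1 + ‖n‖)) * (1 + ‖n‖) = 1 := by rw [hρ]; field_simp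
    nlinarith [norm_nonneg n, mul_pos (mul_pos two_pos hM) (mul_pos hρ0 (by positivity : 0 < 1 + ‖n‖))]
  refine ⟨ρ, hρ0, fun z s hs hz hsρ => ?_⟩
  have hd : ∀ t : ℝ, HasDerivAt (fun t => r (z - t • n)) (-(fderiv ℝ r (z - t • n) n)) t := by
    intro t
    have h1 : HasDerivAt (fun t : ℝ => z - t • n) (-n) t := by
      have := ((hasDerivAt_id t).smul_const n).const_sub z
      simpa using this
    have h2 := (h.diff (z - t • n)).hasFDerivAt.comp_hasDerivAt t h1
    rw [map_neg] at h2
    exact h2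
  have key : ∀ t ∈ Set.Icc 0 s, 1 / 2 ≤ fderiv ℝ r (z - t • n) n := by
    intro t ht
    refine (hlip _).resolve_right ?_
    push Not
    have : ‖z - t • n - p‖ ≤ ρ * (1 + ‖n‖) := by
      rw [show z - t • n - p = (z - p) - t • n by abel]
      refine (norm_sub_le _ _).trans ?_
      rw [norm_smul, Real.norm_eq_abs, abs_of_nonneg ht.1]
      have : t * ‖n‖ ≤ ρ * ‖n‖ := by gcongr; exact ht.2.trans hsρ
      linarith
    have h4 : M * ‖z - t • n - p‖ * ‖n‖ ≤ M * (ρ * (1 + ‖n‖)) * ‖n‖ := by gcongr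
    linarith
  have hA : AntitoneOn (fun t => r (z - t • n) + t / 2) (Set.Icc 0 s) := by
    have hd' : ∀ t, HasDerivAt (fun t => r (z - t • n) + t / 2) (-(fderiv ℝ r (z - t • n) n) + 1 / 2) t := fun t =>
      (hd t).add ((hasDerivAt_id t).div_const 2)
    refine antitoneOn_of_deriv_nonpos (convex_Icc 0 s) (fun t _ => (hd' t).continuousAt.continuousWithinAt)
      (fun t _ => (hd' t).differentiableAt.differentiableWithinAt) fun t ht => ?_
    rw [(hd' t).deriv]
    have := key t (interior_subset ht)
    linarith
  have := hA (Set.left_mem_Icc.2 hs) (Set.right_mem_Icc.2 hs) hs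
  simp only [zero_smul, sub_zero, zero_div, add_zero] at this
  linarith

lemma holder_lim {Ω₁ Ω₂ : Set E} {r₁ r₂ : E → ℝ} {δ0 c M C : ℝ} {φ ψ : E → E} (h : BH Ω₁ Ω₂ r₁ r₂ δ0 c M φ ψ)
    (hE : Est Ω₁ r₁ r₂ φ C) {p n : E} (hp : r₁ p = 0) (hn : fderiv ℝ r₁ p n = 1) :
    ∃ q, r₂ q = 0 ∧ Filter.Tendsto φ (nhdsWithin p Ω₁) (nhds q) := by
  haveI : FiniteDimensional ℝ E := real_fd
  haveI : CompleteSpace E := FiniteDimensional.complete ℝ E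
  have hM := h.s1.M_pos
  have hC := hE.pos
  have hΩ := h.s1.isOpen
  obtain ⟨ρ, hρ, hin⟩ := h.s1.inward hn
  have hdφ : ∀ z ∈ Ω₁, HasFDerivAt φ ((fderiv ℂ φ z).restrictScalars ℝ) z := fun z hz =>
    ((h.hφ z hz).differentiableAt (hΩ.mem_nhds hz)).hasFDerivAt.restrictScalars ℝ
  have hmem : ∀ z, z ∈ Ω₁ ↔ r₁ z < 0 := h.s1.mem_iff
  -- inward estimate
  have hA : ∀ z ∈ Ω₁, ‖z - p‖ ≤ ρ → ∀ s, 0 ≤ s → s ≤ ρ → ‖φ (z - s • n) - φ z‖ ≤ 4 * C * ‖n‖ * √s := by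
    intro z hz hzp s hs hsρ
    have hz0 := (hmem z).1 hz
    set η := -2 * r₁ z with hη
    have hη0 : 0 < η := by rw [hη]; linarith
    have hins : ∀ t ∈ Set.Icc 0 s, (t + η) / 2 ≤ -r₁ (z - t • n) := by
      intro t ht; have := hin z t ht.1 hzp (ht.2.trans hsρ); rw [hη]; linarith
    have hinΩ : ∀ t ∈ Set.Icc 0 s, z - t • n ∈ Ω₁ := by
      intro t ht; rw [hmem]; have := hins t ht; have := ht.1; linarith
    have hd : ∀ t ∈ Set.Icc 0 s, HasDerivAt (fun t : ℝ => φ (z - t • n) - φ z) (fderiv ℂ φ (z - t • n) (-n)) t := by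
      intro t ht
      have h1 : HasDerivAt (fun t : ℝ => z - t • n) (-n) t := by
        have := ((hasDerivAt_id t).smul_const n).const_sub z
        simpa using this
      exact (HasFDerivAt.comp_hasDerivAt (f := fun t : ℝ => z - t • n) t (hdφ _ (hinΩ t ht)) h1).sub_const _
    have hB : ∀ t ∈ Set.Icc 0 s, HasDerivAt (fun t : ℝ => 4 * C * ‖n‖ * (√(t + η) - √η)) (4 * C * ‖n‖ * (1 / (2 * √(t + η)))) t := by
      intro t ht
      exact ((((hasDerivAt_id t).add_const η).sqrt (by have := ht.1; simp only [id]; linarith)).sub_const _).const_mul _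
    have := image_norm_le_of_norm_deriv_right_le_deriv_boundary' (f := fun t : ℝ => φ (z - t • n) - φ z) (a := 0) (b := s)
      (f' := fun t => fderiv ℂ φ (z - t • n) (-n)) (B := fun t : ℝ => 4 * C * ‖n‖ * (√(t + η) - √η)) (B' := fun t => 4 * C * ‖n‖ * (1 / (2 * √(t + η))))
      (fun t ht => (hd t ht).continuousAt.continuousWithinAt) (fun t ht => (hd t ⟨ht.1, ht.2.le⟩).hasDerivWithinAt)
      (by simp) (fun t ht => (hB t ht).continuousAt.continuousWithinAt) (fun t ht => (hB t ⟨ht.1, ht.2.le⟩).hasDerivWithinAt)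
      (by
        intro t ht
        have ht' : t ∈ Set.Icc 0 s := ⟨ht.1, ht.2.le⟩
        have h1 := hE.g _ (hinΩ t ht') (-n)
        rw [norm_neg] at h1
        have hpos : 0 < t + η := by have := ht.1; linarith
        have h2 : √(t + η) / 2 ≤ √(-r₁ (z - t • n)) := by
          refine Real.le_sqrt_of_sq_le ?_
          rw [div_pow, Real.sq_sqrt hpos.le]
          have := hins t ht'
          linarith
        have h3 : 0 < √(t + η) := Real.sqrt_pos.2 hpos
        have h4 : √(t + η) / 2 * ‖fderiv ℂ φ (z - t • n) (-n)‖ ≤ C * ‖n‖ := (mul_le_mul_of_nonneg_right h2 (norm_nonneg _)).trans h1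
        rw [show 4 * C * ‖n‖ * (1 / (2 * √(t + η))) = 2 * (C * ‖n‖) / √(t + η) by field_simp; ring, le_div_iff₀ h3]
        linarith) (Set.right_mem_Icc.2 hs)
    refine this.trans ?_
    have : √(s + η) ≤ √s + √η := by
      rw [Real.sqrt_le_left (by positivity)]
      nlinarith [Real.sq_sqrt hs, Real.sq_sqrt hη0.le, Real.sqrt_nonneg s, Real.sqrt_nonneg η]
    change 4 * C * ‖n‖ * (√(s + η) - √η) ≤ _
    have : 0 ≤ 4 * C * ‖n‖ := by positivity
    nlinarith
  -- Hölder estimate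
  have hH : ∃ K, ∃ ε0 > 0, ∀ ε, 0 < ε → ε ≤ ε0 → ∀ z ∈ Ω₁, ∀ z' ∈ Ω₁, ‖z - p‖ ≤ ε → ‖z' - p‖ ≤ ε → ‖φ z - φ z'‖ ≤ K * √ε := by
    refine ⟨8 * C * ‖n‖ * √(4 * M) + 2 * C / √M, min ρ (ρ / (4 * M)), by positivity, fun ε hε hε0 z hz z' hz' hzp hzp' => ?_⟩
    have hε1 : ε ≤ ρ := hε0.trans (min_le_left _ _)
    have hε2 : 4 * M * ε ≤ ρ := by
      have := hε0.trans (min_le_right _ _)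
      rw [le_div_iff₀ (by positivity)] at this; linarith
    set s := 4 * M * ε with hs
    have hs0 : 0 ≤ s := by positivity
    have h1 := hA z hz (hzp.trans hε1) s hs0 hε2
    have h2 := hA z' hz' (hzp'.trans hε1) s hs0 hε2
    have hball : ∀ x ∈ closedBall p ε, x - s • n ∈ Ω₁ ∧ M * ε ≤ -r₁ (x - s • n) := by
      intro x hx
      rw [mem_closedBall, dist_eq_norm] at hx
      have h3 := hin x s hs0 (hx.trans hε1) hε2
      have h4 := (abs_le.1 (h.s1.lip x p)).2
      rw [hp] at h4
      have h5 : M * ‖x - p‖ ≤ M * ε := by gcongr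
      have h6 : 0 < M * ε := by positivity
      rw [hmem]
      constructor <;> linarith
    have h3 := Convex.norm_image_sub_le_of_norm_hasFDerivWithin_le (f := fun x => φ (x - s • n)) (f' := fun x => (fderiv ℂ φ (x - s • n)).restrictScalars ℝ)
      (s := closedBall p ε) (C := C / √(M * ε)) (x := z') (y := z) (𝕜 := ℝ)
      (fun x hx => by
        have h4 : HasFDerivAt (fun x => x - s • n) (ContinuousLinearMap.id ℝ E) x := (hasFDerivAt_id x).sub_const _
        exact (HasFDerivAt.comp x (hdφ _ (hball x hx).1) h4).hasFDerivWithinAt)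
      (fun x hx => by
        refine ContinuousLinearMap.opNorm_le_bound _ (by positivity) fun t => ?_
        have h4 := hE.g _ (hball x hx).1 t
        have h5 : √(M * ε) ≤ √(-r₁ (x - s • n)) := Real.sqrt_le_sqrt (hball x hx).2
        have h6 : 0 < √(M * ε) := Real.sqrt_pos.2 (by positivity)
        change ‖fderiv ℂ φ (x - s • n) t‖ ≤ _
        rw [div_mul_eq_mul_div, le_div_iff₀ h6]
        nlinarith [norm_nonneg (fderiv ℂ φ (x - s • n) t)])
      (convex_closedBall p ε) (by rwa [mem_closedBall, dist_eq_norm]) (by rwa [mem_closedBall, dist_eq_norm])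
    have h4 : ‖z - z'‖ ≤ 2 * ε := by
      rw [show z - z' = (z - p) - (z' - p) by abel]; exact (norm_sub_le _ _).trans (by linarith)
    have hsq : √(M * ε) = √M * √ε := Real.sqrt_mul hM.le _
    have hsq2 : √s = √(4 * M) * √ε := Real.sqrt_mul (by positivity) _
    have hMs : 0 < √M := Real.sqrt_pos.2 hM
    have hεs : 0 < √ε := Real.sqrt_pos.2 hε
    have h5 : C / √(M * ε) * ‖z - z'‖ ≤ 2 * C / √M * √ε := by
      refine (mul_le_mul_of_nonneg_left h4 (by positivity)).trans (le_of_eq ?_)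
      rw [hsq]; field_simp
      rw [Real.sq_sqrt hε.le]
    calc ‖φ z - φ z'‖ = ‖-(φ (z - s • n) - φ z) + (φ (z - s • n) - φ (z' - s • n)) + (φ (z' - s • n) - φ z')‖ := by congr 1; abel
      _ ≤ ‖φ (z - s • n) - φ z‖ + ‖φ (z - s • n) - φ (z' - s • n)‖ + ‖φ (z' - s • n) - φ z'‖ := by
        refine (norm_add₃_le).trans ?_; rw [norm_neg]
      _ ≤ 4 * C * ‖n‖ * √s + 2 * C / √M * √ε + 4 * C * ‖n‖ * √s := add_le_add (add_le_add h1 (h3.trans h5)) h2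
      _ = _ := by rw [hsq2]; ring
  obtain ⟨K, ε0, hε0, hK⟩ := hH
  haveI hne : (nhdsWithin p Ω₁).NeBot := by
    rw [← mem_closure_iff_nhdsWithin_neBot, Metric.mem_closure_iff]
    intro ε hε
    set s := min ρ (ε / (2 * (1 + ‖n‖))) with hs
    have hs0 : 0 < s := by positivity
    refine ⟨p - s • n, ?_, ?_⟩
    · rw [hmem]; have := hin p s hs0.le (by simp; positivity) (min_le_left _ _); rw [hp] at this; linarith
    · rw [dist_eq_norm, sub_sub_cancel, norm_smul, Real.norm_eq_abs, abs_of_pos hs0]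
      have h1 : s ≤ ε / (2 * (1 + ‖n‖)) := min_le_right _ _
      rw [le_div_iff₀ (by positivity)] at h1
      nlinarith [norm_nonneg n]
  have hcau : Cauchy (Filter.map φ (nhdsWithin p Ω₁)) := by
    rw [Metric.cauchy_iff]
    refine ⟨hne.map φ, fun ε hε => ?_⟩
    have ht : Filter.Tendsto (fun x => K * √x) (nhds 0) (nhds 0) := by
      have : Continuous fun x => K * √x := by fun_prop
      simpa using this.tendsto 0
    obtain ⟨d, hd, hdb⟩ := Metric.eventually_nhds_iff.1 (ht.eventually (gt_mem_nhds hε))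
    set e := min ε0 (d / 2) with he
    have he0 : 0 < e := by positivity
    have heK : K * √e < ε := hdb (by rw [Real.dist_eq, sub_zero, abs_of_pos he0]; exact (min_le_right _ _).trans_lt (by linarith))
    refine ⟨φ '' (Ω₁ ∩ closedBall p e), Filter.image_mem_map (Filter.inter_mem self_mem_nhdsWithin (mem_nhdsWithin_of_mem_nhds (closedBall_mem_nhds p he0))), ?_⟩
    rintro _ ⟨z, ⟨hz, hzp⟩, rfl⟩ _ ⟨z', ⟨hz', hzp'⟩, rfl⟩
    rw [dist_eq_norm]
    rw [mem_closedBall, dist_eq_norm] at hzp hzp'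
    exact (hK e he0 (min_le_left _ _) z hz z' hz' hzp hzp').trans_lt heK
  obtain ⟨q, hq⟩ := cauchy_iff_exists_le_nhds.1 hcau
  refine ⟨q, ?_, hq⟩
  have ht : Filter.Tendsto φ (nhdsWithin p Ω₁) (nhds q) := hq
  have h1 : Filter.Tendsto (fun z => r₂ (φ z)) (nhdsWithin p Ω₁) (nhds (r₂ q)) := (h.s2.smooth.continuous.tendsto q).comp ht
  have h2 : Filter.Tendsto (fun z => C * r₁ z) (nhdsWithin p Ω₁) (nhds (C * r₁ p)) :=
    ((h.s1.smooth.continuous.tendsto p).const_mul C).mono_left nhdsWithin_le_nhds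
  rw [hp, mul_zero] at h2
  refine le_antisymm (le_of_tendsto h1 ?_) (le_of_tendsto_of_tendsto h2 h1 ?_)
  · filter_upwards [self_mem_nhdsWithin] with z hz
    exact ((h.s2.mem_iff _).1 (h.mφ hz)).le
  · filter_upwards [self_mem_nhdsWithin] with z hz
    have := hE.e1 z hz; linarith
end Lim
end

section
section Strict
variable {E Y : Type} [NormedAddCommGroup E] [NormedSpace ℝ E] [NormedAddCommGroup Y] [NormedSpace ℝ Y]

lemma strict_y {g : E × E → Y} {a : E} (hg : ContDiffAt ℝ 1 g (a, 0)) {η : ℝ} (hη : 0 < η) :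
    ∃ ε > 0, ∀ x y, ‖x - a‖ < ε → ‖y‖ < ε → ‖g (x, y) - g (x, 0) - fderiv ℝ g (a, 0) (0, y)‖ ≤ η * ‖y‖ := by
  have h1 : HasStrictFDerivAt g (fderiv ℝ g (a, 0)) (a, 0) := hg.hasStrictFDerivAt (by simp)
  have h2 := h1.isLittleO.def hη
  obtain ⟨ε, hε, hb⟩ := Metric.eventually_nhds_iff.1 h2
  refine ⟨ε, hε, fun x y hx hy => ?_⟩
  have h3 : dist ((x, y), (x, (0 : E))) ((a, (0 : E)), (a, (0 : E))) < ε := by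
    simp only [Prod.dist_eq, dist_eq_norm, sub_zero, norm_zero]
    simp [hx, hy, hε]
  have h4 := hb h3
  simp only [Prod.mk_sub_mk, sub_self, sub_zero] at h4
  refine h4.trans (le_of_eq ?_)
  simp [Prod.norm_def]
end Strict

section Src
variable {E : Type} [NormedAddCommGroup E] [InnerProductSpace ℂ E] [FiniteDimensional ℂ E] [NormedSpace ℝ E] [IsScalarTower ℝ ℂ E]

lemma lam_smooth {r : E → ℝ} (hr : ContDiff ℝ (⊤ : ℕ∞) r) : ContDiff ℝ (⊤ : ℕ∞) (lam r) :=
  (lamL (E := E)).contDiff.comp (hr.fderiv_right (by simp))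

lemma fderiv_snd_of_AE {W : Type} [NormedAddCommGroup W] [NormedSpace ℝ W] [NormedSpace ℂ W] [IsScalarTower ℝ ℂ W] {P : E × E → W} {N : ℕ} (hN : 1 ≤ N)
    {C : ℝ} (h : ∀ x y v, ‖x‖ ≤ 1 → ‖fderiv ℝ P (x, y) (0, v) - I • fderiv ℝ P (x, y) (v, 0)‖ ≤ C * ‖y‖ ^ N * ‖v‖) (x v : E) (hx : ‖x‖ ≤ 1) :
    fderiv ℝ P (x, 0) (0, v) = I • fderiv ℝ P (x, 0) (v, 0) := by
  have := h x 0 v hx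
  rw [norm_zero, zero_pow (by omega), mul_zero, zero_mul] at this
  exact sub_eq_zero.1 (norm_le_zero_iff.1 this)

set_option maxHeartbeats 1000000 in
theorem source_AE {Ω : Set E} {r : E → ℝ} {δ0 c M : ℝ} (h : SPD Ω r δ0 c M) {p n : E} (hp : r p = 0) (hn : lam r p n = 1) {N : ℕ} (hN : 1 ≤ N) :
    ∃ P : E × E → E × (E →L[ℂ] ℂ), ContDiff ℝ (⊤ : ℕ∞) P ∧ P (0, 0) = (p, lam r p) ∧
      (∃ C, ∀ x y v, ‖x‖ ≤ 1 → ‖fderiv ℝ P (x, y) (0, v) - I • fderiv ℝ P (x, y) (v, 0)‖ ≤ C * ‖y‖ ^ N * ‖v‖) ∧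
      (∀ a b, (fderiv ℝ P (0, 0) (a, b)).1 = a - fderiv ℝ r p a • n + I • (b - fderiv ℝ r p b • n)) ∧
      ∃ ε > 0, ∃ C, ∀ x y τ, ‖x‖ < ε → |τ| < ε → ‖y - τ • (I • n)‖ ≤ ε * |τ| →
        |r (P (x, y)).1 + τ| ≤ |τ| / 2 ∧ ‖(P (x, y)).2 - lam r (P (x, y)).1‖ ≤ C * |τ| := by
  haveI : FiniteDimensional ℝ E := real_fd
  set ℓ := fderiv ℝ r p with hℓ
  have hℓn : ℓ n = 1 := by rw [hℓ, ← lam_re, hn]; simp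
  have hℓin : ℓ (I • n) = 0 := by rw [hℓ, ← lam_re, map_smul, hn]; simp
  obtain ⟨σ, F, hσ, hF, hσ0, hFp, hσ', hFr, ε0, hε0, hc1, -⟩ := exists_chart h hp hℓn
  set π : E →L[ℝ] E := ContinuousLinearMap.id ℝ E - ℓ.smulRight n with hπ
  have hπa : ∀ v, π v = v - ℓ v • n := fun v => by simp [hπ]
  have hℓπ : ∀ v, ℓ (π v) = 0 := fun v => by rw [hπa]; simp [hℓn]
  set b : E → E × (E →L[ℂ] ℂ) := fun y => (σ (π y), lam r (σ (π y))) with hb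
  have hbs : ContDiff ℝ (⊤ : ℕ∞) b := by
    have h1 : ContDiff ℝ (⊤ : ℕ∞) fun y => σ (π y) := hσ.comp π.contDiff
    exact h1.prodMk ((lam_smooth h.smooth).comp h1)
  obtain ⟨P, hP, hP0, C, hPC⟩ := exists_AE hbs N
  have hP00 : P (0, 0) = (p, lam r p) := by rw [hP0]; simp [hb, hσ0]
  have hPd : ∀ z, HasFDerivAt P (fderiv ℝ P z) z := fun z => ((hP.differentiable (by simp)) z).hasFDerivAt
  -- derivative in x of first component
  have hDx : ∀ a, (fderiv ℝ P (0, 0) (a, 0)).1 = π a := by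
    intro a
    have h1 : HasFDerivAt (fun x : E => (P (x, 0)).1) ((ContinuousLinearMap.fst ℝ E (E →L[ℂ] ℂ)).comp ((fderiv ℝ P (0, 0)).comp (ContinuousLinearMap.inl ℝ E E))) 0 :=
      (ContinuousLinearMap.fst ℝ E (E →L[ℂ] ℂ)).hasFDerivAt.comp (0:E) (HasFDerivAt.comp (g := P) (f := ContinuousLinearMap.inl ℝ E E) (0:E) (hPd (0, 0)) (ContinuousLinearMap.inl ℝ E E).hasFDerivAt)
    have h2 : HasFDerivAt (fun x : E => (P (x, 0)).1) ((ContinuousLinearMap.id ℝ E).comp π) 0 := by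
      have e : (fun x : E => (P (x, 0)).1) = fun x => σ (π x) := funext fun x => by rw [hP0]
      rw [e]
      refine HasFDerivAt.comp (0:E) ?_ π.hasFDerivAt
      rw [map_zero, ← hσ']
      exact ((hσ.differentiable (by simp)) _).hasFDerivAt
    have := congrArg (fun L => L a) (h1.unique h2)
    simpa using this
  have hD : ∀ a b, (fderiv ℝ P (0, 0) (a, b)).1 = a - ℓ a • n + I • (b - ℓ b • n) := by
    intro a b
    have e : ((a, b) : E × E) = (a, 0) + (0, b) := by simp
    rw [e, map_add, Prod.fst_add, fderiv_snd_of_AE hN hPC 0 b (by simp), Prod.smul_fst, hDx, hDx, hπa, hπa]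
  -- r∘f
  have hR : ContDiff ℝ (⊤ : ℕ∞) fun z => r (P z).1 := h.smooth.comp (contDiff_fst.comp hP)
  have hRd : ∀ v, fderiv ℝ (fun z => r (P z).1) (0, 0) (0, v) = -(lam r p v).im := by
    intro v
    have h1 : HasFDerivAt (fun z => r (P z).1) (ℓ.comp ((ContinuousLinearMap.fst ℝ E (E →L[ℂ] ℂ)).comp (fderiv ℝ P (0, 0)))) (0, 0) := by
      refine HasFDerivAt.comp (f := fun z => (P z).1) ((0 : E), (0 : E)) ?_ ((ContinuousLinearMap.fst ℝ E (E →L[ℂ] ℂ)).hasFDerivAt.comp ((0:E), (0:E)) (hPd (0, 0)))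
      change HasFDerivAt r ℓ (P (0, 0)).1
      rw [hP00]; exact (h.diff p).hasFDerivAt
    rw [h1.fderiv]
    change ℓ (fderiv ℝ P (0, 0) (0, v)).1 = _
    rw [hD, map_zero, zero_smul, sub_zero, zero_add, smul_sub, map_sub, lam_im, neg_neg, show I • (ℓ v • n) = ℓ v • (I • n) from smul_comm _ _ _, map_smul ℓ (ℓ v), hℓin]; simp
    rfl
  have hm : ContDiff ℝ (⊤ : ℕ∞) fun z => (P z).2 - lam r (P z).1 := (contDiff_snd.comp hP).sub ((lam_smooth h.smooth).comp (contDiff_fst.comp hP))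
  set u0 : E := I • n with hu0
  set K : ℝ := ‖u0‖ + 1 with hK
  have hK0 : 0 < K := by positivity
  obtain ⟨ε1, hε1, h1⟩ := strict_y (a := (0 : E)) (hR.contDiffAt.of_le (by exact_mod_cast le_top)) (η := 1 / (4 * K)) (by positivity)
  obtain ⟨ε2, hε2, h2⟩ := strict_y (a := (0 : E)) (hm.contDiffAt.of_le (by exact_mod_cast le_top)) (η := 1) (by positivity)
  set D := fderiv ℝ (fun z => (P z).2 - lam r (P z).1) ((0 : E), (0 : E)) with hDdef
  set ε := min 1 (min (min (ε1 / K) (ε2 / K)) (min (min ε1 ε2) (min (ε0 / (‖π‖ + 1)) (1 / (8 * M))))) with hε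
  have hM := h.M_pos
  have hεpos : 0 < ε := by positivity
  have l1 : ε ≤ 1 := min_le_left _ _
  have l2 : ε ≤ ε1 / K := (min_le_right _ _).trans ((min_le_left _ _).trans (min_le_left _ _))
  have l3 : ε ≤ ε2 / K := (min_le_right _ _).trans ((min_le_left _ _).trans (min_le_right _ _))
  have l4 : ε ≤ ε1 := (min_le_right _ _).trans ((min_le_right _ _).trans ((min_le_left _ _).trans (min_le_left _ _)))
  have l5 : ε ≤ ε2 := (min_le_right _ _).trans ((min_le_right _ _).trans ((min_le_left _ _).trans (min_le_right _ _)))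
  have l6 : ε ≤ ε0 / (‖π‖ + 1) := (min_le_right _ _).trans ((min_le_right _ _).trans ((min_le_right _ _).trans (min_le_left _ _)))
  have l7 : ε ≤ 1 / (8 * M) := (min_le_right _ _).trans ((min_le_right _ _).trans ((min_le_right _ _).trans (min_le_right _ _)))
  refine ⟨P, hP, hP00, ⟨C, hPC⟩, hD, ε, hεpos, (‖D‖ + 1) * K, fun x y τ hx hτ hy => ?_⟩
  have hyn : ‖y‖ ≤ K * |τ| := by
    have e : y = (y - τ • u0) + τ • u0 := by abel
    rw [e]
    refine (norm_add_le _ _).trans ?_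
    rw [norm_smul, Real.norm_eq_abs, hK]
    nlinarith [abs_nonneg τ]
  have hy1 : ‖y‖ < ε1 := by
    rw [le_div_iff₀ hK0] at l2; nlinarith
  have hy2 : ‖y‖ < ε2 := by
    rw [le_div_iff₀ hK0] at l3; nlinarith
  have hbx : P (x, 0) = (σ (π x), lam r (σ (π x))) := by rw [hP0]
  have hr0 : r (P (x, 0)).1 = 0 := by
    rw [hbx]
    have : ‖π x‖ < ε0 := by
      rw [le_div_iff₀ (by positivity)] at l6
      have := π.le_opNorm x
      have h5 : ‖π‖ * ‖x‖ ≤ (‖π‖ + 1) * ‖x‖ := by nlinarith [norm_nonneg x]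
      nlinarith [norm_nonneg π]
    rw [(hc1 _ this).2]; exact hℓπ x
  constructor
  · have h3 := h1 x y (by simpa using hx.trans_le l4) hy1
    rw [hr0, hRd, Real.norm_eq_abs, sub_zero, sub_neg_eq_add] at h3
    have h4 : (lam r p y).im = τ + (lam r p (y - τ • u0)).im := by
      have : lam r p (τ • u0) = (τ : ℂ) * I := by
        rw [hu0, ← rsmul_eq, map_smul, map_smul, hn]; simp
      rw [map_sub, this]; simp
    have h5 : |(lam r p (y - τ • u0)).im| ≤ |τ| / 4 := by
      refine (Complex.abs_im_le_norm _).trans ((h.lam_app_le p _).trans ?_)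
      rw [le_div_iff₀ (by positivity)] at l7
      have h6 : 2 * M * ‖y - τ • u0‖ ≤ 2 * M * (ε * |τ|) := by gcongr
      nlinarith [abs_nonneg τ]
    have h6 : 1 / (4 * K) * ‖y‖ ≤ |τ| / 4 := by
      rw [div_mul_eq_mul_div, div_le_div_iff₀ (by positivity) (by positivity)]; nlinarith
    rw [h4] at h3
    rw [abs_le] at h3 h5 ⊢
    constructor <;> linarith [h3.1, h3.2, h5.1, h5.2]
  · have h3 := h2 x y (by simpa using hx.trans_le l5) hy2
    have h4 : (P (x, 0)).2 - lam r (P (x, 0)).1 = 0 := by rw [hbx]; simp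
    rw [h4, sub_zero] at h3
    have h5 : ‖D (0, y)‖ ≤ ‖D‖ * ‖y‖ := by
      refine (D.le_opNorm _).trans (le_of_eq ?_); simp [Prod.norm_def]
    have h6 := norm_le_norm_sub_add ((P (x, y)).2 - lam r (P (x, y)).1) (D (0, y))
    have h7 : (‖D‖ + 1) * ‖y‖ ≤ (‖D‖ + 1) * (K * |τ|) := by gcongr
    linarith
end Src
end

section
section Tgt
variable {E : Type} [NormedAddCommGroup E] [InnerProductSpace ℂ E] [FiniteDimensional ℂ E] [NormedSpace ℝ E] [IsScalarTower ℝ ℂ E]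

def kap (r : E → ℝ) (n z : E) : E →L[ℂ] ℂ := (lam r z n)⁻¹ • lam r z

lemma finrank_dual : Module.finrank ℝ (E × E) = Module.finrank ℝ (E × (E →L[ℂ] ℂ)) := by
  haveI : FiniteDimensional ℝ E := real_fd
  haveI : FiniteDimensional ℝ (E →L[ℂ] ℂ) := FiniteDimensional.trans ℝ ℂ _
  rw [Module.finrank_prod, Module.finrank_prod]
  congr 1
  have h1 : Module.finrank ℂ (E →L[ℂ] ℂ) = Module.finrank ℂ E := by
    rw [← (LinearMap.toContinuousLinearMap (𝕜 := ℂ) (E := E) (F' := ℂ)).finrank_eq]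
    exact Subspace.dual_finrank_eq
  rw [← Module.finrank_mul_finrank ℝ ℂ E, ← Module.finrank_mul_finrank ℝ ℂ (E →L[ℂ] ℂ), h1]

/-- smooth global version of `kap` -/
lemma exists_kap {r : E → ℝ} (hr : ContDiff ℝ (⊤ : ℕ∞) r) {q n : E} (hn : lam r q n = 1) :
    ∃ κ : E → (E →L[ℂ] ℂ), ContDiff ℝ (⊤ : ℕ∞) κ ∧ κ q = lam r q ∧ ∃ ε > 0, ∀ z, ‖z - q‖ < ε → κ z = kap r n z ∧ 1 / 2 ≤ ‖lam r z n‖ := by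
  haveI : FiniteDimensional ℝ E := real_fd
  have h1 : ContDiff ℝ (⊤ : ℕ∞) fun z => lam r z n :=
    ((ContinuousLinearMap.apply ℂ ℂ n).restrictScalars ℝ).contDiff.comp (lam_smooth hr)
  have h2 : ∀ᶠ z in nhds q, 1 / 2 < ‖lam r z n‖ := by
    refine h1.continuous.norm.continuousAt.eventually (lt_mem_nhds ?_)
    simp only [hn]; norm_num
  obtain ⟨ε, hε, hb⟩ := Metric.eventually_nhds_iff.1 h2
  have h3 : ∀ z, ‖z - q‖ < ε → ContDiffAt ℝ (⊤ : ℕ∞) (kap r n) z := by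
    intro z hz
    have h4 : lam r z n ≠ 0 := by
      intro h0
      have := hb (show dist z q < ε by rwa [dist_eq_norm])
      rw [h0] at this; norm_num at this
    exact (h1.contDiffAt.inv h4).smul (lam_smooth hr).contDiffAt
  obtain ⟨κ, hκ, hκe⟩ := globalize hε h3
  refine ⟨κ, hκ, ?_, ε / 3, by positivity, fun z hz => ⟨hκe z hz, (hb (show dist z q < ε by rw [dist_eq_norm]; linarith)).le⟩⟩
  rw [hκe q (by simp; positivity), kap, hn]; simp

lemma kap_fderiv {r : E → ℝ} (hr : ContDiff ℝ (⊤ : ℕ∞) r) {q n : E} (hn : lam r q n = 1) {κ : E → (E →L[ℂ] ℂ)} (hκ : ContDiff ℝ (⊤ : ℕ∞) κ)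
    (hκq : κ q = lam r q) {ε : ℝ} (hε : 0 < ε) (hk : ∀ z, ‖z - q‖ < ε → κ z = kap r n z ∧ 1 / 2 ≤ ‖lam r z n‖) (v u : E) (hu : lam r q u = 0) :
    fderiv ℝ κ q v n = 0 ∧ fderiv ℝ κ q v u = (D2 r q v u : ℂ) - I * (D2 r q v (I • u) : ℂ) := by
  have hev : ∀ᶠ z in nhds q, κ z = kap r n z ∧ lam r z n ≠ 0 := by
    refine Metric.eventually_nhds_iff.2 ⟨ε, hε, fun z hz => ?_⟩
    obtain ⟨h1, h2⟩ := hk z (by rwa [← dist_eq_norm])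
    exact ⟨h1, fun h0 => by rw [h0] at h2; norm_num at h2⟩
  have hκd : HasFDerivAt κ (fderiv ℝ κ q) q := ((hκ.differentiable (by simp)) q).hasFDerivAt
  have ev : ∀ w : E, HasFDerivAt (fun z => κ z w) (((ContinuousLinearMap.apply ℂ ℂ w).restrictScalars ℝ).comp (fderiv ℝ κ q)) q := fun w =>
    ((ContinuousLinearMap.apply ℂ ℂ w).restrictScalars ℝ).hasFDerivAt.comp q hκd
  have hfr : HasFDerivAt (fderiv ℝ r) (fderiv ℝ (fderiv ℝ r) q) q := (diff_fderiv (hr.contDiffAt.of_le two_le_top)).hasFDerivAt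
  have hl : HasFDerivAt (lam r) (lamL.comp (fderiv ℝ (fderiv ℝ r) q)) q := lamL.hasFDerivAt.comp q hfr
  have evl : ∀ w : E, HasFDerivAt (fun z => lam r z w) (((ContinuousLinearMap.apply ℂ ℂ w).restrictScalars ℝ).comp (lamL.comp (fderiv ℝ (fderiv ℝ r) q))) q := fun w =>
    ((ContinuousLinearMap.apply ℂ ℂ w).restrictScalars ℝ).hasFDerivAt.comp q hl
  constructor
  · have h1 : HasFDerivAt (fun z => κ z n) (0 : E →L[ℝ] ℂ) q := by
      refine (hasFDerivAt_const (1 : ℂ) q).congr_of_eventuallyEq ?_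
      filter_upwards [hev] with z hz
      rw [hz.1, kap]; simp [hz.2]
    exact congrArg (fun L => L v) ((ev n).unique h1)
  · have h1 := (evl n).mul (ev u)
    have h2 : HasFDerivAt (fun z => lam r z u) _ q := h1.congr_of_eventuallyEq (by
      filter_upwards [hev] with z hz
      simp only [Pi.mul_apply]
      rw [hz.1, kap]; simp [hz.2])
    have h3 := congrArg (fun L => L v) ((evl u).unique h2)
    simp only [add_apply, smul_apply, hn, hκq, hu, one_smul, zero_smul, add_zero] at h3
    exact h3.symm

set_option maxHeartbeats 1000000 in
theorem target_AE {Ω : Set E} {r : E → ℝ} {δ0 c M : ℝ} (h : SPD Ω r δ0 c M) {q n : E} (hq : r q = 0) (hn : lam r q n = 1) {N : ℕ} (hN : 1 ≤ N) :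
    ∃ P : E × E → E × (E →L[ℂ] ℂ), ContDiff ℝ (⊤ : ℕ∞) P ∧ P (0, 0) = (q, lam r q) ∧
      (∃ C, ∀ x y v, ‖x‖ ≤ 1 → ‖fderiv ℝ P (x, y) (0, v) - I • fderiv ℝ P (x, y) (v, 0)‖ ≤ C * ‖y‖ ^ N * ‖v‖) ∧
      ∃ Θ : E × (E →L[ℂ] ℂ) → E × E, ContDiff ℝ (⊤ : ℕ∞) Θ ∧ Θ (q, lam r q) = (0, 0) ∧
      ∃ ε > 0, (∀ X, ‖X - (0, 0)‖ < ε → Θ (P X) = X) ∧ (∀ W, ‖W - (q, lam r q)‖ < ε → P (Θ W) = W) ∧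
        ∃ C, ∀ w ν, ‖(w, ν) - (q, lam r q)‖ < ε → ‖(Θ (w, ν)).2‖ ≤ C * (|r w| + ‖ν - kap r n w‖) := by
  haveI : FiniteDimensional ℝ E := real_fd
  haveI : FiniteDimensional ℝ (E →L[ℂ] ℂ) := FiniteDimensional.trans ℝ ℂ _
  set ℓ := fderiv ℝ r q with hℓ
  have hℓn : ℓ n = 1 := by rw [hℓ, ← lam_re, hn]; simp
  obtain ⟨σ, F, hσ, hF, hσ0, hFq, hσ', hFr, ε0, hε0, hc1, hc2⟩ := exists_chart h hq hℓn
  set π : E →L[ℝ] E := ContinuousLinearMap.id ℝ E - ℓ.smulRight n with hπ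
  have hπa : ∀ v, π v = v - ℓ v • n := fun v => by simp [hπ]
  have hℓπ : ∀ v, ℓ (π v) = 0 := fun v => by rw [hπa]; simp [hℓn]
  have hππ : ∀ v, π (π v) = π v := fun v => by rw [hπa (π v), hℓπ]; simp
  obtain ⟨κ, hκ, hκq, ε1, hε1, hk⟩ := exists_kap h.smooth hn
  set b : E → E × (E →L[ℂ] ℂ) := fun y => (σ (π y), (1 + ℓ y) • κ (σ (π y))) with hb
  have hσπ : ContDiff ℝ (⊤ : ℕ∞) fun y => σ (π y) := hσ.comp π.contDiff
  have hbs : ContDiff ℝ (⊤ : ℕ∞) b :=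
    hσπ.prodMk ((contDiff_const.add ℓ.contDiff).smul (hκ.comp hσπ))
  obtain ⟨P, hP, hP0, C, hPC⟩ := exists_AE hbs N
  have hP00 : P (0, 0) = (q, lam r q) := by rw [hP0]; simp [hb, hσ0, hκq]
  have hPd : ∀ z, HasFDerivAt P (fderiv ℝ P z) z := fun z => ((hP.differentiable (by simp)) z).hasFDerivAt
  have hDx : ∀ a, fderiv ℝ P (0, 0) (a, 0) = (π a, ℓ a • lam r q + fderiv ℝ κ q (π a)) := by
    intro a
    have h1 : HasFDerivAt (fun x : E => P (x, 0)) ((fderiv ℝ P (0, 0)).comp (ContinuousLinearMap.inl ℝ E E)) 0 :=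
      HasFDerivAt.comp (g := P) (f := ContinuousLinearMap.inl ℝ E E) (0:E) (hPd (0, 0)) (ContinuousLinearMap.inl ℝ E E).hasFDerivAt
    have e : (fun x : E => P (x, 0)) = b := funext fun x => by rw [hP0]
    rw [e] at h1
    have h3 : HasFDerivAt (fun y => σ (π y)) ((ContinuousLinearMap.id ℝ E).comp π) 0 := by
      refine HasFDerivAt.comp (0:E) ?_ π.hasFDerivAt
      rw [map_zero, ← hσ']
      exact ((hσ.differentiable (by simp)) _).hasFDerivAt
    have h4 : HasFDerivAt (fun y => κ (σ (π y))) ((fderiv ℝ κ q).comp ((ContinuousLinearMap.id ℝ E).comp π)) 0 := by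
      refine HasFDerivAt.comp (f := fun y => σ (π y)) (0:E) ?_ h3
      have e : σ (π 0) = q := by simp [hσ0]
      rw [e]; exact ((hκ.differentiable (by simp)) q).hasFDerivAt
    have h5 : HasFDerivAt (fun y => 1 + ℓ y) ℓ 0 := ℓ.hasFDerivAt.const_add 1
    have h2 := h3.prodMk (h5.smul h4)
    have := congrArg (fun L => L a) (h1.unique h2)
    simp only [ContinuousLinearMap.comp_apply, ContinuousLinearMap.inl_apply] at this
    rw [this]
    simp [hσ0, hκq, add_comm]
  have hinj : ∀ v, fderiv ℝ P (0, 0) v = 0 → v = 0 := by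
    rintro ⟨a, b⟩ hab
    have e : ((a, b) : E × E) = (a, 0) + (0, b) := by simp
    rw [e, map_add, fderiv_snd_of_AE hN hPC 0 b (by simp), hDx, hDx] at hab
    have i1 : π a + I • π b = 0 := congrArg Prod.fst hab
    have i2 : ℓ a • lam r q + fderiv ℝ κ q (π a) + I • (ℓ b • lam r q + fderiv ℝ κ q (π b)) = 0 := congrArg Prod.snd hab
    set u := π b with hu
    have hπau : π a = -(I • u) := eq_neg_of_add_eq_zero_left i1
    have hlu : lam r q u = 0 := by
      apply Complex.ext
      · rw [lam_re]; simpa using hℓπ b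
      · rw [lam_im]
        have : ℓ (π a) = 0 := hℓπ a
        rw [hπau, map_neg] at this
        simpa using this
    have hk1 := fun v => kap_fderiv h.smooth hn hκ hκq hε1 hk v u hlu
    rw [hπau, map_neg] at i2
    have i3 := congrArg (fun L : E →L[ℂ] ℂ => L n) i2
    simp only [add_apply, smul_apply, neg_apply, (hk1 _).1, hn] at i3
    simp only [zero_apply, neg_zero, add_zero, Complex.real_smul, mul_one, smul_eq_mul] at i3
    have ha0 : ℓ a = 0 := by have := congrArg Complex.re i3; simpa using this
    have hb0 : ℓ b = 0 := by have := congrArg Complex.im i3; simpa using this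
    have i4 := congrArg (fun L : E →L[ℂ] ℂ => L u) i2
    simp only [add_apply, smul_apply, neg_apply, (hk1 _).2, hlu] at i4
    simp only [zero_apply, smul_zero, zero_add, smul_eq_mul] at i4
    have i5 := congrArg Complex.im i4
    simp at i5
    have hlev := h.lev q u (by rw [hq, abs_zero]; exact h.δ0_pos.le)
    have hL0 : Lev r q u = 0 := by unfold Lev; linarith
    rw [hL0] at hlev
    have hu0 : u = 0 := by
      have : ‖u‖ ^ 2 ≤ 0 := by
        have := h.c_pos
        by_contra hcon
        push Not at hcon
        nlinarith
      exact norm_eq_zero.1 (pow_eq_zero_iff (two_ne_zero) |>.1 (le_antisymm this (by positivity)))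
    have hbz : b = 0 := by have := hπa b; rw [hb0, zero_smul, sub_zero] at this; rw [← this, ← hu, hu0]
    have haz : a = 0 := by have := hπa a; rw [ha0, zero_smul, sub_zero, hπau, hu0] at this; rw [← this]; simp
    rw [hbz, haz]; rfl
  obtain ⟨Θ, hΘ, hΘ0, ε2, hε2, hΘ1, hΘ2⟩ := loc_inv hP (0, 0) finrank_dual hinj
  rw [hP00] at hΘ0 hΘ1
  -- Lipschitz constants
  obtain ⟨L1, t1, ht1, hL1⟩ := (hΘ.contDiffAt (x := (q, lam r q))).of_le (m := 1) (by exact_mod_cast le_top) |>.exists_lipschitzOnWith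
  obtain ⟨L2, t2, ht2, hL2⟩ := (hσ.contDiffAt (x := (0 : E))).of_le (m := 1) (by exact_mod_cast le_top) |>.exists_lipschitzOnWith
  obtain ⟨L3, t3, ht3, hL3⟩ := (hκ.contDiffAt (x := q)).of_le (m := 1) (by exact_mod_cast le_top) |>.exists_lipschitzOnWith
  have hFc := hF.continuous
  have hσc := hσ.continuous
  have cw : Continuous fun W : E × (E →L[ℂ] ℂ) => F W.1 := hFc.comp continuous_fst
  have cπ : Continuous fun W : E × (E →L[ℂ] ℂ) => π (F W.1) := π.continuous.comp cw
  have cσ : Continuous fun W : E × (E →L[ℂ] ℂ) => σ (π (F W.1)) := hσc.comp cπ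
  have cP : Continuous fun W : E × (E →L[ℂ] ℂ) => P (π (F W.1), 0) := hP.continuous.comp (cπ.prodMk continuous_const)
  have hev : ∀ᶠ W : E × (E →L[ℂ] ℂ) in nhds (q, lam r q), W ∈ t1 ∧ P (π (F W.1), 0) ∈ t1 ∧ F W.1 ∈ t2 ∧ π (F W.1) ∈ t2 ∧ W.1 ∈ t3 ∧ σ (π (F W.1)) ∈ t3
      ∧ ‖((π (F W.1), (0:E)) : E × E) - (0, 0)‖ < ε2 ∧ ‖W.1 - q‖ < ε1 ∧ ‖W.1 - q‖ < ε0 := by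
    have e0 : π (F q) = 0 := by simp [hFq]
    have f1 : ∀ᶠ W : E × (E →L[ℂ] ℂ) in nhds (q, lam r q), W ∈ t1 := ht1
    refine f1.and ((cP.continuousAt.eventually_mem (s := t1) ?_).and ((cw.continuousAt.eventually_mem ?_).and ((cπ.continuousAt.eventually_mem ?_).and
      ((continuous_fst.continuousAt.eventually_mem ?_).and ((cσ.continuousAt.eventually_mem ?_).and (?_)))))) 
    · simpa only [e0, hP00] using ht1
    · simpa only [hFq] using ht2
    · simpa only [e0] using ht2
    · exact ht3
    · simpa only [e0, hσ0] using ht3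
    · refine Filter.Eventually.and ?_ (Filter.Eventually.and ?_ ?_)
      · have : Continuous fun W : E × (E →L[ℂ] ℂ) => ‖((π (F W.1), (0:E)) : E × E) - (0, 0)‖ := ((cπ.prodMk continuous_const).sub continuous_const).norm
        refine this.continuousAt.eventually (gt_mem_nhds ?_)
        simp [hFq, hε2]
      · have : Continuous fun W : E × (E →L[ℂ] ℂ) => ‖W.1 - q‖ := by fun_prop
        exact this.continuousAt.eventually (gt_mem_nhds (by simp [hε1]))
      · have : Continuous fun W : E × (E →L[ℂ] ℂ) => ‖W.1 - q‖ := by fun_prop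
        exact this.continuousAt.eventually (gt_mem_nhds (by simp [hε0]))
  obtain ⟨ε3, hε3, hb3⟩ := Metric.eventually_nhds_iff.1 hev
  refine ⟨P, hP, hP00, ⟨C, hPC⟩, Θ, hΘ, hΘ0, min ε2 ε3, by positivity, fun X hX => hΘ2 X (hX.trans_le (min_le_left _ _)), fun W hW => hΘ1 W (hW.trans_le (min_le_left _ _)),
    L1 * (L2 * ‖n‖ + L3 * (L2 * ‖n‖) + 1), fun w ν hw => ?_⟩
  obtain ⟨g1, g2, g3, g4, g5, g6, g7, g8, g9⟩ := hb3 (show dist (w, ν) (q, lam r q) < ε3 by rw [dist_eq_norm]; exact hw.trans_le (min_le_right _ _))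
  simp only at g2 g3 g4 g5 g6 g7 g8 g9
  set w' := σ (π (F w)) with hw'
  have k1 : ‖w - w'‖ ≤ L2 * ‖n‖ * |r w| := by
    have := hL2.norm_sub_le g3 g4
    rw [hc2 w g9] at this
    refine this.trans (le_of_eq ?_)
    rw [hπa, sub_sub_cancel, hFr, norm_smul, Real.norm_eq_abs]; ring
  have k2 : ‖kap r n w - κ w'‖ ≤ L3 * (L2 * ‖n‖ * |r w|) := by
    rw [← (hk w g8).1]
    refine (hL3.norm_sub_le g5 g6).trans ?_
    gcongr
  have k3 : P (π (F w), 0) = (w', κ w') := by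
    rw [hP0]; simp only [hb, hππ, hℓπ, add_zero, one_smul, hw']
  have k4 := hL1.norm_sub_le g1 g2
  rw [hΘ2 _ g7, k3] at k4
  have k5 : ‖(Θ (w, ν)).2‖ ≤ ‖Θ (w, ν) - (π (F w), 0)‖ := by
    have := norm_snd_le (Θ (w, ν) - (π (F w), 0)); simpa using this
  refine k5.trans (k4.trans ?_)
  have k6 : ‖((w, ν) : E × (E →L[ℂ] ℂ)) - (w', κ w')‖ ≤ (L2 * ‖n‖ + L3 * (L2 * ‖n‖) + 1) * (|r w| + ‖ν - kap r n w‖) := by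
    rw [Prod.mk_sub_mk, Prod.norm_mk]
    have k7 : ‖ν - κ w'‖ ≤ ‖ν - kap r n w‖ + ‖kap r n w - κ w'‖ := norm_sub_le_norm_sub_add_norm_sub _ _ _
    have a1 := abs_nonneg (r w)
    have a2 := norm_nonneg (ν - kap r n w)
    have a3 : 0 ≤ (L2 : ℝ) * ‖n‖ := by positivity
    have a4 : 0 ≤ (L3 : ℝ) * (L2 * ‖n‖) := by positivity
    have a5 := mul_nonneg a3 a2
    have a6 := mul_nonneg a4 a2
    have a7 := mul_nonneg a3 a1
    have a8 := mul_nonneg a4 a1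
    refine max_le ?_ ?_
    · refine k1.trans ?_; nlinarith
    · refine k7.trans ?_; nlinarith
  calc _ ≤ (L1 : ℝ) * ((L2 * ‖n‖ + L3 * (L2 * ‖n‖) + 1) * (|r w| + ‖ν - kap r n w‖)) := by gcongr
    _ = _ := by ring
end Tgt
end

section
section Phat
variable {E : Type} [NormedAddCommGroup E] [InnerProductSpace ℂ E] [FiniteDimensional ℂ E] [NormedSpace ℝ E] [IsScalarTower ℝ ℂ E]
variable {Ω₁ Ω₂ : Set E} {r₁ r₂ : E → ℝ} {δ0 c M C : ℝ} {φ ψ : E → E}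

def pnu (φ ψ : E → E) (W : E × (E →L[ℂ] ℂ)) : E →L[ℂ] ℂ := W.2.comp (fderiv ℂ ψ (φ W.1))
def phat (φ ψ : E → E) (n : E) (W : E × (E →L[ℂ] ℂ)) : E × (E →L[ℂ] ℂ) := (φ W.1, (pnu φ ψ W n)⁻¹ • pnu φ ψ W)

lemma phat_diff (h : BH Ω₁ Ω₂ r₁ r₂ δ0 c M φ ψ) {n : E} {W : E × (E →L[ℂ] ℂ)} (hz : W.1 ∈ Ω₁) (hW : pnu φ ψ W n ≠ 0) :
    DifferentiableAt ℂ (phat φ ψ n) W := by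
  have h1 : DifferentiableAt ℂ φ W.1 := (h.hφ _ hz).differentiableAt (h.s1.isOpen.mem_nhds hz)
  have h2 : DifferentiableAt ℂ (fderiv ℂ ψ) (φ W.1) := (holo_fderiv h.s2.isOpen h.hψ _ (h.mφ hz)).differentiableAt (h.s2.isOpen.mem_nhds (h.mφ hz))
  have h3 : DifferentiableAt ℂ (fun W : E × (E →L[ℂ] ℂ) => φ W.1) W := h1.comp W differentiableAt_fst
  have h4 : DifferentiableAt ℂ (fun W : E × (E →L[ℂ] ℂ) => fderiv ℂ ψ (φ W.1)) W := DifferentiableAt.comp (f := fun W : E × (E →L[ℂ] ℂ) => φ W.1) W h2 h3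
  have h5 : DifferentiableAt ℂ (pnu φ ψ) W := differentiableAt_snd.clm_comp h4
  have h6 : DifferentiableAt ℂ (fun W => pnu φ ψ W n) W := h5.clm_apply (differentiableAt_const _)
  exact h3.prodMk ((h6.inv hW).smul h5)

set_option maxHeartbeats 1000000 in
theorem phat_est (h : BH Ω₁ Ω₂ r₁ r₂ δ0 c M φ ψ) (hC : 1 ≤ C) (hE : Est Ω₁ r₁ r₂ φ C) (hE' : Est Ω₂ r₂ r₁ ψ C)
    {q n : E} (hn : lam r₂ q n = 1) (hnc : ‖n‖ ≤ 2 / c) (K : ℝ) :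
    ∃ ε > 0, ∃ C', ∀ z μ, z ∈ Ω₁ → ‖φ z - q‖ < ε → -r₁ z < ε → ‖μ - lam r₁ z‖ ≤ K * (-r₁ z) →
      pnu φ ψ (z, μ) n ≠ 0 ∧ ‖phat φ ψ n (z, μ)‖ ≤ C' ∧ ‖(phat φ ψ n (z, μ)).2 - kap r₂ n (φ z)‖ ≤ C' * √(-r₁ z) := by
  have hc := h.s1.c_pos
  have hM := h.s1.M_pos
  have h' : BH Ω₁ Ω₂ r₁ r₂ δ0 (c / 2) M φ ψ :=
    { h with
      s1 := h.s1.mono h.s1.δ0_pos le_rfl (by positivity) (by linarith) le_rfl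
      s2 := h.s2.mono h.s1.δ0_pos le_rfl (by positivity) (by linarith) le_rfl }
  obtain ⟨c', hc', d0, hd0, hrig⟩ := rig_c h' hC hE hE'
  obtain ⟨κ, hκ, hκq, ε1, hε1, hk⟩ := exists_kap h.s2.smooth hn
  set K' : ℝ := |K| * C * C with hK'
  have hK'0 : 0 ≤ K' := by positivity
  set ε : ℝ := min (min ε1 (d0 / C)) (min 1 ((c' / (4 * (K' * ‖n‖ + 1))) ^ 2)) with hε
  have hεp : 0 < ε := by positivity
  set B : ℝ := C * C + K' with hB
  have hB0 : 0 ≤ B := by positivity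
  set C1 : ℝ := 4 / c' * (B * (1 + 4 * M * ‖n‖)) with hC1
  have hC10 : 0 ≤ C1 := by positivity
  refine ⟨ε, hεp, M + 4 * M + C1, fun z μ hz hzq hrz hμ => ?_⟩
  have l1 : ε ≤ ε1 := (min_le_left _ _).trans (min_le_left _ _)
  have l2 : ε ≤ d0 / C := (min_le_left _ _).trans (min_le_right _ _)
  have l3 : ε ≤ 1 := (min_le_right _ _).trans (min_le_left _ _)
  have l4 : ε ≤ (c' / (4 * (K' * ‖n‖ + 1))) ^ 2 := (min_le_right _ _).trans (min_le_right _ _)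
  set w := φ z with hw
  have hwΩ : w ∈ Ω₂ := h.mφ hz
  have hψw : ψ w = z := h.li z hz
  have t0 : 0 < -r₁ z := by have := (h.s1.mem_iff z).1 hz; linarith
  have tw0 : 0 < -r₂ w := by have := (h.s2.mem_iff w).1 hwΩ; linarith
  set s := √(-r₁ z) with hs
  have hs0 : 0 < s := Real.sqrt_pos.2 t0
  have hss : s * s = -r₁ z := Real.mul_self_sqrt t0.le
  set sw := √(-r₂ w) with hsw
  have hsw0 : 0 < sw := Real.sqrt_pos.2 tw0
  have hsws : sw * sw = -r₂ w := Real.mul_self_sqrt tw0.le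
  have e1 := hE.e1 z hz
  have e2 := hE.e2 z hz
  have sle : s ≤ C * sw := by
    refine abs_le_of_sq_le_sq' ?_ (by positivity) |>.2
    nlinarith
  have swle : sw ≤ C * s := by
    refine abs_le_of_sq_le_sq' ?_ (by positivity) |>.2
    nlinarith
  have s1 : s ≤ 1 := by rw [hs]; exact Real.sqrt_le_one.2 (by linarith)
  -- bound on perturbation
  have hpert : ∀ t, ‖(μ - lam r₁ z) (fderiv ℂ ψ w t)‖ ≤ K' * s * ‖t‖ := by
    intro t
    have a1 := (μ - lam r₁ z).le_of_opNorm_le hμ (fderiv ℂ ψ w t)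
    have a2 := hE'.g w hwΩ t
    rw [← hsw] at a2
    have a3 : K * (-r₁ z) ≤ |K| * (-r₁ z) := by gcongr; exact le_abs_self K
    have a4 : s * ‖fderiv ℂ ψ w t‖ ≤ C * (C * ‖t‖) := by
      calc s * ‖fderiv ℂ ψ w t‖ ≤ C * sw * ‖fderiv ℂ ψ w t‖ := by gcongr
        _ = C * (sw * ‖fderiv ℂ ψ w t‖) := by ring
        _ ≤ _ := by gcongr
    calc _ ≤ K * (-r₁ z) * ‖fderiv ℂ ψ w t‖ := a1
      _ ≤ |K| * (s * s) * ‖fderiv ℂ ψ w t‖ := by rw [hss]; gcongr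
      _ = |K| * s * (s * ‖fderiv ℂ ψ w t‖) := by ring
      _ ≤ |K| * s * (C * (C * ‖t‖)) := by gcongr
      _ = _ := by rw [hK']; ring
  have hnu : ∀ t, pnu φ ψ (z, μ) t = lam r₁ z (fderiv ℂ ψ w t) + (μ - lam r₁ z) (fderiv ℂ ψ w t) := by
    intro t; simp [pnu, hw]
  obtain ⟨hkw, hlw⟩ := hk w (hzq.trans_le l1)
  have hl0 : lam r₂ w n ≠ 0 := fun h0 => by rw [h0] at hlw; norm_num at hlw
  -- lower bound
  have hlow : c' / 4 ≤ ‖pnu φ ψ (z, μ) n‖ := by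
    have b1 := hrig w hwΩ (by rw [le_div_iff₀ (by linarith)] at l2; nlinarith) ((lam r₂ w n)⁻¹ • n) (by simp [hl0]) (by
      rw [norm_smul, norm_inv]
      have : ‖lam r₂ w n‖⁻¹ ≤ 2 := by
        rw [inv_le_comm₀ (by linarith) (by norm_num)]; linarith
      calc _ ≤ 2 * (2 / c) := by gcongr
        _ = _ := by field_simp)
    rw [hψw, map_smul, map_smul, norm_smul, norm_inv, inv_mul_eq_div, le_div_iff₀ (by linarith)] at b1
    have b2 : K' * s * ‖n‖ ≤ c' / 4 := by
      have : s ≤ c' / (4 * (K' * ‖n‖ + 1)) := by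
        refine abs_le_of_sq_le_sq' ?_ (by positivity) |>.2
        nlinarith
      rw [le_div_iff₀ (by positivity)] at this
      nlinarith
    have b3 := hpert n
    have b4 := norm_sub_le (pnu φ ψ (z, μ) n) ((μ - lam r₁ z) (fderiv ℂ ψ w n))
    rw [hnu n, add_sub_cancel_right, ← hnu n] at b4
    nlinarith
  have hne : pnu φ ψ (z, μ) n ≠ 0 := fun h0 => by rw [h0, norm_zero] at hlow; linarith
  have hkn : ‖kap r₂ n w‖ ≤ 4 * M := by
    rw [kap, norm_smul, norm_inv]
    have : ‖lam r₂ w n‖⁻¹ ≤ 2 := by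
      rw [inv_le_comm₀ (by linarith) (by norm_num)]; linarith
    calc _ ≤ 2 * (2 * M) := by gcongr; exact h.s2.lam_le w
      _ = _ := by ring
  have hdiff : ‖(phat φ ψ n (z, μ)).2 - kap r₂ n w‖ ≤ C1 * s := by
    refine ContinuousLinearMap.opNorm_le_bound _ (by positivity) fun v => ?_
    set t := v - kap r₂ n w v • n with ht
    have ht0 : lam r₂ w t = 0 := by
      rw [ht, map_sub, map_smul]; simp [kap]; field_simp; simp
    have f1 : ((phat φ ψ n (z, μ)).2 - kap r₂ n w) v = (pnu φ ψ (z, μ) n)⁻¹ * pnu φ ψ (z, μ) t := by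
      rw [ht, map_sub, map_smul]
      simp only [phat, sub_apply, smul_apply, smul_eq_mul]
      field_simp
    have f2 : ‖t‖ ≤ (1 + 4 * M * ‖n‖) * ‖v‖ := by
      refine (norm_sub_le _ _).trans ?_
      rw [norm_smul]
      have := (kap r₂ n w).le_of_opNorm_le hkn v
      nlinarith [norm_nonneg n, mul_le_mul_of_nonneg_right this (norm_nonneg n)]
    have f3 : ‖pnu φ ψ (z, μ) t‖ ≤ B * s * ‖t‖ := by
      rw [hnu t]
      refine (norm_add_le _ _).trans ?_
      have g1 := hE'.tn w hwΩ t ht0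
      rw [hψw, ← hsw] at g1
      have g2 := hpert t
      have g3 : C * sw * ‖t‖ ≤ C * (C * s) * ‖t‖ := by gcongr
      rw [hB]; nlinarith
    rw [f1, norm_mul, norm_inv]
    have f4 : ‖pnu φ ψ (z, μ) n‖⁻¹ ≤ 4 / c' := by
      rw [inv_le_comm₀ (by linarith) (by positivity), inv_div]; exact hlow
    calc _ ≤ 4 / c' * (B * s * ((1 + 4 * M * ‖n‖) * ‖v‖)) := by
          gcongr
          exact f3.trans (by gcongr)
      _ = _ := by rw [hC1]; ring
  refine ⟨hne, ?_, ?_⟩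
  · have g1 : ‖(phat φ ψ n (z, μ)).2‖ ≤ 4 * M + C1 := by
      have := norm_le_norm_sub_add (phat φ ψ n (z, μ)).2 (kap r₂ n w)
      nlinarith
    have g2 : ‖(phat φ ψ n (z, μ)).1‖ ≤ M := h.s2.bΩ _ hwΩ
    rw [Prod.norm_def]
    exact max_le (by linarith) (by linarith)
  · refine hdiff.trans ?_
    gcongr; linarith
end Phat
end

section
section GrSec
variable {E Y Z : Type} [NormedAddCommGroup E] [NormedSpace ℝ E] [NormedAddCommGroup Y] [NormedSpace ℝ Y]
  [NormedAddCommGroup Z] [NormedSpace ℝ Z]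

/-- Faà di Bruno type bound for compositions on open sets. -/
lemma comp_le {g : Y → Z} {f : E → Y} {s : Set E} {t : Set Y} (hs : IsOpen s) (ht : IsOpen t)
    (hg : ContDiffOn ℝ (⊤ : ℕ∞) g t) (hf : ContDiffOn ℝ (⊤ : ℕ∞) f s) (hst : Set.MapsTo f s t) {x : E} (hx : x ∈ s)
    {C D : ℝ} (n : ℕ) (hC : ∀ i ≤ n, ‖iteratedFDeriv ℝ i g (f x)‖ ≤ C)
    (hD : ∀ i, 1 ≤ i → i ≤ n → ‖iteratedFDeriv ℝ i f x‖ ≤ D ^ i) :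
    ‖iteratedFDeriv ℝ n (fun z => g (f z)) x‖ ≤ n.factorial * C * D ^ n := by
  have := norm_iteratedFDerivWithin_comp_le (n := n) hg hf (by exact_mod_cast le_top) ht.uniqueDiffOn hs.uniqueDiffOn hst hx (C := C) (D := D)
    (fun i hi => by rw [iteratedFDerivWithin_of_isOpen i ht (hst hx)]; exact hC i hi)
    (fun i h1 hi => by rw [iteratedFDerivWithin_of_isOpen i hs hx]; exact hD i h1 hi)
  rwa [iteratedFDerivWithin_of_isOpen n hs hx] at this

def Gr (u0 : E) (ε : ℝ) (f : E × E → Y) : Prop := ∀ j, ∃ C, ∀ z τ, GG u0 ε z τ → ‖iteratedFDeriv ℝ j f z‖ ≤ C * (τ ^ j)⁻¹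

lemma Gr.mono {u0 : E} {ε ε' : ℝ} {f : E × E → Y} (h : Gr u0 ε f) (hε : ε' ≤ ε) : Gr u0 ε' f := fun j =>
  (h j).imp fun _ hC z τ hz => hC z τ (hz.mono hε)

lemma Gr.unif {u0 : E} {ε : ℝ} {f : E × E → Y} (h : Gr u0 ε f) (n : ℕ) :
    ∃ D, 1 ≤ D ∧ ∀ i ≤ n, ∀ z τ, GG u0 ε z τ → ‖iteratedFDeriv ℝ i f z‖ ≤ D * (τ ^ i)⁻¹ := by
  choose C hC using h
  refine ⟨1 + ∑ i ∈ Finset.range (n + 1), |C i|, ?_, fun i hi z τ hz => ?_⟩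
  · have := Finset.sum_nonneg (s := Finset.range (n + 1)) (f := fun i => |C i|) (fun i _ => abs_nonneg _)
    linarith
  · refine (hC i z τ hz).trans ?_
    have h1 := Finset.single_le_sum (s := Finset.range (n + 1)) (f := fun i => |C i|) (fun i _ => abs_nonneg _) (Finset.mem_range.2 (Nat.lt_succ_of_le hi))
    have := hz.2.1
    gcongr
    linarith [le_abs_self (C i)]

/-- Derivatives of a smooth map are bounded on bounded sets. -/
lemma smooth_bd [FiniteDimensional ℝ Y] {Θ : Y → Z} (hΘ : ContDiff ℝ (⊤ : ℕ∞) Θ) (B : ℝ) (n : ℕ) :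
    ∃ C, 1 ≤ C ∧ ∀ i ≤ n, ∀ w, ‖w‖ ≤ B → ‖iteratedFDeriv ℝ i Θ w‖ ≤ C := by
  haveI : ProperSpace Y := FiniteDimensional.proper ℝ Y
  have : ∀ i, ∃ C, ∀ w, ‖w‖ ≤ B → ‖iteratedFDeriv ℝ i Θ w‖ ≤ C := fun i => by
    obtain ⟨C, hC⟩ := (isCompact_closedBall (0:Y) B).exists_bound_of_continuousOn
      (hΘ.continuous_iteratedFDeriv (m := i) (by exact_mod_cast le_top)).continuousOn
    exact ⟨C, fun w hw => hC w (by simpa using hw)⟩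
  choose C hC using this
  refine ⟨1 + ∑ i ∈ Finset.range (n + 1), |C i|, ?_, fun i hi w hw => ?_⟩
  · have := Finset.sum_nonneg (s := Finset.range (n + 1)) (f := fun i => |C i|) (fun i _ => abs_nonneg _)
    linarith
  · refine (hC i w hw).trans ?_
    have h1 := Finset.single_le_sum (s := Finset.range (n + 1)) (f := fun i => |C i|) (fun i _ => abs_nonneg _) (Finset.mem_range.2 (Nat.lt_succ_of_le hi))
    linarith [le_abs_self (C i)]

lemma Gr.comp [FiniteDimensional ℝ Y] {u0 : E} {ε : ℝ} {g : E × E → Y} (hg : ContDiffOn ℝ (⊤ : ℕ∞) g (Cn u0 ε)) (h : Gr u0 ε g) {Θ : Y → Z}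
    (hΘ : ContDiff ℝ (⊤ : ℕ∞) Θ) : Gr u0 ε fun z => Θ (g z) := by
  intro n
  obtain ⟨D, hD1, hD⟩ := h.unif n
  obtain ⟨C, hC1, hC⟩ := smooth_bd hΘ D n
  refine ⟨n.factorial * C * D ^ n, fun z τ hz => ?_⟩
  have hτ := hz.2.1
  refine (comp_le (isOpen_Cn u0 ε) isOpen_univ hΘ.contDiffOn hg (fun _ _ => trivial) hz.mem (D := D * τ⁻¹) n (fun i hi => hC i hi _ ?_) (fun i h1 hi => ?_)).trans (le_of_eq ?_)
  · simpa using hD 0 (Nat.zero_le _) z τ hz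
  · refine (hD i hi z τ hz).trans ?_
    rw [mul_pow, inv_pow]
    gcongr
    exact le_self_pow₀ hD1 (by omega)
  · rw [mul_pow, inv_pow]; ring

lemma Gr.clm {u0 : E} {ε : ℝ} {f : E × E → Y} (hf : ContDiffOn ℝ (⊤ : ℕ∞) f (Cn u0 ε)) (h : Gr u0 ε f) (L : Y →L[ℝ] Z) :
    Gr u0 ε fun z => L (f z) := by
  intro j
  obtain ⟨C, hC⟩ := h j
  refine ⟨‖L‖ * C, fun z τ hz => ?_⟩
  refine (L.norm_iteratedFDeriv_comp_left (cAt hf hz j) le_rfl).trans ?_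
  rw [mul_assoc]
  exact mul_le_mul_of_nonneg_left (hC z τ hz) (norm_nonneg _)

lemma e_bd {u0 : E} {ε : ℝ} {A V : E × E → Y} (hA : ContDiffOn ℝ (⊤ : ℕ∞) A (Cn u0 ε)) (hV : ContDiffOn ℝ (⊤ : ℕ∞) V (Cn u0 ε))
    (gA : Gr u0 ε A) (gV : Gr u0 ε V) (j : ℕ) :
    (∃ C, ∀ z τ, GG u0 ε z τ → ‖iteratedFDeriv ℝ j (e1 A V) z‖ ≤ C * (τ ^ (j + 1))⁻¹) ∧
    ∃ C, ∀ z τ, GG u0 ε z τ → ‖iteratedFDeriv ℝ j (e2 A V) z‖ ≤ C * (τ ^ (j + 1))⁻¹ := by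
  have key : ∀ (i : E →L[ℝ] E × E) (f : E × E → Y), ContDiffOn ℝ (⊤ : ℕ∞) f (Cn u0 ε) → Gr u0 ε f →
      ∃ C, ∀ z τ, GG u0 ε z τ → ‖iteratedFDeriv ℝ j (fun z => cL E Y i (fderiv ℝ f z)) z‖ ≤ C * (τ ^ (j + 1))⁻¹ := by
    intro i f hf g
    obtain ⟨C, hC⟩ := g (j + 1)
    refine ⟨‖cL E Y i‖ * C, fun z τ hz => ?_⟩
    refine ((cL E Y i).norm_iteratedFDeriv_comp_left (cAt (sm_fderiv (isOpen_Cn u0 ε) hf) hz j) le_rfl).trans ?_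
    rw [norm_iteratedFDeriv_fderiv, mul_assoc]
    exact mul_le_mul_of_nonneg_left (hC z τ hz) (norm_nonneg _)
  obtain ⟨C1, h1⟩ := key (ContinuousLinearMap.inl ℝ E E) A hA gA
  obtain ⟨C2, h2⟩ := key (ContinuousLinearMap.inr ℝ E E) A hA gA
  obtain ⟨C3, h3⟩ := key (ContinuousLinearMap.inl ℝ E E) V hV gV
  obtain ⟨C4, h4⟩ := key (ContinuousLinearMap.inr ℝ E E) V hV gV
  have ho := isOpen_Cn u0 ε
  constructor
  · refine ⟨C2 + C3, fun z τ hz => ?_⟩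
    have : e1 A V = Dy A + Dx V := rfl
    rw [this, iteratedFDeriv_add_apply (cAt (sm_Dy ho hA) hz j) (cAt (sm_Dx ho hV) hz j), add_mul]
    exact (norm_add_le _ _).trans (add_le_add (h2 z τ hz) (h3 z τ hz))
  · refine ⟨C4 + C1, fun z τ hz => ?_⟩
    have : e2 A V = Dy V - Dx A := rfl
    rw [this, iteratedFDeriv_sub_apply (cAt (sm_Dy ho hV) hz j) (cAt (sm_Dx ho hA) hz j), add_mul]
    exact (norm_sub_le _ _).trans (add_le_add (h4 z τ hz) (h1 z τ hz))
end GrSec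

section GrHolo
variable {E Y Z : Type} [NormedAddCommGroup E] [NormedSpace ℝ E] [FiniteDimensional ℝ E]
  [NormedAddCommGroup Y] [NormedSpace ℂ Y] [FiniteDimensional ℂ Y] [NormedSpace ℝ Y] [IsScalarTower ℝ ℂ Y]
  [NormedAddCommGroup Z] [NormedSpace ℂ Z] [FiniteDimensional ℂ Z] [NormedSpace ℝ Z] [IsScalarTower ℝ ℂ Z]

lemma Gr.holo {u0 : E} {ε : ℝ} (h1 : ε ≤ 1) {P : E × E → Y} (hP : ContDiff ℝ (⊤ : ℕ∞) P) {h : Y → Z} {t : Set Y} (ht : IsOpen t)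
    (hh : DifferentiableOn ℂ h t) {c B : ℝ} (hc : 0 < c) (hb : ∀ z τ, GG u0 ε z τ → ∀ W ∈ ball (P z) (c * τ), W ∈ t ∧ ‖h W‖ ≤ B) :
    ContDiffOn ℝ (⊤ : ℕ∞) (fun z => h (P z)) (Cn u0 ε) ∧ Gr u0 ε fun z => h (P z) := by
  have hm : Set.MapsTo P (Cn u0 ε) t := fun z ⟨τ, hz⟩ => (hb z τ hz _ (mem_ball_self (mul_pos hc hz.2.1))).1
  refine ⟨(holo_contDiffOn ht hh).comp hP.contDiffOn hm, fun n => ?_⟩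
  obtain ⟨D, hD1, hD⟩ := smooth_bd hP (‖u0‖ + 1) n
  choose K hK0 hK using fun j => cauchy_iterated (E := Y) j
  set C := ∑ i ∈ Finset.range (n + 1), K i * |B| / c ^ i with hCdef
  refine ⟨n.factorial * C * D ^ n, fun z τ hz => ?_⟩
  have hτ := hz.2.1
  have hτ1 : τ ≤ 1 := hz.2.2.1.le.trans h1
  have hz1 : ‖z‖ ≤ ‖u0‖ + 1 := by
    rw [Prod.norm_def]
    refine max_le (hz.1.le.trans (h1.trans (by linarith [norm_nonneg u0]))) ((hz.norm_snd h1).trans ?_)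
    exact mul_le_of_le_one_right (by positivity) hτ1
  refine (comp_le (isOpen_Cn u0 ε) ht (holo_contDiffOn ht hh) hP.contDiffOn hm hz.mem (D := D) (C := C * (τ ^ n)⁻¹) n (fun i hi => ?_) (fun i h1 hi => ?_)).trans (le_of_eq ?_)
  · refine (hK i (mul_pos hc hτ) (hh.mono fun W hW => (hb z τ hz W hW).1) fun W hW => (hb z τ hz W hW).2).trans ?_
    have s1 := Finset.single_le_sum (s := Finset.range (n + 1)) (f := fun i => K i * |B| / c ^ i)
      (fun i _ => by have := hK0 i; positivity) (Finset.mem_range.2 (Nat.lt_succ_of_le hi))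
    have k0 := hK0 i
    calc K i * B / (c * τ) ^ i ≤ K i * |B| / (c * τ) ^ i := by gcongr; exact le_abs_self B
      _ = K i * |B| / c ^ i * (τ ^ i)⁻¹ := by rw [mul_pow]; field_simp
      _ ≤ C * (τ ^ n)⁻¹ := mul_le_mul s1 (inv_anti₀ (by positivity) (pow_le_pow_of_le_one hτ.le hτ1 hi)) (by positivity) (le_trans (by positivity) s1)
  · exact (hD i hi z hz1).trans (le_self_pow₀ hD1 (by omega))
  · ring
end GrHolo
end

section
section Lift
variable {E : Type} [NormedAddCommGroup E] [InnerProductSpace ℂ E] [FiniteDimensional ℂ E] [NormedSpace ℝ E] [IsScalarTower ℝ ℂ E]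
variable {Ω₁ Ω₂ : Set E} {r₁ r₂ : E → ℝ} {δ0 c M C : ℝ} {φ ψ : E → E}

set_option maxHeartbeats 1000000 in
theorem ball_good (h : BH Ω₁ Ω₂ r₁ r₂ δ0 c M φ ψ) (hC : 1 ≤ C) (hE : Est Ω₁ r₁ r₂ φ C) (hE' : Est Ω₂ r₂ r₁ ψ C)
    {p q n₁ n₂ : E} (hq : Filter.Tendsto φ (nhdsWithin p Ω₁) (nhds q)) (hn2 : lam r₂ q n₂ = 1) (hnc : ‖n₂‖ ≤ 2 / c)
    {P : E × E → E × (E →L[ℂ] ℂ)} (hP : Continuous P) (hP0 : P (0, 0) = (p, lam r₁ p)) {ε0 C0 : ℝ} (hε0 : 0 < ε0)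
    (hS : ∀ x y τ, ‖x‖ < ε0 → |τ| < ε0 → ‖y - τ • (I • n₁)‖ ≤ ε0 * |τ| →
        |r₁ (P (x, y)).1 + τ| ≤ |τ| / 2 ∧ ‖(P (x, y)).2 - lam r₁ (P (x, y)).1‖ ≤ C0 * |τ|) {η : ℝ} (hη : 0 < η) :
    ∃ ε > 0, ε ≤ 1 ∧ ∃ C', 0 ≤ C' ∧ ∀ z τ, GG (I • n₁) ε z τ → ∀ W ∈ ball (P z) (1 / (4 * M) * τ),
      W.1 ∈ Ω₁ ∧ pnu φ ψ W n₂ ≠ 0 ∧ ‖phat φ ψ n₂ W‖ ≤ C' ∧ |r₂ (φ W.1)| ≤ C' * τ ∧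
      ‖(phat φ ψ n₂ W).2 - kap r₂ n₂ (φ W.1)‖ ≤ C' * √τ ∧ ‖phat φ ψ n₂ W - (q, lam r₂ q)‖ < η := by
  have hM := h.s1.M_ge
  obtain ⟨κ, hκ, hκq, ε1, hε1, hk⟩ := exists_kap h.s2.smooth hn2
  set K := 4 * (|C0| + 1) with hK
  obtain ⟨ε2, hε2, C2, hph⟩ := phat_est h hC hE hE' hn2 hnc K
  obtain ⟨ε3, hε3, hkc⟩ := Metric.continuousAt_iff.1 (hκ.continuous.continuousAt (x := q)) (η / 2) (by positivity)
  set m := min (min ε1 ε2) (min ε3 η) with hm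
  have hmpos : 0 < m := by positivity
  obtain ⟨δ, hδ, hd⟩ := Metric.mem_nhdsWithin_iff.1 (hq (ball_mem_nhds q hmpos))
  obtain ⟨δ1, hδ1, hPc⟩ := Metric.continuousAt_iff.1 (hP.continuousAt (x := (0, 0))) (δ / 2) (by positivity)
  set C' := 2 * |C2| + 2 * C with hC'
  have hC'0 : 0 ≤ C' := by positivity
  set s := (η / (4 * (C' + 1))) ^ 2 with hs
  set ε := min (min 1 ε0) (min (min (δ1 / (2 * (‖I • n₁‖ + 1))) δ) (min (ε2 / 2) s)) with hε
  have hεpos : 0 < ε := by positivity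
  have l1 : ε ≤ 1 := (min_le_left _ _).trans (min_le_left _ _)
  have l2 : ε ≤ ε0 := (min_le_left _ _).trans (min_le_right _ _)
  have l3 : ε ≤ δ1 / (2 * (‖I • n₁‖ + 1)) := (min_le_right _ _).trans ((min_le_left _ _).trans (min_le_left _ _))
  have l4 : ε ≤ δ := (min_le_right _ _).trans ((min_le_left _ _).trans (min_le_right _ _))
  have l5 : ε ≤ ε2 / 2 := (min_le_right _ _).trans ((min_le_right _ _).trans (min_le_left _ _))
  have l6 : ε ≤ s := (min_le_right _ _).trans ((min_le_right _ _).trans (min_le_right _ _))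
  refine ⟨ε, hεpos, l1, C', hC'0, fun z τ hz W hW => ?_⟩
  have hτ := hz.2.1
  have hτε := hz.2.2.1
  rw [mem_ball, dist_eq_norm] at hW
  have w1 : ‖W.1 - (P z).1‖ < 1 / (4 * M) * τ := (norm_fst_le (W - P z)).trans_lt hW
  have w2 : ‖W.2 - (P z).2‖ < 1 / (4 * M) * τ := (norm_snd_le (W - P z)).trans_lt hW
  have hMτ : M * (1 / (4 * M) * τ) = τ / 4 := by field_simp
  have hMτ' : 1 / (4 * M) * τ ≤ τ / 4 := by
    have : 1 / (4 * M) ≤ 1 / 4 := one_div_le_one_div_of_le (by norm_num) (by linarith)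
    nlinarith
  obtain ⟨s1, s2⟩ := hS z.1 z.2 τ (hz.1.trans_le l2) (by rw [abs_of_pos hτ]; linarith)
    (by rw [abs_of_pos hτ]; exact hz.2.2.2.le.trans (by gcongr))
  rw [abs_of_pos hτ] at s1 s2
  have hr := h.s1.lip W.1 (P z).1
  have hr' : |r₁ W.1 - r₁ (P z).1| ≤ τ / 4 := hr.trans (by rw [← hMτ]; gcongr)
  have t1 := abs_le.1 s1
  have t2 := abs_le.1 hr'
  simp only [Prod.mk.eta] at t1 s2
  have hlo : τ / 4 ≤ -r₁ W.1 := by linarith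
  have hhi : -r₁ W.1 ≤ 7 / 4 * τ := by linarith
  have hWΩ : W.1 ∈ Ω₁ := (h.s1.mem_iff _).2 (by linarith)
  have hzn : ‖z‖ < δ1 := by
    have a1 := hz.norm_snd l1
    have a2 := norm_nonneg (I • n₁)
    have : (‖I • n₁‖ + 1) * ε ≤ δ1 / 2 := by
      have := mul_le_mul_of_nonneg_left l3 (show 0 ≤ ‖I • n₁‖ + 1 by positivity)
      refine this.trans (le_of_eq ?_)
      field_simp
    rw [Prod.norm_def]
    refine max_lt ?_ ?_
    · have := hz.1; nlinarith
    · nlinarith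
  have hPz : ‖P z - (p, lam r₁ p)‖ < δ / 2 := by
    have := hPc (x := z) (by rw [dist_eq_norm, show ((0:E), (0:E)) = 0 from rfl, sub_zero]; exact hzn)
    rwa [hP0, dist_eq_norm] at this
  have hWp : ‖W.1 - p‖ < δ := by
    have a1 : ‖(P z).1 - p‖ < δ / 2 := (norm_fst_le (P z - (p, lam r₁ p))).trans_lt hPz
    have a2 := norm_sub_le_norm_sub_add_norm_sub W.1 (P z).1 p
    linarith
  have hφ : ‖φ W.1 - q‖ < m := by
    have : φ W.1 ∈ ball q m := hd ⟨by rwa [mem_ball, dist_eq_norm], hWΩ⟩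
    rwa [mem_ball, dist_eq_norm] at this
  have m1 : m ≤ ε1 := (min_le_left _ _).trans (min_le_left _ _)
  have m2 : m ≤ ε2 := (min_le_left _ _).trans (min_le_right _ _)
  have m3 : m ≤ ε3 := (min_le_right _ _).trans (min_le_left _ _)
  have m4 : m ≤ η := (min_le_right _ _).trans (min_le_right _ _)
  have hmu : ‖W.2 - lam r₁ W.1‖ ≤ K * (-r₁ W.1) := by
    have a1 := h.s1.lam_lip (P z).1 W.1
    have a2 : ‖W.2 - lam r₁ W.1‖ ≤ ‖W.2 - (P z).2‖ + ‖(P z).2 - lam r₁ (P z).1‖ + ‖lam r₁ (P z).1 - lam r₁ W.1‖ := by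
      have : W.2 - lam r₁ W.1 = (W.2 - (P z).2) + ((P z).2 - lam r₁ (P z).1) + (lam r₁ (P z).1 - lam r₁ W.1) := by abel
      rw [this]; exact norm_add₃_le
    have a3 : 2 * M * ‖(P z).1 - W.1‖ ≤ τ / 2 := by
      rw [norm_sub_rev]
      have := mul_le_mul_of_nonneg_left w1.le (show 0 ≤ M by linarith)
      linarith
    have a4 : C0 * τ ≤ |C0| * τ := by gcongr; exact le_abs_self _
    have a5 : (|C0| + 1) * τ ≤ K * (-r₁ W.1) := by
      rw [hK]; have := abs_nonneg C0; nlinarith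
    linarith
  obtain ⟨g1, g2, g3⟩ := hph W.1 W.2 hWΩ (hφ.trans_le m2) (by linarith) hmu
  simp only [Prod.mk.eta] at g1 g2 g3
  have hsq : √(-r₁ W.1) ≤ 2 * √τ := by
    rw [show (2:ℝ) = √4 by rw [show (4:ℝ) = 2 ^ 2 by norm_num]; exact (Real.sqrt_sq (by norm_num)).symm, ← Real.sqrt_mul (by norm_num)]
    exact Real.sqrt_le_sqrt (by linarith)
  have g4 : ‖(phat φ ψ n₂ W).2 - kap r₂ n₂ (φ W.1)‖ ≤ C' * √τ := by
    refine g3.trans ?_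
    calc C2 * √(-r₁ W.1) ≤ |C2| * (2 * √τ) := mul_le_mul (le_abs_self _) hsq (by positivity) (by positivity)
      _ ≤ C' * √τ := by rw [hC']; have := Real.sqrt_nonneg τ; nlinarith
  refine ⟨hWΩ, g1, g2.trans ?_, ?_, g4, ?_⟩
  · rw [hC']; have := le_abs_self C2; have := abs_nonneg C2; linarith
  · have a1 := hE.e1 W.1 hWΩ
    have a2 := (h.s2.mem_iff _).1 (h.mφ hWΩ)
    rw [abs_of_neg a2, hC']
    have := abs_nonneg C2
    nlinarith
  · have hst : √τ ≤ η / (4 * (C' + 1)) := by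
      rw [← Real.sqrt_sq (show 0 ≤ η / (4 * (C' + 1)) by positivity)]
      exact Real.sqrt_le_sqrt (by linarith)
    have b1 : C' * √τ ≤ η / 4 := by
      calc C' * √τ ≤ (C' + 1) * (η / (4 * (C' + 1))) := by gcongr; linarith
        _ = η / 4 := by field_simp
    have b2 : ‖kap r₂ n₂ (φ W.1) - lam r₂ q‖ < η / 2 := by
      have := hkc (x := φ W.1) (by rw [dist_eq_norm]; exact hφ.trans_le m3)
      rwa [dist_eq_norm, hκq, (hk _ (hφ.trans_le m1)).1] at this
    rw [Prod.norm_def]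
    refine max_lt (hφ.trans_le m4) ?_
    have := norm_sub_le_norm_sub_add_norm_sub (phat φ ψ n₂ W).2 (kap r₂ n₂ (φ W.1)) (lam r₂ q)
    simp only [Prod.snd_sub]
    linarith
end Lift
end

section
section Lift2
variable {E : Type} [NormedAddCommGroup E] [InnerProductSpace ℂ E] [FiniteDimensional ℂ E] [NormedSpace ℝ E] [IsScalarTower ℝ ℂ E]
variable {Ω₁ Ω₂ : Set E} {r₁ r₂ : E → ℝ} {δ0 c M C : ℝ} {φ ψ : E → E}

lemma e_alg {Y : Type} [NormedAddCommGroup Y] [NormedSpace ℂ Y] [NormedSpace ℝ Y] [IsScalarTower ℝ ℂ Y] (D : E × E →L[ℝ] Y) (a b a' b' : E) :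
    D (a' + b, b' - a) = (D (a', b') - I • D (a, b)) + I • (D (0, b) - I • D (b, 0)) - (D (0, a) - I • D (a, 0)) := by
  have h1 : ((a' + b, b' - a) : E × E) = (a', b') + (b, 0) - (0, a) := by simp
  have h2 : ((a, b) : E × E) = (a, 0) + (0, b) := by simp
  rw [h1, h2, map_sub, map_add, map_add, smul_add, smul_sub, smul_smul, I_mul_I, neg_one_smul]
  abel

lemma e_pt {H : E × E → E × E} {P₁ P₂ : E × E → E × (E →L[ℂ] ℂ)} {Θ : E × (E →L[ℂ] ℂ) → E × E} {f : E × (E →L[ℂ] ℂ) → E × (E →L[ℂ] ℂ)}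
    {z : E × E} (hH : DifferentiableAt ℝ H z) (hP₁ : DifferentiableAt ℝ P₁ z) (hP₂ : DifferentiableAt ℝ P₂ (H z)) (hf : DifferentiableAt ℂ f (P₁ z))
    (hΘ : DifferentiableAt ℝ Θ (P₂ (H z))) (hi : ∀ᶠ X in nhds (H z), Θ (P₂ X) = X) (hg : ∀ᶠ y in nhds z, P₂ (H y) = f (P₁ y))
    {k1 k2 k3 k4 k5 : ℝ} (b1 : ∀ v, ‖fderiv ℝ P₁ z (0, v) - I • fderiv ℝ P₁ z (v, 0)‖ ≤ k1 * ‖v‖)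
    (b2 : ∀ v, ‖fderiv ℝ P₂ (H z) (0, v) - I • fderiv ℝ P₂ (H z) (v, 0)‖ ≤ k2 * ‖v‖) (hk2 : 0 ≤ k2)
    (b3 : ‖fderiv ℂ f (P₁ z)‖ ≤ k3) (b4 : ‖fderiv ℝ H z‖ ≤ k4) (b5 : ‖fderiv ℝ Θ (P₂ (H z))‖ ≤ k5) :
    ‖e1 (fun y => (H y).1) (fun y => (H y).2) z‖ ≤ k5 * (k3 * |k1| + k2 * k4 + k2 * k4) ∧
    ‖e2 (fun y => (H y).1) (fun y => (H y).2) z‖ ≤ k5 * (k3 * |k1| + k2 * k4 + k2 * k4) := by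
  set T := fderiv ℝ H z with hT
  set D := fderiv ℝ P₂ (H z) with hD
  have k3p : 0 ≤ k3 := (ContinuousLinearMap.opNorm_nonneg _).trans b3
  have k4p : 0 ≤ k4 := (norm_nonneg _).trans b4
  have k5p : 0 ≤ k5 := (ContinuousLinearMap.opNorm_nonneg _).trans b5
  have c1 : ∀ v, D (T v) = fderiv ℂ f (P₁ z) (fderiv ℝ P₁ z v) := by
    have x1 : HasFDerivAt (fun y => P₂ (H y)) (D.comp T) z := hP₂.hasFDerivAt.comp z hH.hasFDerivAt
    have x2 : HasFDerivAt (fun y => f (P₁ y)) (((fderiv ℂ f (P₁ z)).restrictScalars ℝ).comp (fderiv ℝ P₁ z)) z :=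
      (hf.hasFDerivAt.restrictScalars ℝ).comp z hP₁.hasFDerivAt
    have x3 := x1.unique (x2.congr_of_eventuallyEq hg)
    intro v
    exact congrArg (fun L => L v) x3
  have c2 : ∀ w, fderiv ℝ Θ (P₂ (H z)) (D w) = w := by
    have x1 : HasFDerivAt (fun y => Θ (P₂ y)) ((fderiv ℝ Θ (P₂ (H z))).comp D) (H z) := hΘ.hasFDerivAt.comp (H z) hP₂.hasFDerivAt
    have x2 : HasFDerivAt (fun y => Θ (P₂ y)) (ContinuousLinearMap.id ℝ (E × E)) (H z) := (hasFDerivAt_id (H z)).congr_of_eventuallyEq hi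
    intro w
    exact congrArg (fun L => L w) (x1.unique x2)
  have key : ∀ v, ‖((T (0, v)).1 + (T (v, 0)).2, (T (0, v)).2 - (T (v, 0)).1)‖ ≤ k5 * (k3 * |k1| + k2 * k4 + k2 * k4) * ‖v‖ := by
    intro v
    have y0 := e_alg D (T (v, 0)).1 (T (v, 0)).2 (T (0, v)).1 (T (0, v)).2
    simp only [Prod.mk.eta] at y0
    rw [c1, c1, ← map_smul, ← map_sub] at y0
    have y1 : ‖fderiv ℂ f (P₁ z) (fderiv ℝ P₁ z (0, v) - I • fderiv ℝ P₁ z (v, 0))‖ ≤ k3 * |k1| * ‖v‖ := by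
      refine ((fderiv ℂ f (P₁ z)).le_of_opNorm_le b3 _).trans ?_
      rw [mul_assoc]
      refine mul_le_mul_of_nonneg_left ((b1 v).trans ?_) k3p
      gcongr
      exact le_abs_self _
    have y2 : ‖T (v, 0)‖ ≤ k4 * ‖v‖ := by have := T.le_of_opNorm_le b4 (v, 0); rwa [norm_pr1] at this
    have y3 := (b2 (T (v, 0)).1).trans (mul_le_mul_of_nonneg_left ((norm_fst_le _).trans y2) hk2)
    have y4 := (b2 (T (v, 0)).2).trans (mul_le_mul_of_nonneg_left ((norm_snd_le _).trans y2) hk2)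
    have y5 : ‖I • (D (0, (T (v, 0)).2) - I • D ((T (v, 0)).2, 0))‖ = ‖D (0, (T (v, 0)).2) - I • D ((T (v, 0)).2, 0)‖ := by
      rw [norm_smul, norm_I, one_mul]
    rw [← c2 ((T (0, v)).1 + (T (v, 0)).2, (T (0, v)).2 - (T (v, 0)).1), y0]
    refine ((fderiv ℝ Θ (P₂ (H z))).le_of_opNorm_le b5 _).trans ?_
    rw [mul_assoc]
    refine mul_le_mul_of_nonneg_left ?_ k5p
    refine (norm_sub_le _ _).trans ((add_le_add_left (norm_add_le _ _) _).trans ?_)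
    rw [y5]
    linarith
  have f1 : fderiv ℝ (fun y => (H y).1) z = (ContinuousLinearMap.fst ℝ E E).comp T := hH.hasFDerivAt.fst.fderiv
  have f2 : fderiv ℝ (fun y => (H y).2) z = (ContinuousLinearMap.snd ℝ E E).comp T := hH.hasFDerivAt.snd.fderiv
  have kp : 0 ≤ k5 * (k3 * |k1| + k2 * k4 + k2 * k4) := by positivity
  constructor
  · refine ContinuousLinearMap.opNorm_le_bound _ kp fun v => le_trans (le_of_eq ?_) ((norm_fst_le _).trans (key v))
    show ‖fderiv ℝ (fun y => (H y).1) z (0, v) + fderiv ℝ (fun y => (H y).2) z (v, 0)‖ = _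
    rw [f1, f2]; rfl
  · refine ContinuousLinearMap.opNorm_le_bound _ kp fun v => le_trans (le_of_eq ?_) ((norm_snd_le _).trans (key v))
    show ‖fderiv ℝ (fun y => (H y).2) z (0, v) - fderiv ℝ (fun y => (H y).1) z (v, 0)‖ = _
    rw [f1, f2]; rfl

set_option maxHeartbeats 1000000 in
theorem lift (h : BH Ω₁ Ω₂ r₁ r₂ δ0 c M φ ψ) (hC : 1 ≤ C) (hE : Est Ω₁ r₁ r₂ φ C) (hE' : Est Ω₂ r₂ r₁ ψ C)
    {p q n₁ n₂ : E} (hp : r₁ p = 0) (hn1 : lam r₁ p n₁ = 1) (hq0 : r₂ q = 0) (hq : Filter.Tendsto φ (nhdsWithin p Ω₁) (nhds q))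
    (hn2 : lam r₂ q n₂ = 1) (hnc : ‖n₂‖ ≤ 2 / c) (N' : ℕ) :
    ∃ P₁ : E × E → E × (E →L[ℂ] ℂ), ContDiff ℝ (⊤ : ℕ∞) P₁ ∧ (P₁ (0, 0)).1 = p ∧
      (∀ a b, (fderiv ℝ P₁ (0, 0) (a, b)).1 = a - fderiv ℝ r₁ p a • n₁ + I • (b - fderiv ℝ r₁ p b • n₁)) ∧
      (∃ ε > 0, ∀ x y τ, ‖x‖ < ε → |τ| < ε → ‖y - τ • (I • n₁)‖ ≤ ε * |τ| → |r₁ (P₁ (x, y)).1 + τ| ≤ |τ| / 2) ∧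
      ∃ P₂ : E × E → E × (E →L[ℂ] ℂ), ContDiff ℝ (⊤ : ℕ∞) P₂ ∧ ∃ ε > 0, ε ≤ 1 ∧ ∃ A V : E × E → E,
        ContDiffOn ℝ (⊤ : ℕ∞) A (Cn (I • n₁) ε) ∧ ContDiffOn ℝ (⊤ : ℕ∞) V (Cn (I • n₁) ε) ∧
        (∀ z ∈ Cn (I • n₁) ε, (P₁ z).1 ∈ Ω₁ ∧ φ (P₁ z).1 = (P₂ (A z, V z)).1) ∧ Gr (I • n₁) ε A ∧ Gr (I • n₁) ε V ∧ Tend0 (I • n₁) ε V ∧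
        (∃ K, ∀ z τ, GG (I • n₁) ε z τ → ‖e1 A V z‖ ≤ K * τ ^ N') ∧ ∃ K, ∀ z τ, GG (I • n₁) ε z τ → ‖e2 A V z‖ ≤ K * τ ^ N' := by
  haveI : FiniteDimensional ℝ E := real_fd
  haveI : FiniteDimensional ℝ (E →L[ℂ] ℂ) := FiniteDimensional.trans ℝ ℂ _
  have hM := h.s1.M_ge
  set u0 := I • n₁ with hu0
  obtain ⟨P₁, hP₁, hP₁0, ⟨C1, hd1⟩, hder, ε0, hε0, C0, hS⟩ := source_AE h.s1 hp hn1 (N := 2 * N' + 2) (by omega)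
  obtain ⟨P₂, hP₂, hP₂0, ⟨C2, hd2⟩, Θ, hΘ, hΘ0, ε2, hε2, hi1, hi2, C3, hC3⟩ := target_AE h.s2 hq0 hn2 (N := 2 * N' + 2) (by omega)
  obtain ⟨δ, hδ, hΘc⟩ := Metric.continuousAt_iff.1 (hΘ.continuous.continuousAt (x := (q, lam r₂ q))) (min ε2 1) (by positivity)
  obtain ⟨ε, hε, hε1, C', hC'0, hb⟩ := ball_good h hC hE hE' hq hn2 hnc hP₁.continuous hP₁0 hε0 hS (η := min ε2 δ) (by positivity)
  set f := phat φ ψ n₂ with hf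
  set t : Set (E × (E →L[ℂ] ℂ)) := ⋃ x : {x : (E × E) × ℝ // GG u0 ε x.1 x.2}, ball (P₁ x.1.1) (1 / (4 * M) * x.1.2) with ht
  have hto : IsOpen t := isOpen_iUnion fun _ => isOpen_ball
  have htm : ∀ z τ, GG u0 ε z τ → ∀ W ∈ ball (P₁ z) (1 / (4 * M) * τ), W ∈ t := fun z τ hz W hW => Set.mem_iUnion.2 ⟨⟨(z, τ), hz⟩, hW⟩
  have hft : ∀ W ∈ t, DifferentiableAt ℂ f W := by
    intro W hW
    obtain ⟨⟨⟨z, τ⟩, hz⟩, hW⟩ := Set.mem_iUnion.1 hW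
    obtain ⟨a1, a2, -⟩ := hb z τ hz W hW
    exact phat_diff h a1 a2
  obtain ⟨hgs, hgG⟩ := Gr.holo (u0 := u0) hε1 hP₁ hto (fun W hW => (hft W hW).differentiableWithinAt) (c := 1 / (4 * M)) (B := C') (by positivity)
    (fun z τ hz W hW => ⟨htm z τ hz W hW, (hb z τ hz W hW).2.2.1⟩)
  have hpos : ∀ z τ, GG u0 ε z τ → 0 < 1 / (4 * M) * τ := fun z τ hz => mul_pos (by positivity) hz.2.1
  have hb0 := fun z τ hz => hb z τ hz (P₁ z) (mem_ball_self (hpos z τ hz))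
  set H : E × E → E × E := fun z => Θ (f (P₁ z)) with hH
  have hHs : ContDiffOn ℝ (⊤ : ℕ∞) H (Cn u0 ε) := hΘ.comp_contDiffOn hgs
  have hHG : Gr u0 ε H := Gr.comp hgs hgG hΘ
  have hHn : ∀ z τ, GG u0 ε z τ → ‖H z - (0, 0)‖ < min ε2 1 := by
    intro z τ hz
    have := hΘc (x := f (P₁ z)) (by rw [dist_eq_norm]; exact (hb0 z τ hz).2.2.2.2.2.trans_le (min_le_right _ _))
    rwa [hΘ0, dist_eq_norm] at this
  have hPH : ∀ z τ, GG u0 ε z τ → P₂ (H z) = f (P₁ z) := fun z τ hz => hi2 _ ((hb0 z τ hz).2.2.2.2.2.trans_le (min_le_left _ _))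
  have hV : ∀ z τ, GG u0 ε z τ → ‖(H z).2‖ ≤ 2 * |C3| * C' * √τ := by
    intro z τ hz
    obtain ⟨-, -, -, a4, a5, a6⟩ := hb0 z τ hz
    have := hC3 (f (P₁ z)).1 (f (P₁ z)).2 (a6.trans_le (min_le_left _ _))
    have hτ : τ ≤ √τ := by
      have t1 : τ ≤ 1 := hz.2.2.1.le.trans hε1
      exact Real.le_sqrt_of_sq_le (by nlinarith [hz.2.1])
    refine this.trans ?_
    calc _ ≤ |C3| * (C' * √τ + C' * √τ) := by
          refine mul_le_mul (le_abs_self _) (add_le_add (a4.trans ?_) a5) (by positivity) (abs_nonneg _)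
          gcongr
      _ = _ := by ring
  have hHd : ∀ z τ, GG u0 ε z τ → DifferentiableAt ℝ H z := fun z τ hz => (cAt hHs hz 1).differentiableAt (by simp)
  obtain ⟨C4, hC4⟩ := hHG 1
  obtain ⟨C5, hC51, hC5⟩ := smooth_bd hΘ C' 1
  have n1 : ∀ {X Y : Type} [NormedAddCommGroup X] [NormedSpace ℝ X] [NormedAddCommGroup Y] [NormedSpace ℝ Y] (g : X → Y) (x : X), ‖fderiv ℝ g x‖ = ‖iteratedFDeriv ℝ 1 g x‖ := by
    intro X Y _ _ _ _ g x
    have := norm_iteratedFDeriv_fderiv (𝕜 := ℝ) (f := g) (x := x) (n := 0)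
    rw [← this]; simp
  have hfin : ∃ K, ∀ z τ, GG u0 ε z τ → ‖e1 (fun y => (H y).1) (fun y => (H y).2) z‖ ≤ K * τ ^ N' ∧ ‖e2 (fun y => (H y).1) (fun y => (H y).2) z‖ ≤ K * τ ^ N' := by
    set B := 2 * |C3| * C' with hB
    have hB0 : 0 ≤ B := by positivity
    refine ⟨C5 * (C' * (4 * M) * (|C1| * (‖u0‖ + 1) ^ (2 * N' + 2)) + |C2| * B ^ (2 * N' + 2) * C4 + |C2| * B ^ (2 * N' + 2) * C4), fun z τ hz => ?_⟩
    have hτ := hz.2.1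
    have t1 : τ ≤ 1 := hz.2.2.1.le.trans hε1
    have hz1 : ‖z.1‖ ≤ 1 := hz.1.le.trans hε1
    have i0 := hHn z τ hz
    have hHz1 : ‖(H z).1‖ ≤ 1 := by
      have := (norm_fst_le (H z - (0, 0))).trans (i0.le.trans (min_le_right _ _)); simpa using this
    have q1 : ∀ v, ‖fderiv ℝ P₁ z (0, v) - I • fderiv ℝ P₁ z (v, 0)‖ ≤ |C1| * (‖u0‖ + 1) ^ (2 * N' + 2) * τ ^ (2 * N' + 2) * ‖v‖ := by
      intro v
      refine (hd1 z.1 z.2 v hz1).trans ?_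
      have := hz.norm_snd hε1
      rw [mul_assoc |C1|, ← mul_pow]
      gcongr
      exact le_abs_self _
    have q2 : ∀ v, ‖fderiv ℝ P₂ (H z) (0, v) - I • fderiv ℝ P₂ (H z) (v, 0)‖ ≤ |C2| * B ^ (2 * N' + 2) * τ ^ (N' + 1) * ‖v‖ := by
      intro v
      refine (hd2 (H z).1 (H z).2 v hHz1).trans ?_
      have e : τ ^ (N' + 1) = √τ ^ (2 * N' + 2) := by
        rw [show 2 * N' + 2 = 2 * (N' + 1) by ring, pow_mul, Real.sq_sqrt hτ.le]
      rw [e, mul_assoc |C2|, ← mul_pow]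
      have := hV z τ hz
      gcongr
      exact le_abs_self _
    have hball : DifferentiableOn ℂ f (ball (P₁ z) (1 / (4 * M) * τ)) := fun W hW => (hft W (htm z τ hz W hW)).differentiableWithinAt
    have q3 := cauchy_fderiv (hpos z τ hz) hball (fun W hW => (hb z τ hz W hW).2.2.1)
    have q4 : ‖fderiv ℝ H z‖ ≤ C4 * τ⁻¹ := by rw [n1]; simpa using hC4 z τ hz
    have q5 : ‖fderiv ℝ Θ (P₂ (H z))‖ ≤ C5 := by
      rw [n1, hPH z τ hz]; exact hC5 1 le_rfl _ (hb0 z τ hz).2.2.1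
    have o1 : ∀ᶠ X in nhds (H z), Θ (P₂ X) = X := by
      have : ContinuousAt (fun X : E × E => ‖X - (0, 0)‖) (H z) := by fun_prop
      filter_upwards [this.eventually (gt_mem_nhds (i0.trans_le (min_le_left _ _)))] with X hX using hi1 X hX
    have o2 : ∀ᶠ y in nhds z, P₂ (H y) = f (P₁ y) := by
      filter_upwards [(isOpen_Cn u0 ε).mem_nhds hz.mem] with y ⟨τ', hy⟩ using hPH y τ' hy
    obtain ⟨z1, z2⟩ := e_pt (hHd z τ hz) (hP₁.differentiable (by simp) z) (hP₂.differentiable (by simp) _)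
      (hft _ (htm z τ hz _ (mem_ball_self (hpos z τ hz)))) (hΘ.differentiable (by simp) _) o1 o2 q1 q2 (by positivity) q3 q4 q5
    have hfi : C5 * (C' / (1 / (4 * M) * τ) * |(|C1| * (‖u0‖ + 1) ^ (2 * N' + 2) * τ ^ (2 * N' + 2))| + |C2| * B ^ (2 * N' + 2) * τ ^ (N' + 1) * (C4 * τ⁻¹)
          + |C2| * B ^ (2 * N' + 2) * τ ^ (N' + 1) * (C4 * τ⁻¹)) ≤
        C5 * (C' * (4 * M) * (|C1| * (‖u0‖ + 1) ^ (2 * N' + 2)) + |C2| * B ^ (2 * N' + 2) * C4 + |C2| * B ^ (2 * N' + 2) * C4) * τ ^ N' := by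
      have r1 : |C2| * B ^ (2 * N' + 2) * τ ^ (N' + 1) * (C4 * τ⁻¹) = |C2| * B ^ (2 * N' + 2) * C4 * τ ^ N' := by
        rw [pow_succ τ N']; field_simp
      have r2 : C' / (1 / (4 * M) * τ) * |(|C1| * (‖u0‖ + 1) ^ (2 * N' + 2) * τ ^ (2 * N' + 2))| = C' * (4 * M) * (|C1| * (‖u0‖ + 1) ^ (2 * N' + 2)) * τ ^ (2 * N' + 1) := by
        rw [abs_of_nonneg (by positivity), pow_succ τ (2 * N' + 1)]; field_simp
      rw [r1, r2, mul_assoc C5, add_mul, add_mul]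
      have : τ ^ (2 * N' + 1) ≤ τ ^ N' := pow_le_pow_of_le_one hτ.le t1 (by omega)
      gcongr
    exact ⟨z1.trans hfi, z2.trans hfi⟩
  obtain ⟨K, hK⟩ := hfin
  refine ⟨P₁, hP₁, by rw [hP₁0], hder, ⟨ε0, hε0, fun x y τ a b d => (hS x y τ a b d).1⟩, P₂, hP₂, ε, hε, hε1, fun z => (H z).1, fun z => (H z).2,
    hHs.fst, hHs.snd, ?_, hHG.clm hHs (ContinuousLinearMap.fst ℝ E E), hHG.clm hHs (ContinuousLinearMap.snd ℝ E E), ?_,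
    ⟨K, fun z τ hz => (hK z τ hz).1⟩, ⟨K, fun z τ hz => (hK z τ hz).2⟩⟩
  · rintro z ⟨τ, hz⟩
    exact ⟨(hb0 z τ hz).1, by rw [Prod.mk.eta, hPH z τ hz]; rfl⟩
  · intro η hη
    refine ⟨(η / (2 * |C3| * C' + 1)) ^ 2, by positivity, fun z τ hz hτ => (hV z τ hz).trans ?_⟩
    have : √τ ≤ η / (2 * |C3| * C' + 1) := by
      rw [← Real.sqrt_sq (show 0 ≤ η / (2 * |C3| * C' + 1) by positivity)]
      exact Real.sqrt_le_sqrt hτ.le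
    calc _ ≤ (2 * |C3| * C' + 1) * (η / (2 * |C3| * C' + 1)) := by gcongr; linarith
      _ = η := by field_simp
end Lift2
end

section
section BdC
variable {E Y Z : Type} [NormedAddCommGroup E] [NormedSpace ℝ E] [NormedAddCommGroup Y] [NormedSpace ℝ Y] [FiniteDimensional ℝ Y]
  [NormedAddCommGroup Z] [NormedSpace ℝ Z]

lemma BdOn.unif {u0 : E} {ε : ℝ} {f : E × E → Z} {n : ℕ} (h : BdOn u0 ε n f) :
    ∃ D, 1 ≤ D ∧ ∀ i ≤ n, ∀ z τ, GG u0 ε z τ → ‖iteratedFDeriv ℝ i f z‖ ≤ D := by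
  have h' : ∀ i, ∃ C, i ≤ n → ∀ z τ, GG u0 ε z τ → ‖iteratedFDeriv ℝ i f z‖ ≤ C := fun i => by
    by_cases hi : i ≤ n
    · exact (h i hi).imp fun _ hC _ => hC
    · exact ⟨0, fun h => absurd h hi⟩
  choose C hC using h'
  refine ⟨1 + ∑ i ∈ Finset.range (n + 1), |C i|, ?_, fun i hi z τ hz => (hC i hi z τ hz).trans ?_⟩
  · have := Finset.sum_nonneg (s := Finset.range (n + 1)) (f := fun i => |C i|) (fun i _ => abs_nonneg _)
    linarith
  · have h1 := Finset.single_le_sum (s := Finset.range (n + 1)) (f := fun i => |C i|) (fun i _ => abs_nonneg _) (Finset.mem_range.2 (Nat.lt_succ_of_le hi))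
    linarith [le_abs_self (C i)]

lemma BdOn.comp {u0 : E} {ε : ℝ} {g : E × E → Y} (hg : ContDiffOn ℝ (⊤ : ℕ∞) g (Cn u0 ε)) {k : ℕ} (h : BdOn u0 ε k g) {Θ : Y → Z}
    (hΘ : ContDiff ℝ (⊤ : ℕ∞) Θ) : BdOn u0 ε k fun z => Θ (g z) := by
  intro n hn
  obtain ⟨D, hD1, hD⟩ := h.unif
  obtain ⟨C, hC1, hC⟩ := smooth_bd hΘ D n
  refine ⟨n.factorial * C * D ^ n, fun z τ hz => ?_⟩
  refine comp_le (isOpen_Cn u0 ε) isOpen_univ hΘ.contDiffOn hg (fun _ _ => trivial) hz.mem (D := D) n (fun i hi => hC i hi _ ?_) (fun i h1 hi => ?_)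
  · simpa using hD 0 (Nat.zero_le _) z τ hz
  · exact (hD i (hi.trans hn) z τ hz).trans (le_self_pow₀ hD1 (by omega))
end BdC

section LocBd
variable {E : Type} [NormedAddCommGroup E] [InnerProductSpace ℂ E] [FiniteDimensional ℂ E] [NormedSpace ℝ E] [IsScalarTower ℝ ℂ E]
variable {Ω₁ Ω₂ : Set E} {r₁ r₂ : E → ℝ} {δ0 c M C : ℝ} {φ ψ : E → E}

set_option maxHeartbeats 1000000 in
theorem loc_bd (h : BH Ω₁ Ω₂ r₁ r₂ δ0 c M φ ψ) (hC : 1 ≤ C) (hE : Est Ω₁ r₁ r₂ φ C) (hE' : Est Ω₂ r₂ r₁ ψ C)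
    {p : E} (hp : r₁ p = 0) (m : ℕ) : ∃ ε > 0, ∃ K, ∀ z ∈ Ω₁, ‖z - p‖ < ε → ‖iteratedFDeriv ℝ m φ z‖ ≤ K := by
  haveI : FiniteDimensional ℝ E := real_fd
  have hδ := h.s1.δ0_pos
  obtain ⟨n₁, hn1, -⟩ := h.s1.exists_normal (z := p) (by rw [hp, abs_zero]; exact hδ.le)
  set ℓ := fderiv ℝ r₁ p with hℓ
  have hℓn : ℓ n₁ = 1 := by rw [hℓ, ← lam_re, hn1]; simp
  have hℓin : ℓ (I • n₁) = 0 := by rw [hℓ, ← lam_re, map_smul, hn1]; simp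
  obtain ⟨q, hq0, hq⟩ := holder_lim h hE hp hℓn
  obtain ⟨n₂, hn2, hnc⟩ := h.s2.exists_normal (z := q) (by rw [hq0, abs_zero]; exact hδ.le)
  obtain ⟨N, hN⟩ := cone_landau (E := E) (m + 2) 1
  obtain ⟨P₁, hP₁, hP₁0, hder, ⟨ε0, hε0, hS⟩, P₂, hP₂, ε, hε, hε1, A, V, hA, hV, hφ, gA, gV, tV, k1, k2⟩ := lift h hC hE hE' hp hn1 hq0 hq hn2 hnc N
  set u0 := I • n₁ with hu0
  have ho := isOpen_Cn u0 ε
  set ε' := ε / 2 ^ (m + 2) with hε'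
  have hε'0 : 0 < ε' := by positivity
  have hε'l : ε' ≤ ε := div_le_self hε.le (one_le_pow₀ (by norm_num))
  have b1 := hN u0 _ ε hε hε1 (e1 A V) (sm_e1 ho hA hV) (fun j _ => (e_bd hA hV gA gV j).1) k1
  have b2 := hN u0 _ ε hε hε1 (e2 A V) (sm_e2 ho hA hV) (fun j _ => (e_bd hA hV gA gV j).2) k2
  have z0 : ∀ f : E × E → E, Gr u0 ε f → BdOn u0 ε' 0 f := fun f hf => by
    obtain ⟨K, hK⟩ := hf 0
    exact bdOn_zero K fun z τ hz => by simpa using hK z τ (hz.mono hε'l)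
  obtain ⟨e, he, hel, cA, cV⟩ := cone_reg m E ε' hε'0 (hε'l.trans hε1) A V (hA.mono (Cn_mono hε'l)) (hV.mono (Cn_mono hε'l)) (z0 A gA) (z0 V gV) (tV.mono hε'l) b1 b2
  have hle : e ≤ ε := hel.trans hε'l
  have hA' := hA.mono (Cn_mono (u0 := u0) hle)
  have hV' := hV.mono (Cn_mono (u0 := u0) hle)
  have hAV : BdOn u0 e m fun z => (A z, V z) := by
    have x1 := cA.clm hA' (ContinuousLinearMap.inl ℝ E E)
    have x2 := cV.clm hV' (ContinuousLinearMap.inr ℝ E E)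
    have := BdOn.add ((ContinuousLinearMap.inl ℝ E E).contDiff.comp_contDiffOn hA') ((ContinuousLinearMap.inr ℝ E E).contDiff.comp_contDiffOn hV') x1 x2
    exact this.congr fun z _ => by simp
  have hAVs := hA'.prodMk hV'
  have hB : BdOn u0 e m fun z => (P₂ (A z, V z)).1 := BdOn.comp hAVs hAV hP₂.fst
  have hBs : ContDiffOn ℝ (⊤ : ℕ∞) (fun z => (P₂ (A z, V z)).1) (Cn u0 e) := hP₂.fst.comp_contDiffOn hAVs
  -- the parametrization
  set J : E →L[ℝ] E × E := (ContinuousLinearMap.id ℝ E - ℓ.smulRight n₁).prod (-(ℓ.smulRight u0)) with hJ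
  have hJa : ∀ x, J x = (x - ℓ x • n₁, (-ℓ x) • u0) := fun x => by simp [hJ]
  set F : E → E := fun x => (P₁ (J x)).1 with hF
  have hFs : ContDiff ℝ (⊤ : ℕ∞) F := (hP₁.comp J.contDiff).fst
  have hJ0 : J 0 = (0, 0) := by simp [hJa]
  have hF0 : F 0 = p := by simp only [hF, hJ0, hP₁0]
  have hFd : ∀ v, fderiv ℝ F 0 v = v := by
    intro v
    have x1 : HasFDerivAt (fun x => P₁ (J x)) ((fderiv ℝ P₁ (0, 0)).comp J) 0 := by
      refine HasFDerivAt.comp (0:E) ?_ J.hasFDerivAt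
      rw [hJ0]; exact (hP₁.differentiable (by simp) _).hasFDerivAt
    have x2 : HasFDerivAt F _ 0 := x1.fst
    rw [x2.fderiv]
    show (fderiv ℝ P₁ (0, 0) (J v)).1 = v
    rw [hJa, hder, ← hℓ, map_sub, map_smul, map_smul, hℓn, hℓin, hu0]
    simp only [smul_eq_mul, mul_one, mul_zero, sub_self, zero_smul, sub_zero]
    rw [neg_smul, smul_neg, smul_comm I (ℓ v) (I • n₁), smul_smul I I, I_mul_I, neg_one_smul, smul_neg, neg_neg, sub_add_cancel]
  obtain ⟨G, hG, hG0, ε3, hε3, hFG, -⟩ := loc_inv hFs 0 rfl (fun v hv => by rwa [hFd] at hv)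
  rw [hF0] at hG0 hFG
  have hQ : ContDiff ℝ (⊤ : ℕ∞) fun z => J (G z) := J.contDiff.comp hG
  have hcl : ∀ᶠ z in nhds p, ‖(J (G z)).1‖ < min e ε0 ∧ |ℓ (G z)| < min e ε0 := by
    have c1 : Continuous fun z => ‖(J (G z)).1‖ := hQ.continuous.fst.norm
    have c2 : Continuous fun z => |ℓ (G z)| := (ℓ.continuous.comp hG.continuous).abs
    refine (c1.continuousAt.eventually (gt_mem_nhds ?_)).and (c2.continuousAt.eventually (gt_mem_nhds ?_))
    · simp only [hG0, hJ0, norm_zero]; positivity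
    · simp only [hG0, map_zero, abs_zero]; positivity
  obtain ⟨ε4, hε4, h4⟩ := Metric.eventually_nhds_iff.1 hcl
  set s : Set E := Ω₁ ∩ ball p (min ε3 ε4) with hs
  have hso : IsOpen s := h.s1.isOpen.inter isOpen_ball
  have hsm : ∀ z ∈ s, F (G z) = z ∧ GG u0 e (J (G z)) (-ℓ (G z)) := by
    rintro z ⟨hz, hzb⟩
    rw [mem_ball] at hzb
    have y1 := hFG z (by rw [← dist_eq_norm]; exact hzb.trans_le (min_le_left _ _))
    obtain ⟨y2, y3⟩ := h4 (hzb.trans_le (min_le_right _ _))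
    have y4 := hS (J (G z)).1 (J (G z)).2 (-ℓ (G z)) (y2.trans_le (min_le_right _ _)) (by rw [abs_neg]; exact y3.trans_le (min_le_right _ _))
      (by rw [hJa, sub_self, norm_zero]; positivity)
    rw [Prod.mk.eta] at y4
    have y5 : r₁ (P₁ (J (G z))).1 < 0 := by
      have : (P₁ (J (G z))).1 = z := y1
      rw [this]; exact (h.s1.mem_iff z).1 hz
    have y6 : 0 < -ℓ (G z) := by
      by_contra hcon
      push Not at hcon
      rw [abs_of_nonpos hcon] at y4
      have := (abs_le.1 y4).1
      linarith
    refine ⟨y1, y2.trans_le (min_le_left _ _), y6, (le_abs_self _).trans_lt (by rw [abs_neg]; exact y3.trans_le (min_le_left _ _)), ?_⟩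
    rw [hJa, sub_self, norm_zero]; positivity
  obtain ⟨D, hD1, hD⟩ := hB.unif
  obtain ⟨D', hD1', hD'⟩ := smooth_bd hQ (‖p‖ + min ε3 ε4) m
  refine ⟨min ε3 ε4, by positivity, m.factorial * D * D' ^ m, fun z hz hzp => ?_⟩
  have hzs : z ∈ s := ⟨hz, by rwa [mem_ball, dist_eq_norm]⟩
  have hev : φ =ᶠ[nhds z] fun y => (P₂ (A (J (G y)), V (J (G y)))).1 := by
    filter_upwards [hso.mem_nhds hzs] with y hy
    obtain ⟨y1, y2⟩ := hsm y hy
    have := (hφ _ (y2.mono hle).mem).2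
    rw [← this]
    exact congrArg φ y1.symm
  rw [(Filter.EventuallyEq.iteratedFDeriv ℝ hev m).eq_of_nhds]
  refine comp_le (g := fun z => (P₂ (A z, V z)).1) (f := fun y => J (G y)) hso (isOpen_Cn u0 e) hBs hQ.contDiffOn (fun y hy => (hsm y hy).2.mem) hzs m
    (fun i hi => hD i hi _ _ (hsm z hzs).2) (fun i h1 hi => ?_)
  refine (hD' i hi z ?_).trans (le_self_pow₀ hD1' (by omega))
  have := norm_le_norm_add_norm_sub' z p
  linarith
end LocBd
end

section
section Seeley

def bq : ℕ → ℝ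
  | 0 => 1
  | k + 1 => -((1 / 2) ^ k / (1 - (1 / 2) ^ (k + 1))) * bq k

lemma bq_rel (k : ℕ) : bq (k + 1) * (1 - (1 / 2) ^ (k + 1)) = -(1 / 2) ^ k * bq k := by
  have : (1 : ℝ) - (1 / 2) ^ (k + 1) ≠ 0 := by
    have := pow_lt_one₀ (n := k + 1) (by norm_num : (0 : ℝ) ≤ 1 / 2) (by norm_num) (by simp)
    linarith
  simp only [bq]; field_simp

lemma bq_le (k : ℕ) : |bq (k + 1)| ≤ 2 := by
  induction k with
  | zero => norm_num [bq]
  | succ k ih =>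
    have h := congrArg abs (bq_rel (k + 1))
    have h1 : (1 / 2 : ℝ) ^ (k + 1) ≤ 1 / 2 := by
      have := pow_le_one₀ (n := k) (by norm_num : (0 : ℝ) ≤ 1 / 2) (by norm_num)
      rw [pow_succ]; linarith
    have h0 : (0 : ℝ) < (1 / 2) ^ (k + 1) := by positivity
    rw [abs_mul, abs_mul, abs_neg, abs_of_pos h0, abs_of_nonneg (a := 1 - (1 / 2) ^ (k + 1 + 1)) (by rw [pow_succ]; linarith), pow_succ _ (k + 1)] at h
    nlinarith [abs_nonneg (bq (k + 1)), abs_nonneg (bq (k + 1 + 1))]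

lemma bq_step {x v : ℝ} (h : HasSum (fun k => bq k * (x / 2) ^ k) v) :
    HasSum (fun k => bq k * x ^ k) ((1 - x) * v) := by
  rw [← hasSum_nat_add_iff' 1] at h ⊢
  have h2 := (hasSum_nat_add_iff' (f := fun k => bq k * (x / 2) ^ k) 1).1 h
  have h3 := h.sub (h2.mul_left x)
  simp only [Finset.sum_range_one, pow_zero, mul_one] at h3 ⊢
  convert h3 using 1
  · funext k
    have := bq_rel k
    have e : x ^ (k + 1) * (bq (k + 1) * (1 - (1 / 2) ^ (k + 1))) = x ^ (k + 1) * (-(1 / 2) ^ k * bq k) := by rw [this]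
    simp only [div_pow, one_div, inv_pow] at e ⊢
    rw [pow_succ x] at e ⊢
    simp only [div_eq_mul_inv]
    linear_combination e
  · ring

lemma bq_zero (t : ℕ) : HasSum (fun k => bq k * (2 ^ t) ^ k) 0 := by
  induction t with
  | zero =>
    have : Summable (fun k => bq k * ((1 : ℝ) / 2) ^ k) := by
      rw [← summable_nat_add_iff 1]
      refine Summable.of_norm_bounded (g := fun k => 1 * ((1 : ℝ) / 2) ^ k) (summable_geometric_two.mul_left _) fun k => ?_
      rw [norm_mul, Real.norm_eq_abs, Real.norm_eq_abs, abs_of_pos (by positivity : (0 : ℝ) < (1 / 2) ^ (k + 1)), pow_succ]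
      nlinarith [bq_le k, (by positivity : (0 : ℝ) < (1 / 2) ^ k)]
    simpa using bq_step this.hasSum
  | succ t ih => simpa using bq_step (x := 2 ^ (t + 1)) (v := 0) (by simpa [pow_succ] using ih)

lemma exists_seq : ∃ a μ : ℕ → ℝ, (∀ k, μ k < 0) ∧ ∀ s : ℕ, HasSum (fun k => a k * μ k ^ s) 1 := by
  have key : ∀ s t : ℕ, HasSum (fun k => bq k * ((2 ^ t) ^ k * (3 - 2 * 2 ^ k) ^ s)) 0 := by
    intro s
    induction s with
    | zero => intro t; simpa using bq_zero t
    | succ s ih =>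
      intro t
      have := ((ih t).mul_left 3).sub ((ih (t + 1)).mul_left 2)
      rw [mul_zero, mul_zero, sub_zero] at this
      refine this.congr_fun fun k => ?_
      rw [pow_succ _ s, pow_succ _ t, mul_pow]; ring
  refine ⟨fun k => -bq (k + 1), fun k => 3 - 2 * 2 ^ (k + 1), fun k => ?_, fun s => ?_⟩
  · have := one_le_pow₀ (n := k) (by norm_num : (1 : ℝ) ≤ 2)
    simp only [pow_succ]; linarith
  · have := key s 0
    rw [← hasSum_nat_add_iff' 1] at this
    simpa [bq, show (3 : ℝ) - 2 = 1 by norm_num] using this.neg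

end Seeley
end

section
section Half
variable {V W : Type} [NormedAddCommGroup V] [NormedSpace ℝ V] [FiniteDimensional ℝ V]
  [NormedAddCommGroup W] [NormedSpace ℝ W] [FiniteDimensional ℝ W]
  {ℓ : V →L[ℝ] ℝ} {n : V} {a μ : ℕ → ℝ}

def Hf (ℓ : V →L[ℝ] ℝ) : Set V := {x | ℓ x < 0}

lemma Hf_open : IsOpen (Hf ℓ) := isOpen_lt ℓ.continuous continuous_const

lemma Hf_convex : Convex ℝ (Hf ℓ) := convex_halfSpace_lt ℓ.isLinear 0

lemma Hf_cl (hn : ℓ n = 1) {x : V} (hx : ℓ x ≤ 0) : x ∈ closure (Hf ℓ) := by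
  have h : Filter.Tendsto (fun t : ℝ => x - t • n) (nhdsWithin 0 (Set.Ioi 0)) (nhds x) := by
    have : Continuous (fun t : ℝ => x - t • n) := by fun_prop
    simpa using (this.tendsto 0).mono_left nhdsWithin_le_nhds
  refine mem_closure_of_tendsto h (Filter.mem_of_superset self_mem_nhdsWithin fun t ht => ?_)
  have : 0 < t := ht
  simp [Hf, hn]; linarith

structure HB (ℓ : V →L[ℝ] ℝ) (f : V → W) : Prop where
  cont : Continuous f
  smooth : ContDiffOn ℝ (⊤ : ℕ∞) f (Hf ℓ)
  bd : ∀ j : ℕ, ∃ C, ∀ x ∈ Hf ℓ, ‖iteratedFDeriv ℝ j f x‖ ≤ C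

lemma HB.of {f : V → W} (hf : ContDiffOn ℝ (⊤ : ℕ∞) f (Hf ℓ)) (hb : ∀ j : ℕ, ∃ C, ∀ x ∈ Hf ℓ, ‖iteratedFDeriv ℝ j f x‖ ≤ C) :
    ∃ g, HB ℓ g ∧ Set.EqOn f g (Hf ℓ) := by
  obtain ⟨C, hC⟩ := hb 1
  have hd : ∀ x ∈ Hf ℓ, DifferentiableAt ℝ f x := fun x hx => (hf.contDiffAt (Hf_open.mem_nhds hx)).differentiableAt (by simp)
  have hl : LipschitzOnWith C.toNNReal f (Hf ℓ) := Hf_convex.lipschitzOnWith_of_nnnorm_fderiv_le hd fun x hx => by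
    have := hC x hx
    rw [norm_iteratedFDeriv_one] at this
    rw [← NNReal.coe_le_coe, coe_nnnorm]
    exact this.trans (Real.le_coe_toNNReal C)
  obtain ⟨g, hg, he⟩ := hl.extend_finite_dimension
  refine ⟨g, ⟨hg.continuous, hf.congr he.symm, fun j => (hb j).imp fun C hC x hx => ?_⟩, he⟩
  have : f =ᶠ[nhds x] g := he.eventuallyEq_of_mem (Hf_open.mem_nhds hx)
  rw [← (Filter.EventuallyEq.iteratedFDeriv ℝ this j).eq_of_nhds]
  exact hC x hx

lemma HB.deriv {f : V → W} (h : HB ℓ f) : ∃ f' : V → V →L[ℝ] W, HB ℓ f' ∧ ∀ x ∈ Hf ℓ, HasFDerivAt f (f' x) x := by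
  obtain ⟨f', h1, h2⟩ := HB.of (f := fderiv ℝ f) (sm_fderiv Hf_open h.smooth) fun j => by
    simpa only [norm_iteratedFDeriv_fderiv] using h.bd (j + 1)
  refine ⟨f', h1, fun x hx => ?_⟩
  rw [← h2 hx]
  exact ((h.smooth.contDiffAt (Hf_open.mem_nhds hx)).differentiableAt (by simp)).hasFDerivAt

lemma HB.bound {f : V → W} (h : HB ℓ f) (hn : ℓ n = 1) : ∃ C, ∀ x, ℓ x ≤ 0 → ‖f x‖ ≤ C := by
  obtain ⟨C, hC⟩ := h.bd 0
  refine ⟨C, fun x hx => ?_⟩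
  have : closure (Hf ℓ) ⊆ {x | ‖f x‖ ≤ C} :=
    closure_minimal (fun y hy => by simpa using hC y hy) (isClosed_le h.cont.norm continuous_const)
  exact this (Hf_cl hn hx)

def TS (ℓ : V →L[ℝ] ℝ) (n : V) (μ : ℕ → ℝ) (k : ℕ) (x : V) : V := x - ((1 - μ k) * max (ℓ x) 0) • n

def GS (ℓ : V →L[ℝ] ℝ) (n : V) (a μ : ℕ → ℝ) (s : ℕ) (f : V → W) (x : V) : W :=
  ∑' k, (a k * μ k ^ s) • f (TS ℓ n μ k x)

lemma TS_le (hn : ℓ n = 1) (hμ : ∀ k, μ k < 0) (k : ℕ) (x : V) : ℓ (TS ℓ n μ k x) ≤ 0 := by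
  have := hμ k
  simp only [TS, map_sub, map_smul, hn, smul_eq_mul, mul_one]
  rcases le_total (ℓ x) 0 with h | h
  · rw [max_eq_right h]; linarith
  · rw [max_eq_left h]; nlinarith

lemma GS_eq (ha : ∀ s : ℕ, HasSum (fun k => a k * μ k ^ s) 1) {f : V → W} {x : V} (hx : ℓ x ≤ 0) (s : ℕ) :
    GS ℓ n a μ s f x = f x := by
  have := (ha s).smul_const (f x)
  rw [one_smul] at this
  simpa [GS, TS, max_eq_right hx] using this.tsum_eq

lemma GS_hasSum (hn : ℓ n = 1) (hμ : ∀ k, μ k < 0) (ha : ∀ s : ℕ, HasSum (fun k => a k * μ k ^ s) 1) {f : V → W}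
    (h : HB ℓ f) (s : ℕ) (x : V) : HasSum (fun k => (a k * μ k ^ s) • f (TS ℓ n μ k x)) (GS ℓ n a μ s f x) := by
  obtain ⟨C, hC⟩ := h.bound hn
  refine (Summable.of_norm_bounded (g := fun k => |a k * μ k ^ s| * C) ((ha s).summable.abs.mul_right C) fun k => ?_).hasSum
  rw [norm_smul, Real.norm_eq_abs]
  gcongr
  exact hC _ (TS_le hn hμ k x)

lemma GS_cont (hn : ℓ n = 1) (hμ : ∀ k, μ k < 0) (ha : ∀ s : ℕ, HasSum (fun k => a k * μ k ^ s) 1) {f : V → W}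
    (h : HB ℓ f) (s : ℕ) : Continuous (GS ℓ n a μ s f) := by
  obtain ⟨C, hC⟩ := h.bound hn
  refine continuous_tsum (u := fun k => |a k * μ k ^ s| * C) (fun k => ?_) ((ha s).summable.abs.mul_right C) fun k x => ?_
  · have := h.cont
    unfold TS; fun_prop
  · rw [norm_smul, Real.norm_eq_abs]
    gcongr
    exact hC _ (TS_le hn hμ k x)

lemma ext_cl {s : Set V} (hs : IsOpen s) (hc : Convex ℝ s) {g : V → W} {D : V → V →L[ℝ] W} (hg : Continuous g) (hD : Continuous D)
    (hd : ∀ y ∈ s, HasFDerivAt g (D y) y) (x : V) : HasFDerivWithinAt g (D x) (closure s) x := by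
  refine hasFDerivWithinAt_closure_of_tendsto_fderiv (fun y hy => (hd y hy).differentiableAt.differentiableWithinAt) hc hs
    (fun y _ => hg.continuousWithinAt) ?_
  refine Filter.Tendsto.congr' ?_ (hD.continuousAt.tendsto.mono_left nhdsWithin_le_nhds)
  filter_upwards [self_mem_nhdsWithin] with y hy using (hd y hy).fderiv.symm

lemma GS_deriv (hn : ℓ n = 1) (hμ : ∀ k, μ k < 0) (ha : ∀ s : ℕ, HasSum (fun k => a k * μ k ^ s) 1) {f : V → W}
    (h : HB ℓ f) (s : ℕ) : ∃ f' : V → V →L[ℝ] W, HB ℓ f' ∧ ∀ x, HasFDerivAt (GS ℓ n a μ s f)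
      ((GS ℓ n a μ s f' x).comp (ContinuousLinearMap.id ℝ V - ℓ.smulRight n) + (GS ℓ n a μ (s + 1) f' x).comp (ℓ.smulRight n)) x := by
  obtain ⟨f', h', hd⟩ := h.deriv
  refine ⟨f', h', ?_⟩
  set P := ContinuousLinearMap.id ℝ V - ℓ.smulRight n with hP
  set Q := ℓ.smulRight n with hQ
  set D : V → V →L[ℝ] W := fun x => (GS ℓ n a μ s f' x).comp P + (GS ℓ n a μ (s + 1) f' x).comp Q with hDdef
  have hDc : Continuous D := ((GS_cont hn hμ ha h' s).clm_comp continuous_const).add ((GS_cont hn hμ ha h' (s + 1)).clm_comp continuous_const)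
  have hGc := GS_cont hn hμ ha h s
  have hneg : ∀ y ∈ Hf ℓ, HasFDerivAt (GS ℓ n a μ s f) (D y) y := by
    intro y hy
    have e : D y = f' y := by
      have hy' : ℓ y ≤ 0 := le_of_lt hy
      simp only [hDdef, GS_eq ha hy', hP]
      ext v; simp
    rw [e]
    refine (hd y hy).congr_of_eventuallyEq ?_
    filter_upwards [Hf_open.mem_nhds hy] with w hw using GS_eq ha (le_of_lt hw) s
  obtain ⟨C, hC⟩ := h'.bound hn
  have hpos : ∀ y ∈ Hf (-ℓ), HasFDerivAt (GS ℓ n a μ s f) (D y) y := by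
    intro y hy
    have hT : ∀ k, ∀ x ∈ Hf (-ℓ), HasFDerivAt (TS ℓ n μ k) (P + μ k • Q) x := by
      intro k x hx
      have : HasFDerivAt (fun x => (P + μ k • Q) x) (P + μ k • Q) x := (P + μ k • Q).hasFDerivAt
      refine this.congr_of_eventuallyEq ?_
      filter_upwards [Hf_open.mem_nhds hx] with w hw
      have hw' : 0 < ℓ w := by simpa [Hf] using hw
      simp only [TS, hP, hQ, max_eq_left hw'.le]
      simp [sub_smul, mul_smul]
      abel
    have hTn : ∀ k, ∀ x ∈ Hf (-ℓ), TS ℓ n μ k x ∈ Hf ℓ := by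
      intro k x hx
      have hw' : 0 < ℓ x := by simpa [Hf] using hx
      simp only [Hf, TS, Set.mem_setOf_eq, map_sub, map_smul, hn, smul_eq_mul, mul_one, max_eq_left hw'.le]
      nlinarith [hμ k]
    have hsum : HasSum (fun k => ((a k * μ k ^ s) • f' (TS ℓ n μ k y)).comp P + ((a k * μ k ^ (s + 1)) • f' (TS ℓ n μ k y)).comp Q) (D y) :=
      (((ContinuousLinearMap.compL ℝ V V W).flip P).hasSum (GS_hasSum hn hμ ha h' s y)).add
        (((ContinuousLinearMap.compL ℝ V V W).flip Q).hasSum (GS_hasSum hn hμ ha h' (s + 1) y))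
    rw [← hsum.tsum_eq]
    refine hasFDerivAt_tsum_of_isPreconnected (u := fun k => |a k * μ k ^ s| * (C * ‖P‖) + |a k * μ k ^ (s + 1)| * (C * ‖Q‖))
      (((ha s).summable.abs.mul_right _).add ((ha (s + 1)).summable.abs.mul_right _)) Hf_open (Hf_convex (ℓ := -ℓ)).isPreconnected
      (f := fun k x => (a k * μ k ^ s) • f (TS ℓ n μ k x))
      (f' := fun k x => ((a k * μ k ^ s) • f' (TS ℓ n μ k x)).comp P + ((a k * μ k ^ (s + 1)) • f' (TS ℓ n μ k x)).comp Q)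
      (fun k x hx => ?_) (fun k x hx => ?_) hy (GS_hasSum hn hμ ha h s y).summable hy
    · have := ((hd _ (hTn k x hx)).comp x (hT k x hx)).const_smul (a k * μ k ^ s)
      rw [ContinuousLinearMap.comp_add, ContinuousLinearMap.comp_smul, smul_add, smul_smul, mul_assoc, ← pow_succ] at this
      exact this
    · have hb : ‖f' (TS ℓ n μ k x)‖ ≤ C := hC _ (TS_le hn hμ k x)
      have hc : ∀ (t : ℝ) (R : V →L[ℝ] V), ‖(t • f' (TS ℓ n μ k x)).comp R‖ ≤ |t| * (C * ‖R‖) := fun t R => by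
        refine (ContinuousLinearMap.opNorm_comp_le _ _).trans ?_
        rw [norm_smul, Real.norm_eq_abs, mul_assoc]
        gcongr
      exact (norm_add_le _ _).trans (add_le_add (hc _ _) (hc _ _))
  intro x
  have h1 := ext_cl Hf_open Hf_convex hGc hDc hneg x
  have h2 := ext_cl Hf_open Hf_convex hGc hDc hpos x
  have hu : closure (Hf ℓ) ∪ closure (Hf (-ℓ)) = Set.univ := by
    refine Set.eq_univ_of_forall fun y => (le_total (ℓ y) 0).imp (Hf_cl hn) fun hy => Hf_cl (n := -n) ?_ ?_
    · simpa using hn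
    · simpa using hy
  rw [← hasFDerivWithinAt_univ, ← hu]
  exact h1.union h2

lemma GS_smooth (hn : ℓ n = 1) (hμ : ∀ k, μ k < 0) (ha : ∀ s : ℕ, HasSum (fun k => a k * μ k ^ s) 1) (m : ℕ) :
    ∀ (W : Type) [NormedAddCommGroup W] [NormedSpace ℝ W] [FiniteDimensional ℝ W] (f : V → W) (s : ℕ), HB ℓ f →
      ContDiff ℝ m (GS ℓ n a μ s f) := by
  induction m with
  | zero => exact fun W _ _ _ f s h => contDiff_zero.2 (GS_cont hn hμ ha h s)
  | succ m ih =>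
    intro W _ _ _ f s h
    obtain ⟨f', h', hd⟩ := GS_deriv hn hμ ha h s
    exact contDiff_succ_iff_hasFDerivAt.2 ⟨_, ((ih _ f' s h').clm_comp contDiff_const).add ((ih _ f' (s + 1) h').clm_comp contDiff_const), hd⟩

/-- Seeley's extension theorem for a half-space. -/
theorem seeley (hn : ℓ n = 1) {f : V → W} (hf : ContDiffOn ℝ (⊤ : ℕ∞) f (Hf ℓ))
    (hb : ∀ j : ℕ, ∃ C, ∀ x ∈ Hf ℓ, ‖iteratedFDeriv ℝ j f x‖ ≤ C) : ∃ g, ContDiff ℝ (⊤ : ℕ∞) g ∧ Set.EqOn g f (Hf ℓ) := by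
  obtain ⟨a, μ, hμ, ha⟩ := exists_seq
  obtain ⟨g, hg, he⟩ := HB.of hf hb
  refine ⟨GS ℓ n a μ 0 g, contDiff_infty.2 fun m => GS_smooth hn hμ ha m W g 0 hg, fun x hx => ?_⟩
  rw [GS_eq ha (le_of_lt hx), he hx]

end Half
end

section
section Fin
variable {E : Type} [NormedAddCommGroup E] [InnerProductSpace ℂ E] [FiniteDimensional ℂ E] [NormedSpace ℝ E] [IsScalarTower ℝ ℂ E]
  {Ω Ω₁ Ω₂ : Set E} {r r₁ r₂ : E → ℝ} {δ0 c M : ℝ} {φ ψ : E → E}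

lemma sum_abs_bd (K : ℕ → ℝ) (j : ℕ) : ∀ i ≤ j, K i ≤ ∑ i ∈ Finset.range (j + 1), |K i| := fun i hi =>
  (le_abs_self _).trans (Finset.single_le_sum (f := fun i => |K i|) (fun _ _ => abs_nonneg _) (Finset.mem_range.2 (by omega)))

lemma unif_bd (h : BH Ω₁ Ω₂ r₁ r₂ δ0 c M φ ψ) (m : ℕ) : ∃ K, ∀ z ∈ Ω₁, ‖iteratedFDeriv ℝ m φ z‖ ≤ K := by
  obtain ⟨C, hC, hE, hE'⟩ := exists_Est h
  have hs := holo_contDiffOn h.s1.isOpen h.hφ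
  have key : ∃ K, ∀ z ∈ {z | r₁ z ≤ 0}, z ∈ Ω₁ → ‖iteratedFDeriv ℝ m φ z‖ ≤ K := by
    refine (h.s1.compact_le h.s1.δ0_pos.le).induction_on (p := fun S => ∃ K, ∀ z ∈ S, z ∈ Ω₁ → ‖iteratedFDeriv ℝ m φ z‖ ≤ K)
      ⟨0, by simp⟩ (fun s t hst => fun ⟨K, hK⟩ => ⟨K, fun z hz => hK z (hst hz)⟩) (fun s t => fun ⟨K, hK⟩ ⟨K', hK'⟩ => ⟨max K K', ?_⟩) ?_
    · rintro z (hz | hz) hzΩ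
      · exact (hK z hz hzΩ).trans (le_max_left _ _)
      · exact (hK' z hz hzΩ).trans (le_max_right _ _)
    · intro x hx
      rcases (show r₁ x ≤ 0 from hx).lt_or_eq with hx | hx
      · have hxΩ := (h.s1.mem_iff x).2 hx
        have hc : ContinuousAt (fun z => ‖iteratedFDeriv ℝ m φ z‖) x :=
          ((hs.contDiffAt (h.s1.isOpen.mem_nhds hxΩ)).iteratedFDeriv_right (m := 0) (i := m) (by rw [zero_add]; exact_mod_cast le_top)).continuousAt.norm
        refine ⟨_, nhdsWithin_le_nhds (hc.eventually (gt_mem_nhds (lt_add_one _))), ‖iteratedFDeriv ℝ m φ x‖ + 1, fun z hz _ => le_of_lt hz⟩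
      · obtain ⟨ε, hε, K, hK⟩ := loc_bd h hC hE hE' hx m
        exact ⟨ball x ε, nhdsWithin_le_nhds (ball_mem_nhds x hε), K, fun z hz hzΩ => hK z hzΩ (by rwa [mem_ball, dist_eq_norm] at hz)⟩
  obtain ⟨K, hK⟩ := key
  exact ⟨K, fun z hz => hK z ((h.s1.mem_iff z).1 hz).le hz⟩

set_option maxHeartbeats 1000000 in
lemma ext_loc (h : SPD Ω r δ0 c M) (hφ : ContDiffOn ℝ (⊤ : ℕ∞) φ Ω) (hb : ∀ m : ℕ, ∃ K, ∀ z ∈ Ω, ‖iteratedFDeriv ℝ m φ z‖ ≤ K)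
    {p : E} (hp : r p = 0) : ∃ ε > 0, ∃ G : E → E, ContDiff ℝ (⊤ : ℕ∞) G ∧ ∀ z ∈ Ω, ‖z - p‖ < ε → G z = φ z := by
  haveI : FiniteDimensional ℝ E := real_fd
  haveI : ProperSpace E := FiniteDimensional.proper ℝ E
  obtain ⟨n, hn, -⟩ := h.exists_normal (z := p) (by rw [hp]; simpa using h.δ0_pos.le)
  have hn1 : fderiv ℝ r p n = 1 := by rw [← lam_re, hn]; simp
  obtain ⟨σ, F, hσ, hF, -, hFp, -, hFr, ε, hε, hi1, hi2⟩ := exists_chart h hp hn1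
  set ℓ := fderiv ℝ r p with hℓ
  obtain ⟨χ, L, hχ, -, hLU, hχ0, hχ1, -⟩ := exists_bump (isCompact_closedBall (0 : E) (ε / 2)) isOpen_ball
    (closedBall_subset_ball (half_lt_self hε))
  set s : Set E := ball 0 ε ∩ Hf ℓ with hs
  have hso : IsOpen s := isOpen_ball.inter Hf_open
  have hst : Set.MapsTo σ s Ω := fun y hy => by
    rw [h.mem_iff, (hi1 y (by simpa using hy.1)).2]; exact hy.2
  have hgs : ContDiffOn ℝ (⊤ : ℕ∞) (fun y => φ (σ y)) s := hφ.comp hσ.contDiffOn hst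
  choose K hK using hb
  have hgb : ∀ j : ℕ, ∃ C, ∀ y ∈ s, ‖iteratedFDeriv ℝ j (fun y => φ (σ y)) y‖ ≤ C := fun j => by
    obtain ⟨D, hD1, hD⟩ := smooth_bd hσ ε j
    refine ⟨_, fun y hy => comp_le hso h.isOpen hφ hσ.contDiffOn hst hy (D := D) j
      (fun i hi => (hK i _ (hst hy)).trans (sum_abs_bd K j i hi)) fun i h1 hi => ?_⟩
    exact (hD i hi y (by simpa using (mem_ball.1 hy.1).le)).trans (le_self_pow₀ hD1 (by omega))
  choose K' hK' using hgb
  have hcov : ∀ y ∈ Hf ℓ, y ∈ s ∨ χ =ᶠ[nhds y] 0 := fun y hy => by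
    by_cases hyL : y ∈ L
    · exact Or.inl ⟨hLU hyL, hy⟩
    · exact Or.inr (hχ0 y hyL)
  have h0 : ∀ y, χ =ᶠ[nhds y] 0 → (fun y => χ y • φ (σ y)) =ᶠ[nhds y] fun _ => 0 := fun y hy => by
    filter_upwards [hy] with w hw; simp [hw]
  obtain ⟨G, hG, hGe⟩ := seeley (ℓ := ℓ) hn1 (f := fun y => χ y • φ (σ y)) (fun y hy => by
    rcases hcov y hy with hy' | hy'
    · exact ((hχ.contDiffOn.smul hgs).contDiffAt (hso.mem_nhds hy')).contDiffWithinAt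
    · exact (contDiffAt_const.congr_of_eventuallyEq (h0 y hy')).contDiffWithinAt) fun j => by
    obtain ⟨D, hD1, hD⟩ := smooth_bd hχ ε j
    refine ⟨∑ i ∈ Finset.range (j + 1), (j.choose i : ℝ) * D * |K' (j - i)|, fun y hy => ?_⟩
    rcases hcov y hy with hy' | hy'
    · have := norm_iteratedFDerivWithin_smul_le (n := j) hχ.contDiffOn hgs hso.uniqueDiffOn hy' (by exact_mod_cast le_top)
      rw [iteratedFDerivWithin_of_isOpen j hso hy'] at this
      refine this.trans (Finset.sum_le_sum fun i hi => ?_)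
      rw [iteratedFDerivWithin_of_isOpen i hso hy', iteratedFDerivWithin_of_isOpen _ hso hy']
      gcongr
      · exact hD i (by have := Finset.mem_range.1 hi; omega) y (by simpa using (mem_ball.1 hy'.1).le)
      · exact (hK' _ y hy').trans (le_abs_self _)
    · rw [(Filter.EventuallyEq.iteratedFDeriv ℝ (h0 y hy') j).eq_of_nhds]
      have : iteratedFDeriv ℝ j (fun _ : E => (0 : E)) y = 0 := by simp
      rw [this, norm_zero]
      positivity
  obtain ⟨ε', hε', hFε⟩ := Metric.continuousAt_iff.1 (hF.continuous.continuousAt (x := p)) (ε / 2) (half_pos hε)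
  refine ⟨min ε ε', lt_min hε hε', fun z => G (F z), hG.comp hF, fun z hz hzp => ?_⟩
  have hz2 := hi2 z (hzp.trans_le (min_le_left _ _))
  have hz1 := hFε (x := z) (by rw [dist_eq_norm]; exact hzp.trans_le (min_le_right _ _))
  rw [hFp] at hz1
  have e1 := hGe (x := F z) (by change ℓ (F z) < 0; rw [hFr]; exact (h.mem_iff z).1 hz)
  have e2 := (hχ1 (F z) (mem_closedBall.2 hz1.le)).eq_of_nhds
  exact e1.trans (by simp [e2, hz2])

lemma global_ext (h : BH Ω₁ Ω₂ r₁ r₂ δ0 c M φ ψ) : ∃ Φ : E → E, ContDiff ℝ (⊤ : ℕ∞) Φ ∧ Set.EqOn Φ φ Ω₁ := by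
  haveI : FiniteDimensional ℝ E := real_fd
  haveI : ProperSpace E := FiniteDimensional.proper ℝ E
  have hs := holo_contDiffOn h.s1.isOpen h.hφ
  obtain ⟨g, hg⟩ := exists_contMDiffMap_forall_mem_convex_of_local (modelWithCornersSelf ℝ E) (n := ⊤)
    (t := fun x => {y : E | x ∈ Ω₁ → y = φ x}) (fun x => by
      by_cases hx : x ∈ Ω₁
      · simpa [hx] using convex_singleton (φ x)
      · simpa [hx] using convex_univ) (fun x => by
      rcases lt_trichotomy (r₁ x) 0 with hx | hx | hx
      · exact ⟨Ω₁, h.s1.isOpen.mem_nhds ((h.s1.mem_iff x).2 hx), φ, hs.contMDiffOn, fun y _ _ => rfl⟩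
      · obtain ⟨ε, hε, G, hG, hGe⟩ := ext_loc h.s1 hs (unif_bd h) hx
        exact ⟨ball x ε, ball_mem_nhds x hε, G, hG.contDiffOn.contMDiffOn, fun y hy hy' => hGe y hy' (by rwa [mem_ball, dist_eq_norm] at hy)⟩
      · exact ⟨{y | 0 < r₁ y}, (isOpen_lt continuous_const h.s1.smooth.continuous).mem_nhds hx, fun _ => 0, contMDiffOn_const,
          fun y hy hy' => absurd ((h.s1.mem_iff y).1 hy') (not_lt.2 (le_of_lt hy))⟩)
  exact ⟨g, g.contMDiff.contDiff, fun x hx => hg x hx⟩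

theorem main_ext (h : BH Ω₁ Ω₂ r₁ r₂ δ0 c M φ ψ) : ∃ (U₁ U₂ : Set E) (Φ Ψ : E → E),
      IsOpen U₁ ∧ closure Ω₁ ⊆ U₁ ∧ ContDiffOn ℝ (⊤ : ℕ∞) Φ U₁ ∧ Set.EqOn Φ φ Ω₁ ∧
      IsOpen U₂ ∧ closure Ω₂ ⊆ U₂ ∧ ContDiffOn ℝ (⊤ : ℕ∞) Ψ U₂ ∧ Set.EqOn Ψ ψ Ω₂ ∧
      Φ '' closure Ω₁ = closure Ω₂ ∧ Set.InjOn Φ (closure Ω₁) ∧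
      (∀ z ∈ closure Ω₁, Ψ (Φ z) = z) ∧ (∀ w ∈ closure Ω₂, Φ (Ψ w) = w) := by
  obtain ⟨Φ, hΦ, eΦ⟩ := global_ext h
  obtain ⟨Ψ, hΨ, eΨ⟩ := global_ext h.symm
  have m1 : Set.MapsTo Φ (closure Ω₁) (closure Ω₂) := Set.MapsTo.closure (fun z hz => by rw [eΦ hz]; exact h.mφ hz) hΦ.continuous
  have m2 : Set.MapsTo Ψ (closure Ω₂) (closure Ω₁) := Set.MapsTo.closure (fun z hz => by rw [eΨ hz]; exact h.mψ hz) hΨ.continuous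
  have l1 : ∀ z ∈ closure Ω₁, Ψ (Φ z) = z := closure_minimal (fun z hz => by
    change Ψ (Φ z) = z; rw [eΦ hz, eΨ (h.mφ hz), h.li z hz]) (isClosed_eq (hΨ.continuous.comp hΦ.continuous) continuous_id)
  have l2 : ∀ w ∈ closure Ω₂, Φ (Ψ w) = w := closure_minimal (fun z hz => by
    change Φ (Ψ z) = z; rw [eΨ hz, eΦ (h.mψ hz), h.ri z hz]) (isClosed_eq (hΦ.continuous.comp hΨ.continuous) continuous_id)
  refine ⟨Set.univ, Set.univ, Φ, Ψ, isOpen_univ, Set.subset_univ _, hΦ.contDiffOn, eΦ, isOpen_univ, Set.subset_univ _, hΨ.contDiffOn, eΨ, ?_, ?_, l1, l2⟩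
  · exact Set.Subset.antisymm m1.image_subset fun w hw => ⟨Ψ w, m2 hw, l2 w hw⟩
  · intro x hx y hy hxy
    rw [← l1 x hx, ← l1 y hy, hxy]

end Fin
end

end FM

/-- Fefferman's mapping theorem. A biholomorphism between bounded
strictly pseudoconvex domains in `ℂⁿ` with `C^∞` boundary extends to a `C^∞`
diffeomorphism of the closures. -/
theorem fefferman_mapping (n : ℕ)
    (Ω₁ Ω₂ : Set (EuclideanSpace ℂ (Fin n)))
    (hΩ₁ : IsStrictlyPseudoconvexDomain n ⊤ Ω₁)
    (hΩ₂ : IsStrictlyPseudoconvexDomain n ⊤ Ω₂)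
    (φ ψ : EuclideanSpace ℂ (Fin n) → EuclideanSpace ℂ (Fin n))
    (hφ : DifferentiableOn ℂ φ Ω₁) (hψ : DifferentiableOn ℂ ψ Ω₂)
    (hφmaps : Set.MapsTo φ Ω₁ Ω₂) (hψmaps : Set.MapsTo ψ Ω₂ Ω₁)
    (hlinv : ∀ z ∈ Ω₁, ψ (φ z) = z) (hrinv : ∀ w ∈ Ω₂, φ (ψ w) = w) :
    ∃ (U₁ U₂ : Set (EuclideanSpace ℂ (Fin n)))
      (Φ Ψ : EuclideanSpace ℂ (Fin n) → EuclideanSpace ℂ (Fin n)),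
      IsOpen U₁ ∧ closure Ω₁ ⊆ U₁ ∧ ContDiffOn ℝ (⊤ : ℕ∞) Φ U₁ ∧ Set.EqOn Φ φ Ω₁ ∧
      IsOpen U₂ ∧ closure Ω₂ ⊆ U₂ ∧ ContDiffOn ℝ (⊤ : ℕ∞) Ψ U₂ ∧ Set.EqOn Ψ ψ Ω₂ ∧
      Φ '' closure Ω₁ = closure Ω₂ ∧ Set.InjOn Φ (closure Ω₁) ∧
      (∀ z ∈ closure Ω₁, Ψ (Φ z) = z) ∧ (∀ w ∈ closure Ω₂, Φ (Ψ w) = w) := by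
  obtain ⟨r₁, δ₁, c₁, M₁, h1⟩ := FM.exists_SPD hΩ₁
  obtain ⟨r₂, δ₂, c₂, M₂, h2⟩ := FM.exists_SPD hΩ₂
  have hδ := lt_min h1.δ0_pos h2.δ0_pos
  have hc := lt_min h1.c_pos h2.c_pos
  exact FM.main_ext ⟨h1.mono hδ (min_le_left _ _) hc (min_le_left _ _) (le_max_left _ _),
    h2.mono hδ (min_le_right _ _) hc (min_le_right _ _) (le_max_right _ _), hφ, hψ, hφmaps, hψmaps, hlinv, hrinv⟩
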